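/- Let S be a finite set of odd primes, let ε : S → {−1, 1}, and set C = 8 · ∏_{p ∈ S} p. There is an absolute constant L > 0 (independent of S and ε) such that the set Q of primes q with q ≡ 3 (mod 8) and with Legendre symbol (−q / p) = ε(p) for every p ∈ S is infinite, and for every integer n ≥ 1 the n-th element of Q (in increasing order) is at most C^L · n · log(2n). -/

import Mathlib

namespace Linnik

open Finset

/-- Truncated inclusion-exclusion sum. -/
noncomputable def truncSum (g : ℕ → ℝ) (m : ℕ) (B : Finset ℕ) : ℝ :=
  ∑ D ∈ B.powerset, if D.card ≤ m then ∏ p ∈ D, (-g p) else 0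

/-- Elementary symmetric sum of degree `m`. -/
noncomputable def elemSum (g : ℕ → ℝ) (m : ℕ) (B : Finset ℕ) : ℝ :=
  ∑ D ∈ B.powerset, if D.card = m then ∏ p ∈ D, g p else 0

lemma truncSum_zero (g : ℕ → ℝ) (B : Finset ℕ) : truncSum g 0 B = 1 := by
  unfold truncSum
  rw [Finset.sum_eq_single ∅]
  · simp
  · intro D _ hD
    simp [hD]
  · simp

lemma elemSum_zero (g : ℕ → ℝ) (B : Finset ℕ) : elemSum g 0 B = 1 := by
  unfold elemSum
  rw [Finset.sum_eq_single ∅]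
  · simp
  · intro D _ hD
    simp [hD]
  · simp

lemma truncSum_insert (g : ℕ → ℝ) (m : ℕ) {B : Finset ℕ} {p : ℕ} (hp : p ∉ B) :
    truncSum g (m + 1) (insert p B) = truncSum g (m + 1) B - g p * truncSum g m B := by
  unfold truncSum
  rw [Finset.sum_powerset_insert hp, sub_eq_add_neg, ← neg_mul, Finset.mul_sum]
  congr 1
  refine Finset.sum_congr rfl fun D hD => ?_
  have hpD : p ∉ D := fun h => hp (Finset.mem_powerset.1 hD h)
  rw [Finset.card_insert_of_notMem hpD, Finset.prod_insert hpD]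
  by_cases h : D.card ≤ m <;> simp [h]

lemma elemSum_insert (g : ℕ → ℝ) (m : ℕ) {B : Finset ℕ} {p : ℕ} (hp : p ∉ B) :
    elemSum g (m + 1) (insert p B) = elemSum g (m + 1) B + g p * elemSum g m B := by
  unfold elemSum
  rw [Finset.sum_powerset_insert hp, Finset.mul_sum]
  congr 1
  refine Finset.sum_congr rfl fun D hD => ?_
  have hpD : p ∉ D := fun h => hp (Finset.mem_powerset.1 hD h)
  rw [Finset.card_insert_of_notMem hpD, Finset.prod_insert hpD]
  by_cases h : D.card = m <;> simp [h]

lemma truncSum_succ (g : ℕ → ℝ) (m : ℕ) (B : Finset ℕ) :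
    truncSum g (m + 1) B = truncSum g m B + (-1) ^ (m + 1) * elemSum g (m + 1) B := by
  unfold truncSum elemSum
  rw [Finset.mul_sum, ← Finset.sum_add_distrib]
  refine Finset.sum_congr rfl fun D _ => ?_
  rcases lt_trichotomy D.card (m + 1) with h | h | h
  · simp [h.le, Nat.lt_succ_iff.1 h, h.ne]
  · simp [h, Finset.prod_neg]
  · simp [h.not_ge, h.ne', (show ¬ D.card ≤ m by omega)]

/-- Bonferroni inequalities. -/
lemma bonferroni (g : ℕ → ℝ) (m : ℕ) (B : Finset ℕ) (h0 : ∀ p ∈ B, 0 ≤ g p)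
    (h1 : ∀ p ∈ B, g p ≤ 1) :
    0 ≤ (-1) ^ m * (truncSum g m B - ∏ p ∈ B, (1 - g p)) := by
  induction B using Finset.induction_on generalizing m with
  | empty =>
    have : truncSum g m ∅ = 1 := by simp [truncSum]
    simp [this]
  | insert p B hp ih =>
    have h0' : ∀ r ∈ B, 0 ≤ g r := fun r hr => h0 r (Finset.mem_insert_of_mem hr)
    have h1' : ∀ r ∈ B, g r ≤ 1 := fun r hr => h1 r (Finset.mem_insert_of_mem hr)
    have hp0 := h0 p (Finset.mem_insert_self _ _)
    have hp1 := h1 p (Finset.mem_insert_self _ _)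
    rw [Finset.prod_insert hp]
    cases m with
    | zero =>
      rw [truncSum_zero]
      have hV1 : ∏ p ∈ B, (1 - g p) ≤ 1 :=
        Finset.prod_le_one (fun r hr => by linarith [h1' r hr]) (fun r hr => by linarith [h0' r hr])
      have hV0 : 0 ≤ ∏ p ∈ B, (1 - g p) :=
        Finset.prod_nonneg (fun r hr => by linarith [h1' r hr])
      simp only [pow_zero, one_mul]
      nlinarith
    | succ m =>
      rw [truncSum_insert g m hp]
      have a := ih (m + 1) h0' h1'
      have b := mul_nonneg hp0 (ih m h0' h1')
      rw [pow_succ] at a ⊢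
      linarith

lemma elemSum_nonneg (g : ℕ → ℝ) (m : ℕ) (B : Finset ℕ) (h0 : ∀ p ∈ B, 0 ≤ g p) :
    0 ≤ elemSum g m B := by
  unfold elemSum
  refine Finset.sum_nonneg fun D hD => ?_
  split_ifs
  · exact Finset.prod_nonneg fun p hp => h0 p (Finset.mem_powerset.1 hD hp)
  · exact le_rfl

lemma pow_add_le_add_pow_succ {s g : ℝ} (hs : 0 ≤ s) (hg : 0 ≤ g) (n : ℕ) :
    s ^ (n + 1) + (n + 1) * g * s ^ n ≤ (s + g) ^ (n + 1) := by
  induction n with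
  | zero => simp
  | succ n ih =>
    have h1 := mul_le_mul_of_nonneg_right ih (add_nonneg hs hg)
    have h2 : 0 ≤ (n + 1) * g * s ^ n * g := by positivity
    push_cast
    calc _ ≤ (s ^ (n + 1) + (n + 1) * g * s ^ n) * (s + g) := by
            ring_nf; ring_nf at h2; nlinarith
      _ ≤ _ := by rw [pow_succ (s + g) (n + 1)]; exact h1

lemma elemSum_le (g : ℕ → ℝ) (m : ℕ) (B : Finset ℕ) (h0 : ∀ p ∈ B, 0 ≤ g p) :
    elemSum g m B ≤ (∑ p ∈ B, g p) ^ m / m.factorial := by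
  induction B using Finset.induction_on generalizing m with
  | empty =>
    cases m with
    | zero => simp [elemSum]
    | succ m => simp [elemSum]
  | insert p B hp ih =>
    have h0' : ∀ r ∈ B, 0 ≤ g r := fun r hr => h0 r (Finset.mem_insert_of_mem hr)
    have hp0 := h0 p (Finset.mem_insert_self _ _)
    cases m with
    | zero => simp [elemSum_zero]
    | succ m =>
      rw [elemSum_insert g m hp, Finset.sum_insert hp, add_comm (g p)]
      have hs : 0 ≤ ∑ r ∈ B, g r := Finset.sum_nonneg h0'
      have a := ih (m + 1) h0'
      have b := mul_le_mul_of_nonneg_left (ih m h0') hp0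
      have c := pow_add_le_add_pow_succ hs hp0 m
      calc _ ≤ (∑ r ∈ B, g r) ^ (m + 1) / (m + 1).factorial
            + g p * ((∑ r ∈ B, g r) ^ m / m.factorial) := by linarith
        _ = ((∑ r ∈ B, g r) ^ (m + 1) + (m + 1) * g p * (∑ r ∈ B, g r) ^ m)
            / (m + 1).factorial := by
            rw [Nat.factorial_succ]; push_cast
            have : (m.factorial : ℝ) ≠ 0 := by positivity
            field_simp
        _ ≤ _ := by gcongr

lemma prod_le_truncSum_even (g : ℕ → ℝ) (b : ℕ) (B : Finset ℕ) (h0 : ∀ p ∈ B, 0 ≤ g p)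
    (h1 : ∀ p ∈ B, g p ≤ 1) : ∏ p ∈ B, (1 - g p) ≤ truncSum g (2 * b) B := by
  have := bonferroni g (2 * b) B h0 h1
  simp at this
  linarith

lemma truncSum_even_le (g : ℕ → ℝ) (b : ℕ) (B : Finset ℕ) (h0 : ∀ p ∈ B, 0 ≤ g p)
    (h1 : ∀ p ∈ B, g p ≤ 1) :
    truncSum g (2 * b) B ≤ ∏ p ∈ B, (1 - g p) + elemSum g (2 * b + 1) B := by
  have := bonferroni g (2 * b + 1) B h0 h1
  rw [truncSum_succ] at this
  simp [pow_succ] at this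
  linarith

lemma sum_powerset_union_mul {A B S₁ S₂ : Finset ℕ} (hAB : Disjoint A B) (h₁ : S₁ ⊆ A)
    (h₂ : S₂ ⊆ B) (F G : Finset ℕ → ℝ) :
    ∑ D ∈ (S₁ ∪ S₂).powerset, F (D ∩ A) * G (D ∩ B)
      = (∑ D ∈ S₁.powerset, F D) * ∑ D ∈ S₂.powerset, G D := by
  rw [Finset.sum_mul_sum, ← Finset.sum_product']
  have dis : ∀ x, x ∈ A → x ∈ B → False := fun x ha hb =>
    (Finset.disjoint_left.1 hAB ha) hb
  refine Finset.sum_nbij' (fun D => (D ∩ A, D ∩ B)) (fun x => x.1 ∪ x.2) ?_ ?_ ?_ ?_ ?_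
  · intro D hD
    simp only [mem_product, mem_powerset] at hD ⊢
    constructor <;> intro x hx <;> have := hD (mem_inter.1 hx).1 <;> grind
  · rintro ⟨D1, D2⟩ h
    simp only [mem_product, mem_powerset] at h ⊢
    exact union_subset_union h.1 h.2
  · intro D hD
    simp only [mem_powerset] at hD ⊢
    ext x
    constructor
    · grind
    · intro hx
      have := hD hx
      grind
  · rintro ⟨D1, D2⟩ h
    simp only [mem_product, mem_powerset] at h ⊢
    obtain ⟨hD1, hD2⟩ := h
    refine Prod.ext ?_ ?_ <;> ext x <;> simp only [mem_inter, mem_union] <;> grind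
  · intro D _; rfl

/-- Upper and lower sieve weights of level `y` on subsets of `P`, whose main terms agree with the
Euler product `∏ (1 - g p)` up to a relative error `η`. -/
structure IsSievePair (P : Finset ℕ) (g : ℕ → ℝ) (η y : ℝ) (lp lm : Finset ℕ → ℝ) : Prop where
  abs_upper : ∀ D, |lp D| ≤ 1
  abs_lower : ∀ D, |lm D| ≤ 1
  supp_upper : ∀ D, lp D ≠ 0 → D ⊆ P ∧ ∏ p ∈ D, (p : ℝ) ≤ y
  supp_lower : ∀ D, lm D ≠ 0 → D ⊆ P ∧ ∏ p ∈ D, (p : ℝ) ≤ y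
  upper : ∀ S ⊆ P, (if S = ∅ then 1 else 0) ≤ ∑ D ∈ S.powerset, lp D
  lower : ∀ S ⊆ P, ∑ D ∈ S.powerset, lm D ≤ (if S = ∅ then 1 else 0)
  main_ge : ∏ p ∈ P, (1 - g p) ≤ ∑ D ∈ P.powerset, lp D * ∏ p ∈ D, g p
  main_le : ∑ D ∈ P.powerset, lp D * ∏ p ∈ D, g p ≤ (1 + η) * ∏ p ∈ P, (1 - g p)
  main_sub : ∑ D ∈ P.powerset, lp D * ∏ p ∈ D, g p - ∑ D ∈ P.powerset, lm D * ∏ p ∈ D, g p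
    ≤ η * ∏ p ∈ P, (1 - g p)

lemma isSievePair_empty (g : ℕ → ℝ) {η y : ℝ} (hη : 0 ≤ η) (hy : 1 ≤ y) :
    IsSievePair ∅ g η y (fun D => if D = ∅ then 1 else 0) (fun D => if D = ∅ then 1 else 0) := by
  have hs : ∀ D : Finset ℕ, (if D = ∅ then (1 : ℝ) else 0) ≠ 0 →
      D ⊆ ∅ ∧ ∏ p ∈ D, (p : ℝ) ≤ y := by
    intro D hD
    have : D = ∅ := by by_contra h; simp [h] at hD
    subst this; simpa using hy
  have ha : ∀ D : Finset ℕ, |(if D = ∅ then (1 : ℝ) else 0)| ≤ 1 := by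
    intro D; split_ifs <;> simp
  refine ⟨ha, ha, hs, hs, ?_, ?_, ?_, ?_, ?_⟩
  · intro S hS
    rw [subset_empty] at hS; subst hS; simp
  · intro S hS
    rw [subset_empty] at hS; subst hS; simp
  · simp
  · simp [hη]
  · simp [hη]

/-- The part of the truncated inclusion-exclusion weight. -/
def truncWeight (m : ℕ) (D : Finset ℕ) : ℝ := if D.card ≤ m then (-1) ^ D.card else 0

/-- Indicator of the sets of size `m`. -/
def cardWeight (m : ℕ) (D : Finset ℕ) : ℝ := if D.card = m then 1 else 0

lemma sum_truncWeight_mul (g : ℕ → ℝ) (m : ℕ) (B : Finset ℕ) :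
    ∑ D ∈ B.powerset, truncWeight m D * ∏ p ∈ D, g p = truncSum g m B := by
  unfold truncSum truncWeight
  refine Finset.sum_congr rfl fun D _ => ?_
  split_ifs
  · rw [Finset.prod_neg]
  · simp

lemma sum_cardWeight_mul (g : ℕ → ℝ) (m : ℕ) (B : Finset ℕ) :
    ∑ D ∈ B.powerset, cardWeight m D * ∏ p ∈ D, g p = elemSum g m B := by
  unfold elemSum cardWeight
  refine Finset.sum_congr rfl fun D _ => ?_
  split_ifs <;> simp

lemma sum_truncWeight (m : ℕ) (B : Finset ℕ) :
    ∑ D ∈ B.powerset, truncWeight m D = truncSum (fun _ => 1) m B := by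
  rw [← sum_truncWeight_mul]; simp

lemma sum_cardWeight (m : ℕ) (B : Finset ℕ) :
    ∑ D ∈ B.powerset, cardWeight m D = elemSum (fun _ => 1) m B := by
  rw [← sum_cardWeight_mul]; simp

lemma sum_powerset_union_mul_prod {A B : Finset ℕ} (hAB : Disjoint A B)
    (F G : Finset ℕ → ℝ) (g : ℕ → ℝ) :
    ∑ D ∈ (A ∪ B).powerset, F (D ∩ A) * G (D ∩ B) * ∏ p ∈ D, g p
      = (∑ D ∈ A.powerset, F D * ∏ p ∈ D, g p) * ∑ D ∈ B.powerset, G D * ∏ p ∈ D, g p := by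
  rw [← sum_powerset_union_mul hAB (Subset.refl _) (Subset.refl _)
    (fun D => F D * ∏ p ∈ D, g p) (fun D => G D * ∏ p ∈ D, g p)]
  refine Finset.sum_congr rfl fun D hD => ?_
  have hD' := mem_powerset.1 hD
  have hdis : Disjoint (D ∩ A) (D ∩ B) := hAB.mono inter_subset_right inter_subset_right
  have : ∏ p ∈ D, g p = (∏ p ∈ D ∩ A, g p) * ∏ p ∈ D ∩ B, g p := by
    rw [← prod_union hdis, ← inter_union_distrib_left, inter_eq_left.2 hD']
  rw [this]; ring

lemma prod_union_le {A B D : Finset ℕ} (hAB : Disjoint A B) (hD : D ⊆ A ∪ B) {y w : ℝ} {m : ℕ}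
    (hw : 1 ≤ w) (hBw : ∀ p ∈ B, (p : ℝ) ≤ w) (hA : ∏ p ∈ D ∩ A, (p : ℝ) ≤ y)
    (hm : (D ∩ B).card ≤ m) : ∏ p ∈ D, (p : ℝ) ≤ y * w ^ m := by
  have hdis : Disjoint (D ∩ A) (D ∩ B) := hAB.mono inter_subset_right inter_subset_right
  have h : ∏ p ∈ D, (p : ℝ) = (∏ p ∈ D ∩ A, (p : ℝ)) * ∏ p ∈ D ∩ B, (p : ℝ) := by
    rw [← prod_union hdis, ← inter_union_distrib_left, inter_eq_left.2 hD]
  rw [h]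
  have h0 : 0 ≤ ∏ p ∈ D ∩ A, (p : ℝ) := prod_nonneg fun p _ => Nat.cast_nonneg p
  refine mul_le_mul hA ?_ (prod_nonneg fun p _ => Nat.cast_nonneg p) (h0.trans hA)
  calc ∏ p ∈ D ∩ B, (p : ℝ) ≤ ∏ p ∈ D ∩ B, w :=
        prod_le_prod (fun p _ => Nat.cast_nonneg p) fun p hp => hBw p (mem_inter.1 hp).2
    _ = w ^ (D ∩ B).card := by simp
    _ ≤ w ^ m := pow_le_pow_right₀ hw hm

lemma IsSievePair.union {A B : Finset ℕ} {g : ℕ → ℝ} {η η' y w ε : ℝ} {lp lm : Finset ℕ → ℝ}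
    (h : IsSievePair A g η y lp lm) (hAB : Disjoint A B) (b : ℕ) (hw : 1 ≤ w)
    (hBw : ∀ p ∈ B, (p : ℝ) ≤ w) (h0 : ∀ p ∈ A ∪ B, 0 ≤ g p) (h1 : ∀ p ∈ A ∪ B, g p ≤ 1)
    (hη : 0 ≤ η) (hε : elemSum g (2 * b + 1) B ≤ ε * ∏ p ∈ B, (1 - g p)) (hε0 : 0 ≤ ε)
    (hη' : (1 + 2 * η) * (1 + 2 * ε) ≤ 1 + 2 * η') :
    ∃ lp' lm', IsSievePair (A ∪ B) g η' (y * w ^ (2 * b + 1)) lp' lm' := by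
  have h0A : ∀ p ∈ A, 0 ≤ g p := fun p hp => h0 p (mem_union_left _ hp)
  have h1A : ∀ p ∈ A, g p ≤ 1 := fun p hp => h1 p (mem_union_left _ hp)
  have h0B : ∀ p ∈ B, 0 ≤ g p := fun p hp => h0 p (mem_union_right _ hp)
  have h1B : ∀ p ∈ B, g p ≤ 1 := fun p hp => h1 p (mem_union_right _ hp)
  let lp' : Finset ℕ → ℝ := fun D =>
    if D ⊆ A ∪ B then lp (D ∩ A) * truncWeight (2 * b) (D ∩ B) else 0
  let lm' : Finset ℕ → ℝ := fun D =>
    if D ⊆ A ∪ B then lm (D ∩ A) * truncWeight (2 * b) (D ∩ B)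
      - lp (D ∩ A) * cardWeight (2 * b + 1) (D ∩ B) else 0
  have sumU : ∀ S ⊆ A ∪ B, ∑ D ∈ S.powerset, lp' D
      = (∑ D ∈ (S ∩ A).powerset, lp D) * truncSum (fun _ => 1) (2 * b) (S ∩ B) := by
    intro S hS
    have hSU : S = (S ∩ A) ∪ (S ∩ B) := by
      rw [← inter_union_distrib_left, inter_eq_left.2 hS]
    rw [← sum_truncWeight, ← sum_powerset_union_mul hAB inter_subset_right inter_subset_right,
      ← hSU]
    exact Finset.sum_congr rfl fun D hD => if_pos ((mem_powerset.1 hD).trans hS)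
  have sumL : ∀ S ⊆ A ∪ B, ∑ D ∈ S.powerset, lm' D
      = (∑ D ∈ (S ∩ A).powerset, lm D) * truncSum (fun _ => 1) (2 * b) (S ∩ B)
        - (∑ D ∈ (S ∩ A).powerset, lp D) * elemSum (fun _ => 1) (2 * b + 1) (S ∩ B) := by
    intro S hS
    have hSU : S = (S ∩ A) ∪ (S ∩ B) := by
      rw [← inter_union_distrib_left, inter_eq_left.2 hS]
    rw [← sum_truncWeight, ← sum_cardWeight,
      ← sum_powerset_union_mul hAB inter_subset_right inter_subset_right,
      ← sum_powerset_union_mul hAB inter_subset_right inter_subset_right,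
      ← hSU, ← Finset.sum_sub_distrib]
    exact Finset.sum_congr rfl fun D hD => if_pos ((mem_powerset.1 hD).trans hS)
  have mainU : ∑ D ∈ (A ∪ B).powerset, lp' D * ∏ p ∈ D, g p
      = (∑ D ∈ A.powerset, lp D * ∏ p ∈ D, g p) * truncSum g (2 * b) B := by
    rw [← sum_truncWeight_mul, ← sum_powerset_union_mul_prod hAB]
    refine Finset.sum_congr rfl fun D hD => ?_
    simp only [lp', if_pos (mem_powerset.1 hD)]
  have mainL : ∑ D ∈ (A ∪ B).powerset, lm' D * ∏ p ∈ D, g p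
      = (∑ D ∈ A.powerset, lm D * ∏ p ∈ D, g p) * truncSum g (2 * b) B
        - (∑ D ∈ A.powerset, lp D * ∏ p ∈ D, g p) * elemSum g (2 * b + 1) B := by
    rw [← sum_truncWeight_mul, ← sum_cardWeight_mul, ← sum_powerset_union_mul_prod hAB,
      ← sum_powerset_union_mul_prod hAB, ← Finset.sum_sub_distrib]
    refine Finset.sum_congr rfl fun D hD => ?_
    simp only [lm', if_pos (mem_powerset.1 hD)]
    ring
  have hVA : 0 ≤ ∏ p ∈ A, (1 - g p) := prod_nonneg fun p hp => by linarith [h1A p hp]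
  have hVB : 0 ≤ ∏ p ∈ B, (1 - g p) := prod_nonneg fun p hp => by linarith [h1B p hp]
  have hT0 := prod_le_truncSum_even g b B h0B h1B
  have hT1 := truncSum_even_le g b B h0B h1B
  have he0 := elemSum_nonneg g (2 * b + 1) B h0B
  have hV : ∏ p ∈ A ∪ B, (1 - g p) = (∏ p ∈ A, (1 - g p)) * ∏ p ∈ B, (1 - g p) :=
    prod_union hAB
  have one0 : ∀ S : Finset ℕ, ∀ p ∈ S, (0 : ℝ) ≤ (fun _ : ℕ => (1 : ℝ)) p := fun _ _ _ => by simp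
  have one1 : ∀ S : Finset ℕ, ∀ p ∈ S, (fun _ : ℕ => (1 : ℝ)) p ≤ 1 := fun _ _ _ => by simp
  have prod1 : ∀ S : Finset ℕ, ∏ p ∈ S, (1 - (fun _ : ℕ => (1 : ℝ)) p) = if S = ∅ then 1 else 0 := by
    intro S
    rcases S.eq_empty_or_nonempty with rfl | hS
    · simp
    · simp [hS.ne_empty]
  refine ⟨lp', lm', ?_, ?_, ?_, ?_, ?_, ?_, ?_, ?_, ?_⟩
  · intro D
    simp only [lp']
    split_ifs
    · rw [abs_mul]
      refine mul_le_one₀ (h.abs_upper _) (abs_nonneg _) ?_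
      unfold truncWeight; split_ifs <;> simp
    · simp
  · intro D
    simp only [lm']
    split_ifs
    · unfold truncWeight cardWeight
      by_cases hc : (D ∩ B).card ≤ 2 * b
      · have : (D ∩ B).card ≠ 2 * b + 1 := by omega
        simp only [hc, this, if_true, if_false, mul_zero, sub_zero, abs_mul, abs_pow, abs_neg,
          abs_one, one_pow, mul_one]
        exact h.abs_lower _
      · by_cases hc' : (D ∩ B).card = 2 * b + 1
        · simp only [hc', if_true, mul_one]
          simp only [show ¬ (2 * b + 1 ≤ 2 * b) by omega, if_false, mul_zero, zero_sub, abs_neg]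
          exact h.abs_upper _
        · simp [hc, hc']
    · simp
  · intro D hD
    have hDs : D ⊆ A ∪ B := by by_contra hh; simp [lp', hh] at hD
    simp only [lp', if_pos hDs] at hD
    have h1 := left_ne_zero_of_mul hD
    have h2 := right_ne_zero_of_mul hD
    refine ⟨hDs, prod_union_le hAB hDs hw hBw (h.supp_upper _ h1).2 ?_⟩
    by_contra hh
    simp [truncWeight, show ¬ (D ∩ B).card ≤ 2 * b by omega] at h2
  · intro D hD
    have hDs : D ⊆ A ∪ B := by by_contra hh; simp [lm', hh] at hD
    simp only [lm', if_pos hDs] at hD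
    have hcard : (D ∩ B).card ≤ 2 * b + 1 := by
      by_contra hh
      simp [truncWeight, cardWeight, show ¬ (D ∩ B).card ≤ 2 * b by omega,
        show ¬ (D ∩ B).card = 2 * b + 1 by omega] at hD
    refine ⟨hDs, prod_union_le hAB hDs hw hBw ?_ hcard⟩
    by_cases h1 : lp (D ∩ A) = 0
    · have : lm (D ∩ A) ≠ 0 := by
        intro h2; simp [h1, h2] at hD
      exact (h.supp_lower _ this).2
    · exact (h.supp_upper _ h1).2
  · intro S hS
    rw [sumU S hS]
    have hA := h.upper (S ∩ A) inter_subset_right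
    have hB := prod_le_truncSum_even (fun _ => 1) b (S ∩ B) (one0 _) (one1 _)
    rw [prod1] at hB
    have key : (if S = ∅ then (1 : ℝ) else 0)
        ≤ (if S ∩ A = ∅ then 1 else 0) * (if S ∩ B = ∅ then 1 else 0) := by
      by_cases hs : S = ∅
      · simp [hs]
      · simp only [hs, if_false]; positivity
    refine key.trans (mul_le_mul hA hB (by positivity) (le_trans (by positivity) hA))
  · intro S hS
    rw [sumL S hS]
    have hA := h.upper (S ∩ A) inter_subset_right
    have hA' := h.lower (S ∩ A) inter_subset_right
    have hB := prod_le_truncSum_even (fun _ => 1) b (S ∩ B) (one0 _) (one1 _)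
    have hB' := truncSum_even_le (fun _ => 1) b (S ∩ B) (one0 _) (one1 _)
    have hE := elemSum_nonneg (fun _ => 1) (2 * b + 1) (S ∩ B) (one0 _)
    rw [prod1] at hB hB'
    by_cases hSB : S ∩ B = ∅
    · have hE1 : elemSum (fun _ => 1) (2 * b + 1) (S ∩ B) = 0 := by
        rw [hSB]; simp [elemSum]
      have hT1 : truncSum (fun _ => 1) (2 * b) (S ∩ B) = 1 := by
        rw [hSB]; simp [truncSum]
      rw [hE1, hT1, mul_one, mul_zero, sub_zero]
      have : S = S ∩ A := by
        conv_lhs => rw [← inter_eq_left.2 hS, inter_union_distrib_left, hSB, union_empty]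
      rw [← this] at hA' ⊢
      exact hA'
    · have hS0 : S ≠ ∅ := by rintro rfl; simp at hSB
      simp only [hSB, hS0, if_false] at hB hB' ⊢
      by_cases hSA : S ∩ A = ∅
      · simp only [hSA, if_true] at hA hA' ⊢
        nlinarith
      · simp only [hSA, if_false] at hA hA'
        nlinarith
  · rw [mainU, hV]
    exact mul_le_mul h.main_ge hT0 hVB (hVA.trans h.main_ge)
  · rw [mainU, hV]
    have hTle : truncSum g (2 * b) B ≤ (1 + ε) * ∏ p ∈ B, (1 - g p) := by linarith
    calc _ ≤ ((1 + η) * ∏ p ∈ A, (1 - g p)) * ((1 + ε) * ∏ p ∈ B, (1 - g p)) :=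
          mul_le_mul h.main_le hTle (hVB.trans hT0) (by positivity)
      _ = ((1 + η) * (1 + ε)) * ((∏ p ∈ A, (1 - g p)) * ∏ p ∈ B, (1 - g p)) := by ring
      _ ≤ _ := by
          refine mul_le_mul_of_nonneg_right ?_ (mul_nonneg hVA hVB)
          nlinarith [mul_nonneg hη hε0]
  · rw [mainU, mainL, hV]
    have hTle : truncSum g (2 * b) B ≤ (1 + ε) * ∏ p ∈ B, (1 - g p) := by linarith
    have e1 : (∑ D ∈ A.powerset, lp D * ∏ p ∈ D, g p - ∑ D ∈ A.powerset, lm D * ∏ p ∈ D, g p)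
        * truncSum g (2 * b) B
        ≤ (η * ∏ p ∈ A, (1 - g p)) * ((1 + ε) * ∏ p ∈ B, (1 - g p)) :=
      mul_le_mul h.main_sub hTle (hVB.trans hT0) (by positivity)
    have e2 : (∑ D ∈ A.powerset, lp D * ∏ p ∈ D, g p) * elemSum g (2 * b + 1) B
        ≤ ((1 + η) * ∏ p ∈ A, (1 - g p)) * (ε * ∏ p ∈ B, (1 - g p)) :=
      mul_le_mul h.main_le hε he0 (by positivity)
    calc _ ≤ (η * (1 + ε) + (1 + η) * ε) * ((∏ p ∈ A, (1 - g p)) * ∏ p ∈ B, (1 - g p)) := by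
          linarith
      _ ≤ _ := by
          refine mul_le_mul_of_nonneg_right ?_ (mul_nonneg hVA hVB)
          linarith

/-- The sieve bound deduced from a pair of sieve weights. -/
lemma IsSievePair.abs_sum_sub_le {P : Finset ℕ} {g : ℕ → ℝ} {η y : ℝ} {lp lm : Finset ℕ → ℝ}
    (h : IsSievePair P g η y lp lm) (N : Finset ℕ) (a : ℕ → ℝ) (ha : ∀ n ∈ N, 0 ≤ a n)
    {Y : ℝ} (hY : 0 ≤ Y) (r : Finset ℕ → ℝ) (hr0 : ∀ D, 0 ≤ r D)
    (hr : ∀ D ⊆ P, ∏ p ∈ D, (p : ℝ) ≤ y →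
      |∑ n ∈ N with ∀ p ∈ D, p ∣ n, a n - Y * ∏ p ∈ D, g p| ≤ r D) :
    |∑ n ∈ N with ∀ p ∈ P, ¬ p ∣ n, a n - Y * ∏ p ∈ P, (1 - g p)|
      ≤ η * (Y * ∏ p ∈ P, (1 - g p))
        + ∑ D ∈ P.powerset.filter (fun D : Finset ℕ => ∏ p ∈ D, (p : ℝ) ≤ y), r D := by
  have hswap : ∀ l : Finset ℕ → ℝ,
      ∑ n ∈ N, a n * ∑ D ∈ (P.filter (· ∣ n)).powerset, l D
        = ∑ D ∈ P.powerset, l D * ∑ n ∈ N with ∀ p ∈ D, p ∣ n, a n := by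
    intro l
    have : ∀ n ∈ N, a n * ∑ D ∈ (P.filter (· ∣ n)).powerset, l D
        = ∑ D ∈ P.powerset, if ∀ p ∈ D, p ∣ n then l D * a n else 0 := by
      intro n _
      rw [← Finset.sum_filter, Finset.mul_sum]
      refine Finset.sum_congr ?_ fun D _ => mul_comm _ _
      ext D
      simp only [mem_powerset, mem_filter, subset_iff]
      constructor
      · intro hh; exact ⟨fun x hx => (hh hx).1, fun x hx => (hh hx).2⟩
      · rintro ⟨h1, h2⟩ x hx; exact ⟨h1 hx, h2 x hx⟩
    rw [Finset.sum_congr rfl this, Finset.sum_comm]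
    refine Finset.sum_congr rfl fun D _ => ?_
    rw [Finset.mul_sum, Finset.sum_filter]
  have hind : ∀ n, (∀ p ∈ P, ¬ p ∣ n) ↔ P.filter (· ∣ n) = ∅ := by
    intro n; rw [Finset.filter_eq_empty_iff]
  have hsum : ∑ n ∈ N with ∀ p ∈ P, ¬ p ∣ n, a n
      = ∑ n ∈ N, a n * (if P.filter (· ∣ n) = ∅ then 1 else 0) := by
    rw [Finset.sum_filter]
    refine Finset.sum_congr rfl fun n _ => ?_
    by_cases hn : P.filter (· ∣ n) = ∅
    · rw [if_pos ((hind n).2 hn), if_pos hn, mul_one]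
    · rw [if_neg (fun hh => hn ((hind n).1 hh)), if_neg hn, mul_zero]
  have hle : ∑ n ∈ N with ∀ p ∈ P, ¬ p ∣ n, a n
      ≤ ∑ D ∈ P.powerset, lp D * ∑ n ∈ N with ∀ p ∈ D, p ∣ n, a n := by
    rw [hsum, ← hswap]
    exact Finset.sum_le_sum fun n hn =>
      mul_le_mul_of_nonneg_left (h.upper _ (filter_subset _ _)) (ha n hn)
  have hge : ∑ D ∈ P.powerset, lm D * ∑ n ∈ N with ∀ p ∈ D, p ∣ n, a n
      ≤ ∑ n ∈ N with ∀ p ∈ P, ¬ p ∣ n, a n := by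
    rw [hsum, ← hswap]
    exact Finset.sum_le_sum fun n hn =>
      mul_le_mul_of_nonneg_left (h.lower _ (filter_subset _ _)) (ha n hn)
  have herr : ∀ l : Finset ℕ → ℝ, (∀ D, |l D| ≤ 1) →
      (∀ D, l D ≠ 0 → D ⊆ P ∧ ∏ p ∈ D, (p : ℝ) ≤ y) →
      |∑ D ∈ P.powerset, l D * ∑ n ∈ N with ∀ p ∈ D, p ∣ n, a n
        - Y * ∑ D ∈ P.powerset, l D * ∏ p ∈ D, g p|
      ≤ ∑ D ∈ P.powerset.filter (fun D : Finset ℕ => ∏ p ∈ D, (p : ℝ) ≤ y), r D := by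
    intro l hl hs
    rw [Finset.mul_sum, ← Finset.sum_sub_distrib, Finset.sum_filter]
    refine (Finset.abs_sum_le_sum_abs _ _).trans (Finset.sum_le_sum fun D hD => ?_)
    by_cases hz : l D = 0
    · simp only [hz, zero_mul, mul_zero, sub_zero, abs_zero]
      split_ifs
      · exact hr0 D
      · exact le_rfl
    · obtain ⟨h1, h2⟩ := hs D hz
      rw [if_pos h2]
      have : l D * ∑ n ∈ N with ∀ p ∈ D, p ∣ n, a n - Y * (l D * ∏ p ∈ D, g p)
          = l D * (∑ n ∈ N with ∀ p ∈ D, p ∣ n, a n - Y * ∏ p ∈ D, g p) := by ring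
      rw [this, abs_mul]
      calc _ ≤ 1 * |∑ n ∈ N with ∀ p ∈ D, p ∣ n, a n - Y * ∏ p ∈ D, g p| :=
            mul_le_mul_of_nonneg_right (hl D) (abs_nonneg _)
        _ ≤ r D := by rw [one_mul]; exact hr D h1 h2
  have e1 := abs_le.1 (herr lp h.abs_upper h.supp_upper)
  have e2 := abs_le.1 (herr lm h.abs_lower h.supp_lower)
  have m1 := mul_le_mul_of_nonneg_left h.main_ge hY
  have m2 := mul_le_mul_of_nonneg_left h.main_le hY
  have m3 := mul_le_mul_of_nonneg_left h.main_sub hY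
  rw [abs_le]
  constructor <;> nlinarith

/-- The primes up to `z`. -/
noncomputable def primesUpTo (z : ℝ) : Finset ℕ := (range (⌊z⌋₊ + 1)).filter Nat.Prime

lemma mem_primesUpTo {z : ℝ} (hz : 0 ≤ z) {p : ℕ} :
    p ∈ primesUpTo z ↔ p.Prime ∧ (p : ℝ) ≤ z := by
  simp only [primesUpTo, mem_filter, mem_range, Nat.lt_succ_iff, Nat.le_floor_iff hz]
  tauto

lemma sum_log_primeFactors_le {n : ℕ} (hn : n ≠ 0) :
    ∑ p ∈ n.primeFactors, Real.log p ≤ Real.log n := by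
  rw [← Real.log_prod (fun p hp => by
    have := (Nat.prime_of_mem_primeFactors hp).pos; positivity)]
  have h := Nat.le_of_dvd (Nat.pos_of_ne_zero hn) (Nat.prod_primeFactors_dvd n)
  have hpos : 0 < ∏ p ∈ n.primeFactors, p :=
    Finset.prod_pos fun p hp => (Nat.prime_of_mem_primeFactors hp).pos
  apply Real.log_le_log
  · rw [← Nat.cast_prod]; exact_mod_cast hpos
  · rw [← Nat.cast_prod]; exact_mod_cast h

lemma card_multiples_ge (N p : ℕ) :
    (N : ℝ) / p - 1 ≤ ((Icc 1 N).filter (p ∣ ·)).card := by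
  have : (Icc 1 N).filter (p ∣ ·) = (Ioc 0 N).filter (p ∣ ·) := by
    ext x; simp; omega
  rw [this, Nat.Ioc_filter_dvd_card_eq_div]
  have := Nat.lt_floor_add_one ((N : ℝ) / p)
  rw [Nat.floor_div_eq_div] at this
  linarith

lemma sum_log_div_prime_le (N : ℕ) (hN : 1 ≤ N) :
    ∑ p ∈ primesUpTo N, Real.log p / p ≤ Real.log N + Real.log 4 := by
  have hNpos : (0 : ℝ) < N := by exact_mod_cast hN
  have h1 : ∑ n ∈ Icc 1 N, ∑ p ∈ n.primeFactors, Real.log p ≤ N * Real.log N := by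
    calc _ ≤ ∑ n ∈ Icc 1 N, Real.log N := by
          refine Finset.sum_le_sum fun n hn => ?_
          have hn' := Finset.mem_Icc.1 hn
          refine (sum_log_primeFactors_le (by omega)).trans ?_
          exact Real.log_le_log (by exact_mod_cast hn'.1) (by exact_mod_cast hn'.2)
      _ = N * Real.log N := by simp
  have h2 : ∑ p ∈ primesUpTo N, Real.log p * ((Icc 1 N).filter (p ∣ ·)).card
      = ∑ n ∈ Icc 1 N, ∑ p ∈ n.primeFactors, Real.log p := by
    have : ∀ n ∈ Icc 1 N, ∑ p ∈ n.primeFactors, Real.log p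
        = ∑ p ∈ primesUpTo N, if p ∣ n then Real.log p else 0 := by
      intro n hn
      have hn' := Finset.mem_Icc.1 hn
      rw [← Finset.sum_filter]
      refine Finset.sum_congr ?_ fun _ _ => rfl
      ext p
      simp only [Nat.mem_primeFactors, mem_filter, mem_primesUpTo hNpos.le, Nat.cast_le]
      constructor
      · rintro ⟨a, b, c⟩
        exact ⟨⟨a, (Nat.le_of_dvd (by omega) b).trans hn'.2⟩, b⟩
      · rintro ⟨⟨a, b⟩, c⟩
        exact ⟨a, c, by omega⟩
    rw [Finset.sum_congr rfl this, Finset.sum_comm]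
    refine Finset.sum_congr rfl fun p _ => ?_
    rw [← Finset.sum_filter]
    simp [mul_comm]
  have h3 : ∑ p ∈ primesUpTo N, Real.log p ≤ Real.log 4 * N := by
    have := Chebyshev.theta_le_log4_mul_x hNpos.le
    rw [Chebyshev.theta_eq_sum_Icc] at this
    refine le_trans (le_of_eq ?_) this
    refine Finset.sum_congr ?_ fun _ _ => rfl
    ext p
    simp [primesUpTo]
  have h4 : ∑ p ∈ primesUpTo N, (N * (Real.log p / p) - Real.log p) ≤ N * Real.log N := by
    rw [← h2] at h1
    refine le_trans (Finset.sum_le_sum fun p hp => ?_) h1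
    have hp' := (mem_primesUpTo hNpos.le).1 hp
    have := mul_le_mul_of_nonneg_left (card_multiples_ge N p)
      (Real.log_natCast_nonneg p)
    calc _ = Real.log p * (N / p - 1) := by ring
      _ ≤ _ := this
  rw [Finset.sum_sub_distrib, ← Finset.mul_sum] at h4
  have : (N : ℝ) * ∑ p ∈ primesUpTo N, Real.log p / p ≤ N * (Real.log N + Real.log 4) := by
    linarith
  exact le_of_mul_le_mul_left this hNpos

lemma sum_inv_prime_block_le {z : ℝ} (hz : 2 ≤ z) (B : Finset ℕ)
    (hB : ∀ p ∈ B, p.Prime ∧ Real.sqrt z < p ∧ (p : ℝ) ≤ z) :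
    ∑ p ∈ B, (1 : ℝ) / p ≤ 6 := by
  have hz0 : 0 ≤ z := by linarith
  have hlog : Real.log 2 ≤ Real.log z := Real.log_le_log (by norm_num) hz
  have hl2 : 0 < Real.log 2 := Real.log_pos (by norm_num)
  have h4 : Real.log 4 = 2 * Real.log 2 := by
    rw [show (4 : ℝ) = 2 ^ 2 by norm_num, Real.log_pow]; norm_num
  have hf : (1 : ℕ) ≤ ⌊z⌋₊ := Nat.le_floor (by push_cast; linarith)
  have h1 : ∑ p ∈ B, Real.log p / p ≤ Real.log z + Real.log 4 := by
    have hsub : B ⊆ primesUpTo (⌊z⌋₊ : ℝ) := by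
      intro p hp
      obtain ⟨a, _, c⟩ := hB p hp
      rw [mem_primesUpTo (Nat.cast_nonneg _)]
      exact ⟨a, by exact_mod_cast Nat.le_floor c⟩
    calc _ ≤ ∑ p ∈ primesUpTo (⌊z⌋₊ : ℝ), Real.log p / p :=
          Finset.sum_le_sum_of_subset_of_nonneg hsub fun p _ _ =>
            div_nonneg (Real.log_natCast_nonneg p) (Nat.cast_nonneg p)
      _ ≤ Real.log ⌊z⌋₊ + Real.log 4 := sum_log_div_prime_le _ hf
      _ ≤ _ := by
          gcongr
          exact Nat.floor_le hz0
  have h2 : ∑ p ∈ B, (1 : ℝ) / p * (Real.log z / 2) ≤ ∑ p ∈ B, Real.log p / p := by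
    refine Finset.sum_le_sum fun p hp => ?_
    obtain ⟨a, b, _⟩ := hB p hp
    have hp0 : (0 : ℝ) < p := by exact_mod_cast a.pos
    have : Real.log z / 2 ≤ Real.log p := by
      rw [← Real.log_sqrt hz0]
      exact Real.log_le_log (Real.sqrt_pos.2 (by linarith)) b.le
    rw [div_mul_eq_mul_div, one_mul]
    gcongr
  rw [← Finset.sum_mul] at h2
  have h3 : (∑ p ∈ B, (1 : ℝ) / p) * (Real.log z / 2) ≤ 6 * (Real.log z / 2) := by linarith
  exact le_of_mul_le_mul_right h3 (by linarith)

/-- Admissible sieve densities of dimension at most two, on primes up to `z`. -/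
structure IsSieveDensity (P : Finset ℕ) (g : ℕ → ℝ) (z : ℝ) : Prop where
  prime : ∀ p ∈ P, p.Prime
  le : ∀ p ∈ P, (p : ℝ) ≤ z
  nonneg : ∀ p ∈ P, 0 ≤ g p
  le_one : ∀ p ∈ P, g p ≤ 1
  le_two_div : ∀ p ∈ P, g p ≤ 2 / p
  sq_le : ∀ p ∈ P, (1 - 1 / (p : ℝ)) ^ 2 ≤ 1 - g p

lemma one_sub_inv_prime_ge {p : ℕ} (hp : p.Prime) : Real.exp (-(2 / p)) ≤ 1 - 1 / (p : ℝ) := by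
  have hp2 : (2 : ℝ) ≤ p := by exact_mod_cast hp.two_le
  have h1 : 1 / (1 - 1 / (p : ℝ)) ≤ Real.exp (2 / p) := by
    have h2 : 1 / (1 - 1 / (p : ℝ)) = 1 / (p - 1) + 1 := by
      have : (p : ℝ) ≠ 0 := by positivity
      have : (p : ℝ) - 1 ≠ 0 := by linarith
      field_simp; ring
    rw [h2]
    refine le_trans ?_ (Real.add_one_le_exp _)
    refine add_le_add_left ?_ 1
    rw [div_le_div_iff₀ (by linarith) (by linarith)]
    linarith
  have h3 : 0 < 1 - 1 / (p : ℝ) := by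
    rw [sub_pos, div_lt_one (by linarith)]; linarith
  rw [Real.exp_neg]
  rw [div_le_iff₀ h3] at h1
  rw [inv_le_iff_one_le_mul₀ (Real.exp_pos _)]
  linarith

lemma IsSieveDensity.elemSum_block_le {B : Finset ℕ} {g : ℕ → ℝ} {z : ℝ} (hz : 2 ≤ z)
    (h : IsSieveDensity B g z) (hB : ∀ p ∈ B, Real.sqrt z < p) (m : ℕ) :
    elemSum g m B ≤ (Real.exp 24 * Real.exp (12 * Real.exp 1) * Real.exp (-(m : ℝ)))
      * ∏ p ∈ B, (1 - g p) := by
  have hs : ∑ p ∈ B, (1 : ℝ) / p ≤ 6 :=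
    sum_inv_prime_block_le hz B fun p hp => ⟨h.prime p hp, hB p hp, h.le p hp⟩
  have hg : ∑ p ∈ B, g p ≤ 12 := by
    calc _ ≤ ∑ p ∈ B, 2 * ((1 : ℝ) / p) := Finset.sum_le_sum fun p hp => by
          have := h.le_two_div p hp
          rw [mul_one_div]; exact this
      _ ≤ 12 := by rw [← Finset.mul_sum]; linarith
  have hg0 : 0 ≤ ∑ p ∈ B, g p := Finset.sum_nonneg h.nonneg
  have h1 : elemSum g m B ≤ Real.exp (12 * Real.exp 1) * Real.exp (-(m : ℝ)) := by
    refine (elemSum_le g m B h.nonneg).trans ?_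
    have h2 : (12 * Real.exp 1) ^ m / m.factorial ≤ Real.exp (12 * Real.exp 1) :=
      Real.pow_div_factorial_le_exp _ (by positivity) m
    calc _ ≤ (12 : ℝ) ^ m / m.factorial := by gcongr
      _ = (12 * Real.exp 1) ^ m / m.factorial * Real.exp (-(m : ℝ)) := by
          rw [mul_pow, ← Real.exp_nat_mul, mul_one, Real.exp_neg]
          have := Real.exp_pos (m : ℝ)
          field_simp
      _ ≤ _ := by gcongr
  have h2 : Real.exp (-24) ≤ ∏ p ∈ B, (1 - g p) := by
    calc Real.exp (-24) ≤ Real.exp (∑ p ∈ B, -(4 * (1 / (p : ℝ)))) := by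
          apply Real.exp_le_exp.2
          rw [Finset.sum_neg_distrib, ← Finset.mul_sum]; linarith
      _ = ∏ p ∈ B, Real.exp (-(4 * (1 / (p : ℝ)))) := Real.exp_sum _ _
      _ ≤ ∏ p ∈ B, (1 - g p) := by
          refine Finset.prod_le_prod (fun _ _ => (Real.exp_pos _).le) fun p hp => ?_
          refine le_trans ?_ (h.sq_le p hp)
          have := one_sub_inv_prime_ge (h.prime p hp)
          calc _ = Real.exp (-(2 / p)) ^ 2 := by
                rw [← Real.exp_nat_mul]; congr 1; push_cast; ring
            _ ≤ _ := by gcongr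
  have h3 : 1 ≤ Real.exp 24 * ∏ p ∈ B, (1 - g p) := by
    calc (1 : ℝ) = Real.exp 24 * Real.exp (-24) := by rw [← Real.exp_add]; simp
      _ ≤ _ := by gcongr
  calc _ ≤ Real.exp (12 * Real.exp 1) * Real.exp (-(m : ℝ)) := h1
    _ ≤ (Real.exp (12 * Real.exp 1) * Real.exp (-(m : ℝ)))
        * (Real.exp 24 * ∏ p ∈ B, (1 - g p)) := le_mul_of_one_le_right (by positivity) h3
    _ = _ := by ring

lemma IsSieveDensity.mono {P Q : Finset ℕ} {g : ℕ → ℝ} {z w : ℝ} (h : IsSieveDensity P g z)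
    (hQ : Q ⊆ P) (hw : ∀ p ∈ Q, (p : ℝ) ≤ w) : IsSieveDensity Q g w :=
  ⟨fun p hp => h.prime p (hQ hp), hw, fun p hp => h.nonneg p (hQ hp),
    fun p hp => h.le_one p (hQ hp), fun p hp => h.le_two_div p (hQ hp),
    fun p hp => h.sq_le p (hQ hp)⟩

lemma IsSieveDensity.exists_sievePair_aux {K : ℝ}
    (hK : K = 4 * (Real.exp 24 * Real.exp (12 * Real.exp 1))) (k : ℕ) :
    ∀ (b : ℕ) (z : ℝ), 1 ≤ z → z < 2 ^ 2 ^ k → ∀ (P : Finset ℕ) (g : ℕ → ℝ),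
      IsSieveDensity P g z → ∃ lp lm,
        IsSievePair P g ((Real.exp (K * Real.exp (-(b : ℝ))) - 1) / 2) (z ^ (4 * b + 6)) lp lm := by
  have hK0 : 0 < K := by rw [hK]; positivity
  have hη0 : ∀ b : ℕ, 0 ≤ (Real.exp (K * Real.exp (-(b : ℝ))) - 1) / 2 := by
    intro b
    have := Real.add_one_le_exp (K * Real.exp (-(b : ℝ)))
    have : 0 ≤ K * Real.exp (-(b : ℝ)) := by positivity
    linarith
  induction k with
  | zero =>
    intro b z hz1 hz P g h
    have hP : P = ∅ := by
      rw [Finset.eq_empty_iff_forall_notMem]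
      intro p hp
      have h1 := h.le p hp
      have h2 : (2 : ℝ) ≤ p := by exact_mod_cast (h.prime p hp).two_le
      norm_num at hz
      linarith
    subst hP
    exact ⟨_, _, isSievePair_empty g (hη0 b) (one_le_pow₀ hz1)⟩
  | succ k ih =>
    intro b z hz1 hz P g h
    rcases lt_or_ge z 2 with hz2 | hz2
    · refine ih b z hz1 (hz2.trans_le ?_) P g h
      exact le_self_pow₀ (by norm_num) (by positivity)
    have hz0 : 0 ≤ z := by linarith
    set w := Real.sqrt z with hw
    have hw1 : 1 ≤ w := by rw [hw]; exact Real.one_le_sqrt.2 hz1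
    have hww : w ^ 2 = z := Real.sq_sqrt hz0
    have hw2 : w < 2 ^ 2 ^ k := by
      rw [hw, Real.sqrt_lt' (by positivity), ← pow_mul, ← pow_succ]
      exact hz
    obtain ⟨lp, lm, hs⟩ := ih (b + 1) w hw1 hw2 (P.filter fun p : ℕ => (p : ℝ) ≤ w) g
      (h.mono (filter_subset _ _) fun p hp => (mem_filter.1 hp).2)
    have hun : (P.filter fun p : ℕ => (p : ℝ) ≤ w) ∪ (P.filter fun p : ℕ => ¬ (p : ℝ) ≤ w) = P :=
      filter_union_filter_not_eq _ _
    have hBd : IsSieveDensity (P.filter fun p : ℕ => ¬ (p : ℝ) ≤ w) g z :=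
      h.mono (filter_subset _ _) fun p hp => h.le p (mem_filter.1 hp).1
    have hε := hBd.elemSum_block_le hz2 (fun p hp => not_le.1 (mem_filter.1 hp).2) (2 * b + 1)
    obtain ⟨lp', lm', hs'⟩ := hs.union (disjoint_filter_filter_not _ _ _) b hz1
      (fun p hp => h.le p (mem_filter.1 hp).1) (by rw [hun]; exact h.nonneg)
      (by rw [hun]; exact h.le_one) (hη0 _) hε (by positivity)
      (η' := (Real.exp (K * Real.exp (-(b : ℝ))) - 1) / 2) (by
        set E := Real.exp 24 * Real.exp (12 * Real.exp 1)
        have hE : 0 < E := by positivity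
        have e1 : Real.exp (-((2 * b + 1 : ℕ) : ℝ)) ≤ Real.exp (-(b : ℝ)) * Real.exp (-1) := by
          rw [← Real.exp_add]; apply Real.exp_le_exp.2; push_cast
          have : (0 : ℝ) ≤ b := Nat.cast_nonneg b
          linarith
        have e2 : Real.exp (-((b + 1 : ℕ) : ℝ)) = Real.exp (-(b : ℝ)) * Real.exp (-1) := by
          rw [← Real.exp_add]; congr 1; push_cast; ring
        have e3 : Real.exp (-1) ≤ 1 / 2 := by
          have := Real.exp_neg_one_lt_d9; linarith
        have e4 := Real.add_one_le_exp (2 * (E * Real.exp (-((2 * b + 1 : ℕ) : ℝ))))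
        have hx := Real.exp_pos (-(b : ℝ))
        calc _ = Real.exp (K * Real.exp (-((b + 1 : ℕ) : ℝ)))
              * (2 * (E * Real.exp (-((2 * b + 1 : ℕ) : ℝ))) + 1) := by ring
          _ ≤ Real.exp (K * Real.exp (-((b + 1 : ℕ) : ℝ)))
              * Real.exp (2 * (E * Real.exp (-((2 * b + 1 : ℕ) : ℝ)))) := by gcongr
          _ ≤ Real.exp (K * Real.exp (-(b : ℝ))) := by
              rw [← Real.exp_add]
              apply Real.exp_le_exp.2
              rw [e2]
              have : E * Real.exp (-((2 * b + 1 : ℕ) : ℝ))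
                  ≤ E * (Real.exp (-(b : ℝ)) * (1 / 2)) := by
                gcongr
                exact e1.trans (by gcongr)
              have h5 : K * (Real.exp (-(b : ℝ)) * Real.exp (-1))
                  ≤ K * (Real.exp (-(b : ℝ)) * (1 / 2)) := by gcongr
              have h6 : K * (Real.exp (-(b : ℝ)) * (1 / 2))
                = 2 * (E * Real.exp (-(b : ℝ))) := by rw [hK]; ring
              have h7 : K * Real.exp (-(b : ℝ)) = 4 * (E * Real.exp (-(b : ℝ))) := by
                rw [hK]; ring
              have h8 : 0 < E * Real.exp (-(b : ℝ)) := by positivity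
              linarith
          _ = _ := by ring)
    rw [hun] at hs'
    refine ⟨lp', lm', ?_⟩
    convert hs' using 1
    rw [← hww, ← pow_mul, ← pow_mul, ← pow_add]
    congr 1
    ring

lemma IsSievePair.mono {P : Finset ℕ} {g : ℕ → ℝ} {η η' y : ℝ} {lp lm : Finset ℕ → ℝ}
    (h : IsSievePair P g η y lp lm) (hη : η ≤ η') (h1 : ∀ p ∈ P, g p ≤ 1) :
    IsSievePair P g η' y lp lm := by
  have hV : 0 ≤ ∏ p ∈ P, (1 - g p) := prod_nonneg fun p hp => by linarith [h1 p hp]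
  refine ⟨h.abs_upper, h.abs_lower, h.supp_upper, h.supp_lower, h.upper, h.lower, h.main_ge,
    h.main_le.trans ?_, h.main_sub.trans ?_⟩ <;> gcongr

/-- Existence of Brun-Hooley type weights of level `z ^ (4 * b + 6)`. -/
theorem exists_sievePair : ∃ K : ℝ, 0 < K ∧ ∀ (b : ℕ) (z : ℝ), 1 ≤ z →
    ∀ (P : Finset ℕ) (g : ℕ → ℝ), IsSieveDensity P g z →
      ∃ lp lm, IsSievePair P g (K * Real.exp (-(b : ℝ))) (z ^ (4 * b + 6)) lp lm := by
  obtain ⟨K, hK⟩ : ∃ K : ℝ, K = 4 * (Real.exp 24 * Real.exp (12 * Real.exp 1)) := ⟨_, rfl⟩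
  have hK0 : 0 < K := by rw [hK]; positivity
  refine ⟨K * Real.exp K, by positivity, fun b z hz P g h => ?_⟩
  obtain ⟨k, hk⟩ : ∃ k : ℕ, z < 2 ^ 2 ^ k := by
    obtain ⟨n, hn⟩ := pow_unbounded_of_one_lt z (one_lt_two)
    exact ⟨n, hn.trans (pow_lt_pow_right₀ one_lt_two n.lt_two_pow_self)⟩
  obtain ⟨lp, lm, hs⟩ := IsSieveDensity.exists_sievePair_aux hK k b z hz hk P g h
  refine ⟨lp, lm, hs.mono ?_ h.le_one⟩
  set x := K * Real.exp (-(b : ℝ)) with hx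
  have hx0 : 0 < x := by positivity
  have hxK : x ≤ K := by
    rw [hx]
    refine mul_le_of_le_one_right hK0.le (Real.exp_le_one_iff.2 ?_)
    simp
  have h1 : Real.exp x - 1 ≤ x * Real.exp x := by
    have := Real.add_one_le_exp (-x)
    have h2 : Real.exp (-x) * Real.exp x = 1 := by rw [← Real.exp_add]; simp
    nlinarith [Real.exp_pos x]
  have h2 : x * Real.exp x ≤ x * Real.exp K := by gcongr
  have h3 : K * Real.exp K * Real.exp (-(b : ℝ)) = x * Real.exp K := by rw [hx]; ring
  have : 0 < x * Real.exp K := by positivity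
  linarith

lemma abs_card_modEq_sub_le (v : ℕ) {r : ℕ} (hr : 0 < r) {x : ℝ} (hx : 0 ≤ x) :
    |(((Icc 1 ⌊x⌋₊).filter (fun n => n ≡ v [MOD r])).card : ℝ) - x / r| ≤ 2 := by
  set N := ⌊x⌋₊ with hN
  have h1 : (Icc 1 N).filter (fun n => n ≡ v [MOD r]) = (Ioc 0 N).filter (fun n => n ≡ v [MOD r]) := by
    ext n; simp only [mem_filter, mem_Icc, mem_Ioc]; constructor <;> rintro ⟨⟨a, b⟩, c⟩ <;>
      exact ⟨⟨by omega, b⟩, c⟩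
  have h2 := Nat.Ioc_filter_modEq_card 0 N hr v
  rw [← h1] at h2
  have hr' : (0 : ℚ) < r := by exact_mod_cast hr
  rw [max_eq_left (by
    rw [sub_nonneg]
    apply Int.floor_le_floor
    gcongr
    positivity)] at h2
  have f1 := Int.floor_le (((N : ℚ) - v) / r)
  have f2 := Int.lt_floor_add_one (((N : ℚ) - v) / r)
  have f3 := Int.floor_le ((((0 : ℕ) : ℚ) - v) / r)
  have f4 := Int.lt_floor_add_one ((((0 : ℕ) : ℚ) - v) / r)
  have h3 : ((((Icc 1 N).filter (fun n => n ≡ v [MOD r])).card : ℤ) : ℚ)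
    = (⌊((N : ℚ) - v) / r⌋ : ℚ) - (⌊(((0 : ℕ) : ℚ) - v) / r⌋ : ℚ) := by
    rw [h2]; push_cast; ring
  have e : ((N : ℚ) - v) / r - (((0 : ℕ) : ℚ) - v) / r = N / r := by
    push_cast; ring
  have hlo : (N : ℚ) / r - 1 ≤ (((Icc 1 N).filter (fun n => n ≡ v [MOD r])).card : ℚ) := by
    push_cast at h3; push_cast at *; linarith
  have hhi : (((Icc 1 N).filter (fun n => n ≡ v [MOD r])).card : ℚ) ≤ (N : ℚ) / r + 1 := by
    push_cast at h3; push_cast at *; linarith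
  have hlo' : (N : ℝ) / r - 1 ≤ (((Icc 1 N).filter (fun n => n ≡ v [MOD r])).card : ℝ) := by
    have := (Rat.cast_le (K := ℝ)).2 hlo
    push_cast at this; exact this
  have hhi' : (((Icc 1 N).filter (fun n => n ≡ v [MOD r])).card : ℝ) ≤ (N : ℝ) / r + 1 := by
    have := (Rat.cast_le (K := ℝ)).2 hhi
    push_cast at this; exact this
  have g1 : (N : ℝ) ≤ x := Nat.floor_le hx
  have g2 : x < N + 1 := Nat.lt_floor_add_one x
  have hr1 : (1 : ℝ) ≤ r := by exact_mod_cast hr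
  have g3 : (N : ℝ) / r ≤ x / r := by gcongr
  have g4 : x / r ≤ (N : ℝ) / r + 1 := by
    calc x / r ≤ (N + 1) / r := by gcongr
      _ = (N : ℝ) / r + 1 / r := by ring
      _ ≤ _ := by
        gcongr
        rw [div_le_one (by linarith)]; exact hr1
  rw [abs_le]; constructor <;> linarith

lemma exists_modEq_iff {q d : ℕ} [NeZero q] (hqd : Nat.Coprime q d) (a : ZMod q) :
    ∃ v : ℕ, ∀ n : ℕ, ((n : ZMod q) = a ∧ d ∣ n) ↔ n ≡ v [MOD q * d] := by
  refine ⟨Nat.chineseRemainder hqd a.val 0, fun n => ?_⟩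
  have hc := (Nat.chineseRemainder hqd a.val 0).2
  rw [← Nat.modEq_and_modEq_iff_modEq_mul hqd]
  have h1 : (n : ZMod q) = a ↔ n ≡ a.val [MOD q] := by
    conv_lhs => rw [← ZMod.natCast_zmod_val a]
    exact ZMod.natCast_eq_natCast_iff n a.val q
  rw [h1, ← Nat.modEq_zero_iff_dvd]
  constructor
  · rintro ⟨h, h'⟩; exact ⟨h.trans hc.1.symm, h'.trans hc.2.symm⟩
  · rintro ⟨h, h'⟩; exact ⟨h.trans hc.1, h'.trans hc.2⟩

lemma prod_primes_dvd_iff {D : Finset ℕ} (hD : ∀ p ∈ D, p.Prime) (n : ℕ) :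
    (∀ p ∈ D, p ∣ n) ↔ ∏ p ∈ D, p ∣ n := by
  constructor
  · intro h
    exact Finset.prod_primes_dvd n (fun p hp => (hD p hp).prime) h
  · intro h p hp
    exact (Finset.dvd_prod_of_mem _ hp).trans h

lemma abs_card_dvd_sub_le {q d : ℕ} [NeZero q] (hqd : Nat.Coprime q d) (hd : 0 < d)
    (a : ZMod q) {x : ℝ} (hx : 0 ≤ x) :
    |(((Icc 1 ⌊x⌋₊).filter (fun n : ℕ => (n : ZMod q) = a ∧ d ∣ n)).card : ℝ) - x / q * (1 / d)|
      ≤ 2 := by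
  obtain ⟨v, hv⟩ := exists_modEq_iff hqd a
  rw [Finset.filter_congr (fun n _ => hv n)]
  have := abs_card_modEq_sub_le v (r := q * d) (Nat.mul_pos (NeZero.pos q) hd) hx
  convert this using 3
  push_cast
  field_simp

/-- Numbers without prime factors up to `z`. -/
def Rough (z : ℝ) (n : ℕ) : Prop := ∀ p ∈ primesUpTo z, ¬ p ∣ n

noncomputable instance (z : ℝ) (n : ℕ) : Decidable (Rough z n) := by
  unfold Rough; infer_instance

/-- The density of rough numbers. -/
noncomputable def rho (z : ℝ) : ℝ := ∏ p ∈ primesUpTo z, (1 - 1 / (p : ℝ))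

/-- The number of `z`-rough numbers up to `x` in a residue class. -/
noncomputable def roughCount (z : ℝ) {q : ℕ} (a : ZMod q) (x : ℝ) : ℕ :=
  ((Icc 1 ⌊x⌋₊).filter (fun n : ℕ => (n : ZMod q) = a ∧ Rough z n)).card

lemma prime_of_mem_primesUpTo {z : ℝ} {p : ℕ} (hp : p ∈ primesUpTo z) : p.Prime :=
  (mem_filter.1 hp).2

lemma rho_pos (z : ℝ) : 0 < rho z := by
  refine Finset.prod_pos fun p hp => ?_
  have := (prime_of_mem_primesUpTo hp).one_lt
  have h : (1 : ℝ) < p := by exact_mod_cast this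
  rw [sub_pos, div_lt_one (by linarith)]; exact h

lemma rho_le_one (z : ℝ) : rho z ≤ 1 := by
  refine Finset.prod_le_one (fun p hp => ?_) fun p _ => ?_
  · have := (prime_of_mem_primesUpTo hp).one_lt
    have h : (1 : ℝ) < p := by exact_mod_cast this
    rw [sub_nonneg, div_le_one (by linarith)]; exact h.le
  · have : (0 : ℝ) ≤ 1 / p := by positivity
    linarith

lemma rho_anti {z w : ℝ} (h : z ≤ w) : rho w ≤ rho z := by
  have hs : primesUpTo z ⊆ primesUpTo w := by
    intro p hp
    simp only [primesUpTo, mem_filter, mem_range] at hp ⊢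
    exact ⟨lt_of_lt_of_le hp.1 (Nat.add_le_add_right (Nat.floor_mono h) 1), hp.2⟩
  unfold rho
  rw [← Finset.prod_sdiff hs]
  refine mul_le_of_le_one_left (rho_pos z).le ?_
  refine Finset.prod_le_one (fun p hp => ?_) fun p _ => ?_
  · have := (prime_of_mem_primesUpTo (mem_sdiff.1 hp).1).one_lt
    have h : (1 : ℝ) < p := by exact_mod_cast this
    rw [sub_nonneg, div_le_one (by linarith)]; exact h.le
  · have : (0 : ℝ) ≤ 1 / p := by positivity
    linarith

lemma rho_eq_totient {q : ℕ} (hq : 0 < q) {z : ℝ} (hz : (q : ℝ) ≤ z) :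
    (∏ p ∈ (primesUpTo z).filter (fun p => ¬ p ∣ q), (1 - 1 / (p : ℝ))) * (q.totient : ℝ) / q
      = rho z := by
  have hq0 : (q : ℝ) ≠ 0 := by positivity
  have hz0 : 0 ≤ z := le_trans (by positivity) hz
  have h1 : (primesUpTo z).filter (fun p => p ∣ q) = q.primeFactors := by
    ext p
    simp only [mem_filter, mem_primesUpTo hz0, Nat.mem_primeFactors]
    constructor
    · rintro ⟨⟨a, _⟩, c⟩; exact ⟨a, c, by omega⟩
    · rintro ⟨a, b, _⟩
      refine ⟨⟨a, le_trans ?_ hz⟩, b⟩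
      exact_mod_cast Nat.le_of_dvd hq b
  have h2 : (q.totient : ℝ) = q * ∏ p ∈ q.primeFactors, (1 - 1 / (p : ℝ)) := by
    have := Nat.totient_eq_mul_prod_factors q
    have h3 : ((q.totient : ℚ) : ℝ) = ((q * ∏ p ∈ q.primeFactors, (1 - (p : ℚ)⁻¹) : ℚ) : ℝ) := by
      rw [this]
    push_cast at h3
    simpa [one_div] using h3
  rw [h2, ← h1, mul_div_assoc, mul_div_cancel_left₀ _ hq0, rho,
    ← Finset.prod_filter_mul_prod_filter_not (primesUpTo z) (fun p => p ∣ q), mul_comm]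

lemma card_subsets_le {P : Finset ℕ} (hP : ∀ p ∈ P, p.Prime) {y : ℝ} (hy : 0 ≤ y) :
    ((P.powerset.filter (fun D : Finset ℕ => ∏ p ∈ D, (p : ℝ) ≤ y)).card : ℝ) ≤ y := by
  have h : (P.powerset.filter (fun D : Finset ℕ => ∏ p ∈ D, (p : ℝ) ≤ y)).card
      ≤ (Icc 1 ⌊y⌋₊).card := by
    refine Finset.card_le_card_of_injOn (fun D => ∏ p ∈ D, p) ?_ ?_
    · intro D hD
      simp only [coe_filter, mem_powerset, Set.mem_ofPred_eq] at hD
      simp only [coe_Icc, Set.mem_Icc]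
      refine ⟨Finset.prod_pos fun p hp => (hP p (hD.1 hp)).pos, Nat.le_floor ?_⟩
      push_cast; exact hD.2
    · intro D hD E hE h
      simp only [coe_filter, mem_powerset, Set.mem_ofPred_eq] at hD hE
      simp only at h
      rw [← Nat.primeFactors_prod (s := D) (fun p hp => hP p (hD.1 hp)),
        ← Nat.primeFactors_prod (s := E) (fun p hp => hP p (hE.1 hp)), h]
  rw [Nat.card_Icc, Nat.add_sub_cancel] at h
  exact le_trans (by exact_mod_cast h) (Nat.floor_le hy)

/-- Fundamental lemma for rough numbers in arithmetic progressions. -/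
theorem exists_abs_roughCount_sub_le : ∃ K : ℝ, 0 < K ∧ ∀ (b : ℕ) (z : ℝ) (q : ℕ) [NeZero q],
    (q : ℝ) ≤ z → ∀ a : ZMod q, IsUnit a → ∀ x : ℝ, 0 ≤ x →
      |(roughCount z a x : ℝ) - rho z * x / q.totient|
        ≤ K * Real.exp (-(b : ℝ)) * (rho z * x / q.totient) + 2 * z ^ (4 * b + 6) := by
  obtain ⟨K, hK, hsieve⟩ := exists_sievePair
  refine ⟨K, hK, fun b z q _ hqz a ha x hx => ?_⟩
  have hq : 0 < q := NeZero.pos q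
  have hq1 : (1 : ℝ) ≤ q := by exact_mod_cast hq
  have hz1 : 1 ≤ z := hq1.trans hqz
  have hz0 : 0 ≤ z := by linarith
  set P := (primesUpTo z).filter (fun p => ¬ p ∣ q) with hP
  have hPprime : ∀ p ∈ P, p.Prime := fun p hp => prime_of_mem_primesUpTo (mem_filter.1 hp).1
  have hPge : ∀ p ∈ P, (2 : ℝ) ≤ p := fun p hp => by exact_mod_cast (hPprime p hp).two_le
  have hPinv : ∀ p ∈ P, 1 / (p : ℝ) ≤ 1 := fun p hp => by
    rw [div_le_one (by linarith [hPge p hp])]; linarith [hPge p hp]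
  have hdens : IsSieveDensity P (fun p => 1 / (p : ℝ)) z := by
    refine ⟨hPprime, fun p hp => ((mem_primesUpTo hz0).1 (mem_filter.1 hp).1).2,
      fun p _ => by positivity, hPinv, fun p _ => by gcongr; norm_num, fun p hp => ?_⟩
    have h1 := hPinv p hp
    have h2 : 0 ≤ 1 / (p : ℝ) := by positivity
    nlinarith
  obtain ⟨lp, lm, hs⟩ := hsieve b z hz1 P _ hdens
  have key := hs.abs_sum_sub_le ((Icc 1 ⌊x⌋₊).filter (fun n : ℕ => (n : ZMod q) = a))
    (fun _ => 1) (fun _ _ => zero_le_one) (Y := x / q) (by positivity) (fun _ => 2)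
    (fun _ => by norm_num) (by
      intro D hD _
      have hDp : ∀ p ∈ D, p.Prime := fun p hp => hPprime p (hD hp)
      have hcop : Nat.Coprime q (∏ p ∈ D, p) := by
        refine Nat.Coprime.prod_right fun p hp => ?_
        rw [Nat.coprime_comm, Nat.Prime.coprime_iff_not_dvd (hDp p hp)]
        exact (mem_filter.1 (hD hp)).2
      have h := abs_card_dvd_sub_le hcop (Finset.prod_pos fun p hp => (hDp p hp).pos) a hx
      have e1 : ∑ n ∈ (Icc 1 ⌊x⌋₊).filter (fun n : ℕ => (n : ZMod q) = a) with ∀ p ∈ D, p ∣ n,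
          (1 : ℝ) = (((Icc 1 ⌊x⌋₊).filter (fun n : ℕ => (n : ZMod q) = a ∧ ∏ p ∈ D, p ∣ n)).card : ℝ) := by
        rw [Finset.filter_filter]
        simp only [sum_const, nsmul_eq_mul, mul_one]
        congr 2
        refine Finset.filter_congr fun n _ => ?_
        rw [prod_primes_dvd_iff hDp]
      rw [e1]
      convert h using 3
      push_cast
      simp [one_div])
  have e1 : ∑ n ∈ (Icc 1 ⌊x⌋₊).filter (fun n : ℕ => (n : ZMod q) = a) with ∀ p ∈ P, ¬ p ∣ n,
      (1 : ℝ) = roughCount z a x := by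
    rw [Finset.filter_filter]
    simp only [sum_const, nsmul_eq_mul, mul_one, roughCount]
    congr 2
    refine Finset.filter_congr fun n _ => ?_
    refine and_congr_right fun hn => ?_
    constructor
    · intro h p hp hpn
      by_cases hpq : p ∣ q
      · have hpp := prime_of_mem_primesUpTo hp
        rw [← hn, ZMod.isUnit_iff_coprime] at ha
        exact Nat.Prime.not_dvd_one hpp (ha ▸ Nat.dvd_gcd hpn hpq)
      · exact h p (mem_filter.2 ⟨hp, hpq⟩) hpn
    · intro h p hp
      exact h p (mem_filter.1 hp).1
  have hφ : (0 : ℝ) < q.totient := by exact_mod_cast Nat.totient_pos.2 hq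
  have e2 : x / q * ∏ p ∈ P, (1 - 1 / (p : ℝ)) = rho z * x / q.totient := by
    rw [← rho_eq_totient hq hqz, ← hP]
    field_simp
  have e3 : ∑ D ∈ P.powerset.filter (fun D : Finset ℕ => ∏ p ∈ D, (p : ℝ) ≤ z ^ (4 * b + 6)),
      (2 : ℝ) ≤ 2 * z ^ (4 * b + 6) := by
    have := card_subsets_le hPprime (y := z ^ (4 * b + 6)) (by positivity)
    simp only [sum_const, nsmul_eq_mul]
    linarith
  rw [e1, e2] at key
  linarith

lemma rho_le_inv_log {z : ℝ} (hz : 1 < z) : rho z ≤ 1 / Real.log z := by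
  let f : ℕ →* ℝ :=
    { toFun := fun n => (n : ℝ)⁻¹
      map_one' := by simp
      map_mul' := fun m n => by push_cast; rw [mul_inv] }
  have hf : ∀ n, f n = (n : ℝ)⁻¹ := fun n => rfl
  have h := (EulerProduct.summable_and_hasSum_factoredNumbers_prod_filter_prime_geometric (f := f)
    (fun {p} hp => by
      have : (1 : ℝ) < p := by exact_mod_cast hp.one_lt
      rw [hf, Real.norm_of_nonneg (by positivity)]
      exact inv_lt_one_of_one_lt₀ this) (range (⌊z⌋₊ + 1))).2
  have hprod : ∏ p ∈ range (⌊z⌋₊ + 1) with p.Prime, (1 - f p)⁻¹ = (rho z)⁻¹ := by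
    rw [rho, ← Finset.prod_inv_distrib]
    refine Finset.prod_congr rfl fun p _ => ?_
    rw [hf, one_div]
  rw [hprod] at h
  have hmem : ∀ n ∈ Icc 1 ⌊z⌋₊, n ∈ Nat.factoredNumbers (range (⌊z⌋₊ + 1)) := by
    intro n hn
    have := mem_Icc.1 hn
    rw [Nat.mem_factoredNumbers']
    intro p _ hpn
    have := Nat.le_of_dvd (by omega) hpn
    simp; omega
  have hsum : ∑ n ∈ Icc 1 ⌊z⌋₊, (n : ℝ)⁻¹ ≤ (rho z)⁻¹ := by
    have := sum_le_hasSum ((Icc 1 ⌊z⌋₊).subtype (· ∈ Nat.factoredNumbers (range (⌊z⌋₊ + 1))))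
      (fun n _ => by rw [hf]; positivity) h
    refine le_trans (le_of_eq ?_) this
    rw [Finset.sum_subtype_of_mem (fun n => f n) hmem]
    exact Finset.sum_congr rfl fun n _ => (hf n).symm
  have hharm : Real.log (⌊z⌋₊ + 1 : ℕ) ≤ ∑ n ∈ Icc 1 ⌊z⌋₊, (n : ℝ)⁻¹ := by
    refine (log_add_one_le_harmonic ⌊z⌋₊).trans (le_of_eq ?_)
    rw [harmonic_eq_sum_Icc]; push_cast; rfl
  have hlog : Real.log z ≤ Real.log (⌊z⌋₊ + 1 : ℕ) := by
    apply Real.log_le_log (by linarith)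
    push_cast
    exact (Nat.lt_floor_add_one z).le
  have hl0 : 0 < Real.log z := Real.log_pos hz
  rw [one_div]
  rw [le_inv_comm₀ (rho_pos z) hl0]
  linarith

lemma not_dvd_of_prime_of_lt {z : ℝ} (hz : 0 ≤ z) {p : ℕ} (hp : p.Prime) (h : z < p) :
    Rough z p := by
  intro r hr hrp
  have hr' := (mem_primesUpTo hz).1 hr
  have := (Nat.prime_dvd_prime_iff_eq hr'.1 hp).1 hrp
  subst this
  linarith [hr'.2]

lemma card_primes_le_roughCount_add {z : ℝ} (hz : 0 ≤ z) {q : ℕ} (a : ZMod q) (x : ℝ) :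
    (((Icc 1 ⌊x⌋₊).filter (fun n : ℕ => (n : ZMod q) = a ∧ n.Prime)).card : ℝ)
      ≤ roughCount z a x + z := by
  have h : ((Icc 1 ⌊x⌋₊).filter (fun n : ℕ => (n : ZMod q) = a ∧ n.Prime)).card
      ≤ roughCount z a x + ⌊z⌋₊ := by
    have h2 : (Icc 1 ⌊x⌋₊).filter (fun n : ℕ => (n : ZMod q) = a ∧ n.Prime)
        ⊆ (Icc 1 ⌊x⌋₊).filter (fun n : ℕ => (n : ZMod q) = a ∧ Rough z n) ∪ Icc 1 ⌊z⌋₊ := by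
      intro p hp
      simp only [mem_filter, mem_union, mem_Icc] at hp ⊢
      rcases le_or_gt (p : ℝ) z with hpz | hpz
      · right; exact ⟨hp.1.1, Nat.le_floor hpz⟩
      · left; exact ⟨hp.1, hp.2.1, not_dvd_of_prime_of_lt hz hp.2.2 hpz⟩
    refine (card_le_card h2).trans ((card_union_le _ _).trans ?_)
    simp [roughCount]
  have h3 : (⌊z⌋₊ : ℝ) ≤ z := Nat.floor_le hz
  have h4 : (((Icc 1 ⌊x⌋₊).filter (fun n : ℕ => (n : ZMod q) = a ∧ n.Prime)).card : ℝ)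
      ≤ (roughCount z a x : ℝ) + ⌊z⌋₊ := by exact_mod_cast h
  linarith

lemma exists_rho_ge : ∃ c : ℝ, 0 < c ∧ c ≤ 1 ∧ ∀ z : ℝ, 2 ≤ z → c / Real.log z ≤ rho z := by
  obtain ⟨K, hK, hF⟩ := exists_abs_roughCount_sub_le
  have main : ∀ z : ℝ, 5 ≤ z → 1 / (40 * (1 + K)) / Real.log z ≤ rho z := by
    intro z hz
    have hz0 : 0 ≤ z := by linarith
    have hl0 : 0 < Real.log z := Real.log_pos (by linarith)
    have hlz : Real.log z ≤ z := (Real.log_le_sub_one_of_pos (by linarith)).trans (by linarith)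
    have h1 := hF 0 z 1 (by push_cast; linarith) 1 isUnit_one (z ^ 10) (by positivity)
    have h2 := (abs_le.1 h1).2
    simp only [Nat.totient_one, Nat.cast_one, div_one, Nat.cast_zero, neg_zero, Real.exp_zero,
      mul_one, mul_zero, zero_add] at h2
    have h3 := card_primes_le_roughCount_add hz0 (1 : ZMod 1) (z ^ 10)
    have h4 := Chebyshev.pi_ge' (x := z ^ 10) (one_lt_pow₀ (by linarith) (by norm_num))
    have e1 : ((Icc 1 ⌊z ^ 10⌋₊).filter (fun n : ℕ => (n : ZMod 1) = 1 ∧ n.Prime)).card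
        = Nat.primeCounting ⌊z ^ 10⌋₊ := by
      rw [Nat.primeCounting, Nat.primeCounting', Nat.count_eq_card_filter_range]
      congr 1
      ext n
      simp only [mem_filter, mem_Icc, mem_range, Nat.lt_succ_iff]
      constructor
      · rintro ⟨⟨a, b⟩, c, d⟩; exact ⟨b, d⟩
      · rintro ⟨a, b⟩; exact ⟨⟨b.one_lt.le, a⟩, Subsingleton.elim _ _, b⟩
    rw [e1] at h3
    have hlog10 : Real.log (z ^ 10) = 10 * Real.log z := by rw [Real.log_pow]; norm_num
    have z10 : (5 : ℝ) ^ 9 * z ≤ z ^ 10 := by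
      calc (5 : ℝ) ^ 9 * z ≤ z ^ 9 * z := by gcongr
        _ = z ^ 10 := by ring
    have hlog2 : Real.log (z ^ 10 + 2) ≤ 11 * z := by
      calc Real.log (z ^ 10 + 2) ≤ Real.log (z ^ 11) := by
            apply Real.log_le_log (by positivity)
            have : z ^ 11 = z ^ 10 * z := by ring
            nlinarith
        _ = 11 * Real.log z := by rw [Real.log_pow]; norm_num
        _ ≤ _ := by linarith
    have hl2 := Real.log_two_gt_d9
    rw [hlog10] at h4
    have h5 : z ^ 10 / (20 * Real.log z) ≤ Nat.primeCounting ⌊z ^ 10⌋₊ := by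
      refine le_trans ?_ h4
      rw [div_le_div_iff₀ (by positivity) (by positivity)]
      have : z ^ 10 / 2 ≤ (z ^ 10 - 1) * Real.log 2 - Real.log (z ^ 10 + 2) := by
        norm_num at z10
        nlinarith
      nlinarith
    have h6 : 3 * z ^ 6 ≤ z ^ 10 / (40 * Real.log z) := by
      rw [le_div_iff₀ (by positivity)]
      calc 3 * z ^ 6 * (40 * Real.log z) ≤ 3 * z ^ 6 * (40 * z) := by gcongr
        _ = 120 * z ^ 7 := by ring
        _ ≤ z ^ 3 * z ^ 7 := by
            have : (120 : ℝ) ≤ z ^ 3 := by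
              calc (120 : ℝ) ≤ 5 ^ 3 := by norm_num
                _ ≤ z ^ 3 := by gcongr
            gcongr
        _ = z ^ 10 := by ring
    have h7 : z ≤ z ^ 6 := le_self_pow₀ (by linarith) (by norm_num)
    have h8 : z ^ 10 / (20 * Real.log z) = 2 * (z ^ 10 / (40 * Real.log z)) := by
      field_simp; norm_num
    have h9 : z ^ 10 / (40 * Real.log z) ≤ (1 + K) * rho z * z ^ 10 := by nlinarith
    rw [div_div, div_le_iff₀ (by positivity)]
    rw [div_le_iff₀ (by positivity)] at h9
    have hz10 : 0 < z ^ 10 := by positivity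
    nlinarith
  refine ⟨1 / (120 * (1 + K)), by positivity, ?_, fun z hz => ?_⟩
  · rw [div_le_one (by positivity)]; linarith
  have hl0 : 0 < Real.log z := Real.log_pos (by linarith)
  rcases le_or_gt 5 z with h | h
  · refine le_trans ?_ (main z h)
    gcongr
    norm_num
  · have h5 := main 5 le_rfl
    refine le_trans (le_trans ?_ h5) (rho_anti h.le)
    have hl5 : Real.log 5 ≤ 3 * Real.log z := by
      calc Real.log 5 ≤ Real.log (2 ^ 3) := Real.log_le_log (by norm_num) (by norm_num)
        _ = 3 * Real.log 2 := by rw [Real.log_pow]; norm_num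
        _ ≤ 3 * Real.log z := by gcongr
    have hl50 : 0 < Real.log 5 := Real.log_pos (by norm_num)
    rw [div_div, div_div, div_le_div_iff₀ (by positivity) (by positivity)]
    nlinarith

lemma roughCount_anti {z w : ℝ} (h : z ≤ w) {q : ℕ} (a : ZMod q) (x : ℝ) :
    roughCount w a x ≤ roughCount z a x := by
  refine card_le_card (monotone_filter_right _ ?_)
  rintro n _ ⟨h1, h2⟩
  refine ⟨h1, fun p hp => h2 p ?_⟩
  simp only [primesUpTo, mem_filter, mem_range] at hp ⊢
  exact ⟨lt_of_lt_of_le hp.1 (Nat.add_le_add_right (Nat.floor_mono h) 1), hp.2⟩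

/-- Brun-Titchmarsh type bound for rough numbers. -/
theorem exists_roughCount_le : ∃ K : ℝ, 0 < K ∧ ∀ (q : ℕ) [NeZero q] (a : ZMod q), IsUnit a →
    ∀ y : ℝ, 1 < y → (q : ℝ) ^ 20 ≤ y →
      (roughCount (y ^ (1 / 20 : ℝ)) a y : ℝ) + y ^ (1 / 20 : ℝ)
        ≤ K * (y / (q.totient * Real.log y)) := by
  obtain ⟨K, hK, hF⟩ := exists_abs_roughCount_sub_le
  refine ⟨20 * (1 + K) + 60, by positivity, fun q _ a ha y hy hqy => ?_⟩
  set z := y ^ (1 / 20 : ℝ) with hz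
  have hy0 : 0 < y := by linarith
  have hzy : z ^ 20 = y := by
    rw [hz, ← Real.rpow_natCast, ← Real.rpow_mul hy0.le]; norm_num
  have hz1 : 1 < z := Real.one_lt_rpow hy (by norm_num)
  have hqz : (q : ℝ) ≤ z := by
    rw [← hzy] at hqy
    exact le_of_pow_le_pow_left₀ (by norm_num) (by linarith) hqy
  have hq : 0 < q := NeZero.pos q
  have hφ : (0 : ℝ) < q.totient := by exact_mod_cast Nat.totient_pos.2 hq
  have hφq : (q.totient : ℝ) ≤ q := by exact_mod_cast Nat.totient_le q
  have hlz : 0 < Real.log z := Real.log_pos hz1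
  have hlzz : Real.log z ≤ z := (Real.log_le_sub_one_of_pos (by linarith)).trans (by linarith)
  have hly : Real.log y = 20 * Real.log z := by rw [← hzy, Real.log_pow]; norm_num
  have h := (abs_le.1 (hF 0 z q hqz a ha y hy0.le)).2
  simp only [Nat.cast_zero, neg_zero, Real.exp_zero, mul_one, mul_zero, zero_add] at h
  have hr := rho_le_inv_log hz1
  set Q := y / (q.totient * Real.log y) with hQ
  have h1 : rho z * y / q.totient ≤ 20 * Q := by
    have : 20 * Q = (1 / Real.log z) * y / q.totient := by
      rw [hQ, hly]; field_simp
    rw [this]; gcongr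
  have h2 : z ^ 6 ≤ 20 * Q := by
    have : 20 * Q = z ^ 20 / (q.totient * Real.log z) := by
      rw [hQ, hly, hzy]; field_simp
    rw [this, le_div_iff₀ (by positivity)]
    calc z ^ 6 * (q.totient * Real.log z) ≤ z ^ 6 * (z * z) := by
          gcongr; exact hφq.trans hqz
      _ = z ^ 8 := by ring
      _ ≤ z ^ 20 := pow_le_pow_right₀ hz1.le (by norm_num)
  have h3 : z ≤ z ^ 6 := le_self_pow₀ hz1.le (by norm_num)
  nlinarith

/-- The `z`-rough numbers greater than one and at most `x` in a residue class. -/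
noncomputable def roughCount₂ (z : ℝ) {q : ℕ} (a : ZMod q) (x : ℝ) : ℕ :=
  ((Icc 2 ⌊x⌋₊).filter (fun n : ℕ => (n : ZMod q) = a ∧ Rough z n)).card

lemma roughCount₂_le (z : ℝ) {q : ℕ} (a : ZMod q) (x : ℝ) :
    roughCount₂ z a x ≤ roughCount z a x := by
  refine card_le_card (filter_subset_filter _ ?_)
  exact Icc_subset_Icc_left (by norm_num)

lemma roughCount_le_add_one (z : ℝ) {q : ℕ} (a : ZMod q) (x : ℝ) :
    roughCount z a x ≤ roughCount₂ z a x + 1 := by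
  have h : (Icc 1 ⌊x⌋₊).filter (fun n : ℕ => (n : ZMod q) = a ∧ Rough z n)
      ⊆ (Icc 2 ⌊x⌋₊).filter (fun n : ℕ => (n : ZMod q) = a ∧ Rough z n) ∪ {1} := by
    intro n hn
    simp only [mem_filter, mem_Icc, mem_union, mem_singleton] at hn ⊢
    by_cases h1 : n = 1
    · right; exact h1
    · left; exact ⟨⟨by omega, hn.1.2⟩, hn.2⟩
  exact (card_le_card h).trans ((card_union_le _ _).trans (by simp [roughCount₂]))

lemma Rough.lt_of_one_lt {z : ℝ} (hz : 0 ≤ z) {n : ℕ} (h : Rough z n) (hn : 1 < n) :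
    z < n := by
  by_contra hcon
  push Not at hcon
  have hp := Nat.minFac_prime (n := n) (by omega)
  refine h n.minFac ((mem_primesUpTo hz).2 ⟨hp, le_trans ?_ hcon⟩) (Nat.minFac_dvd n)
  exact_mod_cast Nat.minFac_le (by omega)

lemma roughCount₂_eq_zero {z : ℝ} (hz : 0 ≤ z) {q : ℕ} (a : ZMod q) {x : ℝ} (hx0 : 0 ≤ x)
    (hx : x ≤ z) : roughCount₂ z a x = 0 := by
  rw [roughCount₂, card_eq_zero, filter_eq_empty_iff]
  rintro n hn ⟨_, h⟩
  have hn' := mem_Icc.1 hn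
  have h1 := h.lt_of_one_lt hz (by omega)
  have h2 : (n : ℝ) ≤ x := (Nat.le_floor_iff hx0).1 hn'.2
  linarith

set_option maxHeartbeats 800000 in
/-- Rough numbers in progressions have density `rho z / φ(q)`, with an error
decaying exponentially in `log x / log z`. -/
theorem exists_abs_roughCount₂_sub_le : ∃ K : ℝ, 0 < K ∧ ∀ (q : ℕ) [NeZero q] (z : ℝ), 4 ≤ z →
    (q : ℝ) ^ 20 ≤ z → ∀ a : ZMod q, IsUnit a → ∀ x : ℝ, 1 ≤ x →
      |(roughCount₂ z a x : ℝ) - rho z * x / q.totient|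
        ≤ K * (x * Real.exp (-(Real.log x / (8 * Real.log z))) / (q.totient * Real.log z)) := by
  obtain ⟨K, hK, hF⟩ := exists_abs_roughCount_sub_le
  obtain ⟨K₂, hK₂, hB⟩ := exists_roughCount_le
  refine ⟨(K * Real.exp 1 + 3) + (1 + K₂) * Real.exp 3, by positivity,
    fun q _ z hz4 hqz a ha x hx => ?_⟩
  have hz0 : 0 ≤ z := by linarith
  have hq : 0 < q := NeZero.pos q
  have hq1 : (1 : ℝ) ≤ q := by exact_mod_cast hq
  have hqz1 : (q : ℝ) ≤ z := (le_self_pow₀ hq1 (by norm_num)).trans hqz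
  have hφ : (0 : ℝ) < q.totient := by exact_mod_cast Nat.totient_pos.2 hq
  have hφq : (q.totient : ℝ) ≤ q := by exact_mod_cast Nat.totient_le q
  have hx0 : 0 < x := by linarith
  set l := Real.log z with hl
  have hzl : Real.exp l = z := Real.exp_log (by linarith)
  have hl1 : 5 / 4 ≤ l := by
    have h4 : Real.log 4 = 2 * Real.log 2 := by
      rw [show (4 : ℝ) = 2 ^ 2 by norm_num, Real.log_pow]; norm_num
    have := Real.log_two_gt_d9
    have : Real.log 4 ≤ l := Real.log_le_log (by norm_num) hz4
    linarith
  have hl0 : 0 < l := by linarith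
  have hlz : l ≤ z := by rw [← hzl]; linarith [Real.add_one_le_exp l]
  obtain ⟨u, hu⟩ : ∃ u, u = Real.log x / l := ⟨_, rfl⟩
  have hxu : x = Real.exp (u * l) := by
    rw [hu, div_mul_cancel₀ _ hl0.ne', Real.exp_log hx0]
  have hu0 : 0 ≤ u := by rw [hu]; exact div_nonneg (Real.log_nonneg hx) hl0.le
  have hexp : Real.log x / (8 * l) = u / 8 := by rw [hu]; field_simp
  rw [hexp]
  have hrho : rho z ≤ 1 / l := rho_le_inv_log (by linarith)
  have hY : rho z * x / q.totient ≤ x / (q.totient * l) := by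
    calc _ ≤ (1 / l) * x / q.totient := by gcongr
      _ = _ := by field_simp
  have hY0 : 0 ≤ rho z * x / q.totient := by
    have := (rho_pos z).le
    positivity
  obtain ⟨Q, hQ⟩ : ∃ Q, Q = x * Real.exp (-(u / 8)) / (q.totient * l) := ⟨_, rfl⟩
  have hQ0 : 0 < Q := by rw [hQ]; positivity
  rw [← hQ]
  rcases le_or_gt 20 u with hu20 | hu20
  · obtain ⟨b, hb⟩ : ∃ b, b = ⌊u / 8⌋₊ := ⟨_, rfl⟩
    have hb1 : (b : ℝ) ≤ u / 8 := by rw [hb]; exact Nat.floor_le (by positivity)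
    have hb2 : u / 8 < b + 1 := by rw [hb]; exact Nat.lt_floor_add_one _
    have h := hF b z q hqz1 a ha x hx0.le
    have hz6 : 1 ≤ z ^ (4 * b + 6) := one_le_pow₀ (by linarith)
    have h1 : K * Real.exp (-(b : ℝ)) * (rho z * x / q.totient) ≤ K * Real.exp 1 * Q := by
      have : Real.exp (-(b : ℝ)) ≤ Real.exp 1 * Real.exp (-(u / 8)) := by
        rw [← Real.exp_add]; apply Real.exp_le_exp.2; linarith
      calc _ ≤ K * (Real.exp 1 * Real.exp (-(u / 8))) * (x / (q.totient * l)) := by gcongr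
        _ = _ := by rw [hQ]; ring
    have h2 : z ^ (4 * b + 6) ≤ Q := by
      rw [hQ, le_div_iff₀ (by positivity)]
      calc z ^ (4 * b + 6) * (q.totient * l) ≤ z ^ (4 * b + 6) * (z * z) := by
            gcongr; exact hφq.trans hqz1
        _ = z ^ (4 * b + 8) := by ring
        _ = Real.exp ((4 * b + 8 : ℕ) * l) := by rw [Real.exp_nat_mul, hzl]
        _ ≤ Real.exp (u * l + -(u / 8)) := by
            apply Real.exp_le_exp.2
            push_cast
            have : (4 * (b : ℝ) + 8) * l ≤ (u / 2 + 8) * l := by gcongr; linarith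
            nlinarith
        _ = _ := by rw [Real.exp_add, ← hxu]
    have hc1 : (roughCount z a x : ℝ) ≤ roughCount₂ z a x + 1 := by
      exact_mod_cast roughCount_le_add_one z a x
    have hc2 : (roughCount₂ z a x : ℝ) ≤ roughCount z a x := by
      exact_mod_cast roughCount₂_le z a x
    have h3 := abs_le.1 h
    have h4 : 0 ≤ (1 + K₂) * Real.exp 3 * Q := by positivity
    have h5 : (K * Real.exp 1 + 3 + (1 + K₂) * Real.exp 3) * Q
        = K * Real.exp 1 * Q + 3 * Q + (1 + K₂) * Real.exp 3 * Q := by ring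
    rw [abs_le, h5]
    constructor <;> linarith
  · have hexp3 : x / (q.totient * l) ≤ Real.exp 3 * Q := by
      rw [hQ]
      calc _ = 1 * (x / (q.totient * l)) := (one_mul _).symm
        _ ≤ (Real.exp 3 * Real.exp (-(u / 8))) * (x / (q.totient * l)) := by
            gcongr
            rw [← Real.exp_add]; apply Real.one_le_exp; linarith
        _ = _ := by ring
    have hA : (roughCount₂ z a x : ℝ) ≤ K₂ * (x / (q.totient * l)) := by
      rcases le_or_gt x z with hxz | hxz
      · rw [roughCount₂_eq_zero hz0 a hx0.le hxz]
        push_cast; positivity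
      · have h1 := hB q a ha x (by linarith) (hqz.trans hxz.le)
        have h2 : x ^ (1 / 20 : ℝ) ≤ z := by
          rw [hxu, ← Real.exp_mul, ← hzl]
          apply Real.exp_le_exp.2; nlinarith
        have h3 : (roughCount₂ z a x : ℝ) ≤ roughCount (x ^ (1 / 20 : ℝ)) a x := by
          exact_mod_cast (roughCount₂_le z a x).trans (roughCount_anti h2 a x)
        have h4 : 0 ≤ x ^ (1 / 20 : ℝ) := by positivity
        have h5 : x / (q.totient * Real.log x) ≤ x / (q.totient * l) := by
          have : l ≤ Real.log x := Real.log_le_log (by linarith) hxz.le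
          gcongr
        have h6 := mul_le_mul_of_nonneg_left h5 hK₂.le
        linarith
    have h6 : (1 + K₂) * (x / (q.totient * l)) ≤ (1 + K₂) * Real.exp 3 * Q := by
      rw [mul_assoc]; gcongr
    have h7 : 0 ≤ (K * Real.exp 1 + 3) * Q := by positivity
    have h8 : (0 : ℝ) ≤ roughCount₂ z a x := Nat.cast_nonneg _
    have h9 : 0 ≤ x / (q.totient * l) := by positivity
    have h10 : 0 ≤ K₂ * (x / (q.totient * l)) := by positivity
    have h11 : (K * Real.exp 1 + 3 + (1 + K₂) * Real.exp 3) * Q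
        = (K * Real.exp 1 + 3) * Q + (1 + K₂) * Real.exp 3 * Q := by ring
    rw [add_mul, one_mul] at h6
    rw [abs_le, h11]
    constructor <;> linarith

/-- A Dirichlet series with nonnegative coefficients whose summatory function is
`D t + O(t ^ (1 - θ))` continues to the half plane `1 - θ < re s`. -/
theorem exists_continuation {g : ℕ → ℝ} (hg0 : ∀ n, 0 ≤ g n) (hg1 : ∀ n, g n ≤ 1) {D B θ : ℝ}
    (hθ : 0 < θ)
    (h : ∀ t : ℝ, 1 ≤ t → |∑ k ∈ Icc 1 ⌊t⌋₊, g k - D * t| ≤ B * t ^ (1 - θ)) :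
    ∃ G : ℂ → ℂ, DifferentiableOn ℂ G {s | 1 - θ < s.re} ∧
      (∀ s : ℂ, 1 - θ < s.re → ‖G s‖ ≤ B / (s.re - 1 + θ)) ∧
      (∀ s, G (starRingEnd ℂ s) = starRingEnd ℂ (G s)) ∧
      ∀ s : ℂ, 1 < s.re → LSeries (fun n => (g n : ℂ)) s = s * (G s + D / (s - 1)) := by
  set E : ℝ → ℝ := fun t => ∑ k ∈ Icc 1 ⌊t⌋₊, g k - D * t with hE
  set f : ℝ → ℂ := (Set.Ioi (1 : ℝ)).indicator (fun t => (E t : ℂ)) with hf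
  have hfint : ∀ s : ℂ, mellin f (-s) = ∫ t in Set.Ioi (1 : ℝ), (t : ℂ) ^ (-s - 1) * (E t : ℂ) := by
    intro s
    rw [mellin]
    have h1 : ∀ t : ℝ, (t : ℂ) ^ (-s - 1) • f t = (Set.Ioi (1 : ℝ)).indicator
        (fun t : ℝ => (t : ℂ) ^ (-s - 1) * (E t : ℂ)) t := by
      intro t
      by_cases ht : t ∈ Set.Ioi (1 : ℝ) <;> simp [hf, ht, Set.indicator]
    simp_rw [h1]
    rw [MeasureTheory.setIntegral_indicator measurableSet_Ioi,
      Set.inter_eq_right.2 (Set.Ioi_subset_Ioi zero_le_one)]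
  have hmeas : Measurable E := by
    refine Measurable.sub ?_ (by fun_prop)
    exact (measurable_from_nat (f := fun n => ∑ k ∈ Icc 1 n, g k)).comp Nat.measurable_floor
  have hfmeas : Measurable f :=
    (Complex.measurable_ofReal.comp hmeas).indicator measurableSet_Ioi
  have hsum : ∀ n : ℕ, ∑ k ∈ Icc 1 n, g k ≤ n := fun n => by
    calc _ ≤ ∑ k ∈ Icc 1 n, (1 : ℝ) := sum_le_sum fun k _ => hg1 k
      _ = n := by simp
  have hsum0 : ∀ n : ℕ, 0 ≤ ∑ k ∈ Icc 1 n, g k := fun n => sum_nonneg fun k _ => hg0 k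
  have hfbd : ∀ t : ℝ, ‖f t‖ ≤ (1 + |D|) * |t| := by
    intro t
    by_cases ht : t ∈ Set.Ioi (1 : ℝ)
    · have ht0 : (0 : ℝ) ≤ t := by have : (1 : ℝ) < t := ht; linarith
      simp only [hf, ht, Set.indicator_of_mem, Complex.norm_real, Real.norm_eq_abs, hE]
      have h1 := hsum ⌊t⌋₊
      have h2 := Nat.floor_le ht0
      have h3 := hsum0 ⌊t⌋₊
      have h4 : |∑ k ∈ Icc 1 ⌊t⌋₊, g k| ≤ |t| := by
        rw [abs_of_nonneg h3, abs_of_nonneg ht0]; linarith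
      calc _ ≤ |∑ k ∈ Icc 1 ⌊t⌋₊, g k| + |D * t| := abs_sub _ _
        _ ≤ |t| + |D| * |t| := by rw [abs_mul]; gcongr
        _ = _ := by ring
    · simp only [hf, ht, Set.indicator_of_notMem, not_false_eq_true, norm_zero]; positivity
  have hloc : MeasureTheory.LocallyIntegrableOn f (Set.Ioi 0) := by
    have : MeasureTheory.LocallyIntegrable (fun t : ℝ => (1 + |D|) * |t|) :=
      Continuous.locallyIntegrable (by fun_prop)
    refine MeasureTheory.LocallyIntegrable.locallyIntegrableOn ?_ _
    refine this.mono hfmeas.aestronglyMeasurable (Filter.Eventually.of_forall fun t => ?_)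
    rw [Real.norm_of_nonneg (by positivity)]; exact hfbd t
  have htop : f =O[Filter.atTop] fun x : ℝ => x ^ (-(θ - 1)) := by
    refine Asymptotics.IsBigO.of_bound B ?_
    filter_upwards [Filter.eventually_gt_atTop 1] with t ht
    have : t ∈ Set.Ioi (1 : ℝ) := ht
    simp only [hf, this, Set.indicator_of_mem, Complex.norm_real, Real.norm_eq_abs]
    rw [abs_of_nonneg (a := t ^ _) (by positivity), neg_sub]
    exact h t ht.le
  have hbot : ∀ b : ℝ, f =O[nhdsWithin 0 (Set.Ioi 0)] fun x : ℝ => x ^ (-b) := by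
    intro b
    refine Asymptotics.IsBigO.of_bound 0 ?_
    filter_upwards [mem_nhdsWithin_of_mem_nhds (Iio_mem_nhds (zero_lt_one' ℝ))] with t ht
    have : t ∉ Set.Ioi (1 : ℝ) := by simp only [Set.mem_Ioi, not_lt]; exact le_of_lt ht
    simp [hf, this]
  refine ⟨fun s => mellin f (-s), ?_, ?_, ?_, ?_⟩
  · intro s hs
    have hs' : 1 - θ < s.re := hs
    have h1 : DifferentiableAt ℂ (mellin f) (-s) :=
      mellin_differentiableAt_of_isBigO_rpow hloc htop (by rw [Complex.neg_re]; linarith)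
        (hbot (-s.re - 1)) (by rw [Complex.neg_re]; linarith)
    exact (h1.comp s differentiableAt_id.neg).differentiableWithinAt
  · intro s hs
    simp only [hfint]
    have hexp : -s.re - θ < -1 := by linarith
    calc _ ≤ ∫ t in Set.Ioi (1 : ℝ), B * t ^ (-s.re - θ) := by
          refine MeasureTheory.norm_integral_le_of_norm_le
            ((integrableOn_Ioi_rpow_of_lt hexp one_pos).const_mul B) ?_
          refine (MeasureTheory.ae_restrict_iff' measurableSet_Ioi).2
            (Filter.Eventually.of_forall fun t ht => ?_)
          have ht1 : (1 : ℝ) < t := ht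
          have ht0 : (0 : ℝ) < t := by linarith
          rw [norm_mul, Complex.norm_cpow_eq_rpow_re_of_pos ht0, Complex.norm_real,
            Real.norm_eq_abs]
          have hre : (-s - 1).re = -s.re - 1 := by simp
          rw [hre]
          calc _ ≤ t ^ (-s.re - 1) * (B * t ^ (1 - θ)) := by gcongr; exact h t ht1.le
            _ = B * (t ^ (-s.re - 1) * t ^ (1 - θ)) := by ring
            _ = _ := by rw [← Real.rpow_add ht0]; congr 2; ring
      _ = _ := by
          rw [MeasureTheory.integral_const_mul, integral_Ioi_rpow_of_lt hexp one_pos,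
            Real.one_rpow, neg_div, ← div_neg, mul_one_div]
          congr 1; ring
  · intro s
    simp only [hfint]
    rw [← integral_conj]
    refine MeasureTheory.setIntegral_congr_fun measurableSet_Ioi fun t ht => ?_
    have ht0 : (0 : ℝ) < t := by have : (1 : ℝ) < t := ht; linarith
    simp only [map_mul, Complex.conj_ofReal]
    congr 1
    rw [← map_neg, ← map_one (starRingEnd ℂ), ← map_sub, Complex.cpow_conj, map_one,
      Complex.conj_ofReal]
    rw [Complex.arg_ofReal_of_nonneg ht0.le]; exact Real.pi_ne_zero.symm
  · intro s hs
    have hO : (fun n : ℕ => ∑ k ∈ Icc 1 n, g k) =O[Filter.atTop] fun n : ℕ => (n : ℝ) ^ (1 : ℝ) := by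
      refine Asymptotics.IsBigO.of_bound 1 (Filter.Eventually.of_forall fun n => ?_)
      rw [Real.rpow_one, Real.norm_of_nonneg (hsum0 n), Real.norm_of_nonneg (Nat.cast_nonneg n),
        one_mul]
      exact hsum n
    rw [LSeries_eq_mul_integral_of_nonneg g zero_le_one hs hO hg0]
    congr 1
    simp only [hfint]
    have hconv : MeasureTheory.IntegrableOn
        (fun t : ℝ => (t : ℂ) ^ (-s - 1) * (E t : ℂ)) (Set.Ioi 1) := by
      have h1 : MellinConvergent f (-s) :=
        mellinConvergent_of_isBigO_rpow hloc htop (by rw [Complex.neg_re]; linarith)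
          (hbot (-s.re - 1)) (by rw [Complex.neg_re]; linarith)
      have h2 := h1.mono_set (Set.Ioi_subset_Ioi (zero_le_one' ℝ))
      refine h2.congr_fun (fun t ht => ?_) measurableSet_Ioi
      simp [hf, ht, Set.indicator_of_mem]
    have hpow : (-s).re < -1 := by rw [Complex.neg_re]; linarith
    have hint2 := (integrableOn_Ioi_cpow_of_lt hpow one_pos).const_mul (D : ℂ)
    have hval : ∫ t in Set.Ioi (1 : ℝ), (D : ℂ) * (t : ℂ) ^ (-s) = D / (s - 1) := by
      rw [MeasureTheory.integral_const_mul, integral_Ioi_cpow_of_lt hpow one_pos,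
        Complex.ofReal_one, Complex.one_cpow, neg_div, ← div_neg, mul_one_div]
      congr 1; ring
    rw [← hval, ← MeasureTheory.integral_add hconv hint2]
    refine MeasureTheory.setIntegral_congr_fun measurableSet_Ioi fun t ht => ?_
    have ht0 : (0 : ℝ) < t := by have : (1 : ℝ) < t := ht; linarith
    have htne : (t : ℂ) ≠ 0 := by exact_mod_cast ht0.ne'
    have h1 : (t : ℂ) ^ (-s) = (t : ℂ) ^ (-s - 1) * t := by
      rw [Complex.cpow_sub _ _ htne, Complex.cpow_one, div_mul_cancel₀ _ htne]
    simp only [hE]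
    rw [h1, show -(s + 1) = -s - 1 by ring]
    push_cast
    ring

/-- `R` collects the regular parts of the Dirichlet series over the `z`-rough numbers in the
residue classes modulo `q`, in the variable `w = (s - 1) log z`. -/
structure IsRegularPart (q : ℕ) (z K : ℝ) (R : (ZMod q)ˣ → ℂ → ℂ) : Prop where
  differentiableOn : ∀ a, DifferentiableOn ℂ (R a) {w | -(1 / 8) < w.re}
  norm_le : ∀ a w, -(1 / 16) ≤ w.re → ‖w‖ ≤ 5 → ‖R a w‖ ≤ K / q.totient
  conj : ∀ a w, R a (starRingEnd ℂ w) = starRingEnd ℂ (R a w)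
  lseries_eq : ∀ (a : (ZMod q)ˣ) (w : ℂ), 0 < w.re →
    LSeries (fun n => ((if 1 < n ∧ (n : ZMod q) = a ∧ Rough z n then 1 else 0 : ℝ) : ℂ))
      (1 + w / Real.log z) = (rho z * Real.log z / q.totient : ℝ) / w + R a w

lemma log_ge_of_four_le {z : ℝ} (hz : 4 ≤ z) : 5 / 4 ≤ Real.log z := by
  have h4 : Real.log 4 = 2 * Real.log 2 := by
    rw [show (4 : ℝ) = 2 ^ 2 by norm_num, Real.log_pow]; norm_num
  have := Real.log_two_gt_d9
  have : Real.log 4 ≤ Real.log z := Real.log_le_log (by norm_num) hz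
  linarith

theorem exists_isRegularPart : ∃ K : ℝ, 1 ≤ K ∧ ∀ (q : ℕ) [NeZero q] (z : ℝ), 4 ≤ z →
    (q : ℝ) ^ 20 ≤ z → ∃ R, IsRegularPart q z K R := by
  obtain ⟨K, hK, hF⟩ := exists_abs_roughCount₂_sub_le
  refine ⟨1 + 80 * K, by linarith, fun q _ z hz hqz => ?_⟩
  have hl := log_ge_of_four_le hz
  set l := Real.log z with hldef
  have hl0 : 0 < l := by linarith
  have hφ : (0 : ℝ) < q.totient := by exact_mod_cast Nat.totient_pos.2 (NeZero.pos q)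
  have hex : ∀ a : (ZMod q)ˣ, ∃ Ra : ℂ → ℂ, DifferentiableOn ℂ Ra {w | -(1 / 8) < w.re} ∧
      (∀ w : ℂ, -(1 / 16) ≤ w.re → ‖w‖ ≤ 5 → ‖Ra w‖ ≤ (1 + 80 * K) / q.totient) ∧
      (∀ w, Ra (starRingEnd ℂ w) = starRingEnd ℂ (Ra w)) ∧
      ∀ w : ℂ, 0 < w.re →
        LSeries (fun n => ((if 1 < n ∧ (n : ZMod q) = a ∧ Rough z n then 1 else 0 : ℝ) : ℂ))
          (1 + w / l) = (rho z * l / q.totient : ℝ) / w + Ra w := by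
    intro a
    obtain ⟨G, hG1, hG2, hG3, hG4⟩ := exists_continuation
      (g := fun n => if 1 < n ∧ (n : ZMod q) = a ∧ Rough z n then 1 else 0)
      (fun n => by split_ifs <;> norm_num)
      (fun n => by split_ifs <;> norm_num)
      (D := rho z / q.totient) (B := K / (q.totient * l)) (θ := 1 / (8 * l)) (by positivity) (by
        intro t ht
        have ht0 : 0 < t := by linarith
        have h1 : ∑ k ∈ Icc 1 ⌊t⌋₊, (if 1 < k ∧ (k : ZMod q) = a ∧ Rough z k then (1 : ℝ) else 0)
            = roughCount₂ z (a : ZMod q) t := by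
          rw [roughCount₂, ← sum_filter, sum_const, nsmul_eq_mul, mul_one]
          congr 2
          ext k; simp only [mem_filter, mem_Icc]; constructor
          · rintro ⟨⟨_, h2⟩, h3, h4⟩; exact ⟨⟨h3, h2⟩, h4⟩
          · rintro ⟨⟨h1, h2⟩, h3⟩; exact ⟨⟨by omega, h2⟩, by omega, h3⟩
        rw [h1]
        have h2 := hF q z hz hqz a a.isUnit t ht
        have h3 : t ^ (1 - 1 / (8 * l)) = t * Real.exp (-(Real.log t / (8 * l))) := by
          rw [Real.rpow_sub ht0, Real.rpow_one, Real.rpow_def_of_pos ht0, Real.exp_neg,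
            mul_one_div, div_eq_mul_inv]
        rw [h3]
        calc _ = |(roughCount₂ z (a : ZMod q) t : ℝ) - rho z * t / q.totient| := by
              congr 2; ring
          _ ≤ _ := h2
          _ = _ := by ring)
    have hre : ∀ w : ℂ, (1 + w / l).re = 1 + w.re / l := by
      intro w; rw [Complex.add_re, Complex.div_ofReal_re, Complex.one_re]
    have hmem : ∀ w : ℂ, -(1 / 8) < w.re → 1 - 1 / (8 * l) < (1 + w / l).re := by
      intro w hw
      rw [hre, show (1 : ℝ) / (8 * l) = (1 / 8) / l by field_simp]
      have := div_lt_div_of_pos_right hw hl0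
      rw [neg_div] at this
      linarith
    refine ⟨fun w => (rho z / q.totient : ℝ) + (1 + w / l) * G (1 + w / l), ?_, ?_, ?_, ?_⟩
    · have h1 : DifferentiableOn ℂ (fun w : ℂ => 1 + w / l) {w | -(1 / 8) < w.re} := by fun_prop
      exact (differentiableOn_const _).add (h1.mul (hG1.comp h1 fun w hw => hmem w hw))
    · intro w hw hw5
      have h1 : ‖G (1 + w / l)‖ ≤ 16 * K / q.totient := by
        refine (hG2 _ (hmem w (by linarith))).trans ?_
        rw [hre, show 1 + w.re / l - 1 + 1 / (8 * l) = (w.re + 1 / 8) / l by field_simp; ring,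
          div_div, mul_assoc, mul_div_cancel₀ _ hl0.ne', ← div_div,
          div_le_iff₀ (by linarith)]
        have : 0 ≤ K / q.totient := by positivity
        calc K / q.totient = 16 * K / q.totient * (1 / 16) := by ring
          _ ≤ _ := by gcongr; linarith
      have h2 : ‖1 + w / l‖ ≤ 5 := by
        refine (norm_add_le _ _).trans ?_
        rw [norm_one, norm_div, Complex.norm_real, Real.norm_of_nonneg hl0.le]
        have : ‖w‖ / l ≤ 5 / (5 / 4) := by gcongr
        linarith
      have h3 : ‖((rho z / q.totient : ℝ) : ℂ)‖ ≤ 1 / q.totient := by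
        rw [Complex.norm_real, Real.norm_of_nonneg (div_nonneg (rho_pos z).le hφ.le)]
        gcongr; exact rho_le_one z
      calc _ ≤ ‖((rho z / q.totient : ℝ) : ℂ)‖ + ‖1 + w / l‖ * ‖G (1 + w / l)‖ := by
            rw [← norm_mul]; exact norm_add_le _ _
        _ ≤ 1 / q.totient + 5 * (16 * K / q.totient) := by gcongr
        _ = _ := by ring
    · intro w
      have h1 : (1 : ℂ) + starRingEnd ℂ w / l = starRingEnd ℂ (1 + w / l) := by simp
      simp only [h1]
      rw [hG3, ← map_mul, map_add (starRingEnd ℂ) (_ : ℂ) (_ * _), Complex.conj_ofReal]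
    · intro w hw
      rw [hG4 _ (by rw [hre]; have := div_pos hw hl0; linarith)]
      have hw0 : w ≠ 0 := by rintro rfl; simp at hw
      have hlc : (l : ℂ) ≠ 0 := by exact_mod_cast hl0.ne'
      have hφc : (q.totient : ℂ) ≠ 0 := by exact_mod_cast hφ.ne'
      simp only []
      generalize G (1 + w / l) = g
      rw [add_sub_cancel_left]
      push_cast
      field_simp
      ring
  choose R h1 h2 h3 h4 using hex
  exact ⟨R, h1, h2, h3, h4⟩

section Orthogonality

variable {q : ℕ}

lemma char_inv_eq_conj (χ : DirichletCharacter ℂ q) (a : (ZMod q)ˣ) :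
    χ ((a : ZMod q)⁻¹) = starRingEnd ℂ (χ a) := by
  rw [← Complex.inv_eq_conj (χ.unit_norm_eq_one a), ZMod.inv_coe_unit]
  exact map_units_inv χ a

lemma norm_sum_char_mul_le [NeZero q] (χ : DirichletCharacter ℂ q) {T : (ZMod q)ˣ → ℂ} {K : ℝ}
    (hT : ∀ a, ‖T a‖ ≤ K / q.totient) : ‖∑ a : (ZMod q)ˣ, χ a * T a‖ ≤ K := by
  have hφ : (0 : ℝ) < q.totient := by exact_mod_cast Nat.totient_pos.2 (NeZero.pos q)
  calc _ ≤ ∑ a : (ZMod q)ˣ, K / q.totient := by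
        refine (norm_sum_le _ _).trans (sum_le_sum fun a _ => ?_)
        rw [norm_mul, χ.unit_norm_eq_one, one_mul]; exact hT a
    _ = K := by
        rw [sum_const, card_univ, ZMod.card_units_eq_totient, nsmul_eq_mul]; field_simp

lemma sum_char_conj_mul_sum [NeZero q] (T : (ZMod q)ˣ → ℂ) (b : (ZMod q)ˣ) :
    ∑ χ : DirichletCharacter ℂ q, starRingEnd ℂ (χ b) * ∑ a : (ZMod q)ˣ, χ a * T a = q.totient * T b := by
  simp_rw [mul_sum]
  rw [sum_comm]
  have : ∀ a : (ZMod q)ˣ, ∑ χ : DirichletCharacter ℂ q, starRingEnd ℂ (χ b) * (χ a * T a)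
      = if a = b then q.totient * T b else 0 := by
    intro a
    simp_rw [← char_inv_eq_conj, ← mul_assoc]
    rw [← sum_mul, DirichletCharacter.sum_char_inv_mul_char_eq ℂ b.isUnit]
    by_cases h : a = b
    · simp [h]
    · rw [if_neg, if_neg h, zero_mul]
      exact fun h' => h (Units.ext h').symm
  simp_rw [this]
  simp

lemma sum_norm_sq_sum_char_le [NeZero q] {T : (ZMod q)ˣ → ℂ} {K : ℝ}
    (hT : ∀ a, ‖T a‖ ≤ K / q.totient) :
    ∑ χ : DirichletCharacter ℂ q, ‖∑ a : (ZMod q)ˣ, χ a * T a‖ ^ 2 ≤ K ^ 2 := by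
  have hφ : (0 : ℝ) < q.totient := by exact_mod_cast Nat.totient_pos.2 (NeZero.pos q)
  have h1 : ((∑ χ : DirichletCharacter ℂ q, ‖∑ a : (ZMod q)ˣ, χ a * T a‖ ^ 2 : ℝ) : ℂ)
      = ((q.totient * ∑ b, ‖T b‖ ^ 2 : ℝ) : ℂ) := by
    push_cast
    calc _ = ∑ χ : DirichletCharacter ℂ q, ∑ b, starRingEnd ℂ (T b) *
          (starRingEnd ℂ (χ b) * ∑ a : (ZMod q)ˣ, χ a * T a) := by
          refine sum_congr rfl fun χ _ => ?_
          rw [← Complex.conj_mul', map_sum, sum_mul]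
          refine sum_congr rfl fun b _ => ?_
          rw [map_mul]; ring
      _ = ∑ b, starRingEnd ℂ (T b) * (q.totient * T b) := by
          rw [sum_comm]
          refine sum_congr rfl fun b _ => ?_
          rw [← mul_sum, sum_char_conj_mul_sum]
      _ = _ := by
          rw [mul_sum]
          refine sum_congr rfl fun b _ => ?_
          rw [← Complex.conj_mul']; ring
  rw [Complex.ofReal_inj.1 h1]
  calc _ ≤ q.totient * ∑ b : (ZMod q)ˣ, (K / q.totient) ^ 2 := by
        gcongr with b; exact hT b
    _ = _ := by
        rw [sum_const, card_univ, ZMod.card_units_eq_totient, nsmul_eq_mul]; field_simp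

end Orthogonality

/-- The modulus `q ∏_{p ≤ z} p`. -/
noncomputable def modulus (q : ℕ) (z : ℝ) : ℕ := q * ∏ p ∈ primesUpTo z, p

/-- A character modulo `q` restricted to the `z`-rough numbers. -/
noncomputable def roughChar {q : ℕ} (z : ℝ) (χ : DirichletCharacter ℂ q) :
    DirichletCharacter ℂ (modulus q z) :=
  DirichletCharacter.changeLevel (Dvd.intro _ rfl) χ

lemma coprime_modulus_iff {q : ℕ} [NeZero q] {z : ℝ} (hz : (q : ℝ) ≤ z) (n : ℕ) :
    n.Coprime (modulus q z) ↔ Rough z n := by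
  rw [modulus, Nat.coprime_mul_iff_right, Nat.coprime_prod_right_iff]
  have hz0 : 0 ≤ z := (Nat.cast_nonneg q).trans hz
  constructor
  · rintro ⟨_, h⟩ p hp hpn
    have := (prime_of_mem_primesUpTo hp)
    exact ((Nat.Prime.coprime_iff_not_dvd this).1 (h p hp).symm) hpn
  · intro h
    refine ⟨?_, fun p hp => ((Nat.Prime.coprime_iff_not_dvd (prime_of_mem_primesUpTo hp)).2
      (h p hp)).symm⟩
    refine Nat.coprime_of_dvd fun p hp hpn hpq => ?_
    refine h p ((mem_primesUpTo hz0).2 ⟨hp, ?_⟩) hpn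
    exact le_trans (by exact_mod_cast Nat.le_of_dvd (NeZero.pos q) hpq) hz

lemma roughChar_apply {q : ℕ} [NeZero q] {z : ℝ} (hz : (q : ℝ) ≤ z) (χ : DirichletCharacter ℂ q)
    (n : ℕ) : roughChar z χ n = if Rough z n then χ n else 0 := by
  split_ifs with h <;> rw [← coprime_modulus_iff hz] at h
  · have := DirichletCharacter.changeLevel_eq_cast_of_dvd' χ
      (Dvd.intro _ rfl : q ∣ modulus q z) (a := (n : ℤ)) (Nat.isCoprime_iff_coprime.2 h)
    rw [Int.cast_natCast, Int.cast_natCast] at this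
    exact this
  · exact MulChar.map_nonunit _ (by rwa [ZMod.isUnit_iff_coprime])

lemma roughChar_mul {q : ℕ} (z : ℝ) (χ ψ : DirichletCharacter ℂ q) :
    roughChar z (χ * ψ) = roughChar z χ * roughChar z ψ := map_mul _ _ _

lemma roughChar_one {q : ℕ} (z : ℝ) : roughChar z (1 : DirichletCharacter ℂ q) = 1 := map_one _

/-- The `L`-series over rough numbers in the variable `w = (s - 1) log z`. -/
noncomputable def roughL {q : ℕ} (z : ℝ) (χ : DirichletCharacter ℂ q) (w : ℂ) : ℂ :=
  LSeries (fun n => roughChar z χ n) (1 + w / Real.log z)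

/-- The regular part of `roughL`. -/
noncomputable def regPart {q : ℕ} [NeZero q] (R : (ZMod q)ˣ → ℂ → ℂ) (χ : DirichletCharacter ℂ q)
    (w : ℂ) : ℂ := 1 + ∑ a : (ZMod q)ˣ, χ a * R a w

lemma re_one_add_div (w : ℂ) (l : ℝ) : (1 + w / l).re = 1 + w.re / l := by
  rw [Complex.add_re, Complex.div_ofReal_re, Complex.one_re]

lemma one_lt_re_one_add_div {w : ℂ} {l : ℝ} (hl : 0 < l) (hw : 0 < w.re) :
    1 < (1 + w / l).re := by
  rw [re_one_add_div]; have := div_pos hw hl; linarith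

theorem roughL_eq {q : ℕ} [NeZero q] {z K : ℝ} (hz : 4 ≤ z) (hqz : (q : ℝ) ≤ z)
    {R : (ZMod q)ˣ → ℂ → ℂ} (hR : IsRegularPart q z K R) (χ : DirichletCharacter ℂ q) {w : ℂ}
    (hw : 0 < w.re) :
    roughL z χ w = regPart R χ w + if χ = 1 then ((rho z * Real.log z : ℝ) : ℂ) / w else 0 := by
  have hl0 : 0 < Real.log z := by linarith [log_ge_of_four_le hz]
  have hs := one_lt_re_one_add_div hl0 hw
  have hφ : (q.totient : ℂ) ≠ 0 := by exact_mod_cast (Nat.totient_pos.2 (NeZero.pos q)).ne'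
  set g : (ZMod q)ˣ → ℕ → ℂ := fun a n =>
    ((if 1 < n ∧ (n : ZMod q) = a ∧ Rough z n then 1 else 0 : ℝ) : ℂ) with hg
  have hgs : ∀ a, LSeriesSummable (g a) (1 + w / Real.log z) := fun a =>
    LSeriesSummable_of_bounded_of_one_lt_re (m := 1) (fun n _ => by
      simp only [hg]; split_ifs <;> simp) hs
  have hds : LSeriesSummable LSeries.delta (1 + w / Real.log z) :=
    LSeriesSummable_of_bounded_of_one_lt_re (m := 1) (fun n _ => by
      simp only [LSeries.delta]; split_ifs <;> simp) hs
  have hdec : ∀ {n : ℕ}, n ≠ 0 →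
      roughChar z χ n = (LSeries.delta + ∑ a : (ZMod q)ˣ, χ a • g a) n := by
    intro n hn
    rw [roughChar_apply hqz, Pi.add_apply, Finset.sum_apply]
    simp only [Pi.smul_apply, smul_eq_mul, hg, LSeries.delta]
    rcases eq_or_ne n 1 with rfl | hn1
    · have : Rough z 1 := fun p hp h => (prime_of_mem_primesUpTo hp).one_lt.ne'
        (Nat.dvd_one.1 h)
      simp [this]
    · have hn2 : 1 < n := by omega
      rw [if_neg hn1, zero_add]
      by_cases hr : Rough z n
      · rw [if_pos hr]
        have hu : IsUnit (n : ZMod q) := by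
          rw [ZMod.isUnit_iff_coprime]
          exact Nat.Coprime.coprime_dvd_right (Dvd.intro _ rfl) ((coprime_modulus_iff hqz n).2 hr)
        obtain ⟨u, hu⟩ := hu
        rw [sum_eq_single u]
        · simp [hn2, hu, hr]
        · intro b _ hb
          rw [if_neg]; · simp
          rintro ⟨_, h, _⟩; exact hb (Units.ext (by rw [← h, hu]))
        · simp
      · simp [hr]
  rw [roughL, LSeries_congr hdec, LSeries_add hds (LSeriesSummable.sum fun a _ => (hgs a).smul _),
    LSeries_delta, LSeries_sum fun a _ => (hgs a).smul _, regPart, Pi.one_apply, add_assoc]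
  congr 1
  have h1 : ∀ a : (ZMod q)ˣ, LSeries (χ a • g a) (1 + w / Real.log z)
      = χ a * R a w + χ a * ((rho z * Real.log z / q.totient : ℝ) / w) := by
    intro a
    rw [LSeries_smul, hR.lseries_eq a w hw]; ring
  rw [sum_congr rfl fun a _ => h1 a, sum_add_distrib, ← sum_mul]
  congr 1
  split_ifs with h
  · subst h
    have : ∀ a : (ZMod q)ˣ, (1 : DirichletCharacter ℂ q) a = 1 := fun a => MulChar.one_apply_coe a
    simp_rw [this]
    rw [sum_const, card_univ, ZMod.card_units_eq_totient, nsmul_eq_mul]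
    push_cast
    field_simp
  · have h2 : ∑ a : (ZMod q)ˣ, χ a = ∑ a : ZMod q, χ a := by
      refine sum_of_injOn (fun a : (ZMod q)ˣ => (a : ZMod q)) (fun a _ b _ hab => Units.ext hab)
        (fun _ _ => mem_coe.2 (mem_univ _)) (fun a _ ha => ?_) (fun _ _ => rfl)
      refine MulChar.map_nonunit _ fun hu => ha ?_
      obtain ⟨u, rfl⟩ := hu
      simp
    rw [h2, MulChar.sum_eq_zero_of_ne_one h, zero_mul]

/-- `f` is holomorphic on a half plane and bounded by `K` on a region containing the origin. -/
structure Tame (K : ℝ) (f : ℂ → ℂ) : Prop where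
  differentiableOn : DifferentiableOn ℂ f {w | -(1 / 8) < w.re}
  norm_le : ∀ w : ℂ, -(1 / 16) ≤ w.re → ‖w‖ ≤ 5 → ‖f w‖ ≤ K

lemma isOpen_halfPlane (r : ℝ) : IsOpen {w : ℂ | r < w.re} :=
  isOpen_lt continuous_const Complex.continuous_re

namespace Tame

variable {K : ℝ} {f : ℂ → ℂ}

lemma differentiableAt (h : Tame K f) {w : ℂ} (hw : -(1 / 8) < w.re) : DifferentiableAt ℂ f w :=
  h.differentiableOn.differentiableAt ((isOpen_halfPlane _).mem_nhds hw)

lemma norm_deriv_le (h : Tame K f) {w : ℂ} (hw : -(1 / 32) ≤ w.re) (hw4 : ‖w‖ ≤ 4) :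
    ‖deriv f w‖ ≤ 32 * K := by
  have hball : ∀ u ∈ Metric.closedBall w (1 / 32), -(1 / 16) ≤ u.re ∧ ‖u‖ ≤ 5 := by
    intro u hu
    rw [Metric.mem_closedBall, dist_eq_norm] at hu
    have h1 := (Complex.abs_re_le_norm (u - w)).trans hu
    rw [Complex.sub_re, abs_le] at h1
    have h2 : ‖u‖ ≤ ‖u - w‖ + ‖w‖ := by simpa using norm_add_le (u - w) w
    constructor <;> linarith
  have h1 : ‖deriv f w‖ ≤ K / (1 / 32) := by
    refine Complex.norm_deriv_le_of_forall_mem_sphere_norm_le (by norm_num) ?_ ?_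
    · apply DifferentiableOn.diffContOnCl
      rw [closure_ball _ (by norm_num)]
      refine h.differentiableOn.mono fun u hu => ?_
      have := (hball u hu).1
      change -(1 / 8) < u.re
      linarith
    · intro u hu
      have := hball u (Metric.sphere_subset_closedBall hu)
      exact h.norm_le u this.1 this.2
  calc _ ≤ _ := h1
    _ = _ := by ring

lemma convex_region : Convex ℝ {w : ℂ | -(1 / 32) ≤ w.re ∧ ‖w‖ ≤ 4} := by
  have h1 : Convex ℝ {w : ℂ | -(1 / 32) ≤ w.re} := convex_halfSpace_re_ge _
  have h2 : Convex ℝ {w : ℂ | ‖w‖ ≤ 4} := by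
    have h : {w : ℂ | ‖w‖ ≤ 4} = Metric.closedBall 0 4 := by ext w; simp
    rw [h]
    exact convex_closedBall _ _
  exact h1.inter h2

lemma norm_sub_le (h : Tame K f) {w u : ℂ} (hw : -(1 / 32) ≤ w.re) (hw4 : ‖w‖ ≤ 4)
    (hu : -(1 / 32) ≤ u.re) (hu4 : ‖u‖ ≤ 4) : ‖f w - f u‖ ≤ 32 * K * ‖w - u‖ := by
  refine Convex.norm_image_sub_le_of_norm_deriv_le (s := {w : ℂ | -(1 / 32) ≤ w.re ∧ ‖w‖ ≤ 4})
    (fun x hx => h.differentiableAt (by linarith [hx.1])) (fun x hx => h.norm_deriv_le hx.1 hx.2)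
    convex_region ⟨hu, hu4⟩ ⟨hw, hw4⟩

lemma dslope (h : Tame K f) (hK : 0 ≤ K) {p : ℝ} (hp0 : p ≤ 0) (hp1 : -(1 / 128) ≤ p) :
    Tame (128 * K) (dslope f p) := by
  constructor
  · refine (Complex.differentiableOn_dslope ((isOpen_halfPlane _).mem_nhds ?_)).2
      h.differentiableOn
    change -(1 / 8) < (p : ℂ).re
    rw [Complex.ofReal_re]; linarith
  · intro w hw hw5
    have hpn : ‖(p : ℂ)‖ ≤ 1 / 128 := by
      rw [Complex.norm_real, Real.norm_eq_abs, abs_le]; constructor <;> linarith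
    rcases eq_or_ne w p with rfl | hne
    · rw [dslope_same]
      refine (h.norm_deriv_le ?_ (by linarith)).trans (by linarith)
      rw [Complex.ofReal_re]; linarith
    rw [dslope_of_ne _ hne, slope_def_module, norm_smul, norm_inv]
    have hpos : 0 < ‖w - p‖ := norm_pos_iff.2 (sub_ne_zero.2 hne)
    rw [inv_mul_le_iff₀ hpos]
    rcases le_or_gt (1 / 64) ‖w - p‖ with hfar | hnear
    · calc ‖f w - f p‖ ≤ ‖f w‖ + ‖f p‖ := _root_.norm_sub_le _ _
        _ ≤ K + K := add_le_add (h.norm_le w hw hw5)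
            (h.norm_le p (by rw [Complex.ofReal_re]; linarith) (by linarith))
        _ = (1 / 64) * (128 * K) := by ring
        _ ≤ _ := by gcongr
    · have h1 := (Complex.abs_re_le_norm (w - p)).trans hnear.le
      rw [Complex.sub_re, Complex.ofReal_re, abs_le] at h1
      have h2 : ‖w‖ ≤ ‖w - p‖ + ‖(p : ℂ)‖ := by simpa using norm_add_le (w - p) (p : ℂ)
      refine (h.norm_sub_le (by linarith) (by linarith)
        (by rw [Complex.ofReal_re]; linarith) (by linarith)).trans ?_
      nlinarith

end Tame

/-- A Lipschitz function on `(0, 1]` bounded below by `c σ ^ (3 / 4)` is bounded below. -/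
lemma exists_lower_bound_of_lipschitz {K c : ℝ} (hK : 0 < K) (hc : 0 < c) :
    ∃ c' > 0, ∀ g : ℝ → ℝ, (∀ σ, 0 ≤ g σ) →
      (∀ σ τ, 0 < σ → σ ≤ 1 → 0 < τ → τ ≤ 1 → g σ - g τ ≤ K * |σ - τ|) →
      (∀ σ, 0 < σ → σ ≤ 1 → c * σ ^ 3 ≤ g σ ^ 4) → ∀ σ, 0 < σ → σ ≤ 1 → c' ≤ g σ := by
  set c₂ := min 1 c with hc₂
  have hc₂0 : 0 < c₂ := lt_min one_pos hc
  have hc₂1 : c₂ ≤ 1 := min_le_left _ _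
  set d := min 1 (c₂ / (2 * K)) with hd
  have hd0 : 0 < d := lt_min one_pos (by positivity)
  have hd1 : d ≤ 1 := min_le_left _ _
  have hdK : d * (2 * K) ≤ c₂ := by
    rw [← le_div_iff₀ (by positivity)]; exact min_le_right _ _
  refine ⟨c₂ * d ^ 3 / 2, by positivity, fun g hg0 hgL hg σ hσ0 hσ1 => ?_⟩
  set τ := max σ (d ^ 4) with hτ
  have hτ0 : 0 < τ := lt_max_of_lt_left hσ0
  have hτ1 : τ ≤ 1 := max_le hσ1 (pow_le_one₀ hd0.le hd1)
  have h1 : c₂ * d ^ 3 ≤ g τ := by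
    refine le_of_pow_le_pow_left₀ (n := 4) (by norm_num) (hg0 τ) ?_
    calc (c₂ * d ^ 3) ^ 4 = c₂ ^ 4 * (d ^ 4) ^ 3 := by ring
      _ ≤ c * τ ^ 3 := by
          gcongr
          · calc c₂ ^ 4 ≤ c₂ ^ 1 := pow_le_pow_of_le_one hc₂0.le hc₂1 (by norm_num)
              _ ≤ c := by rw [pow_one]; exact min_le_right _ _
          · exact le_max_right _ _
      _ ≤ _ := hg τ hτ0 hτ1
  have h2 := hgL τ σ hτ0 hτ1 hσ0 hσ1
  have h3 : |τ - σ| ≤ d ^ 4 := by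
    rw [abs_of_nonneg (sub_nonneg.2 (le_max_left _ _))]
    rcases le_total σ (d ^ 4) with h | h
    · rw [hτ, max_eq_right h]; linarith
    · rw [hτ, max_eq_left h, sub_self]; positivity
  have h4 : K * |τ - σ| ≤ c₂ * d ^ 3 / 2 := by
    calc K * |τ - σ| ≤ K * d ^ 4 := by gcongr
      _ = (d * (2 * K)) * d ^ 3 / 2 := by ring
      _ ≤ _ := by gcongr
  linarith

/-- The closed-open unit box on which lower bounds are established. -/
def Box (w : ℂ) : Prop := 0 < w.re ∧ w.re ≤ 1 ∧ |w.im| ≤ 1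

lemma Box.norm_le {w : ℂ} (h : Box w) : ‖w‖ ≤ 2 := by
  refine (Complex.norm_le_abs_re_add_abs_im w).trans ?_
  rw [abs_of_pos h.1]
  linarith [h.2.1, h.2.2]

lemma exists_lower_bound_on_box {K c : ℝ} (hK : 0 < K) (hc : 0 < c) :
    ∃ c' > 0, ∀ e : ℂ → ℂ, (∀ w u, Box w → Box u → ‖e w - e u‖ ≤ K * ‖w - u‖) →
      (∀ σ : ℝ, 0 < σ → σ ≤ 1 → c ≤ ‖e σ‖) →
      (∀ σ t : ℝ, 0 < σ → σ ≤ 1 → |t| ≤ 1 → c * σ ^ 3 * |t| ^ 5 ≤ ‖e (σ + t * Complex.I)‖ ^ 4) →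
      ∀ w, Box w → c' ≤ ‖e w‖ := by
  set t₀ := c / (2 * K) with ht₀
  have ht₀0 : 0 < t₀ := by positivity
  obtain ⟨c₁, hc₁, H⟩ := exists_lower_bound_of_lipschitz hK (show 0 < c * t₀ ^ 5 by positivity)
  refine ⟨min (c / 2) c₁, lt_min (by positivity) hc₁, fun e hL hreal h341 w hw => ?_⟩
  have hbox : ∀ σ t : ℝ, 0 < σ → σ ≤ 1 → |t| ≤ 1 → Box (σ + t * Complex.I) := by
    intro σ t h1 h2 h3
    simp [Box, h1, h2, h3]
  have hwe : w = (w.re : ℂ) + (w.im : ℂ) * Complex.I := (Complex.re_add_im w).symm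
  rcases le_or_gt |w.im| t₀ with ht | ht
  · refine (min_le_left _ _).trans ?_
    have hb : Box (w.re : ℂ) := by simp [Box, hw.1, hw.2.1]
    have h1 := hL (w.re : ℂ) w hb hw
    have h2 : ‖(w.re : ℂ) - w‖ = |w.im| := by
      have : (w.re : ℂ) - w = -((w.im : ℂ) * Complex.I) := by
        apply Complex.ext <;> simp
      rw [this, norm_neg, norm_mul, Complex.norm_I, mul_one, Complex.norm_real, Real.norm_eq_abs]
    have h3 := hreal w.re hw.1 hw.2.1
    have h4 : ‖e w.re‖ - ‖e w‖ ≤ ‖e w.re - e w‖ := norm_sub_norm_le _ _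
    have h5 : K * |w.im| ≤ c / 2 := by
      calc K * |w.im| ≤ K * t₀ := by gcongr
        _ = c / 2 := by rw [ht₀]; field_simp
    rw [h2] at h1
    linarith
  · refine (min_le_right _ _).trans ?_
    have := H (fun σ => ‖e (σ + w.im * Complex.I)‖) (fun _ => norm_nonneg _) ?_ ?_ w.re hw.1 hw.2.1
    · rw [hwe]; simpa using this
    · intro σ τ h1 h2 h3 h4
      refine (norm_sub_norm_le _ _).trans ((hL _ _ (hbox σ _ h1 h2 hw.2.2)
        (hbox τ _ h3 h4 hw.2.2)).trans (le_of_eq ?_))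
      congr 1
      rw [add_sub_add_right_eq_sub, ← Complex.ofReal_sub, Complex.norm_real, Real.norm_eq_abs]
    · intro σ h1 h2
      refine le_trans ?_ (h341 σ w.im h1 h2 hw.2.2)
      calc c * t₀ ^ 5 * σ ^ 3 = c * σ ^ 3 * t₀ ^ 5 := by ring
        _ ≤ _ := by gcongr

/-- A tame real function that is at least `σ / K` on `(0, 1]`, but small somewhere there,
has a real zero close to the origin. -/
lemma exists_real_zero {K : ℝ} (hK : 1 ≤ K) : ∃ c > 0, ∀ f : ℂ → ℂ, Tame K f →
    (∀ w, f (starRingEnd ℂ w) = starRingEnd ℂ (f w)) →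
    (∀ σ : ℝ, 0 < σ → σ ≤ 1 → σ / K ≤ ‖f σ‖) →
    (∃ σ : ℝ, 0 < σ ∧ σ ≤ 1 ∧ ‖f σ‖ < c) →
    ∃ lam : ℝ, 0 ≤ lam ∧ lam ≤ 1 / 128 ∧ f (-lam : ℝ) = 0 ∧ Tame (128 * K) (dslope f (-lam : ℝ)) ∧
      ∀ σ : ℝ, 0 < σ → σ ≤ 1 → 1 / (4 * K) ≤ ‖dslope f (-lam : ℝ) σ‖ := by
  have hK0 : 0 < K := by linarith
  set Λ := 1 / (16384 * K ^ 2) with hΛ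
  have hK2 : 1 ≤ K ^ 2 := one_le_pow₀ hK
  have hΛ0 : 0 < Λ := by positivity
  have hΛ1 : Λ ≤ 1 / 16384 := by
    rw [hΛ]; apply one_div_le_one_div_of_le <;> linarith
  have hΛK : 16384 * K * Λ = 1 / K := by rw [hΛ]; field_simp
  refine ⟨Λ / (264 * K ^ 3), by positivity, fun f hf hconj hlow ⟨σ₀, hσ₀0, hσ₀1, hσ₀⟩ => ?_⟩
  set g : ℝ → ℝ := fun x => (f x).re with hg
  have hreal : ∀ x : ℝ, f x = (g x : ℂ) := by
    intro x
    have := hconj x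
    rw [Complex.conj_ofReal] at this
    exact (Complex.conj_eq_iff_re.1 this.symm).symm
  have hgn : ∀ x : ℝ, ‖f x‖ = |g x| := fun x => by
    rw [hreal x, Complex.norm_real, Real.norm_eq_abs]
  have hD := hf.dslope hK0.le (p := 0) le_rfl (by norm_num)
  rw [Complex.ofReal_zero] at hD
  have hexp : ∀ w, f w = f 0 + w * dslope f 0 w := by
    intro w
    have := sub_smul_dslope f 0 w
    rw [sub_zero, smul_eq_mul] at this
    rw [this]; ring
  have hσK : σ₀ ≤ Λ / (264 * K ^ 2) := by
    have h1 := (hlow σ₀ hσ₀0 hσ₀1).trans hσ₀.le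
    rw [div_le_iff₀ hK0] at h1
    calc σ₀ ≤ _ := h1
      _ = _ := by field_simp
  have hf0 : ‖f 0‖ ≤ Λ / (8 * K) := by
    have h1 := hf.norm_sub_le (w := 0) (u := σ₀) (by norm_num) (by norm_num)
      (by rw [Complex.ofReal_re]; linarith)
      (by rw [Complex.norm_real, Real.norm_of_nonneg hσ₀0.le]; linarith)
    rw [zero_sub, norm_neg, Complex.norm_real, Real.norm_of_nonneg hσ₀0.le] at h1
    have h2 : ‖f 0‖ ≤ ‖f 0 - f σ₀‖ + ‖f σ₀‖ := by simpa using norm_add_le (f 0 - f σ₀) (f σ₀)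
    have h3 : 32 * K * σ₀ ≤ 32 * K * (Λ / (264 * K ^ 2)) := by gcongr
    have h4 : Λ / (264 * K ^ 3) ≤ Λ / (264 * K) := by
      gcongr
      nlinarith
    calc ‖f 0‖ ≤ 32 * K * (Λ / (264 * K ^ 2)) + Λ / (264 * K) := by linarith
      _ = _ := by field_simp; ring
  have hsum : ‖f Λ + f (-Λ : ℝ)‖ ≤ 3 * Λ / (4 * K) := by
    have h1 : f Λ + f (-Λ : ℝ) = 2 * f 0 + Λ * (dslope f 0 Λ - dslope f 0 (-Λ : ℝ)) := by
      rw [hexp Λ, hexp (-Λ : ℝ)]; push_cast; ring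
    have h2 := hD.norm_sub_le (w := Λ) (u := (-Λ : ℝ)) (by rw [Complex.ofReal_re]; linarith)
      (by rw [Complex.norm_real, Real.norm_of_nonneg hΛ0.le]; linarith)
      (by rw [Complex.ofReal_re]; linarith)
      (by rw [Complex.norm_real, norm_neg, Real.norm_of_nonneg hΛ0.le]; linarith)
    have h3 : ‖(Λ : ℂ) - (-Λ : ℝ)‖ = 2 * Λ := by
      rw [← Complex.ofReal_sub, Complex.norm_real, Real.norm_eq_abs, sub_neg_eq_add,
        abs_of_pos (by linarith)]; ring
    rw [h3] at h2
    rw [h1]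
    calc _ ≤ ‖2 * f 0‖ + ‖(Λ : ℂ) * (dslope f 0 Λ - dslope f 0 (-Λ : ℝ))‖ := norm_add_le _ _
      _ ≤ 2 * (Λ / (8 * K)) + Λ * (32 * (128 * K) * (2 * Λ)) := by
          rw [norm_mul, norm_mul, Complex.norm_real, Real.norm_of_nonneg hΛ0.le,
            Complex.norm_ofNat]
          gcongr
      _ = Λ / (4 * K) + Λ * (16384 * K * Λ) / 2 := by ring
      _ = _ := by rw [hΛK]; field_simp; norm_num
  have hΛlow := hlow Λ hΛ0 (by linarith)
  have hopp : g Λ * g (-Λ) < 0 := by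
    have h1 : |g Λ + g (-Λ)| ≤ 3 * Λ / (4 * K) := by
      rw [hreal, hreal, ← Complex.ofReal_add, Complex.norm_real, Real.norm_eq_abs] at hsum
      linarith
    rw [hgn] at hΛlow
    have h2 : 0 < Λ / K := by positivity
    have h3 : 3 * Λ / (4 * K) = 3 / 4 * (Λ / K) := by ring
    rw [h3, abs_le] at h1
    rcases le_or_gt 0 (g Λ) with h | h
    · rw [abs_of_nonneg h] at hΛlow
      exact mul_neg_of_pos_of_neg (by linarith) (by linarith)
    · rw [abs_of_neg h] at hΛlow
      exact mul_neg_of_neg_of_pos h (by linarith)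
  have hcont : ContinuousOn g (Set.Icc (-Λ) Λ) := by
    intro x hx
    have h1 : ContinuousAt f (x : ℂ) := (hf.differentiableAt (by
      rw [Complex.ofReal_re]; linarith [hx.1])).continuousAt
    exact (Complex.continuous_re.continuousAt.comp
      (h1.comp Complex.continuous_ofReal.continuousAt)).continuousWithinAt
  obtain ⟨y, hy, hy0⟩ : ∃ y ∈ Set.Icc (-Λ) Λ, g y = 0 := by
    rcases mul_neg_iff.1 hopp with ⟨h1, h2⟩ | ⟨h1, h2⟩
    · exact intermediate_value_Icc (by linarith) hcont ⟨h2.le, h1.le⟩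
    · exact intermediate_value_Icc' (by linarith) hcont ⟨h1.le, h2.le⟩
  have hy1 : y ≤ 0 := by
    by_contra hpos
    push Not at hpos
    have := hlow y hpos (by linarith [hy.2])
    rw [hgn, hy0, abs_zero] at this
    have : 0 < y / K := by positivity
    linarith
  obtain ⟨lam, rfl⟩ : ∃ lam, y = -lam := ⟨-y, by ring⟩
  have hlam0 : 0 ≤ lam := by linarith
  have hlamΛ : lam ≤ Λ := by linarith [hy.1]
  have hz : f (-lam : ℝ) = 0 := by rw [hreal, hy0, Complex.ofReal_zero]
  have hE := hf.dslope hK0.le (p := -lam) hy1 (by linarith)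
  refine ⟨lam, hlam0, by linarith, hz, hE, ?_⟩
  have hbig : ∀ σ : ℝ, 0 < σ → σ ≤ 1 → lam ≤ σ → 1 / (2 * K) ≤ ‖dslope f (-lam : ℝ) σ‖ := by
    intro σ h0 h1 h2
    have h3 : ‖f σ‖ = (σ + lam) * ‖dslope f (-lam : ℝ) σ‖ := by
      have := sub_smul_dslope f (-lam : ℝ) (σ : ℂ)
      rw [hz, sub_zero] at this
      rw [← this, norm_smul, ← Complex.ofReal_sub, Complex.norm_real, Real.norm_eq_abs,
        sub_neg_eq_add, abs_of_pos (by linarith)]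
    have h4 := hlow σ h0 h1
    rw [h3] at h4
    have h5 : 0 < σ + lam := by linarith
    calc 1 / (2 * K) = (σ / K) / (2 * σ) := by field_simp
      _ ≤ (σ / K) / (σ + lam) := by gcongr; linarith
      _ ≤ _ := by rw [div_le_iff₀ h5]; linarith
  intro σ h0 h1
  have h2K : 1 / (4 * K) = 1 / (2 * K) / 2 := by field_simp; norm_num
  rcases le_or_gt lam σ with h | h
  · refine le_trans ?_ (hbig σ h0 h1 h)
    rw [h2K]; have : 0 < 1 / (2 * K) := by positivity
    linarith
  · have h2 := hbig lam (by linarith) (by linarith) le_rfl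
    have h3 := hE.norm_sub_le (w := lam) (u := σ) (by rw [Complex.ofReal_re]; linarith)
      (by rw [Complex.norm_real, Real.norm_of_nonneg hlam0]; linarith)
      (by rw [Complex.ofReal_re]; linarith)
      (by rw [Complex.norm_real, Real.norm_of_nonneg h0.le]; linarith)
    rw [← Complex.ofReal_sub, Complex.norm_real, Real.norm_of_nonneg (by linarith)] at h3
    have h4 := norm_sub_norm_le (dslope f (-lam : ℝ) lam) (dslope f (-lam : ℝ) σ)
    have h5 : 32 * (128 * K) * (lam - σ) ≤ 1 / (2 * K) / 2 := by
      calc 32 * (128 * K) * (lam - σ) ≤ 32 * (128 * K) * Λ := by gcongr; linarith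
        _ = (16384 * K * Λ) / 4 := by ring
        _ = _ := by rw [hΛK]; field_simp; norm_num
    rw [h2K]
    linarith

lemma char_eq_one_or_neg_one {q : ℕ} {χ : DirichletCharacter ℂ q} (h : χ ^ 2 = 1)
    (a : (ZMod q)ˣ) : χ a = 1 ∨ χ a = -1 := by
  have : χ a * χ a = 1 := by
    rw [← sq, ← MulChar.pow_apply_coe, h, MulChar.one_apply_coe]
  exact mul_self_eq_one_iff.1 this

section

variable {q : ℕ} [NeZero q] {z K : ℝ} {R : (ZMod q)ˣ → ℂ → ℂ}

lemma tame_regPart (hR : IsRegularPart q z K R) (χ : DirichletCharacter ℂ q) :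
    Tame (1 + K) (regPart R χ) := by
  constructor
  · unfold regPart
    refine (differentiableOn_const _).add (DifferentiableOn.fun_sum fun a _ => ?_)
    exact (hR.differentiableOn a).const_mul _
  · intro w hw hw5
    refine (norm_add_le _ _).trans ?_
    rw [norm_one]
    gcongr
    exact norm_sum_char_mul_le χ fun a => hR.norm_le a w hw hw5

lemma regPart_conj (hR : IsRegularPart q z K R) {χ : DirichletCharacter ℂ q} (h : χ ^ 2 = 1)
    (w : ℂ) : regPart R χ (starRingEnd ℂ w) = starRingEnd ℂ (regPart R χ w) := by
  simp only [regPart, map_add, map_one, map_sum, map_mul, hR.conj]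
  congr 1
  refine sum_congr rfl fun a _ => ?_
  rcases char_eq_one_or_neg_one h a with h | h <;> simp [h]

/-- The principal `L`-series with its pole removed. -/
noncomputable def principalPart (z : ℝ) (R : (ZMod q)ˣ → ℂ → ℂ) (w : ℂ) : ℂ :=
  (rho z * Real.log z : ℝ) + w * regPart R 1 w

lemma rho_mul_log_le_one {z : ℝ} (hz : 4 ≤ z) : rho z * Real.log z ≤ 1 := by
  have hl0 : 0 < Real.log z := by linarith [log_ge_of_four_le hz]
  rw [← le_div_iff₀ hl0]; exact rho_le_inv_log (by linarith)

lemma rho_mul_log_nonneg {z : ℝ} (hz : 4 ≤ z) : 0 ≤ rho z * Real.log z :=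
  mul_nonneg (rho_pos z).le (by linarith [log_ge_of_four_le hz])

lemma tame_principalPart (hz : 4 ≤ z) (hK : 0 ≤ K) (hR : IsRegularPart q z K R) :
    Tame (6 * (1 + K)) (principalPart z R) := by
  have hT := tame_regPart hR 1
  constructor
  · exact (differentiableOn_const _).add (differentiableOn_id.mul hT.differentiableOn)
  · intro w hw hw5
    have h1 := hT.norm_le w hw hw5
    calc _ ≤ ‖((rho z * Real.log z : ℝ) : ℂ)‖ + ‖w‖ * ‖regPart R 1 w‖ := by
          rw [← norm_mul]; exact norm_add_le _ _
      _ ≤ 1 + 5 * (1 + K) := by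
          rw [Complex.norm_real, Real.norm_of_nonneg (rho_mul_log_nonneg hz)]
          gcongr; exact rho_mul_log_le_one hz
      _ ≤ _ := by linarith

lemma roughL_one (hz : 4 ≤ z) (hqz : (q : ℝ) ≤ z) (hR : IsRegularPart q z K R) {w : ℂ}
    (hw : 0 < w.re) : roughL z (1 : DirichletCharacter ℂ q) w = principalPart z R w / w := by
  have hw0 : w ≠ 0 := by rintro rfl; simp at hw
  rw [roughL_eq hz hqz hR 1 hw, if_pos rfl, principalPart]
  field_simp
  ring

lemma norm_roughL_one_le (hz : 4 ≤ z) (hqz : (q : ℝ) ≤ z) (hK : 0 ≤ K) (hR : IsRegularPart q z K R)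
    {w : ℂ} (hw : 0 < w.re) (hw5 : ‖w‖ ≤ 5) :
    ‖roughL z (1 : DirichletCharacter ℂ q) w‖ ≤ 6 * (1 + K) / ‖w‖ := by
  rw [roughL_one hz hqz hR hw, norm_div]
  gcongr
  exact (tame_principalPart hz hK hR).norm_le w (by linarith) hw5

lemma roughL_of_ne_one (hz : 4 ≤ z) (hqz : (q : ℝ) ≤ z) (hR : IsRegularPart q z K R)
    {χ : DirichletCharacter ℂ q} (hχ : χ ≠ 1) {w : ℂ} (hw : 0 < w.re) :
    roughL z χ w = regPart R χ w := by
  rw [roughL_eq hz hqz hR χ hw, if_neg hχ, add_zero]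

end

lemma one_le_norm_roughL_product {q : ℕ} {z : ℝ} (hz : 4 ≤ z) (χ : DirichletCharacter ℂ q)
    {σ : ℝ} (hσ : 0 < σ) (t : ℝ) :
    1 ≤ ‖roughL z (1 : DirichletCharacter ℂ q) σ‖ ^ 3 * ‖roughL z χ (σ + t * Complex.I)‖ ^ 4 *
      ‖roughL z (χ ^ 2) (σ + (2 * t : ℝ) * Complex.I)‖ := by
  have hl0 : 0 < Real.log z := by linarith [log_ge_of_four_le hz]
  have h := DirichletCharacter.norm_LSeries_product_ge_one (roughChar z χ) (div_pos hσ hl0)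
    (t / Real.log z)
  rw [norm_mul, norm_mul, norm_pow, norm_pow] at h
  have h2 : roughChar z χ ^ 2 = roughChar z (χ ^ 2) := (map_pow _ _ _).symm
  rw [h2] at h
  simp only [roughL, roughChar_one]
  have e1 : (1 : ℂ) + (σ : ℂ) / (Real.log z : ℂ) = 1 + ((σ / Real.log z : ℝ) : ℂ) := by push_cast; rfl
  have e2 : (1 : ℂ) + ((σ : ℂ) + t * Complex.I) / (Real.log z : ℂ)
      = 1 + ((σ / Real.log z : ℝ) : ℂ) + Complex.I * ((t / Real.log z : ℝ) : ℂ) := by push_cast; ring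
  have e3 : (1 : ℂ) + ((σ : ℂ) + (2 * t : ℝ) * Complex.I) / (Real.log z : ℂ)
      = 1 + ((σ / Real.log z : ℝ) : ℂ) + 2 * Complex.I * ((t / Real.log z : ℝ) : ℂ) := by
    push_cast; ring
  rw [e1, e2, e3]
  exact h

lemma local_factor_norm_ge {x : ℝ} (hx0 : 0 ≤ x) (hx1 : x < 1) {a b : ℂ} (ha : a = 1 ∨ a = -1)
    (hb : b = 1 ∨ b = -1) :
    1 ≤ ‖(1 - 1 * (x : ℂ))⁻¹ * (1 - a * x)⁻¹ * (1 - b * x)⁻¹ * (1 - a * b * x)⁻¹‖ := by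
  have key : ∀ y : ℝ, 0 < y → y ≤ 1 → 1 ≤ ‖((y : ℂ))⁻¹‖ := by
    intro y hy0 hy1
    rw [norm_inv, Complex.norm_real, Real.norm_of_nonneg hy0.le]
    exact (one_le_inv₀ hy0).2 hy1
  have hx2 : 0 < 1 - x := by linarith
  have hx3 : 0 < 1 + x := by linarith
  have hsq : (1 - x) * (1 + x) ≤ 1 := by nlinarith
  have hp : 0 < (1 - x) * (1 + x) := by positivity
  rcases ha with rfl | rfl <;> rcases hb with rfl | rfl
  · convert key ((1 - x) ^ 4) (by positivity) (pow_le_one₀ hx2.le (by linarith)) using 2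
    push_cast; rw [← mul_inv, ← mul_inv, ← mul_inv]; congr 1; ring
  all_goals
    convert key (((1 - x) * (1 + x)) ^ 2) (by positivity) (pow_le_one₀ hp.le hsq) using 2
    push_cast; rw [← mul_inv, ← mul_inv, ← mul_inv]; congr 1; ring

lemma one_le_norm_roughL_four {q : ℕ} {z : ℝ} (hz : 4 ≤ z) {χ ψ : DirichletCharacter ℂ q}
    (hχ : χ ^ 2 = 1) (hψ : ψ ^ 2 = 1) {σ : ℝ} (hσ : 0 < σ) :
    1 ≤ ‖roughL z (1 : DirichletCharacter ℂ q) σ‖ * ‖roughL z χ σ‖ * ‖roughL z ψ σ‖ *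
      ‖roughL z (χ * ψ) σ‖ := by
  have hl0 : 0 < Real.log z := by linarith [log_ge_of_four_le hz]
  have hs := one_lt_re_one_add_div hl0 (w := (σ : ℂ)) (by simpa using hσ)
  have e1 : (1 : ℂ) + (σ : ℂ) / (Real.log z : ℂ) = ((1 + σ / Real.log z : ℝ) : ℂ) := by push_cast; rfl
  have hs1 : 0 < 1 + σ / Real.log z := by positivity
  rw [← norm_mul, ← norm_mul, ← norm_mul]
  have hP := (((DirichletCharacter.LSeries_eulerProduct_hasProd
    (roughChar z (1 : DirichletCharacter ℂ q)) hs).mul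
    (DirichletCharacter.LSeries_eulerProduct_hasProd (roughChar z χ) hs)).mul
    (DirichletCharacter.LSeries_eulerProduct_hasProd (roughChar z ψ) hs)).mul
    (DirichletCharacter.LSeries_eulerProduct_hasProd (roughChar z (χ * ψ)) hs)
  refine ge_of_tendsto' hP.norm fun T => ?_
  refine (Finset.prod_const_one (s := T)).symm.trans_le
    (Finset.prod_le_prod (fun _ _ => zero_le_one) fun p _ => ?_)
  rw [roughChar_mul, roughChar_one, MulChar.mul_apply]
  have hχ' : roughChar z χ ^ 2 = 1 := by
    rw [← roughChar_one, ← hχ]; exact (map_pow _ _ _).symm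
  have hψ' : roughChar z ψ ^ 2 = 1 := by
    rw [← roughChar_one, ← hψ]; exact (map_pow _ _ _).symm
  by_cases hu : IsUnit ((p : ℕ) : ZMod (modulus q z))
  · obtain ⟨u, hu⟩ := hu
    rw [← hu, MulChar.one_apply_coe]
    have hp1 : (1 : ℝ) < (p : ℕ) := by exact_mod_cast p.2.one_lt
    have hx : (((p : ℕ) : ℝ) : ℂ) ^ (-(1 + (σ : ℂ) / (Real.log z : ℂ)))
        = (((p : ℕ) : ℝ) ^ (-(1 + σ / Real.log z)) : ℝ) := by
      rw [Complex.ofReal_cpow (by positivity), e1]; push_cast; rfl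
    rw [Complex.ofReal_natCast] at hx
    rw [hx]
    exact local_factor_norm_ge (by positivity)
      (Real.rpow_lt_one_of_one_lt_of_neg hp1 (by linarith))
      (char_eq_one_or_neg_one hχ' u) (char_eq_one_or_neg_one hψ' u)
  · simp [MulChar.map_nonunit _ hu]

lemma Tame.mono {K K' : ℝ} {f : ℂ → ℂ} (h : Tame K f) (hK : K ≤ K') : Tame K' f :=
  ⟨h.differentiableOn, fun w hw hw5 => (h.norm_le w hw hw5).trans hK⟩

lemma Tame.norm_sub_le_of_box {K : ℝ} {f : ℂ → ℂ} (h : Tame K f) {w u : ℂ} (hw : Box w)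
    (hu : Box u) : ‖f w - f u‖ ≤ 32 * K * ‖w - u‖ :=
  h.norm_sub_le (by linarith [hw.1]) (by linarith [hw.norm_le]) (by linarith [hu.1])
    (by linarith [hu.norm_le])

lemma box_ofReal {σ : ℝ} (h0 : 0 < σ) (h1 : σ ≤ 1) : Box σ := by
  refine ⟨?_, ?_, ?_⟩ <;> simp [h0, h1]

lemma box_add_mul_I {σ t : ℝ} (h0 : 0 < σ) (h1 : σ ≤ 1) (ht : |t| ≤ 1) : Box (σ + t * Complex.I) := by
  refine ⟨?_, ?_, ?_⟩ <;> simp [h0, h1, ht]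

lemma le_norm_add_mul_I (σ t : ℝ) : |t| ≤ ‖(σ : ℂ) + t * Complex.I‖ := by
  simpa using Complex.abs_im_le_norm ((σ : ℂ) + t * Complex.I)

lemma norm_add_mul_I_le {σ t : ℝ} (h0 : 0 < σ) (h1 : σ ≤ 1) (ht : |t| ≤ 2) :
    ‖(σ : ℂ) + t * Complex.I‖ ≤ 3 := by
  refine (Complex.norm_le_abs_re_add_abs_im _).trans ?_
  simp [abs_of_pos h0]
  linarith

section

variable {q : ℕ} [NeZero q] {z K : ℝ} {R : (ZMod q)ˣ → ℂ → ℂ}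

lemma norm_roughL_one_ofReal_le (hz : 4 ≤ z) (hqz : (q : ℝ) ≤ z) (hK : 0 ≤ K)
    (hR : IsRegularPart q z K R) {σ : ℝ} (h0 : 0 < σ) (h1 : σ ≤ 1) :
    ‖roughL z (1 : DirichletCharacter ℂ q) σ‖ ≤ 6 * (1 + K) / σ := by
  have := norm_roughL_one_le hz hqz hK hR (w := (σ : ℂ)) (by simpa using h0)
    (by rw [Complex.norm_real, Real.norm_of_nonneg h0.le]; linarith)
  rwa [Complex.norm_real, Real.norm_of_nonneg h0.le] at this

lemma cube_le_norm_roughL_pow_four (hz : 4 ≤ z) (hqz : (q : ℝ) ≤ z) (hK : 0 ≤ K)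
    (hR : IsRegularPart q z K R) (χ : DirichletCharacter ℂ q) {σ : ℝ} (h0 : 0 < σ) (h1 : σ ≤ 1)
    (t : ℝ) : σ ^ 3 ≤ (6 * (1 + K)) ^ 3 * ‖roughL z χ (σ + t * Complex.I)‖ ^ 4 *
      ‖roughL z (χ ^ 2) (σ + (2 * t : ℝ) * Complex.I)‖ := by
  have h := one_le_norm_roughL_product hz χ h0 t
  have h2 := norm_roughL_one_ofReal_le hz hqz hK hR h0 h1
  have h3 : ‖roughL z (1 : DirichletCharacter ℂ q) σ‖ ^ 3 ≤ (6 * (1 + K) / σ) ^ 3 := by gcongr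
  have h4 : 1 ≤ (6 * (1 + K) / σ) ^ 3 * ‖roughL z χ (σ + t * Complex.I)‖ ^ 4 *
      ‖roughL z (χ ^ 2) (σ + (2 * t : ℝ) * Complex.I)‖ := h.trans (by gcongr)
  rw [div_pow, div_mul_eq_mul_div, div_mul_eq_mul_div, le_div_iff₀ (by positivity), one_mul] at h4
  exact h4

lemma one_le_norm_roughL_one (hz : 4 ≤ z) {σ : ℝ} (h0 : 0 < σ) :
    1 ≤ ‖roughL z (1 : DirichletCharacter ℂ q) σ‖ := by
  have h := one_le_norm_roughL_four hz (χ := (1 : DirichletCharacter ℂ q))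
    (ψ := (1 : DirichletCharacter ℂ q)) (one_pow 2) (one_pow 2) h0
  rw [mul_one] at h
  by_contra! h'
  have := pow_lt_one₀ (norm_nonneg _) h' (n := 4) (by norm_num)
  linarith [this, h, show ‖roughL z (1 : DirichletCharacter ℂ q) σ‖ ^ 4 =
    ‖roughL z (1 : DirichletCharacter ℂ q) σ‖ * ‖roughL z (1 : DirichletCharacter ℂ q) σ‖ *
    ‖roughL z (1 : DirichletCharacter ℂ q) σ‖ * ‖roughL z (1 : DirichletCharacter ℂ q) σ‖ by ring]

lemma le_norm_regPart_of_sq_eq_one (hz : 4 ≤ z) (hqz : (q : ℝ) ≤ z) (hK : 0 ≤ K)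
    (hR : IsRegularPart q z K R) {χ : DirichletCharacter ℂ q} (hχ : χ ≠ 1) (hχ2 : χ ^ 2 = 1)
    {σ : ℝ} (h0 : 0 < σ) (h1 : σ ≤ 1) : σ / (6 * (1 + K)) ≤ ‖regPart R χ σ‖ := by
  have h := one_le_norm_roughL_four hz hχ2 (ψ := (1 : DirichletCharacter ℂ q)) (one_pow 2) h0
  rw [mul_one, roughL_of_ne_one hz hqz hR hχ (by simpa using h0)] at h
  have h2 := norm_roughL_one_ofReal_le hz hqz hK hR h0 h1
  have h3 : 1 ≤ ((6 * (1 + K) / σ) * ‖regPart R χ σ‖) ^ 2 := by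
    refine h.trans ?_
    rw [show (6 * (1 + K) / σ * ‖regPart R χ σ‖) ^ 2 = 6 * (1 + K) / σ * ‖regPart R χ σ‖ *
      (6 * (1 + K) / σ) * ‖regPart R χ σ‖ by ring]
    gcongr
  have h4 : 1 ≤ (6 * (1 + K) / σ) * ‖regPart R χ σ‖ := by
    by_contra! h'
    have := pow_lt_one₀ (by positivity) h' (n := 2) (by norm_num)
    linarith
  rw [div_mul_eq_mul_div, le_div_iff₀ h0, one_mul] at h4
  rw [div_le_iff₀ (by positivity)]
  linarith

end

lemma exists_le_norm_principalPart {K : ℝ} (hK : 1 ≤ K) : ∃ c > 0, ∀ (q : ℕ) [NeZero q] (z : ℝ)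
    (R : (ZMod q)ˣ → ℂ → ℂ), 4 ≤ z → (q : ℝ) ≤ z → IsRegularPart q z K R → ∀ w, Box w →
    c ≤ ‖principalPart z R w‖ := by
  obtain ⟨c₁, hc₁, -, hρ⟩ := exists_rho_ge
  set K₁ := 6 * (1 + K) with hK₁
  have hK₁0 : 0 < K₁ := by rw [hK₁]; linarith
  set c := min (min (c₁ / 2) (c₁ / (64 * K₁))) (1 / K₁ ^ 4) with hc
  have hc0 : 0 < c := by positivity
  obtain ⟨c', hc', H⟩ := exists_lower_bound_on_box (K := 32 * K₁) (c := c) (by positivity) hc0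
  refine ⟨c', hc', fun q _ z R hz hqz hR => H _ ?_ ?_ ?_⟩
  · exact fun w u hw hu => (tame_principalPart hz (by linarith) hR).norm_sub_le_of_box hw hu
  · intro σ h0 h1
    rcases le_or_gt σ (c₁ / (64 * K₁)) with h | h
    · have h2 := (tame_principalPart hz (by linarith) hR).norm_sub_le (w := 0) (u := σ)
        (by norm_num) (by norm_num) (by simp; linarith)
        (by rw [Complex.norm_real, Real.norm_of_nonneg h0.le]; linarith)
      rw [zero_sub, norm_neg, Complex.norm_real, Real.norm_of_nonneg h0.le] at h2
      have h3 : ‖principalPart z R 0‖ = rho z * Real.log z := by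
        rw [principalPart, zero_mul, add_zero, Complex.norm_real,
          Real.norm_of_nonneg (rho_mul_log_nonneg hz)]
      have h4 : c₁ ≤ rho z * Real.log z := by
        have := hρ z (by linarith)
        rwa [div_le_iff₀ (by linarith [log_ge_of_four_le hz])] at this
      have h5 := norm_sub_norm_le (principalPart z R 0) (principalPart z R σ)
      have h6 : 32 * K₁ * σ ≤ c₁ / 2 := by
        calc 32 * K₁ * σ ≤ 32 * K₁ * (c₁ / (64 * K₁)) := by gcongr
          _ = c₁ / 2 := by field_simp; norm_num
      have h7 : c ≤ c₁ / 2 := (min_le_left _ _).trans (min_le_left _ _)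
      linarith
    · have h2 := one_le_norm_roughL_one (q := q) hz h0
      rw [roughL_one hz hqz hR (by simpa using h0), norm_div, Complex.norm_real,
        Real.norm_of_nonneg h0.le, le_div_iff₀ h0, one_mul] at h2
      have h7 : c ≤ c₁ / (64 * K₁) := (min_le_left _ _).trans (min_le_right _ _)
      linarith
  · intro σ t h0 h1 ht
    rcases eq_or_ne t 0 with rfl | ht0
    · simp
    have ht0' : 0 < |t| := abs_pos.2 ht0
    have h := cube_le_norm_roughL_pow_four hz hqz (by linarith) hR (1 : DirichletCharacter ℂ q) h0 h1 t
    have hw := le_norm_add_mul_I σ t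
    have hw0 := ht0'.trans_le hw
    have h2 := norm_roughL_one_le hz hqz (by linarith) hR (w := σ + (2 * t : ℝ) * Complex.I)
      (by simpa using h0) ((norm_add_mul_I_le h0 h1 (by rw [abs_mul, abs_two]; linarith)).trans (by norm_num))
    have hw2 := le_norm_add_mul_I σ (2 * t)
    rw [abs_mul, abs_two] at hw2
    have h3 : ‖roughL z (1 : DirichletCharacter ℂ q) (σ + (2 * t : ℝ) * Complex.I)‖ ≤ K₁ / |t| :=
      h2.trans (by gcongr; linarith)
    rw [one_pow, roughL_one hz hqz hR (w := σ + t * Complex.I) (by simpa using h0), norm_div, div_pow] at h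
    have h4 : ‖principalPart z R (σ + t * Complex.I)‖ ^ 4 / ‖(σ : ℂ) + t * Complex.I‖ ^ 4 ≤
        ‖principalPart z R (σ + t * Complex.I)‖ ^ 4 / |t| ^ 4 := by gcongr
    have h5 : σ ^ 3 ≤ K₁ ^ 3 * (‖principalPart z R (σ + t * Complex.I)‖ ^ 4 / |t| ^ 4) * (K₁ / |t|) :=
      h.trans (by gcongr)
    have h6 : σ ^ 3 * |t| ^ 5 ≤ K₁ ^ 4 * ‖principalPart z R (σ + t * Complex.I)‖ ^ 4 := by
      calc _ ≤ (K₁ ^ 3 * (‖principalPart z R (σ + t * Complex.I)‖ ^ 4 / |t| ^ 4) * (K₁ / |t|)) * |t| ^ 5 := by gcongr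
        _ = _ := by field_simp
    have h7 : c ≤ 1 / K₁ ^ 4 := min_le_right _ _
    calc c * σ ^ 3 * |t| ^ 5 ≤ 1 / K₁ ^ 4 * (σ ^ 3 * |t| ^ 5) := by rw [mul_assoc]; gcongr
      _ ≤ 1 / K₁ ^ 4 * (K₁ ^ 4 * ‖principalPart z R (σ + t * Complex.I)‖ ^ 4) := by gcongr
      _ = _ := by field_simp

/-- Complex characters: a uniform lower bound on the box. -/
lemma exists_le_norm_regPart_of_sq_ne_one {K : ℝ} (hK : 1 ≤ K) : ∃ c > 0, ∀ (q : ℕ) [NeZero q]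
    (z : ℝ) (R : (ZMod q)ˣ → ℂ → ℂ), 4 ≤ z → (q : ℝ) ≤ z → IsRegularPart q z K R →
    ∀ χ : DirichletCharacter ℂ q, χ ^ 2 ≠ 1 → ∀ w, Box w → c ≤ ‖regPart R χ w‖ := by
  set K₁ := 6 * (1 + K) with hK₁
  have hK₁0 : 1 ≤ K₁ := by rw [hK₁]; linarith
  obtain ⟨c₂, hc₂, H₂⟩ := exists_lower_bound_of_lipschitz (K := 32 * (1 + K)) (c := 1 / K₁ ^ 4)
    (by positivity) (by positivity)
  obtain ⟨c', hc', H⟩ := exists_lower_bound_on_box (K := 32 * (1 + K)) (c := min c₂ (1 / K₁ ^ 4))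
    (by positivity) (by positivity)
  refine ⟨c', hc', fun q _ z R hz hqz hR χ hχ => ?_⟩
  have hχ1 : χ ≠ 1 := by rintro rfl; exact hχ (one_pow 2)
  have hT := tame_regPart hR χ
  have key : ∀ σ t : ℝ, 0 < σ → σ ≤ 1 → |t| ≤ 1 →
      1 / K₁ ^ 4 * σ ^ 3 ≤ ‖regPart R χ (σ + t * Complex.I)‖ ^ 4 := by
    intro σ t h0 h1 ht
    have h := cube_le_norm_roughL_pow_four hz hqz (by linarith) hR χ h0 h1 t
    rw [roughL_of_ne_one hz hqz hR hχ1 (w := σ + t * Complex.I) (by simpa using h0),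
      roughL_of_ne_one hz hqz hR hχ (w := σ + (2 * t : ℝ) * Complex.I) (by simpa using h0)] at h
    have h2 := (tame_regPart hR (χ ^ 2)).norm_le (σ + (2 * t : ℝ) * Complex.I)
      (by simp; linarith)
      ((norm_add_mul_I_le h0 h1 (by rw [abs_mul, abs_two]; linarith)).trans (by norm_num))
    have h3 : ‖regPart R (χ ^ 2) (σ + (2 * t : ℝ) * Complex.I)‖ ≤ K₁ := h2.trans (by rw [hK₁]; linarith)
    rw [one_div, inv_mul_le_iff₀ (by positivity)]
    calc _ ≤ _ := h
      _ ≤ K₁ ^ 3 * ‖regPart R χ (σ + t * Complex.I)‖ ^ 4 * K₁ := by gcongr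
      _ = _ := by ring
  refine H _ (fun w u hw hu => hT.norm_sub_le_of_box hw hu) ?_ ?_
  · refine fun σ h0 h1 => (min_le_left _ _).trans (H₂ (fun σ => ‖regPart R χ σ‖)
      (fun _ => norm_nonneg _) ?_ ?_ σ h0 h1)
    · intro σ τ hσ0 hσ1 hτ0 hτ1
      have := hT.norm_sub_le_of_box (box_ofReal hσ0 hσ1) (box_ofReal hτ0 hτ1)
      rw [← Complex.ofReal_sub, Complex.norm_real, Real.norm_eq_abs] at this
      exact (norm_sub_norm_le _ _).trans this
    · intro σ h0 h1
      simpa using key σ 0 h0 h1 (by simp)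
  · intro σ t h0 h1 ht
    refine le_trans ?_ (key σ t h0 h1 ht)
    calc min c₂ (1 / K₁ ^ 4) * σ ^ 3 * |t| ^ 5 ≤ 1 / K₁ ^ 4 * σ ^ 3 * 1 := by
          gcongr
          · exact min_le_right _ _
          · exact pow_le_one₀ (abs_nonneg _) ht
      _ = _ := mul_one _

lemma pow_four_ge_of_sq_eq_one {q : ℕ} [NeZero q] {z K : ℝ} {R : (ZMod q)ˣ → ℂ → ℂ} (hz : 4 ≤ z)
    (hqz : (q : ℝ) ≤ z) (hK : 0 ≤ K) (hR : IsRegularPart q z K R) {χ : DirichletCharacter ℂ q}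
    (hχ : χ ≠ 1) (hχ2 : χ ^ 2 = 1) {σ t : ℝ} (h0 : 0 < σ) (h1 : σ ≤ 1) (ht : |t| ≤ 1) :
    1 / (6 * (1 + K)) ^ 4 * σ ^ 3 * |t| ≤ ‖regPart R χ (σ + t * Complex.I)‖ ^ 4 := by
  set K₁ := 6 * (1 + K) with hK₁
  have hK₁0 : 0 < K₁ := by positivity
  rcases eq_or_ne t 0 with rfl | ht0
  · simp
  have ht0' : 0 < |t| := abs_pos.2 ht0
  have h := cube_le_norm_roughL_pow_four hz hqz hK hR χ h0 h1 t
  have h2 := norm_roughL_one_le hz hqz hK hR (w := σ + (2 * t : ℝ) * Complex.I)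
    (by simpa using h0)
    ((norm_add_mul_I_le h0 h1 (by rw [abs_mul, abs_two]; linarith)).trans (by norm_num))
  have hw2 := le_norm_add_mul_I σ (2 * t)
  rw [abs_mul, abs_two] at hw2
  have h3 : ‖roughL z (1 : DirichletCharacter ℂ q) (σ + (2 * t : ℝ) * Complex.I)‖ ≤ K₁ / |t| :=
    h2.trans (by gcongr; linarith)
  rw [hχ2, roughL_of_ne_one hz hqz hR hχ (w := σ + t * Complex.I) (by simpa using h0)] at h
  rw [one_div, mul_assoc, inv_mul_le_iff₀ (by positivity)]
  calc σ ^ 3 * |t| ≤ (K₁ ^ 3 * ‖regPart R χ (σ + t * Complex.I)‖ ^ 4 * (K₁ / |t|)) * |t| := by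
        gcongr; exact h.trans (by gcongr)
    _ = _ := by field_simp

/-- Real characters whose `L`-series stays away from `0` on the real segment. -/
lemma exists_le_norm_regPart_of_sq_eq_one {K c : ℝ} (hK : 1 ≤ K) (hc : 0 < c) : ∃ c' > 0,
    ∀ (q : ℕ) [NeZero q] (z : ℝ) (R : (ZMod q)ˣ → ℂ → ℂ), 4 ≤ z → (q : ℝ) ≤ z →
    IsRegularPart q z K R → ∀ χ : DirichletCharacter ℂ q, χ ≠ 1 → χ ^ 2 = 1 →
    (∀ σ : ℝ, 0 < σ → σ ≤ 1 → c ≤ ‖regPart R χ σ‖) → ∀ w, Box w → c' ≤ ‖regPart R χ w‖ := by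
  set K₁ := 6 * (1 + K) with hK₁
  have hK₁0 : 1 ≤ K₁ := by rw [hK₁]; linarith
  obtain ⟨c', hc', H⟩ := exists_lower_bound_on_box (K := 32 * (1 + K)) (c := min c (1 / K₁ ^ 4))
    (by positivity) (by positivity)
  refine ⟨c', hc', fun q _ z R hz hqz hR χ hχ hχ2 hreal => ?_⟩
  refine H _ (fun w u hw hu => (tame_regPart hR χ).norm_sub_le_of_box hw hu) ?_ ?_
  · exact fun σ h0 h1 => (min_le_left _ _).trans (hreal σ h0 h1)
  · intro σ t h0 h1 ht
    refine le_trans ?_ (pow_four_ge_of_sq_eq_one hz hqz (by linarith) hR hχ hχ2 h0 h1 ht)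
    gcongr
    · exact min_le_right _ _
    · simpa using pow_le_pow_of_le_one (abs_nonneg t) ht (show 1 ≤ 5 by norm_num)

/-- Real characters with a real zero: the quotient by the zero is bounded below. -/
lemma exists_le_norm_dslope {K : ℝ} (hK : 1 ≤ K) : ∃ c > 0, ∃ c' > 0,
    ∀ (q : ℕ) [NeZero q] (z : ℝ) (R : (ZMod q)ˣ → ℂ → ℂ), 4 ≤ z → (q : ℝ) ≤ z →
    IsRegularPart q z K R → ∀ χ : DirichletCharacter ℂ q, χ ≠ 1 → χ ^ 2 = 1 →
    (∃ σ : ℝ, 0 < σ ∧ σ ≤ 1 ∧ ‖regPart R χ σ‖ < c) →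
    ∃ lam : ℝ, 0 ≤ lam ∧ lam ≤ 1 / 128 ∧ regPart R χ (-lam : ℝ) = 0 ∧
      Tame (128 * (6 * (1 + K))) (dslope (regPart R χ) (-lam : ℝ)) ∧
      ∀ w, Box w → c' ≤ ‖dslope (regPart R χ) (-lam : ℝ) w‖ := by
  set K₁ := 6 * (1 + K) with hK₁
  have hK₁0 : 1 ≤ K₁ := by rw [hK₁]; linarith
  obtain ⟨c, hc, H₁⟩ := exists_real_zero hK₁0
  obtain ⟨c', hc', H⟩ := exists_lower_bound_on_box (K := 32 * (128 * K₁))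
    (c := min (1 / (4 * K₁)) (1 / (3 ^ 4 * K₁ ^ 4))) (by positivity) (by positivity)
  refine ⟨c, hc, c', hc', fun q _ z R hz hqz hR χ hχ hχ2 hex => ?_⟩
  obtain ⟨lam, hl0, hl1, hzero, hT, hlow⟩ := H₁ (regPart R χ)
    ((tame_regPart hR χ).mono (by rw [hK₁]; linarith)) (regPart_conj hR hχ2)
    (fun σ h0 h1 => le_norm_regPart_of_sq_eq_one hz hqz (by linarith) hR hχ hχ2 h0 h1) hex
  refine ⟨lam, hl0, hl1, hzero, hT, H _ (fun w u hw hu => hT.norm_sub_le_of_box hw hu) ?_ ?_⟩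
  · exact fun σ h0 h1 => (min_le_left _ _).trans (hlow σ h0 h1)
  · intro σ t h0 h1 ht
    have h := pow_four_ge_of_sq_eq_one hz hqz (by linarith) hR hχ hχ2 h0 h1 ht
    have hfac : regPart R χ (σ + t * Complex.I) = ((σ + t * Complex.I) - (-lam : ℝ)) *
        dslope (regPart R χ) (-lam : ℝ) (σ + t * Complex.I) := by
      have := sub_smul_dslope (regPart R χ) (-lam : ℝ) (σ + t * Complex.I)
      rw [smul_eq_mul, hzero, sub_zero] at this
      exact this.symm
    have hn : ‖((σ : ℂ) + t * Complex.I) - (-lam : ℝ)‖ ≤ 3 := by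
      have e : ((σ : ℂ) + t * Complex.I) - (-lam : ℝ) = ((σ + lam : ℝ) : ℂ) + t * Complex.I := by
        push_cast; ring
      rw [e]
      refine (Complex.norm_le_abs_re_add_abs_im _).trans ?_
      have : 0 < σ + lam := by positivity
      simp only [Complex.add_re, Complex.ofReal_re, Complex.mul_re, Complex.I_re, mul_zero,
        Complex.ofReal_im, Complex.I_im, mul_one, sub_self, add_zero, Complex.add_im,
        Complex.mul_im, zero_add]
      rw [abs_of_pos this]; linarith
    rw [hfac, norm_mul] at h
    have h' : 1 / K₁ ^ 4 * σ ^ 3 * |t| ≤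
        (3 * ‖dslope (regPart R χ) (-lam : ℝ) (σ + t * Complex.I)‖) ^ 4 := h.trans (by gcongr)
    rw [mul_pow 3] at h'
    calc min (1 / (4 * K₁)) (1 / (3 ^ 4 * K₁ ^ 4)) * σ ^ 3 * |t| ^ 5
        ≤ 1 / (3 ^ 4 * K₁ ^ 4) * σ ^ 3 * |t| := by
          gcongr
          · exact min_le_right _ _
          · simpa using pow_le_pow_of_le_one (abs_nonneg t) ht (show 1 ≤ 5 by norm_num)
      _ = (1 / K₁ ^ 4 * σ ^ 3 * |t|) / 3 ^ 4 := by field_simp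
      _ ≤ _ := by rw [div_le_iff₀ (by positivity)]; linarith

/-- At most one real character has a small value on the real segment. -/
lemma exists_unique_small {K : ℝ} (hK : 1 ≤ K) : ∃ c > 0, ∀ (q : ℕ) [NeZero q] (z : ℝ)
    (R : (ZMod q)ˣ → ℂ → ℂ), 4 ≤ z → (q : ℝ) ≤ z → IsRegularPart q z K R →
    ∀ χ ψ : DirichletCharacter ℂ q, χ ≠ 1 → ψ ≠ 1 → χ ^ 2 = 1 → ψ ^ 2 = 1 →
    (∃ σ : ℝ, 0 < σ ∧ σ ≤ 1 ∧ ‖regPart R χ σ‖ < c) →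
    (∃ σ : ℝ, 0 < σ ∧ σ ≤ 1 ∧ ‖regPart R ψ σ‖ < c) → χ = ψ := by
  set K₁ := 6 * (1 + K) with hK₁
  have hK₁0 : 1 ≤ K₁ := by rw [hK₁]; linarith
  set M := 1 + 32 * K₁ * (K₁ + 1) with hM
  have hM0 : 1 ≤ M := by rw [hM]; nlinarith [mul_pos (show 0 < K₁ by linarith) (show 0 < K₁ + 1 by linarith)]
  set c := 1 / (2 * K₁ ^ 2 * M ^ 2) with hc
  have hc0 : 0 < c := by positivity
  have hc1 : c ≤ 1 := by
    rw [hc, div_le_one (by positivity)]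
    have h1 : 1 ≤ K₁ ^ 2 := one_le_pow₀ hK₁0
    have h2 : 1 ≤ M ^ 2 := one_le_pow₀ hM0
    nlinarith
  refine ⟨c, hc0, fun q _ z R hz hqz hR χ ψ hχ hψ hχ2 hψ2 hχs hψs => ?_⟩
  by_contra hne
  have small : ∀ χ : DirichletCharacter ℂ q, χ ≠ 1 → χ ^ 2 = 1 →
      (∃ σ : ℝ, 0 < σ ∧ σ ≤ 1 ∧ ‖regPart R χ σ‖ < c) → ‖regPart R χ c‖ ≤ M * c := by
    rintro χ hχ hχ2 ⟨σ, h0, h1, hσ⟩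
    have h2 := le_norm_regPart_of_sq_eq_one hz hqz (by linarith) hR hχ hχ2 h0 h1
    rw [div_le_iff₀ (by positivity)] at h2
    have h3 : σ ≤ K₁ * c := by nlinarith
    have h4 := (tame_regPart hR χ).norm_sub_le_of_box (box_ofReal hc0 hc1) (box_ofReal h0 h1)
    rw [← Complex.ofReal_sub, Complex.norm_real, Real.norm_eq_abs] at h4
    have h5 : |c - σ| ≤ (K₁ + 1) * c := by
      rw [abs_le]; constructor <;> nlinarith [mul_pos (show 0 < K₁ by linarith) hc0]
    have h6 := norm_sub_norm_le (regPart R χ c) (regPart R χ σ)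
    have h7 : 32 * (1 + K) * |c - σ| ≤ 32 * K₁ * ((K₁ + 1) * c) := by
      gcongr; rw [hK₁]; linarith
    calc _ ≤ c + 32 * K₁ * ((K₁ + 1) * c) := by linarith
      _ = M * c := by rw [hM]; ring
  have hprod : χ * ψ ≠ 1 := by
    intro h
    apply hne
    have : χ * ψ = ψ * ψ := by rw [h, ← sq, hψ2]
    exact mul_right_cancel this
  have h := one_le_norm_roughL_four hz hχ2 hψ2 hc0
  have hcre : 0 < ((c : ℝ) : ℂ).re := by simpa using hc0
  rw [roughL_of_ne_one hz hqz hR hχ hcre, roughL_of_ne_one hz hqz hR hψ hcre,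
    roughL_of_ne_one hz hqz hR hprod hcre] at h
  have h1 := norm_roughL_one_ofReal_le hz hqz (by linarith) hR hc0 hc1
  have h2 := small χ hχ hχ2 hχs
  have h3 := small ψ hψ hψ2 hψs
  have h4 := (tame_regPart hR (χ * ψ)).norm_le c (by simp; linarith)
    (by rw [Complex.norm_real, Real.norm_of_nonneg hc0.le]; linarith)
  have h5 : 1 ≤ K₁ / c * (M * c) * (M * c) * K₁ :=
    h.trans (by gcongr; exact h4.trans (by rw [hK₁]; linarith))
  have h6 : K₁ / c * (M * c) * (M * c) * K₁ = 1 / 2 := by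
    rw [show K₁ / c * (M * c) * (M * c) * K₁ = K₁ ^ 2 * M ^ 2 * c by field_simp, hc]
    field_simp
  linarith

/-- Zero-free box for all characters, up to a single simple real zero of one real character. -/
theorem exists_zero_free_box {K : ℝ} (hK : 1 ≤ K) : ∃ c > 0, ∀ (q : ℕ) [NeZero q] (z : ℝ)
    (R : (ZMod q)ˣ → ℂ → ℂ), 4 ≤ z → (q : ℝ) ≤ z → IsRegularPart q z K R →
    (∀ w, Box w → c ≤ ‖principalPart z R w‖) ∧
    ((∀ χ : DirichletCharacter ℂ q, χ ≠ 1 → ∀ w, Box w → c ≤ ‖regPart R χ w‖) ∨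
      ∃ χ₁ : DirichletCharacter ℂ q, χ₁ ≠ 1 ∧ χ₁ ^ 2 = 1 ∧ ∃ lam : ℝ, 0 ≤ lam ∧ lam ≤ 1 / 128 ∧
        regPart R χ₁ (-lam : ℝ) = 0 ∧
        Tame (128 * (6 * (1 + K))) (dslope (regPart R χ₁) (-lam : ℝ)) ∧
        (∀ w, Box w → c ≤ ‖dslope (regPart R χ₁) (-lam : ℝ) w‖) ∧
        ∀ χ : DirichletCharacter ℂ q, χ ≠ 1 → χ ≠ χ₁ → ∀ w, Box w → c ≤ ‖regPart R χ w‖) := by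
  obtain ⟨c₁, hc₁, H₁⟩ := exists_le_norm_principalPart hK
  obtain ⟨c₂, hc₂, H₂⟩ := exists_le_norm_regPart_of_sq_ne_one hK
  obtain ⟨c₃, hc₃, c₄, hc₄, H₃⟩ := exists_le_norm_dslope hK
  obtain ⟨c₅, hc₅, H₅⟩ := exists_unique_small hK
  obtain ⟨c₆, hc₆, H₆⟩ := exists_le_norm_regPart_of_sq_eq_one hK (lt_min hc₃ hc₅)
  refine ⟨min (min c₁ c₂) (min c₄ c₆), by positivity, fun q _ z R hz hqz hR =>
    ⟨fun w hw => ?_, ?_⟩⟩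
  · exact ((min_le_left _ _).trans (min_le_left _ _)).trans (H₁ q z R hz hqz hR w hw)
  have le₂ : min (min c₁ c₂) (min c₄ c₆) ≤ c₂ := (min_le_left _ _).trans (min_le_right _ _)
  have le₄ : min (min c₁ c₂) (min c₄ c₆) ≤ c₄ := (min_le_right _ _).trans (min_le_left _ _)
  have le₆ : min (min c₁ c₂) (min c₄ c₆) ≤ c₆ := (min_le_right _ _).trans (min_le_right _ _)
  by_cases hex : ∃ χ₁ : DirichletCharacter ℂ q, χ₁ ≠ 1 ∧ χ₁ ^ 2 = 1 ∧
      ∃ σ : ℝ, 0 < σ ∧ σ ≤ 1 ∧ ‖regPart R χ₁ σ‖ < min c₃ c₅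
  · obtain ⟨χ₁, hχ₁, hχ₁2, σ, h0, h1, hσ⟩ := hex
    obtain ⟨lam, hl0, hl1, hzero, hT, hlow⟩ := H₃ q z R hz hqz hR χ₁ hχ₁ hχ₁2
      ⟨σ, h0, h1, hσ.trans_le (min_le_left _ _)⟩
    refine Or.inr ⟨χ₁, hχ₁, hχ₁2, lam, hl0, hl1, hzero, hT,
      fun w hw => le₄.trans (hlow w hw), fun χ hχ hne w hw => ?_⟩
    by_cases hχ2 : χ ^ 2 = 1
    · refine le₆.trans (H₆ q z R hz hqz hR χ hχ hχ2 (fun τ hτ0 hτ1 => ?_) w hw)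
      by_contra! hτ
      exact hne (H₅ q z R hz hqz hR χ χ₁ hχ hχ₁ hχ2 hχ₁2
        ⟨τ, hτ0, hτ1, hτ.trans_le (min_le_right _ _)⟩ ⟨σ, h0, h1, hσ.trans_le (min_le_right _ _)⟩)
    · exact le₂.trans (H₂ q z R hz hqz hR χ hχ2 w hw)
  · push Not at hex
    refine Or.inl fun χ hχ w hw => ?_
    by_cases hχ2 : χ ^ 2 = 1
    · exact le₆.trans (H₆ q z R hz hqz hR χ hχ hχ2 (fun τ hτ0 hτ1 => hex χ hχ hχ2 τ hτ0 hτ1) w hw)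
    · exact le₂.trans (H₂ q z R hz hqz hR χ hχ2 w hw)

/-- Points within `δ` of the box. -/
lemma region_of_near_box {w u : ℂ} {δ : ℝ} (hδ : δ ≤ 1 / 32) (hw : Box w)
    (hu : u ∈ Metric.closedBall w δ) : -(1 / 32) ≤ u.re ∧ ‖u‖ ≤ 4 := by
  rw [Metric.mem_closedBall, dist_eq_norm] at hu
  have h1 := (Complex.abs_re_le_norm (u - w)).trans hu
  rw [Complex.sub_re, abs_le] at h1
  have h2 : ‖u‖ ≤ ‖u - w‖ + ‖w‖ := by simpa using norm_add_le (u - w) w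
  have := hw.norm_le
  have := hw.1
  constructor <;> linarith

lemma Tame.half_le_norm {K c δ : ℝ} {f : ℂ → ℂ} (h : Tame K f) (hK : 0 ≤ K) (hδ : δ ≤ 1 / 32)
    (hδc : 32 * K * δ ≤ c / 2) {w u : ℂ} (hw : Box w) (hu : u ∈ Metric.closedBall w δ)
    (hc : c ≤ ‖f w‖) : c / 2 ≤ ‖f u‖ := by
  obtain ⟨h1, h2⟩ := region_of_near_box hδ hw hu
  have h3 := h.norm_sub_le (w := w) (u := u) (by linarith [hw.1]) (by linarith [hw.norm_le]) h1 h2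
  rw [Metric.mem_closedBall, dist_comm, dist_eq_norm] at hu
  have h4 : 32 * K * ‖w - u‖ ≤ 32 * K * δ := by gcongr
  have := norm_sub_norm_le (f w) (f u)
  linarith

lemma Tame.differentiableAt_deriv {K : ℝ} {f : ℂ → ℂ} (h : Tame K f) {w : ℂ}
    (hw : -(1 / 8) < w.re) : DifferentiableAt ℂ (deriv f) w :=
  (h.differentiableOn.deriv (isOpen_halfPlane _)).differentiableAt ((isOpen_halfPlane _).mem_nhds hw)

lemma Tame.differentiableAt_logDeriv {K : ℝ} {f : ℂ → ℂ} (h : Tame K f) {w : ℂ}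
    (hw : -(1 / 8) < w.re) (h0 : f w ≠ 0) : DifferentiableAt ℂ (logDeriv f) w :=
  (h.differentiableAt_deriv hw).div (h.differentiableAt hw) h0

lemma Tame.norm_logDeriv_le {K c : ℝ} {f : ℂ → ℂ} (h : Tame K f) (hc0 : 0 < c) {w : ℂ}
    (hw : -(1 / 32) ≤ w.re) (hw4 : ‖w‖ ≤ 4) (hc : c ≤ ‖f w‖) : ‖logDeriv f w‖ ≤ 32 * K / c := by
  rw [logDeriv_apply, norm_div]
  have := h.norm_deriv_le hw hw4
  have := (norm_nonneg _).trans this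
  gcongr

section

variable {q : ℕ} [NeZero q] {z K : ℝ} {R : (ZMod q)ˣ → ℂ → ℂ}

lemma IsRegularPart.tame (hR : IsRegularPart q z K R) (a : (ZMod q)ˣ) :
    Tame (K / q.totient) (R a) :=
  ⟨hR.differentiableOn a, hR.norm_le a⟩

lemma deriv_regPart (hR : IsRegularPart q z K R) (χ : DirichletCharacter ℂ q) {w : ℂ}
    (hw : -(1 / 8) < w.re) : deriv (regPart R χ) w = ∑ a : (ZMod q)ˣ, χ a * deriv (R a) w := by
  have h : HasDerivAt (fun w => 1 + ∑ a : (ZMod q)ˣ, χ a * R a w)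
      (∑ a : (ZMod q)ˣ, χ a * deriv (R a) w) w := by
    refine (HasDerivAt.fun_sum fun a _ => ?_).const_add 1
    exact ((hR.tame a).differentiableAt hw).hasDerivAt.const_mul _
  exact h.deriv

lemma norm_sum_logDeriv_regPart_le (hK : 0 ≤ K) (hR : IsRegularPart q z K R) {w : ℂ} {c : ℝ}
    (hc : 0 < c) (hw : -(1 / 32) ≤ w.re) (hw4 : ‖w‖ ≤ 4) (T U : Finset (DirichletCharacter ℂ q))
    (hTU : Disjoint T U) (hun : T.disjUnion U hTU = univ) (hU : #U ≤ 2)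
    (hT : ∀ χ ∈ T, c ≤ ‖regPart R χ w‖) (a : (ZMod q)ˣ) :
    ‖∑ χ ∈ T, starRingEnd ℂ (χ a) * logDeriv (regPart R χ) w‖ ≤
      96 * K + ((32 * K) ^ 2 + K ^ 2) / c := by
  have hφ : (0 : ℝ) < q.totient := by exact_mod_cast Nat.totient_pos.2 (NeZero.pos q)
  have hw8 : -(1 / 8) < w.re := by linarith
  have hdR : ∀ b, ‖deriv (R b) w‖ ≤ 32 * K / q.totient := fun b => by
    rw [mul_div_assoc]; exact (hR.tame b).norm_deriv_le hw hw4
  have hRb : ∀ b, ‖R b w‖ ≤ K / q.totient := fun b => hR.norm_le b w (by linarith) (by linarith)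
  set D : DirichletCharacter ℂ q → ℂ := fun χ => ∑ b : (ZMod q)ˣ, χ b * deriv (R b) w with hD
  set E : DirichletCharacter ℂ q → ℂ := fun χ => ∑ b : (ZMod q)ˣ, χ b * R b w with hE
  have hunit : ∀ χ : DirichletCharacter ℂ q, ‖starRingEnd ℂ (χ a)‖ = 1 := fun χ => by
    rw [RCLike.norm_conj, χ.unit_norm_eq_one]
  have hsplit : ∑ χ ∈ T, starRingEnd ℂ (χ a) * logDeriv (regPart R χ) w =
      (∑ χ, starRingEnd ℂ (χ a) * D χ - ∑ χ ∈ U, starRingEnd ℂ (χ a) * D χ) -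
        ∑ χ ∈ T, starRingEnd ℂ (χ a) * (D χ * E χ / regPart R χ w) := by
    rw [← hun, sum_disjUnion, add_sub_cancel_right, ← sum_sub_distrib]
    refine sum_congr rfl fun χ hχ => ?_
    have h0 : regPart R χ w ≠ 0 := norm_pos_iff.1 (hc.trans_le (hT χ hχ))
    have hreg : regPart R χ w = 1 + E χ := rfl
    rw [logDeriv_apply, deriv_regPart hR χ hw8]
    change _ * (D χ / _) = _
    field_simp
    rw [hreg]; ring
  rw [hsplit]
  have h1 : ‖∑ χ, starRingEnd ℂ (χ a) * D χ‖ ≤ 32 * K := by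
    rw [hD, sum_char_conj_mul_sum, norm_mul, Complex.norm_natCast]
    calc _ ≤ (q.totient : ℝ) * (32 * K / q.totient) := by gcongr; exact hdR a
      _ = _ := by field_simp
  have h2 : ‖∑ χ ∈ U, starRingEnd ℂ (χ a) * D χ‖ ≤ 64 * K := by
    calc _ ≤ ∑ χ ∈ U, 32 * K := by
          refine (norm_sum_le _ _).trans (sum_le_sum fun χ _ => ?_)
          rw [norm_mul, hunit, one_mul]; exact norm_sum_char_mul_le χ hdR
      _ ≤ 2 * (32 * K) := by
          rw [sum_const, nsmul_eq_mul]; gcongr; exact_mod_cast hU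
      _ = _ := by ring
  have h3 : ‖∑ χ ∈ T, starRingEnd ℂ (χ a) * (D χ * E χ / regPart R χ w)‖ ≤
      ((32 * K) ^ 2 + K ^ 2) / c := by
    calc _ ≤ ∑ χ ∈ T, (‖D χ‖ ^ 2 + ‖E χ‖ ^ 2) / c := by
          refine (norm_sum_le _ _).trans (sum_le_sum fun χ hχ => ?_)
          rw [norm_mul, hunit, one_mul, norm_div, norm_mul]
          have := hT χ hχ
          gcongr
          nlinarith [sq_nonneg (‖D χ‖ - ‖E χ‖), sq_nonneg (‖D χ‖), sq_nonneg ‖E χ‖]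
      _ ≤ ∑ χ, (‖D χ‖ ^ 2 + ‖E χ‖ ^ 2) / c :=
          sum_le_sum_of_subset_of_nonneg (subset_univ _) fun _ _ _ => by positivity
      _ = (∑ χ, ‖D χ‖ ^ 2 + ∑ χ, ‖E χ‖ ^ 2) / c := by rw [← sum_div, sum_add_distrib]
      _ ≤ _ := by
          gcongr
          · exact sum_norm_sq_sum_char_le hdR
          · exact sum_norm_sq_sum_char_le hRb
  refine (norm_sub_le _ _).trans ?_
  have := norm_sub_le (∑ χ, starRingEnd ℂ (χ a) * D χ) (∑ χ ∈ U, starRingEnd ℂ (χ a) * D χ)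
  linarith

end

/-- Bounded derivative on the box, from bounds on a neighbourhood. -/
lemma norm_deriv_le_of_near_box {f : ℂ → ℂ} {C δ : ℝ} (hδ : 0 < δ) {w : ℂ}
    (h : ∀ u ∈ Metric.closedBall w δ, DifferentiableAt ℂ f u ∧ ‖f u‖ ≤ C) :
    ‖deriv f w‖ ≤ C / δ := by
  refine Complex.norm_deriv_le_of_forall_mem_sphere_norm_le hδ ?_
    fun u hu => (h u (Metric.sphere_subset_closedBall hu)).2
  refine DifferentiableOn.diffContOnCl_ball (U := Metric.closedBall w δ) (fun u hu => ?_) subset_rfl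
  exact (h u hu).1.differentiableWithinAt

/-- The von Mangoldt function on rough numbers in a residue class. -/
noncomputable def roughLambda {q : ℕ} (z : ℝ) (a : (ZMod q)ˣ) (n : ℕ) : ℝ :=
  if (n : ZMod q) = a ∧ Rough z n then ArithmeticFunction.vonMangoldt n else 0

instance {q : ℕ} [NeZero q] {z : ℝ} : NeZero (modulus q z) :=
  ⟨mul_ne_zero (NeZero.ne q) (prod_ne_zero_iff.2 fun _ hp => (prime_of_mem_primesUpTo hp).ne_zero)⟩

lemma logDeriv_roughL {q : ℕ} [NeZero q] {z : ℝ} (hz : 4 ≤ z) (χ : DirichletCharacter ℂ q)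
    {w : ℂ} (hw : 0 < w.re) : logDeriv (roughL z χ) w = -(LSeries ((fun n : ℕ => roughChar z χ n) *
      fun n : ℕ => (ArithmeticFunction.vonMangoldt n : ℂ)) (1 + w / Real.log z)) / Real.log z := by
  have hl0 : 0 < Real.log z := by linarith [log_ge_of_four_le hz]
  have hs := one_lt_re_one_add_div hl0 hw
  rw [DirichletCharacter.LSeries_twist_vonMangoldt_eq _ hs]
  have hd : DifferentiableAt ℂ (LSeries fun n => roughChar z χ n) (1 + w / Real.log z) :=
    (LSeries_hasDerivAt (by
      rw [DirichletCharacter.absicssaOfAbsConv_eq_one (NeZero.ne _)]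
      exact_mod_cast hs)).differentiableAt
  have hg : HasDerivAt (fun w : ℂ => 1 + w / (Real.log z : ℂ)) (1 / (Real.log z : ℂ)) w :=
    ((hasDerivAt_id w).div_const _).const_add 1
  have h := hd.hasDerivAt.comp w hg
  rw [logDeriv_apply, show roughL z χ = (LSeries fun n => roughChar z χ n) ∘
    (fun w : ℂ => 1 + w / (Real.log z : ℂ)) from rfl, h.deriv]
  simp only [Function.comp]
  field_simp

lemma sum_conj_mul_logDeriv_roughL {q : ℕ} [NeZero q] {z : ℝ} (hz : 4 ≤ z) (hqz : (q : ℝ) ≤ z)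
    (a : (ZMod q)ˣ) {w : ℂ} (hw : 0 < w.re) :
    ∑ χ : DirichletCharacter ℂ q, starRingEnd ℂ (χ a) * -logDeriv (roughL z χ) w =
      q.totient / Real.log z * LSeries (fun n => (roughLambda z a n : ℂ)) (1 + w / Real.log z) := by
  have hl0 : 0 < Real.log z := by linarith [log_ge_of_four_le hz]
  have hs := one_lt_re_one_add_div hl0 hw
  simp_rw [logDeriv_roughL hz _ hw, neg_div, neg_neg, mul_div_assoc']
  rw [← sum_div, div_mul_eq_mul_div]
  congr 1
  have hsum : ∀ χ ∈ (univ : Finset (DirichletCharacter ℂ q)),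
      LSeriesSummable (starRingEnd ℂ (χ a) • ((fun n : ℕ => roughChar z χ n) *
      fun n : ℕ => (ArithmeticFunction.vonMangoldt n : ℂ))) (1 + w / Real.log z) := fun χ _ =>
    LSeriesSummable.smul _ (DirichletCharacter.LSeriesSummable_twist_vonMangoldt (roughChar z χ) hs)
  calc _ = ∑ χ : DirichletCharacter ℂ q, LSeries (starRingEnd ℂ (χ a) •
        ((fun n : ℕ => roughChar z χ n) * fun n : ℕ => (ArithmeticFunction.vonMangoldt n : ℂ)))
          (1 + w / Real.log z) := by
        refine sum_congr rfl fun χ _ => ?_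
        rw [LSeries_smul]
    _ = LSeries ((q.totient : ℂ) • (fun n => (roughLambda z a n : ℂ))) (1 + w / Real.log z) := by
        rw [← LSeries_sum hsum]
        refine LSeries_congr (fun {n} _ => ?_) _
        simp only [Finset.sum_apply, Pi.smul_apply, Pi.mul_apply, smul_eq_mul]
        simp_rw [← mul_assoc]
        rw [← sum_mul]
        simp_rw [roughChar_apply hqz, roughLambda]
        by_cases hr : Rough z n
        · simp only [hr, if_true, and_true]
          simp_rw [← char_inv_eq_conj]
          rw [DirichletCharacter.sum_char_inv_mul_char_eq ℂ a.isUnit]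
          by_cases h : (n : ZMod q) = a
          · simp [h]
          · rw [if_neg (fun h' => h h'.symm), if_neg h]; simp
        · simp [hr]
    _ = _ := by rw [LSeries_smul]

section

variable {q : ℕ} [NeZero q] {z K : ℝ} {R : (ZMod q)ˣ → ℂ → ℂ}

lemma logDeriv_roughL_of_ne_one (hz : 4 ≤ z) (hqz : (q : ℝ) ≤ z) (hR : IsRegularPart q z K R)
    {χ : DirichletCharacter ℂ q} (hχ : χ ≠ 1) {w : ℂ} (hw : 0 < w.re) :
    logDeriv (roughL z χ) w = logDeriv (regPart R χ) w := by
  refine (logDeriv_congr_nhds ?_).self_of_nhds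
  filter_upwards [(isOpen_halfPlane 0).mem_nhds hw] with u hu
  exact roughL_of_ne_one hz hqz hR hχ hu

lemma logDeriv_roughL_one (hz : 4 ≤ z) (hqz : (q : ℝ) ≤ z) (hK : 0 ≤ K)
    (hR : IsRegularPart q z K R) {w : ℂ} (hw : 0 < w.re) (h0 : principalPart z R w ≠ 0) :
    logDeriv (roughL z (1 : DirichletCharacter ℂ q)) w =
      logDeriv (principalPart z R) w - 1 / w := by
  have hw0 : w ≠ 0 := by rintro rfl; simp at hw
  have h1 : logDeriv (roughL z (1 : DirichletCharacter ℂ q)) w =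
      logDeriv (fun u => principalPart z R u / id u) w := by
    refine (logDeriv_congr_nhds ?_).self_of_nhds
    filter_upwards [(isOpen_halfPlane 0).mem_nhds hw] with u hu
    exact roughL_one hz hqz hR hu
  rw [h1, logDeriv_div w h0 hw0
    ((tame_principalPart hz hK hR).differentiableAt (by linarith)) differentiableAt_id, logDeriv_id]

lemma logDeriv_regPart_of_zero {χ : DirichletCharacter ℂ q} {lam : ℝ}
    (hl : 0 ≤ lam) (hzero : regPart R χ (-lam : ℝ) = 0) {K' : ℝ}
    (hT : Tame K' (dslope (regPart R χ) (-lam : ℝ))) {w : ℂ} (hw : 0 < w.re)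
    (h0 : dslope (regPart R χ) (-lam : ℝ) w ≠ 0) :
    logDeriv (regPart R χ) w = 1 / (w + lam) + logDeriv (dslope (regPart R χ) (-lam : ℝ)) w := by
  have hfac : regPart R χ = fun u => (u + lam) * dslope (regPart R χ) (-lam : ℝ) u := by
    ext u
    have := sub_smul_dslope (regPart R χ) (-lam : ℝ) u
    rw [smul_eq_mul, hzero, sub_zero, Complex.ofReal_neg, sub_neg_eq_add] at this
    rw [Complex.ofReal_neg]; exact this.symm
  have hne : w + lam ≠ 0 := by
    intro h
    have := congrArg Complex.re h
    simp at this; linarith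
  have hd : DifferentiableAt ℂ (fun u : ℂ => u + lam) w := differentiableAt_id.add_const _
  conv_lhs => rw [hfac]
  rw [logDeriv_mul w hne h0 hd (hT.differentiableAt (by linarith))]
  congr 1
  rw [logDeriv_apply]
  simp

lemma roughChar_ne_one {χ : DirichletCharacter ℂ q} (hχ : χ ≠ 1) : roughChar z χ ≠ 1 := by
  rw [← roughChar_one (q := q)]
  have : NeZero (q * ∏ p ∈ primesUpTo z, p) := inferInstanceAs (NeZero (modulus q z))
  exact fun h => hχ (DirichletCharacter.changeLevel_injective _ h)

lemma LFunction_roughChar_one (hz : 4 ≤ z) (hqz : (q : ℝ) ≤ z) (hR : IsRegularPart q z K R)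
    {χ : DirichletCharacter ℂ q} (hχ : χ ≠ 1) :
    DirichletCharacter.LFunction (roughChar z χ) 1 = regPart R χ 0 := by
  have hl0 : 0 < Real.log z := by linarith [log_ge_of_four_le hz]
  have hcont : Continuous fun t : ℝ =>
      DirichletCharacter.LFunction (roughChar z χ) (1 + (t : ℂ) / Real.log z) := by
    have := (DirichletCharacter.differentiable_LFunction (roughChar_ne_one (z := z) hχ)).continuous
    fun_prop
  have h1 : Filter.Tendsto (fun t : ℝ =>
      DirichletCharacter.LFunction (roughChar z χ) (1 + (t : ℂ) / Real.log z))
      (nhdsWithin 0 (Set.Ioi 0)) (nhds (DirichletCharacter.LFunction (roughChar z χ) 1)) := by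
    have := (hcont.tendsto 0).mono_left (nhdsWithin_le_nhds (s := Set.Ioi 0))
    simpa using this
  have hc2 : ContinuousAt (fun t : ℝ => regPart R χ t) 0 := by
    have : ContinuousAt (regPart R χ) ((0 : ℝ) : ℂ) :=
      ((tame_regPart hR χ).differentiableAt (by simp)).continuousAt
    exact this.comp Complex.continuous_ofReal.continuousAt
  have h2 : Filter.Tendsto (fun t : ℝ => regPart R χ t)
      (nhdsWithin 0 (Set.Ioi 0)) (nhds (regPart R χ 0)) := by
    simpa using hc2.tendsto.mono_left (nhdsWithin_le_nhds (s := Set.Ioi 0))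
  refine tendsto_nhds_unique h1 (h2.congr' ?_)
  filter_upwards [self_mem_nhdsWithin] with t ht
  have ht' : 0 < (t : ℂ).re := by simpa using ht
  rw [← roughL_of_ne_one hz hqz hR hχ ht', roughL,
    DirichletCharacter.LFunction_eq_LSeries _ (one_lt_re_one_add_div hl0 ht')]

end

/-- The statement that the prime Dirichlet series over the class `a` is `1/w - τ/(w+λ)` up to a
function which is bounded together with its derivative on the box. -/
def HasPolarForm (q : ℕ) [NeZero q] (z K lam τ : ℝ) (a : (ZMod q)ˣ) : Prop :=
  ∃ Ψ : ℂ → ℂ, (∀ w, Box w → DifferentiableAt ℂ Ψ w ∧ ‖Ψ w‖ ≤ K ∧ ‖deriv Ψ w‖ ≤ K) ∧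
    ∀ w, Box w → q.totient / Real.log z *
      LSeries (fun n => (roughLambda z a n : ℂ)) (1 + w / Real.log z) =
        1 / w - τ / (w + lam) + Ψ w

theorem exists_hasPolarForm : ∃ K ≥ 1, ∀ (q : ℕ) [NeZero q] (z : ℝ), 4 ≤ z → (q : ℝ) ^ 20 ≤ z →
    (∀ a, HasPolarForm q z K 0 0 a) ∨ ∃ χ₁ : DirichletCharacter ℂ q, χ₁ ≠ 1 ∧ χ₁ ^ 2 = 1 ∧
      ∃ lam, 0 ≤ lam ∧ ‖DirichletCharacter.LFunction (roughChar z χ₁) 1‖ ≤ K * lam ∧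
        ∀ (a : (ZMod q)ˣ) (τ : ℝ), (τ : ℂ) = χ₁ a → HasPolarForm q z K lam τ a := by
  obtain ⟨K, hK, HR⟩ := exists_isRegularPart
  obtain ⟨c, hc, H⟩ := exists_zero_free_box hK
  set K₂ := 128 * (6 * (1 + K)) with hK₂
  have hK₂0 : 1 ≤ K₂ := by rw [hK₂]; linarith
  set δ := min (1 / 32) (c / (64 * K₂)) with hδ
  have hδ0 : 0 < δ := by positivity
  have hδ1 : δ ≤ 1 / 32 := min_le_left _ _
  have hδ2 : 32 * K₂ * δ ≤ c / 2 := by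
    calc 32 * K₂ * δ ≤ 32 * K₂ * (c / (64 * K₂)) := by gcongr; exact min_le_right _ _
      _ = c / 2 := by field_simp; norm_num
  set C := 32 * K₂ / (c / 2) + 32 * K₂ / (c / 2) + (96 * K + ((32 * K) ^ 2 + K ^ 2) / (c / 2)) with hC
  have hC0 : 0 ≤ C := by positivity
  refine ⟨max (max 1 (32 * K₂)) (max C (C / δ)), (le_max_left _ _).trans (le_max_left _ _),
    fun q _ z hz hqz20 => ?_⟩
  have hqz : (q : ℝ) ≤ z := le_trans (by
    have : (1 : ℝ) ≤ q := by exact_mod_cast NeZero.one_le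
    simpa using pow_le_pow_right₀ this (show 1 ≤ 20 by norm_num)) hqz20
  obtain ⟨R, hR⟩ := HR q z hz hqz20
  obtain ⟨hprin, hdich⟩ := H q z R hz hqz hR
  have hKn : 0 ≤ K := by linarith
  have tameP : Tame K₂ (principalPart z R) :=
    (tame_principalPart hz hKn hR).mono (by rw [hK₂]; linarith)
  have tameχ : ∀ χ, Tame K₂ (regPart R χ) := fun χ =>
    (tame_regPart hR χ).mono (by rw [hK₂]; linarith)
  have hnear : ∀ f : ℂ → ℂ, Tame K₂ f → (∀ w, Box w → c ≤ ‖f w‖) → ∀ w, Box w →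
      ∀ u ∈ Metric.closedBall w δ, c / 2 ≤ ‖f u‖ := fun f hf hcf w hw u hu =>
    hf.half_le_norm (by linarith) hδ1 hδ2 hw hu (hcf w hw)
  have hlog : ∀ f : ℂ → ℂ, Tame K₂ f → (∀ w, Box w → c ≤ ‖f w‖) → ∀ w, Box w →
      ∀ u ∈ Metric.closedBall w δ, DifferentiableAt ℂ (logDeriv f) u ∧
        ‖logDeriv f u‖ ≤ 32 * K₂ / (c / 2) := by
    intro f hf hcf w hw u hu
    obtain ⟨h1, h2⟩ := region_of_near_box hδ1 hw hu
    have h3 := hnear f hf hcf w hw u hu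
    refine ⟨hf.differentiableAt_logDeriv (by linarith) ?_, hf.norm_logDeriv_le (by positivity) h1 h2 h3⟩
    exact norm_pos_iff.1 (lt_of_lt_of_le (by positivity) h3)
  have hself : ∀ w : ℂ, w ∈ Metric.closedBall w δ := fun w => Metric.mem_closedBall_self hδ0.le
  have finish : ∀ (a : (ZMod q)ˣ) (lam τ : ℝ) (Ψ : ℂ → ℂ),
      (∀ w, Box w → ∀ u ∈ Metric.closedBall w δ, DifferentiableAt ℂ Ψ u ∧ ‖Ψ u‖ ≤ C) →
      (∀ w, Box w → ∑ χ : DirichletCharacter ℂ q, starRingEnd ℂ (χ a) * -logDeriv (roughL z χ) w =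
        1 / w - τ / (w + lam) + Ψ w) →
      HasPolarForm q z (max (max 1 (32 * K₂)) (max C (C / δ))) lam τ a := by
    intro a lam τ Ψ hΨ hid
    refine ⟨Ψ, fun w hw => ⟨(hΨ w hw w (hself w)).1, ?_, ?_⟩, fun w hw => ?_⟩
    · exact (hΨ w hw w (hself w)).2.trans ((le_max_left _ _).trans (le_max_right _ _))
    · exact (norm_deriv_le_of_near_box hδ0 (hΨ w hw)).trans
        ((le_max_right _ _).trans (le_max_right _ _))
    · rw [← sum_conj_mul_logDeriv_roughL hz hqz a hw.1, hid w hw]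
  have hsumT : ∀ (T U : Finset (DirichletCharacter ℂ q)) (hTU : Disjoint T U)
      (hun : T.disjUnion U hTU = univ) (hU : #U ≤ 2)
      (hT : ∀ χ ∈ T, ∀ w, Box w → c ≤ ‖regPart R χ w‖) (a : (ZMod q)ˣ),
      ∀ w, Box w → ∀ u ∈ Metric.closedBall w δ,
        DifferentiableAt ℂ (fun u => ∑ χ ∈ T, starRingEnd ℂ (χ a) * logDeriv (regPart R χ) u) u ∧
        ‖∑ χ ∈ T, starRingEnd ℂ (χ a) * logDeriv (regPart R χ) u‖ ≤
          96 * K + ((32 * K) ^ 2 + K ^ 2) / (c / 2) := by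
    intro T U hTU hun hU hT a w hw u hu
    obtain ⟨h1, h2⟩ := region_of_near_box hδ1 hw hu
    refine ⟨DifferentiableAt.fun_sum fun χ hχ => ?_, norm_sum_logDeriv_regPart_le hKn hR
      (by positivity) h1 h2 T U hTU hun hU
      (fun χ hχ => hnear _ (tameχ χ) (hT χ hχ) w hw u hu) a⟩
    exact ((hlog _ (tameχ χ) (hT χ hχ) w hw u hu).1).const_mul _
  have hone : ∀ a : (ZMod q)ˣ, starRingEnd ℂ ((1 : DirichletCharacter ℂ q) a) = 1 := fun a => by
    rw [MulChar.one_apply_coe, map_one]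
  have hprin0 : ∀ w, Box w → principalPart z R w ≠ 0 := fun w hw =>
    norm_pos_iff.1 (hc.trans_le (hprin w hw))
  rcases hdich with hno | ⟨χ₁, hχ₁, hχ₁2, lam, hl0, hl1, hzero, hT, hlow, hrest⟩
  · refine Or.inl fun a => finish a 0 0 (fun u => -logDeriv (principalPart z R) u -
      ∑ χ ∈ univ.erase 1, starRingEnd ℂ (χ a) * logDeriv (regPart R χ) u) ?_ ?_
    · intro w hw u hu
      have h1 := hlog _ tameP hprin w hw u hu
      have h2 := hsumT (univ.erase 1) {1} (by simp) (by ext; simp) (by simp)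
        (fun χ hχ => hno χ (ne_of_mem_erase hχ)) a w hw u hu
      refine ⟨h1.1.neg.sub h2.1, (norm_sub_le _ _).trans ?_⟩
      rw [norm_neg]
      have : 0 ≤ 32 * K₂ / (c / 2) := by positivity
      linarith [h1.2, h2.2]
    · intro w hw
      rw [← add_sum_erase univ _ (mem_univ 1), hone,
        logDeriv_roughL_one hz hqz hKn hR hw.1 (hprin0 w hw)]
      have : ∑ χ ∈ (univ : Finset (DirichletCharacter ℂ q)).erase 1, starRingEnd ℂ (χ a) * -logDeriv (roughL z χ) w =
          -∑ χ ∈ univ.erase 1, starRingEnd ℂ (χ a) * logDeriv (regPart R χ) w := by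
        rw [← sum_neg_distrib]
        refine sum_congr rfl fun χ hχ => ?_
        rw [logDeriv_roughL_of_ne_one hz hqz hR (ne_of_mem_erase hχ) hw.1]; ring
      rw [this]; push_cast; ring
  · refine Or.inr ⟨χ₁, hχ₁, hχ₁2, lam, hl0, ?_, fun a τ hτ => finish a lam τ
      (fun u => -logDeriv (principalPart z R) u -
        τ * logDeriv (dslope (regPart R χ₁) (-lam : ℝ)) u -
        ∑ χ ∈ (univ.erase 1).erase χ₁, starRingEnd ℂ (χ a) * logDeriv (regPart R χ) u) ?_ ?_⟩
    · rw [LFunction_roughChar_one hz hqz hR hχ₁]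
      have h := (tameχ χ₁).norm_sub_le (w := 0) (u := (-lam : ℝ)) (by norm_num) (by norm_num)
        (by simp; linarith) (by
          rw [Complex.norm_real, norm_neg, Real.norm_of_nonneg hl0]; linarith)
      rw [hzero, sub_zero, zero_sub, norm_neg, Complex.norm_real, norm_neg,
        Real.norm_of_nonneg hl0] at h
      exact h.trans (by gcongr; exact (le_max_right _ _).trans (le_max_left _ _))
    · intro w hw u hu
      have h1 := hlog _ tameP hprin w hw u hu
      have h2 := hsumT ((univ.erase 1).erase χ₁) {1, χ₁} (by simp)
        (by ext χ; simp; tauto) (card_le_two)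
        (fun χ hχ => hrest χ (ne_of_mem_erase (mem_of_mem_erase hχ)) (ne_of_mem_erase hχ)) a w hw u hu
      have h3 := hlog _ hT hlow w hw u hu
      have hτ1 : ‖(τ : ℂ)‖ = 1 := by rw [hτ, χ₁.unit_norm_eq_one]
      refine ⟨(h1.1.neg.sub (h3.1.const_mul _)).sub h2.1, (norm_sub_le _ _).trans ?_⟩
      have h4 := norm_sub_le (-logDeriv (principalPart z R) u)
        (τ * logDeriv (dslope (regPart R χ₁) (-lam : ℝ)) u)
      rw [norm_neg, norm_mul, hτ1, one_mul] at h4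
      linarith [h1.2, h2.2, h3.2]
    · intro w hw
      have hχ₁mem : χ₁ ∈ (univ : Finset (DirichletCharacter ℂ q)).erase 1 :=
        mem_erase.2 ⟨hχ₁, mem_univ _⟩
      have hconj : starRingEnd ℂ (χ₁ a) = τ := by rw [← hτ, Complex.conj_ofReal]
      rw [← add_sum_erase univ _ (mem_univ 1), hone, ← add_sum_erase _ _ hχ₁mem, hconj,
        logDeriv_roughL_one hz hqz hKn hR hw.1 (hprin0 w hw),
        logDeriv_roughL_of_ne_one hz hqz hR hχ₁ hw.1,
        logDeriv_regPart_of_zero hl0 hzero hT hw.1 (norm_pos_iff.1 (hc.trans_le (hlow w hw)))]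
      have : ∑ χ ∈ ((univ : Finset (DirichletCharacter ℂ q)).erase 1).erase χ₁, starRingEnd ℂ (χ a) * -logDeriv (roughL z χ) w =
          -∑ χ ∈ (univ.erase 1).erase χ₁, starRingEnd ℂ (χ a) * logDeriv (regPart R χ) w := by
        rw [← sum_neg_distrib]
        refine sum_congr rfl fun χ hχ => ?_
        rw [logDeriv_roughL_of_ne_one hz hqz hR (ne_of_mem_erase (mem_of_mem_erase hχ)) hw.1]; ring
      rw [this]; ring

end Linnik

namespace Linnik

open Finset MeasureTheory

/-- The Fejér-type kernel `(2 (1 - cos v)) / v ^ 2`. -/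
noncomputable def fejer (v : ℝ) : ℝ := ∫ t in (0 : ℝ)..1, 2 * (1 - t) * Real.cos (t * v)

theorem sq_mul_fejer (v : ℝ) : v ^ 2 * fejer v = 2 * (1 - Real.cos v) := by
  have hd : ∀ t : ℝ, HasDerivAt
      (fun t => 2 * (1 - t) * v * Real.sin (t * v) - 2 * Real.cos (t * v))
      (v ^ 2 * (2 * (1 - t) * Real.cos (t * v))) t := by
    intro t
    have hl : HasDerivAt (fun t : ℝ => t * v) v t := by
      simpa using (hasDerivAt_id t).mul_const v
    have h1 : HasDerivAt (fun t : ℝ => 2 * (1 - t) * v) (-2 * v) t := by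
      have := (((hasDerivAt_id t).const_sub 1).const_mul 2).mul_const v
      simpa using this
    exact ((h1.mul hl.sin).sub (hl.cos.const_mul 2)).congr_deriv (by ring)
  rw [fejer, ← intervalIntegral.integral_const_mul,
    intervalIntegral.integral_eq_sub_of_hasDerivAt (fun t _ => hd t)
      (Continuous.intervalIntegrable (by fun_prop) _ _)]
  simp
  ring

theorem integral_two_mul_one_sub (c : ℝ) : ∫ t in (0 : ℝ)..1, 2 * (1 - t) * c = c := by
  have hd : ∀ t : ℝ, HasDerivAt (fun t => (2 * t - t ^ 2) * c) (2 * (1 - t) * c) t := by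
    intro t
    exact ((((hasDerivAt_id t).const_mul 2).sub (hasDerivAt_pow 2 t)).mul_const c).congr_deriv
      (by norm_num; left; ring)
  rw [intervalIntegral.integral_eq_sub_of_hasDerivAt (fun t _ => hd t)
      (Continuous.intervalIntegrable (by fun_prop) _ _)]
  norm_num

theorem fejer_le_one (v : ℝ) : fejer v ≤ 1 := by
  rw [← integral_two_mul_one_sub 1]
  refine intervalIntegral.integral_mono_on zero_le_one
    (Continuous.intervalIntegrable (by fun_prop) _ _)
    (Continuous.intervalIntegrable (by fun_prop) _ _) fun t ht => ?_
  exact mul_le_mul_of_nonneg_left (Real.cos_le_one _) (by linarith [ht.2])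

theorem half_le_fejer {v : ℝ} (hv : |v| ≤ 1) : 1 / 2 ≤ fejer v := by
  rw [← integral_two_mul_one_sub (1 / 2)]
  refine intervalIntegral.integral_mono_on zero_le_one
    (Continuous.intervalIntegrable (by fun_prop) _ _)
    (Continuous.intervalIntegrable (by fun_prop) _ _) fun t ht => ?_
  refine mul_le_mul_of_nonneg_left ?_ (by linarith [ht.2])
  have h1 : (t * v) ^ 2 ≤ 1 := by
    rw [sq_le_one_iff_abs_le_one, abs_mul, abs_of_nonneg ht.1]
    exact mul_le_one₀ ht.2 (abs_nonneg v) hv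
  linarith [Real.one_sub_sq_div_two_le_cos (x := t * v)]

theorem fejer_nonneg (v : ℝ) : 0 ≤ fejer v := by
  by_cases hv : v = 0
  · linarith [half_le_fejer (v := v) (by simp [hv])]
  · refine nonneg_of_mul_nonneg_right (a := v ^ 2) ?_ (by positivity)
    rw [sq_mul_fejer]; linarith [Real.cos_le_one v]

theorem sq_mul_fejer_le (v : ℝ) : v ^ 2 * fejer v ≤ 4 := by
  rw [sq_mul_fejer]; linarith [Real.neg_one_le_cos v]

theorem fejer_le (v : ℝ) : fejer v ≤ 5 * (1 + v ^ 2)⁻¹ := by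
  rw [← div_eq_mul_inv, le_div_iff₀ (by positivity)]
  linarith [sq_mul_fejer_le v, fejer_le_one v]

theorem continuous_fejer : Continuous fejer := by
  refine intervalIntegral.continuous_parametric_intervalIntegral_of_continuous'
    (f := fun v t => 2 * (1 - t) * Real.cos (t * v)) ?_ 0 1
  fun_prop

/-- The pairing of a function with the Fourier transform of the kernel centred at `Y`. -/
noncomputable def fejerPair (Y : ℝ) (f : ℝ → ℂ) : ℂ :=
  ∫ t in (0 : ℝ)..1, 2 * (1 - t) * Complex.exp (t * Y * Complex.I) * f t

theorem norm_weight_le {Y t : ℝ} (h0 : 0 ≤ t) (h1 : t ≤ 1) :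
    ‖2 * (1 - t) * Complex.exp (t * Y * Complex.I)‖ ≤ 2 := by
  rw [norm_mul, ← Complex.ofReal_mul, Complex.norm_exp_ofReal_mul_I, mul_one]
  have : (2 * (1 - t) : ℂ) = ((2 * (1 - t) : ℝ) : ℂ) := by push_cast; ring
  rw [this, Complex.norm_real, Real.norm_of_nonneg (by linarith)]
  linarith

theorem norm_fejerPair_le {Y K : ℝ} {f : ℝ → ℂ}
    (hf : ∀ t, 0 ≤ t → t ≤ 1 → ‖f t‖ ≤ K) : ‖fejerPair Y f‖ ≤ 2 * K := by
  have := intervalIntegral.norm_integral_le_of_norm_le_const (a := (0 : ℝ)) (b := 1) (C := 2 * K)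
    (f := fun t : ℝ => 2 * (1 - t) * Complex.exp (t * Y * Complex.I) * f t) fun t ht => by
      rw [Set.uIoc_of_le zero_le_one] at ht
      rw [norm_mul]
      exact mul_le_mul (norm_weight_le ht.1.le ht.2) (hf t ht.1.le ht.2) (norm_nonneg _) (by norm_num)
  simpa [fejerPair] using this

theorem norm_exp_shift (w t u : ℝ) :
    ‖Complex.exp (-(w + t * Complex.I) * u)‖ = Real.exp (-w * u) := by
  rw [Complex.norm_exp]; congr 1; simp

theorem re_fejerPair_exp (Y w u : ℝ) :
    (fejerPair Y fun t => Complex.exp (-(w + t * Complex.I) * u)).re =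
      Real.exp (-w * u) * fejer (u - Y) := by
  rw [fejerPair, fejer, ← intervalIntegral.integral_const_mul]
  have hi : IntervalIntegrable (fun t : ℝ => 2 * (1 - (t : ℂ)) * Complex.exp (t * Y * Complex.I) *
      Complex.exp (-(w + t * Complex.I) * u)) volume 0 1 :=
    Continuous.intervalIntegrable (by fun_prop) _ _
  have := Complex.reCLM.intervalIntegral_comp_comm hi
  simp only [Complex.reCLM_apply] at this
  rw [← this]
  refine intervalIntegral.integral_congr fun t _ => ?_
  have e : 2 * (1 - (t : ℂ)) * Complex.exp (t * Y * Complex.I) *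
      Complex.exp (-(w + t * Complex.I) * u) =
      ((2 * (1 - t) : ℝ) : ℂ) * Complex.exp (-w * u + (-(t * (u - Y))) * Complex.I) := by
    rw [mul_assoc, ← Complex.exp_add]
    push_cast
    congr 2; ring
  rw [e, Complex.re_ofReal_mul, Complex.exp_re]
  simp
  ring

theorem hasSum_fejerPair {M u : ℕ → ℝ} (hM : ∀ n, 0 ≤ M n) {w : ℝ}
    (hs : Summable fun n => M n * Real.exp (-w * u n)) (Y : ℝ) :
    HasSum (fun n => M n * (Real.exp (-w * u n) * fejer (u n - Y)))
      (fejerPair Y fun t => ∑' n, M n * Complex.exp (-(w + t * Complex.I) * u n)).re := by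
  have h : HasSum (fun n => ∫ t in (0 : ℝ)..1, 2 * (1 - t) * Complex.exp (t * Y * Complex.I) *
      (M n * Complex.exp (-(w + t * Complex.I) * u n)))
      (fejerPair Y fun t => ∑' n, M n * Complex.exp (-(w + t * Complex.I) * u n)) := by
    have hb : ∀ n (t : ℝ), 0 ≤ t → t ≤ 1 → ‖2 * (1 - t) * Complex.exp (t * Y * Complex.I) *
        (M n * Complex.exp (-(w + t * Complex.I) * u n))‖ ≤ 2 * (M n * Real.exp (-w * u n)) := by
      intro n t h0 h1
      rw [norm_mul, norm_mul (M n : ℂ), norm_exp_shift, Complex.norm_real,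
        Real.norm_of_nonneg (hM n)]
      exact mul_le_mul_of_nonneg_right (norm_weight_le h0 h1)
        (mul_nonneg (hM n) (Real.exp_pos _).le)
    refine intervalIntegral.hasSum_integral_of_dominated_convergence
      (fun n _ => 2 * (M n * Real.exp (-w * u n)))
      (fun n => Continuous.aestronglyMeasurable (by fun_prop)) ?_ ?_ ?_ ?_
    · refine fun n => Filter.Eventually.of_forall fun t ht => ?_
      rw [Set.uIoc_of_le zero_le_one] at ht
      exact hb n t ht.1.le ht.2
    · exact Filter.Eventually.of_forall fun t _ => hs.mul_left 2
    · simp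
    · refine Filter.Eventually.of_forall fun t ht => ?_
      refine HasSum.mul_left _ (Summable.hasSum (Summable.of_norm_bounded hs fun n => ?_))
      rw [norm_mul, norm_exp_shift, Complex.norm_real, Real.norm_of_nonneg (hM n)]
  have h2 := Complex.hasSum_re h
  convert h2 using 2 with n
  have e : (∫ t in (0 : ℝ)..1, 2 * (1 - t) * Complex.exp (t * Y * Complex.I) *
      (M n * Complex.exp (-(w + t * Complex.I) * u n))) =
      (M n : ℂ) * fejerPair Y fun t => Complex.exp (-(w + t * Complex.I) * u n) := by
    rw [fejerPair, ← intervalIntegral.integral_const_mul]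
    refine intervalIntegral.integral_congr fun t _ => ?_
    ring
  rw [e, Complex.re_ofReal_mul, re_fejerPair_exp]

theorem re_fejerPair_inv {β : ℝ} (hβ : 0 < β) (Y : ℝ) :
    (fejerPair Y fun t => 1 / (β + t * Complex.I)).re =
      ∫ v in Set.Ioi (0 : ℝ), Real.exp (-β * v) * fejer (v - Y) := by
  have hL : ∀ t : ℝ, 1 / (β + t * Complex.I) =
      ∫ v : ℝ in Set.Ioi (0 : ℝ), Complex.exp (-(β + t * Complex.I) * v) := by
    intro t
    rw [integral_exp_mul_complex_Ioi (by simpa using hβ), Complex.ofReal_zero, mul_zero,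
      Complex.exp_zero, neg_div_neg_eq]
  have hprod : Integrable (Function.uncurry fun t v : ℝ =>
      2 * (1 - (t : ℂ)) * Complex.exp (t * Y * Complex.I) *
        Complex.exp (-(β + t * Complex.I) * v))
      ((volume.restrict (Set.uIoc 0 1)).prod (volume.restrict (Set.Ioi 0))) := by
    have h1 : Integrable (fun t : ℝ => (2 : ℝ)) (volume.restrict (Set.uIoc (0 : ℝ) 1)) := by
      rw [Set.uIoc_of_le zero_le_one]; exact integrable_const _
    have h2 : Integrable (fun v : ℝ => Real.exp (-β * v)) (volume.restrict (Set.Ioi 0)) :=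
      exp_neg_integrableOn_Ioi 0 hβ
    refine (h1.mul_prod h2).mono' (Continuous.aestronglyMeasurable (by fun_prop)) ?_
    rw [Measure.prod_restrict]
    refine (ae_restrict_iff' (measurableSet_uIoc.prod measurableSet_Ioi)).2
      (Filter.Eventually.of_forall ?_)
    rintro ⟨t, v⟩ ⟨ht, -⟩
    simp only [Set.uIoc_of_le zero_le_one, Set.mem_Ioc] at ht
    simp only [Function.uncurry]
    rw [norm_mul, norm_exp_shift]
    exact mul_le_mul_of_nonneg_right (norm_weight_le ht.1.le ht.2) (Real.exp_pos _).le
  have hsw := intervalIntegral_integral_swap hprod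
  have e1 : fejerPair Y (fun t => 1 / (β + t * Complex.I)) =
      ∫ v in Set.Ioi (0 : ℝ), fejerPair Y fun t => Complex.exp (-(β + t * Complex.I) * v) := by
    rw [fejerPair]
    simp only [fejerPair]
    rw [← hsw]
    refine intervalIntegral.integral_congr fun t _ => ?_
    rw [hL, integral_const_mul]
  rw [e1]
  have hi : Integrable (fun v : ℝ => fejerPair Y fun t => Complex.exp (-(β + t * Complex.I) * v))
      (volume.restrict (Set.Ioi 0)) := by
    have := hprod.integral_prod_right
    refine this.congr (Filter.Eventually.of_forall fun v => ?_)
    simp only [fejerPair, Function.uncurry]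
    rw [intervalIntegral.integral_of_le zero_le_one, Set.uIoc_of_le zero_le_one]
  have := Complex.reCLM.integral_comp_comm hi
  simp only [Complex.reCLM_apply] at this
  rw [← this]
  refine integral_congr_ae (Filter.Eventually.of_forall fun v => ?_)
  exact re_fejerPair_exp Y β v

theorem integrable_exp_mul_fejer {β : ℝ} (hβ : 0 ≤ β) (Y : ℝ) :
    IntegrableOn (fun v => Real.exp (-β * v) * fejer (v - Y)) (Set.Ioi 0) := by
  have h1 : Integrable (fun v : ℝ => 5 * (1 + (v - Y) ^ 2)⁻¹) :=
    (integrable_inv_one_add_sq.comp_sub_right Y).const_mul 5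
  refine h1.integrableOn.mono' ?_ ?_
  · have := continuous_fejer
    exact Continuous.aestronglyMeasurable (by fun_prop)
  · refine (ae_restrict_iff' measurableSet_Ioi).2 (Filter.Eventually.of_forall fun v hv => ?_)
    rw [norm_mul, Real.norm_of_nonneg (Real.exp_pos _).le, Real.norm_of_nonneg (fejer_nonneg _)]
    have : Real.exp (-β * v) ≤ 1 := Real.exp_le_one_iff.2 (by
      have : 0 < v := hv
      nlinarith)
    exact (mul_le_of_le_one_left (fejer_nonneg _) this).trans (fejer_le _)

theorem abs_re_fejerPair_inv_le {β : ℝ} (hβ : 0 < β) (Y : ℝ) :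
    |(fejerPair Y fun t => 1 / (β + t * Complex.I)).re| ≤ 20 := by
  rw [re_fejerPair_inv hβ]
  have h1 : Integrable (fun v : ℝ => 5 * (1 + (v - Y) ^ 2)⁻¹) :=
    (integrable_inv_one_add_sq.comp_sub_right Y).const_mul 5
  rw [abs_of_nonneg (integral_nonneg fun v => mul_nonneg (Real.exp_pos _).le (fejer_nonneg _))]
  calc ∫ v in Set.Ioi (0 : ℝ), Real.exp (-β * v) * fejer (v - Y)
      ≤ ∫ v in Set.Ioi (0 : ℝ), 5 * (1 + (v - Y) ^ 2)⁻¹ := by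
        refine setIntegral_mono_on (integrable_exp_mul_fejer hβ.le Y) h1.integrableOn
          measurableSet_Ioi fun v hv => ?_
        have : Real.exp (-β * v) ≤ 1 := Real.exp_le_one_iff.2 (by
          have : 0 < v := hv
          nlinarith)
        exact (mul_le_of_le_one_left (fejer_nonneg _) this).trans (fejer_le _)
    _ ≤ ∫ v, 5 * (1 + (v - Y) ^ 2)⁻¹ := by
        refine setIntegral_le_integral h1 (Filter.Eventually.of_forall fun v => ?_)
        simp only [Pi.zero_apply]; positivity
    _ = 5 * Real.pi := by
        rw [integral_const_mul, integral_sub_right_eq_self (fun v : ℝ => (1 + v ^ 2)⁻¹) Y,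
          integral_univ_inv_one_add_sq]
    _ ≤ 20 := by linarith [Real.pi_le_four]

theorem norm_fejerPair_le_of_hasDerivAt {X K : ℝ} (hX : 0 < X) {g : ℝ → ℂ}
    (hg : ∀ t, 0 ≤ t → t ≤ 1 → DifferentiableAt ℝ g t ∧ ‖g t‖ ≤ K ∧ ‖deriv g t‖ ≤ K) :
    ‖fejerPair X g‖ ≤ 6 * K / X := by
  have hK : 0 ≤ K := (norm_nonneg _).trans (hg 0 le_rfl zero_le_one).2.1
  have hXI : (X : ℂ) * Complex.I ≠ 0 := by simp [hX.ne']
  set u : ℝ → ℂ := fun t => 2 * (1 - t) * g t with hu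
  set u' : ℝ → ℂ := fun t => -2 * g t + 2 * (1 - t) * deriv g t with hu'
  set v : ℝ → ℂ := fun t => Complex.exp (t * X * Complex.I) / (X * Complex.I) with hv
  have hud : ∀ t ∈ Set.uIcc (0 : ℝ) 1, HasDerivAt u (u' t) t := by
    intro t ht
    rw [Set.uIcc_of_le zero_le_one] at ht
    have h1 : HasDerivAt (fun t : ℝ => 2 * (1 - (t : ℂ))) (-2) t := by
      have := (((hasDerivAt_id t).ofReal_comp).const_sub 1).const_mul (2 : ℂ)
      simpa using this
    exact h1.mul (hg t ht.1 ht.2).1.hasDerivAt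
  have hvd : ∀ t ∈ Set.uIcc (0 : ℝ) 1, HasDerivAt v (Complex.exp (t * X * Complex.I)) t := by
    intro t _
    have h1 : HasDerivAt (fun t : ℝ => (t : ℂ) * X * Complex.I) (X * Complex.I) t := by
      have := (((hasDerivAt_id t).ofReal_comp).mul_const (X : ℂ)).mul_const Complex.I
      simpa using this
    have := h1.cexp.div_const (X * Complex.I)
    rwa [mul_div_cancel_right₀ _ hXI] at this
  have hub : ∀ t, 0 ≤ t → t ≤ 1 → ‖u' t‖ ≤ 4 * K := by
    intro t h0 h1
    have e : ‖(2 * (1 - t) : ℂ)‖ = 2 * (1 - t) := by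
      rw [show (2 * (1 - t) : ℂ) = ((2 * (1 - t) : ℝ) : ℂ) by push_cast; ring, Complex.norm_real,
        Real.norm_of_nonneg (by linarith)]
    have h2 := norm_add_le (-2 * g t) (2 * (1 - t) * deriv g t)
    rw [norm_mul, norm_mul _ (deriv g t), e, norm_neg, Complex.norm_two] at h2
    have h3 : 2 * (1 - t) * ‖deriv g t‖ ≤ 2 * K :=
      mul_le_mul (by linarith) (hg t h0 h1).2.2 (norm_nonneg _) (by norm_num)
    have h4 := (hg t h0 h1).2.1
    linarith
  have hvn : ∀ t, ‖v t‖ = 1 / X := by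
    intro t
    simp only [hv, norm_div, norm_mul, Complex.norm_I, Complex.norm_real, mul_one]
    rw [← Complex.ofReal_mul, Complex.norm_exp_ofReal_mul_I, Real.norm_of_nonneg hX.le]
  have hui : IntervalIntegrable u' volume 0 1 := by
    rw [intervalIntegrable_iff_integrableOn_Ioc_of_le zero_le_one]
    have hm : AEStronglyMeasurable u' (volume.restrict (Set.Ioc 0 1)) := by
      have hc : ContinuousOn g (Set.Icc 0 1) := fun t ht =>
        (hg t ht.1 ht.2).1.continuousAt.continuousWithinAt
      have h1 : AEStronglyMeasurable g (volume.restrict (Set.Ioc (0 : ℝ) 1)) :=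
        (hc.mono Set.Ioc_subset_Icc_self).aestronglyMeasurable measurableSet_Ioc
      have h2 : AEStronglyMeasurable (deriv g) (volume.restrict (Set.Ioc (0 : ℝ) 1)) :=
        (measurable_deriv g).aestronglyMeasurable
      have h3 : Continuous fun t : ℝ => (2 * (1 - t) : ℂ) := by fun_prop
      exact (h1.const_mul (-2)).add (h3.aestronglyMeasurable.mul h2)
    refine Integrable.of_bound hm (4 * K) ?_
    refine (ae_restrict_iff' measurableSet_Ioc).2 (Filter.Eventually.of_forall fun t ht => ?_)
    exact hub t ht.1.le ht.2
  have key := intervalIntegral.integral_mul_deriv_eq_deriv_mul hud hvd hui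
    (Continuous.intervalIntegrable (by fun_prop) _ _)
  have e : fejerPair X g = ∫ t in (0 : ℝ)..1, u t * Complex.exp (t * X * Complex.I) := by
    rw [fejerPair]
    refine intervalIntegral.integral_congr fun t _ => ?_
    simp only [hu]; ring
  have hb : ‖∫ t in (0 : ℝ)..1, u' t * v t‖ ≤ 4 * K * (1 / X) := by
    have := intervalIntegral.norm_integral_le_of_norm_le_const (a := (0 : ℝ)) (b := 1)
      (C := 4 * K * (1 / X)) (f := fun t => u' t * v t) fun t ht => by
        rw [Set.uIoc_of_le zero_le_one] at ht
        rw [norm_mul, hvn]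
        exact mul_le_mul_of_nonneg_right (hub t ht.1.le ht.2) (by positivity)
    simpa using this
  have hu1 : u 1 = 0 := by simp [hu]
  have hu0 : ‖u 0‖ ≤ 2 * K := by
    simp only [hu]
    rw [norm_mul]
    simpa using (hg 0 le_rfl zero_le_one).2.1
  rw [e, key, hu1, zero_mul, zero_sub]
  refine (norm_sub_le _ _).trans ?_
  rw [norm_neg, norm_mul, hvn]
  have : ‖u 0‖ * (1 / X) ≤ 2 * K * (1 / X) := mul_le_mul_of_nonneg_right hu0 (by positivity)
  have e2 : 6 * K / X = 2 * K * (1 / X) + 4 * K * (1 / X) := by ring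
  linarith

theorem sum_inv_sq_le {X D : ℝ} (hD : 1 < D) (J : Finset ℕ) (hJ : ∀ j ∈ J, D ≤ |(j : ℝ) - X|) :
    ∑ j ∈ J, 1 / ((j : ℝ) - X) ^ 2 ≤ 2 / (D - 1) := by
  set H : ℝ → ℝ := fun y => -(1 / (max y D - 1)) + 1 / max (-y) (D - 1) with hH
  have hD0 : 0 < D - 1 := by linarith
  have hmax1 : ∀ y, 0 < max y D - 1 := fun y => by linarith [le_max_right y D]
  have hmax2 : ∀ y, 0 < max (-y) (D - 1) := fun y => hD0.trans_le (le_max_right _ _)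
  have hmono1 : ∀ y, 1 / (max (y + 1) D - 1) ≤ 1 / (max y D - 1) := fun y =>
    one_div_le_one_div_of_le (hmax1 y) (by
      linarith [max_le_max_right D (show y ≤ y + 1 by linarith)])
  have hmono2 : ∀ y, 1 / max (-y) (D - 1) ≤ 1 / max (-(y + 1)) (D - 1) := fun y =>
    one_div_le_one_div_of_le (hmax2 _) (max_le_max_right _ (by linarith))
  have hstep : ∀ y, D ≤ |y| → 1 / y ^ 2 ≤ H (y + 1) - H y := by
    intro y hy
    rcases le_abs.1 hy with h | h
    · have e1 : 1 / (max y D - 1) = 1 / (y - 1) := by rw [max_eq_left h]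
      have e2 : 1 / (max (y + 1) D - 1) = 1 / y := by
        rw [max_eq_left (by linarith)]; congr 1; ring
      have hy0 : 0 < y - 1 := by linarith
      have hy1 : 0 < y := by linarith
      have e3 : 1 / (y - 1) - 1 / y - 1 / y ^ 2 = 1 / ((y - 1) * y ^ 2) := by
        field_simp; ring
      have : 0 ≤ 1 / ((y - 1) * y ^ 2) := by positivity
      simp only [hH]
      have := hmono2 y
      rw [e1, e2]; linarith
    · have e1 : 1 / max (-y) (D - 1) = 1 / (-y) := by rw [max_eq_left (by linarith)]
      have e2 : 1 / max (-(y + 1)) (D - 1) = 1 / (-y - 1) := by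
        rw [max_eq_left (by linarith)]; congr 1; ring
      have hy0 : 0 < -y - 1 := by linarith
      have hy1 : 0 < -y := by linarith
      have e3 : 1 / (-y - 1) - 1 / (-y) - 1 / y ^ 2 = 1 / ((-y - 1) * y ^ 2) := by
        have : y ≠ 0 := by linarith
        have : -y - 1 ≠ 0 := hy0.ne'
        field_simp; ring
      have : 0 ≤ 1 / ((-y - 1) * y ^ 2) := by positivity
      simp only [hH]
      have := hmono1 y
      rw [e1, e2]; linarith
  have hmono : ∀ y, 0 ≤ H (y + 1) - H y := fun y => by
    simp only [hH]; linarith [hmono1 y, hmono2 y]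
  obtain ⟨N, hN⟩ := J.exists_nat_subset_range
  calc ∑ j ∈ J, 1 / ((j : ℝ) - X) ^ 2 ≤ ∑ j ∈ J, (H ((j : ℝ) - X + 1) - H ((j : ℝ) - X)) :=
        sum_le_sum fun j hj => hstep _ (hJ j hj)
    _ ≤ ∑ j ∈ range N, (H ((j : ℝ) - X + 1) - H ((j : ℝ) - X)) :=
        sum_le_sum_of_subset_of_nonneg hN fun j _ _ => hmono _
    _ = H ((N : ℝ) - X) - H (((0 : ℕ) : ℝ) - X) := by
        rw [← Finset.sum_range_sub (fun j : ℕ => H ((j : ℝ) - X))]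
        refine sum_congr rfl fun j _ => ?_
        congr 2; push_cast; ring
    _ ≤ 2 / (D - 1) := by
        simp only [hH]
        have h1 : 0 ≤ 1 / (max ((N : ℝ) - X) D - 1) := (one_div_pos.2 (hmax1 _)).le
        have h2 : 1 / max (-((N : ℝ) - X)) (D - 1) ≤ 1 / (D - 1) :=
          one_div_le_one_div_of_le hD0 (le_max_right _ _)
        have h3 : 1 / (max (((0 : ℕ) : ℝ) - X) D - 1) ≤ 1 / (D - 1) :=
          one_div_le_one_div_of_le hD0 (by linarith [le_max_right (((0 : ℕ) : ℝ) - X) D])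
        have h4 : 0 ≤ 1 / max (-(((0 : ℕ) : ℝ) - X)) (D - 1) := (one_div_pos.2 (hmax2 _)).le
        have e : 2 / (D - 1) = 1 / (D - 1) + 1 / (D - 1) := by ring
        linarith

/-- A Dirichlet series with nonnegative coefficients `M n` and frequencies `u n` whose sum
continues to a box with explicit polar part `1 / w - τ / (w + lam)`. -/
structure IsPolarSeries (M u : ℕ → ℝ) (K lam τ : ℝ) : Prop where
  coeff_nonneg : ∀ n, 0 ≤ M n
  freq_nonneg : ∀ n, 0 ≤ u n
  lam_nonneg : 0 ≤ lam
  abs_le_one : |τ| ≤ 1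
  summable : ∀ σ : ℝ, 0 < σ → Summable fun n => M n * Real.exp (-σ * u n)
  polar : ∃ Ψ : ℂ → ℂ,
    (∀ w, Box w → DifferentiableAt ℂ Ψ w ∧ ‖Ψ w‖ ≤ K ∧ ‖deriv Ψ w‖ ≤ K) ∧
    ∀ w, Box w → ∑' n, (M n : ℂ) * Complex.exp (-w * u n) = 1 / w - τ / (w + lam) + Ψ w

theorem fejerPair_add {Y : ℝ} {f g : ℝ → ℂ} (hf : ContinuousOn f (Set.Icc 0 1))
    (hg : ContinuousOn g (Set.Icc 0 1)) :
    fejerPair Y (fun t => f t + g t) = fejerPair Y f + fejerPair Y g := by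
  have h : ∀ f : ℝ → ℂ, ContinuousOn f (Set.Icc 0 1) → IntervalIntegrable
      (fun t : ℝ => 2 * (1 - (t : ℂ)) * Complex.exp (t * Y * Complex.I) * f t) volume 0 1 := by
    intro f hf
    refine ContinuousOn.intervalIntegrable ?_
    rw [Set.uIcc_of_le zero_le_one]
    exact (Continuous.continuousOn (by fun_prop)).mul hf
  simp only [fejerPair, mul_add]
  exact intervalIntegral.integral_add (h f hf) (h g hg)

theorem fejerPair_const_mul (Y : ℝ) (c : ℂ) (f : ℝ → ℂ) :
    fejerPair Y (fun t => c * f t) = c * fejerPair Y f := by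
  simp only [fejerPair]
  rw [← intervalIntegral.integral_const_mul]
  refine intervalIntegral.integral_congr fun t _ => ?_
  ring

theorem continuousOn_inv_shift {β : ℝ} (hβ : 0 < β) :
    Continuous fun t : ℝ => 1 / ((β : ℂ) + t * Complex.I) := by
  refine continuous_const.div (by fun_prop) fun t h => ?_
  have := congrArg Complex.re h
  simp at this
  exact hβ.ne' this

theorem IsPolarSeries.exists_hasSum {M u : ℕ → ℝ} {K lam τ : ℝ} (h : IsPolarSeries M u K lam τ)
    {w : ℝ} (hw : 0 < w) (hw1 : w ≤ 1) :
    ∃ g : ℝ → ℂ, (∀ t, 0 ≤ t → t ≤ 1 → DifferentiableAt ℝ g t ∧ ‖g t‖ ≤ K ∧ ‖deriv g t‖ ≤ K) ∧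
      ∀ Y, HasSum (fun n => M n * (Real.exp (-w * u n) * fejer (u n - Y)))
        ((fejerPair Y fun t => 1 / (w + t * Complex.I)).re -
          τ * (fejerPair Y fun t => 1 / ((w + lam : ℝ) + t * Complex.I)).re +
          (fejerPair Y g).re) := by
  obtain ⟨Ψ, hΨ, hP⟩ := h.polar
  have hbox : ∀ t : ℝ, 0 ≤ t → t ≤ 1 → Box (w + t * Complex.I) := fun t h0 h1 =>
    box_add_mul_I hw hw1 (abs_le.2 ⟨by linarith, h1⟩)
  have hlin : ∀ t : ℝ, HasDerivAt (fun t : ℝ => (w : ℂ) + t * Complex.I) Complex.I t := by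
    intro t
    have := (((hasDerivAt_id t).ofReal_comp).mul_const Complex.I).const_add (w : ℂ)
    simpa using this
  have hder : ∀ t : ℝ, 0 ≤ t → t ≤ 1 → HasDerivAt (fun t : ℝ => Ψ (w + t * Complex.I))
      (deriv Ψ (w + t * Complex.I) * Complex.I) t := fun t h0 h1 =>
    HasDerivAt.comp t (hΨ _ (hbox t h0 h1)).1.hasDerivAt (hlin t)
  have hg : ∀ t, 0 ≤ t → t ≤ 1 → DifferentiableAt ℝ (fun t : ℝ => Ψ (w + t * Complex.I)) t ∧
      ‖Ψ (w + t * Complex.I)‖ ≤ K ∧ ‖deriv (fun t : ℝ => Ψ (w + t * Complex.I)) t‖ ≤ K := by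
    intro t h0 h1
    refine ⟨(hder t h0 h1).differentiableAt, (hΨ _ (hbox t h0 h1)).2.1, ?_⟩
    rw [(hder t h0 h1).deriv, norm_mul, Complex.norm_I, mul_one]
    exact (hΨ _ (hbox t h0 h1)).2.2
  refine ⟨_, hg, fun Y => ?_⟩
  have hs := hasSum_fejerPair h.coeff_nonneg (h.summable w hw) Y
  have hwl : 0 < w + lam := by linarith [h.lam_nonneg]
  have hgc : ContinuousOn (fun t : ℝ => Ψ (w + t * Complex.I)) (Set.Icc 0 1) := fun t ht =>
    (hg t ht.1 ht.2).1.continuousAt.continuousWithinAt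
  have c1 := (continuousOn_inv_shift hw).continuousOn (s := Set.Icc 0 1)
  have c2 : ContinuousOn (fun t : ℝ => (-τ : ℂ) * (1 / ((w + lam : ℝ) + t * Complex.I)))
      (Set.Icc 0 1) := (continuous_const.mul (continuousOn_inv_shift hwl)).continuousOn
  have e : (fejerPair Y fun t => ∑' n, (M n : ℂ) * Complex.exp (-(w + t * Complex.I) * u n)) =
      fejerPair Y fun t => (1 / (w + t * Complex.I) +
        (-τ : ℂ) * (1 / ((w + lam : ℝ) + t * Complex.I))) + Ψ (w + t * Complex.I) := by
    refine intervalIntegral.integral_congr fun t ht => ?_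
    rw [Set.uIcc_of_le zero_le_one] at ht
    simp only []
    rw [hP _ (hbox t ht.1 ht.2)]
    congr 2
    push_cast
    rw [show (w : ℂ) + t * Complex.I + lam = w + lam + t * Complex.I by ring]
    ring
  have c3 : ContinuousOn (fun t : ℝ => 1 / ((w : ℂ) + t * Complex.I) +
      (-τ : ℂ) * (1 / ((w + lam : ℝ) + t * Complex.I))) (Set.Icc 0 1) := c1.add c2
  rw [e, fejerPair_add c3 hgc, fejerPair_add c1 c2, fejerPair_const_mul] at hs
  convert hs using 1
  simp [sub_eq_add_neg]

theorem IsPolarSeries.sum_window_le {M u : ℕ → ℝ} {K lam τ : ℝ} (h : IsPolarSeries M u K lam τ)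
    {w : ℝ} (hw : 0 < w) (hw1 : w ≤ 1) (Y : ℝ) (F : Finset ℕ) (hF : ∀ n ∈ F, |u n - Y| ≤ 1) :
    ∑ n ∈ F, M n * Real.exp (-w * u n) ≤ 80 + 4 * K := by
  obtain ⟨g, hg, hs⟩ := h.exists_hasSum hw hw1
  have hnn : ∀ n, 0 ≤ M n * (Real.exp (-w * u n) * fejer (u n - Y)) := fun n =>
    mul_nonneg (h.coeff_nonneg n) (mul_nonneg (Real.exp_pos _).le (fejer_nonneg _))
  have h1 := sum_le_hasSum F (fun n _ => hnn n) (hs Y)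
  have h2 := abs_le.1 (abs_re_fejerPair_inv_le hw Y)
  have h3 := abs_re_fejerPair_inv_le (β := w + lam) (by linarith [h.lam_nonneg]) Y
  have h4 : |τ * (fejerPair Y fun t => 1 / ((w + lam : ℝ) + t * Complex.I)).re| ≤ 1 * 20 := by
    rw [abs_mul]; exact mul_le_mul h.abs_le_one h3 (abs_nonneg _) zero_le_one
  have h5 := (Complex.re_le_norm _).trans (norm_fejerPair_le (Y := Y) fun t h0 h1 => (hg t h0 h1).2.1)
  have h6 : ∑ n ∈ F, M n * Real.exp (-w * u n) ≤
      2 * ∑ n ∈ F, M n * (Real.exp (-w * u n) * fejer (u n - Y)) := by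
    rw [mul_sum]
    refine sum_le_sum fun n hn => ?_
    have := half_le_fejer (hF n hn)
    have h0 : 0 ≤ M n * Real.exp (-w * u n) := mul_nonneg (h.coeff_nonneg n) (Real.exp_pos _).le
    nlinarith
  linarith [(abs_le.1 h4).1]

theorem IsPolarSeries.sum_tail_le {M u : ℕ → ℝ} {K lam τ : ℝ} (h : IsPolarSeries M u K lam τ)
    {w : ℝ} (hw : 0 < w) (hw1 : w ≤ 1) (hK : 0 ≤ K) (X : ℝ) {V : ℝ} (hV : 2 < V) (F : Finset ℕ)
    (hF : ∀ n ∈ F, V ≤ |u n - X|) :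
    ∑ n ∈ F, M n * (Real.exp (-w * u n) * fejer (u n - X)) ≤
      32 * (80 + 4 * K) / (V - 2) := by
  set j : ℕ → ℕ := fun n => ⌊u n⌋₊ with hj
  have hju : ∀ n, |u n - j n| ≤ 1 := fun n => by
    have h1 := Nat.floor_le (h.freq_nonneg n)
    have h2 := Nat.lt_floor_add_one (u n)
    rw [abs_le]; constructor <;> simp only [hj] <;> linarith
  have hjX : ∀ n ∈ F, V - 1 ≤ |(j n : ℝ) - X| := fun n hn => by
    have h1 := abs_sub_le (u n) (j n) X
    linarith [hju n, hF n hn]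
  have hfe : ∀ n ∈ F, fejer (u n - X) ≤ 16 * (1 / ((j n : ℝ) - X) ^ 2) := fun n hn => by
    have h1 := abs_sub_le (j n : ℝ) (u n) X
    rw [abs_sub_comm (j n : ℝ) (u n)] at h1
    have h2 : |(j n : ℝ) - X| ≤ 2 * |u n - X| := by linarith [hju n, hF n hn]
    have h3 : 0 < |(j n : ℝ) - X| := by linarith [hjX n hn]
    have h4 : ((j n : ℝ) - X) ^ 2 ≤ 4 * (u n - X) ^ 2 := by
      rw [← sq_abs ((j n : ℝ) - X), ← sq_abs (u n - X)]
      nlinarith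
    have h5 : 0 < ((j n : ℝ) - X) ^ 2 := by rw [← sq_abs]; positivity
    rw [mul_one_div, le_div_iff₀ h5]
    have := sq_mul_fejer_le (u n - X)
    nlinarith [fejer_nonneg (u n - X)]
  have hB : 0 ≤ 80 + 4 * K := by linarith
  calc ∑ n ∈ F, M n * (Real.exp (-w * u n) * fejer (u n - X))
      = ∑ i ∈ F.image j, ∑ n ∈ F with j n = i,
          M n * (Real.exp (-w * u n) * fejer (u n - X)) :=
        (sum_fiberwise_of_maps_to (fun n hn => mem_image_of_mem j hn) _).symm
    _ ≤ ∑ i ∈ F.image j, 16 * (1 / ((i : ℝ) - X) ^ 2) * (80 + 4 * K) := by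
        refine sum_le_sum fun i _ => ?_
        calc ∑ n ∈ F with j n = i, M n * (Real.exp (-w * u n) * fejer (u n - X))
            ≤ ∑ n ∈ F with j n = i, 16 * (1 / ((i : ℝ) - X) ^ 2) *
                (M n * Real.exp (-w * u n)) := by
              refine sum_le_sum fun n hn => ?_
              obtain ⟨hn, hi⟩ := mem_filter.1 hn
              have := hfe n hn
              rw [hi] at this
              have h0 : 0 ≤ M n * Real.exp (-w * u n) :=
                mul_nonneg (h.coeff_nonneg n) (Real.exp_pos _).le
              rw [← mul_assoc, mul_comm]
              exact mul_le_mul_of_nonneg_right this h0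
          _ ≤ _ := by
              rw [← mul_sum]
              refine mul_le_mul_of_nonneg_left ?_ (by positivity)
              refine h.sum_window_le hw hw1 i _ fun n hn => ?_
              rw [← (mem_filter.1 hn).2]
              exact hju n
    _ = 16 * (80 + 4 * K) * ∑ i ∈ F.image j, 1 / ((i : ℝ) - X) ^ 2 := by
        rw [mul_sum]; exact sum_congr rfl fun i _ => by ring
    _ ≤ 16 * (80 + 4 * K) * (2 / (V - 1 - 1)) := by
        refine mul_le_mul_of_nonneg_left (sum_inv_sq_le (by linarith) _ fun i hi => ?_)
          (by positivity)
        obtain ⟨n, hn, rfl⟩ := mem_image.1 hi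
        exact hjX n hn
    _ = 32 * (80 + 4 * K) / (V - 2) := by
        rw [show V - 1 - 1 = V - 2 by ring]; ring

theorem IsPolarSeries.main_term_ge {lam τ X κ : ℝ} (hl : 0 ≤ lam) (hτ : |τ| ≤ 1) (hX : 2 ≤ X)
    (hκ : 0 ≤ κ) (h : ∀ v, X / 2 ≤ v → κ ≤ 1 - τ * Real.exp (-lam * v)) :
    κ / 6 ≤ (fejerPair X fun t => 1 / ((1 / X : ℝ) + t * Complex.I)).re -
      τ * (fejerPair X fun t => 1 / ((1 / X + lam : ℝ) + t * Complex.I)).re := by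
  have hw : 0 < 1 / X := by positivity
  have hwl : 0 < 1 / X + lam := by linarith
  rw [re_fejerPair_inv hw, re_fejerPair_inv hwl, ← integral_const_mul]
  have i1 := integrable_exp_mul_fejer hw.le X
  have i2 := (integrable_exp_mul_fejer hwl.le X).const_mul τ
  rw [← integral_sub i1 i2]
  have e : ∀ v : ℝ, Real.exp (-(1 / X) * v) * fejer (v - X) -
      τ * (Real.exp (-(1 / X + lam) * v) * fejer (v - X)) =
      Real.exp (-(1 / X) * v) * (1 - τ * Real.exp (-lam * v)) * fejer (v - X) := by
    intro v
    rw [show -(1 / X + lam) * v = -(1 / X) * v + -lam * v by ring, Real.exp_add]; ring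
  have hnn : ∀ v ∈ Set.Ioi (0 : ℝ), 0 ≤ Real.exp (-(1 / X) * v) * fejer (v - X) -
      τ * (Real.exp (-(1 / X + lam) * v) * fejer (v - X)) := by
    intro v hv
    rw [e]
    have hv : 0 < v := hv
    have h1 : Real.exp (-lam * v) ≤ 1 := Real.exp_le_one_iff.2 (by nlinarith)
    have h2 : τ * Real.exp (-lam * v) ≤ 1 := by
      have := (abs_le.1 hτ).2
      nlinarith [Real.exp_pos (-lam * v)]
    have := fejer_nonneg (v - X)
    have := Real.exp_pos (-(1 / X) * v)
    have : 0 ≤ 1 - τ * Real.exp (-lam * v) := by linarith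
    positivity
  have hsub : Set.Icc (X - 1) X ⊆ Set.Ioi (0 : ℝ) := fun v hv => by
    have := hv.1
    rw [Set.mem_Ioi]; linarith
  calc κ / 6 = ∫ v in Set.Icc (X - 1) X, κ / 6 := by
        rw [setIntegral_const]; simp
    _ ≤ ∫ v in Set.Icc (X - 1) X, (Real.exp (-(1 / X) * v) * fejer (v - X) -
      τ * (Real.exp (-(1 / X + lam) * v) * fejer (v - X))) := by
        refine setIntegral_mono_on (by simp) ((i1.sub i2).mono_set hsub) measurableSet_Icc
          fun v hv => ?_
        rw [e]
        have h1 : Real.exp (-1) ≤ Real.exp (-(1 / X) * v) := by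
          refine Real.exp_le_exp.2 ?_
          rw [neg_mul, neg_le_neg_iff, one_div, inv_mul_le_iff₀ (by linarith)]
          linarith [hv.2]
        have h2 : (1 / 3 : ℝ) ≤ Real.exp (-1) := by
          rw [Real.exp_neg, one_div]
          exact inv_anti₀ (Real.exp_pos 1) (by linarith [Real.exp_one_lt_d9])
        have h3 := h v (by linarith [hv.1])
        have h4 := half_le_fejer (v := v - X) (abs_le.2 ⟨by linarith [hv.1], by linarith [hv.2]⟩)
        calc κ / 6 = 1 / 3 * κ * (1 / 2) := by ring
          _ ≤ Real.exp (-(1 / X) * v) * (1 - τ * Real.exp (-lam * v)) * fejer (v - X) := by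
            refine mul_le_mul (mul_le_mul (h2.trans h1) h3 hκ (Real.exp_pos _).le) h4 (by norm_num)
              (mul_nonneg (Real.exp_pos _).le (hκ.trans h3))
    _ ≤ _ := setIntegral_mono_set (i1.sub i2)
        ((ae_restrict_iff' measurableSet_Ioi).2 (Filter.Eventually.of_forall hnn))
        hsub.eventuallyLE

/-- A lower bound for the mass of a polar series in a bounded window around `X`. -/
theorem exists_window_mass {K κ : ℝ} (hK : 0 ≤ K) (hκ : 0 < κ) :
    ∃ V > 0, ∃ X₀ ≥ 2, ∀ (M u : ℕ → ℝ) (lam τ X : ℝ), IsPolarSeries M u K lam τ → X₀ ≤ X →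
      (∀ v, X / 2 ≤ v → κ ≤ 1 - τ * Real.exp (-lam * v)) →
      ∃ F : Finset ℕ, (∀ n ∈ F, |u n - X| ≤ V) ∧ κ / 16 ≤ ∑ n ∈ F, M n := by
  set V : ℝ := 2 + 32 * (80 + 4 * K) * 48 / κ with hV
  have hV2 : 2 < V := by
    have : 0 < 32 * (80 + 4 * K) * 48 / κ := by positivity
    linarith
  refine ⟨V, by linarith, max 2 (6 * K * 48 / κ), le_max_left _ _,
    fun M u lam τ X h hX hv => ?_⟩
  have hX2 : 2 ≤ X := (le_max_left _ _).trans hX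
  have hX0 : 0 < X := by linarith
  have hw : 0 < 1 / X := by positivity
  have hw1 : 1 / X ≤ 1 := by rw [div_le_one hX0]; linarith
  obtain ⟨g, hg, hs⟩ := h.exists_hasSum hw hw1
  have h1 := IsPolarSeries.main_term_ge h.lam_nonneg h.abs_le_one hX2 hκ.le hv
  have h2 := (Complex.abs_re_le_norm _).trans (norm_fejerPair_le_of_hasDerivAt hX0 hg)
  have h3 : 6 * K / X ≤ κ / 48 := by
    have := (le_max_right _ _).trans hX
    rw [div_le_iff₀ hκ] at this
    rw [div_le_iff₀ hX0]; linarith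
  have h4 := (abs_le.1 h2).1
  have hlt : κ / 8 < (fejerPair X fun t => 1 / ((1 / X : ℝ) + t * Complex.I)).re -
      τ * (fejerPair X fun t => 1 / ((1 / X + lam : ℝ) + t * Complex.I)).re +
        (fejerPair X g).re := by linarith
  obtain ⟨F, hF⟩ := ((hs X).eventually_const_lt hlt).exists
  refine ⟨F.filter fun n => |u n - X| ≤ V, fun n hn => (mem_filter.1 hn).2, ?_⟩
  have h5 := sum_filter_add_sum_filter_not F (fun n => |u n - X| ≤ V)
    fun n => M n * (Real.exp (-(1 / X) * u n) * fejer (u n - X))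
  have h6 := h.sum_tail_le hw hw1 hK X hV2 (F.filter fun n => ¬|u n - X| ≤ V)
    fun n hn => (not_le.1 (mem_filter.1 hn).2).le
  have h7 : 32 * (80 + 4 * K) / (V - 2) = κ / 48 := by
    have : 80 + 4 * K ≠ 0 := by positivity
    rw [hV, add_sub_cancel_left]; field_simp
  have h8 : ∑ n ∈ F with |u n - X| ≤ V, M n * (Real.exp (-(1 / X) * u n) * fejer (u n - X)) ≤
      ∑ n ∈ F with |u n - X| ≤ V, M n := by
    refine sum_le_sum fun n _ => mul_le_of_le_one_right (h.coeff_nonneg n) ?_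
    refine mul_le_one₀ (Real.exp_le_one_iff.2 ?_) (fejer_nonneg _) (fejer_le_one _)
    have := mul_nonneg hw.le (h.freq_nonneg n)
    linarith
  linarith

/-- The number of primes `p ≤ x` in the residue class `a`. -/
noncomputable def primeCount {q : ℕ} (a : ZMod q) (x : ℝ) : ℕ :=
  #((Ioc 0 ⌊x⌋₊).filter fun p : ℕ => p.Prime ∧ (p : ZMod q) = a)

lemma roughLambda_nonneg {q : ℕ} (z : ℝ) (a : (ZMod q)ˣ) (n : ℕ) : 0 ≤ roughLambda z a n := by
  rw [roughLambda]; split_ifs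
  · exact ArithmeticFunction.vonMangoldt_nonneg
  · exact le_rfl

lemma roughLambda_le {q : ℕ} (z : ℝ) (a : (ZMod q)ˣ) (n : ℕ) :
    roughLambda z a n ≤ ArithmeticFunction.vonMangoldt n := by
  rw [roughLambda]; split_ifs
  · exact le_rfl
  · exact ArithmeticFunction.vonMangoldt_nonneg

lemma term_one_add_div {ℓ : ℝ} (f : ℕ → ℂ) (w : ℂ) (n : ℕ) :
    LSeries.term f (1 + w / ℓ) n = f n / n * Complex.exp (-w * (Real.log n / ℓ : ℝ)) := by
  rcases eq_or_ne n 0 with rfl | hn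
  · simp
  · have hn0 : (n : ℂ) ≠ 0 := by exact_mod_cast hn
    rw [LSeries.term_of_ne_zero hn, Complex.cpow_add _ _ hn0, Complex.cpow_one,
      Complex.cpow_def_of_ne_zero hn0, neg_mul, Complex.exp_neg, div_mul_eq_div_div, div_eq_mul_inv]
    congr 3
    push_cast [Complex.natCast_log]
    ring

lemma HasPolarForm.isPolarSeries {q : ℕ} [NeZero q] {z K lam τ : ℝ} {a : (ZMod q)ˣ} (hz : 4 ≤ z)
    (h : HasPolarForm q z K lam τ a) (hl : 0 ≤ lam) (hτ : |τ| ≤ 1) :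
    IsPolarSeries (fun n => q.totient / Real.log z * (roughLambda z a n / n))
      (fun n => Real.log n / Real.log z) K lam τ := by
  have hℓ : 0 < Real.log z := Real.log_pos (by linarith)
  refine ⟨fun n => ?_, fun n => ?_, hl, hτ, fun σ hσ => ?_, ?_⟩
  · have := roughLambda_nonneg z a n
    positivity
  · exact div_nonneg (Real.log_natCast_nonneg n) hℓ.le
  · have h1 : LSeriesSummable (fun n : ℕ => (ArithmeticFunction.vonMangoldt n : ℂ))
        (1 + (σ : ℂ) / Real.log z) := by
      refine ArithmeticFunction.LSeriesSummable_vonMangoldt ?_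
      rw [← Complex.ofReal_div, Complex.add_re, Complex.one_re, Complex.ofReal_re]
      have : 0 < σ / Real.log z := by positivity
      linarith
    refine Summable.of_norm_bounded ((h1.norm).mul_left (q.totient / Real.log z)) fun n => ?_
    have e : ‖LSeries.term (fun n : ℕ => (ArithmeticFunction.vonMangoldt n : ℂ))
        (1 + (σ : ℂ) / Real.log z) n‖ = ArithmeticFunction.vonMangoldt n / n *
          Real.exp (-σ * (Real.log n / Real.log z)) := by
      rw [term_one_add_div, norm_mul, norm_div, Complex.norm_real, Complex.norm_natCast,
        ← Complex.ofReal_neg, ← Complex.ofReal_mul, Complex.norm_exp, Complex.ofReal_re,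
        Real.norm_of_nonneg ArithmeticFunction.vonMangoldt_nonneg]
    rw [e]
    have h0 := roughLambda_nonneg z a n
    rw [Real.norm_of_nonneg (by positivity), mul_assoc]
    have := roughLambda_le z a n
    gcongr
  · obtain ⟨Ψ, hΨ, hP⟩ := h
    refine ⟨Ψ, hΨ, fun w hw => ?_⟩
    rw [← hP w hw, LSeries, ← tsum_mul_left]
    refine tsum_congr fun n => ?_
    rw [term_one_add_div]
    push_cast
    ring

theorem exists_primeCount_ge_of_hasPolarForm {K κ : ℝ} (hK : 0 ≤ K) (hκ : 0 < κ) :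
    ∃ W > 0, ∃ X₀ ≥ 2, ∀ (q : ℕ) [NeZero q] (z : ℝ), 4 ≤ z → (q : ℝ) ≤ z →
      ∀ (a : (ZMod q)ˣ) (lam τ X : ℝ), 0 ≤ lam → |τ| ≤ 1 → HasPolarForm q z K lam τ a → X₀ ≤ X →
      (∀ v, X / 4 ≤ v → κ ≤ 1 - τ * Real.exp (-lam * v)) →
      z ^ (X - W) ≤ primeCount (a : ZMod q) (z ^ X) * (X * Real.log z) := by
  obtain ⟨V, hV, X₀, hX₀, hmass⟩ := exists_window_mass hK hκ
  obtain ⟨m, hm⟩ := exists_pow_lt_of_lt_one (show 0 < κ / 32 by positivity)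
    (show (1 / 4 : ℝ) < 1 by norm_num)
  set W : ℝ := 2 * V + 1 + m with hW
  refine ⟨W, by positivity, max (X₀ + 2 * V) (4 * W + 6),
    (le_max_left _ _).trans' (by linarith), fun q _ z hz hqz a lam τ X hl hτ hP hX hv => ?_⟩
  have hX1 : X₀ + 2 * V ≤ X := (le_max_left _ _).trans hX
  have hX2 : 4 * W + 6 ≤ X := (le_max_right _ _).trans hX
  have hz0 : 0 < z := by linarith
  have hz1 : 1 < z := by linarith
  have hℓ := log_ge_of_four_le hz
  have hq0 : (0 : ℝ) < q.totient := by exact_mod_cast Nat.totient_pos.2 (NeZero.pos q)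
  have hqt : (q.totient : ℝ) ≤ z := le_trans (by exact_mod_cast q.totient_le) hqz
  obtain ⟨F, hF, hmF⟩ := hmass _ _ lam τ (X - V) (hP.isPolarSeries hz hl hτ) (by linarith)
    fun v hv' => hv v (by linarith)
  set x := z ^ X with hx
  have hx0 : 0 < x := Real.rpow_pos_of_pos hz0 _
  have hlogx : Real.log x = X * Real.log z := Real.log_rpow hz0 X
  -- the mass is carried by integers `z ^ (X - 2 * V) ≤ n ≤ x`
  have hsum : ∑ n ∈ F, (q.totient / Real.log z * (roughLambda z a n / n)) ≤
      q.totient / Real.log z * (z ^ (-(X - 2 * V)) *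
        ∑ n ∈ Ioc 0 ⌊x⌋₊, roughLambda z a n) := by
    rw [← mul_sum]
    refine mul_le_mul_of_nonneg_left ?_ (by positivity)
    have h1 : ∑ n ∈ F, roughLambda z a n / n = ∑ n ∈ F with n ≠ 0, roughLambda z a n / n := by
      rw [sum_filter]
      refine sum_congr rfl fun n _ => ?_
      split_ifs with h
      · rfl
      · simp only [not_not] at h; simp [h]
    rw [h1, mul_sum]
    calc ∑ n ∈ F with n ≠ 0, roughLambda z a n / n
        ≤ ∑ n ∈ F with n ≠ 0, z ^ (-(X - 2 * V)) * roughLambda z a n := by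
          refine sum_le_sum fun n hn => ?_
          obtain ⟨hn, hn0⟩ := mem_filter.1 hn
          have hn1 : (0 : ℝ) < n := by exact_mod_cast Nat.pos_of_ne_zero hn0
          rw [div_eq_mul_inv, mul_comm, Real.rpow_neg hz0.le]
          refine mul_le_mul_of_nonneg_right (inv_anti₀ (Real.rpow_pos_of_pos hz0 _) ?_)
            (roughLambda_nonneg _ _ _)
          rw [Real.rpow_le_iff_le_log hz0 hn1, ← le_div_iff₀ (by linarith)]
          have := (abs_le.1 (hF n hn)).1
          linarith
      _ ≤ ∑ n ∈ Ioc 0 ⌊x⌋₊, z ^ (-(X - 2 * V)) * roughLambda z a n := by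
          refine sum_le_sum_of_subset_of_nonneg (fun n hn => ?_) fun n _ _ =>
            mul_nonneg (Real.rpow_nonneg hz0.le _) (roughLambda_nonneg _ _ _)
          obtain ⟨hn, hn0⟩ := mem_filter.1 hn
          have hn1 : (0 : ℝ) < n := by exact_mod_cast Nat.pos_of_ne_zero hn0
          refine mem_Ioc.2 ⟨Nat.pos_of_ne_zero hn0, Nat.le_floor ?_⟩
          have := (abs_le.1 (hF n hn)).2
          rw [hx, Real.le_rpow_iff_log_le hn1 hz0, ← div_le_iff₀ (by linarith)]
          linarith
  -- primes against prime powers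
  have hpsi : ∑ n ∈ Ioc 0 ⌊x⌋₊, roughLambda z a n ≤
      primeCount (a : ZMod q) x * (X * Real.log z) + 2 * √x * Real.log x := by
    have hx1 : 1 ≤ x := Real.one_le_rpow hz1.le (by linarith)
    rw [← sum_filter_add_sum_filter_not (Ioc 0 ⌊x⌋₊) Nat.Prime]
    refine add_le_add ?_ ?_
    · rw [primeCount, ← nsmul_eq_mul, ← hlogx, ← sum_const]
      rw [← filter_filter, sum_filter _ (fun _ => Real.log x)]
      refine sum_le_sum fun p hp => ?_
      obtain ⟨hp, hpp⟩ := mem_filter.1 hp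
      rw [roughLambda]
      split_ifs with h1 h2 h2
      · rw [ArithmeticFunction.vonMangoldt_apply_prime hpp]
        refine Real.log_le_log (by exact_mod_cast hpp.pos) ?_
        exact (Nat.cast_le.2 (mem_Ioc.1 hp).2).trans (Nat.floor_le hx0.le)
      · exact absurd h1.1 h2
      · exact Real.log_nonneg hx1
      · exact le_rfl
    · refine le_trans ?_ (Chebyshev.psi_sub_theta_le hx1)
      rw [Chebyshev.psi_sub_theta_eq_sum_not_prime]
      exact sum_le_sum fun n _ => roughLambda_le z a n
  set T := ∑ n ∈ Ioc 0 ⌊x⌋₊, roughLambda z a n with hT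
  have hT0 : 0 ≤ T := sum_nonneg fun n _ => roughLambda_nonneg _ _ _
  have h1 : κ / 16 ≤ z * (z ^ (-(X - 2 * V)) * T) := by
    refine hmF.trans (hsum.trans (mul_le_mul_of_nonneg_right ?_
      (mul_nonneg (Real.rpow_nonneg hz0.le _) hT0)))
    exact (div_le_self hq0.le (by linarith)).trans hqt
  have h2 : 2 * z ^ (-(m : ℝ)) ≤ κ / 16 := by
    have : z ^ (-(m : ℝ)) ≤ (1 / 4) ^ m := by
      rw [Real.rpow_neg hz0.le, Real.rpow_natCast, one_div, inv_pow]
      exact inv_anti₀ (by positivity) (pow_le_pow_left₀ (by norm_num) hz _)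
    linarith
  have h3 : 2 * z ^ (X - W) ≤ T := by
    have e : z ^ (X - W) = z ^ (-(m : ℝ)) * z ^ (X - 2 * V - 1) := by
      rw [← Real.rpow_add hz0]; congr 1; rw [hW]; ring
    have e2 : z ^ (X - 2 * V - 1) * (z * (z ^ (-(X - 2 * V)) * T)) = T := by
      have : z ^ (X - 2 * V - 1) * z ^ (1 : ℝ) * z ^ (-(X - 2 * V)) = 1 := by
        rw [← Real.rpow_add hz0, ← Real.rpow_add hz0]; ring_nf; simp
      rw [Real.rpow_one] at this
      linear_combination T * this
    rw [e, ← mul_assoc, ← e2, mul_comm]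
    exact mul_le_mul_of_nonneg_left (h2.trans h1) (Real.rpow_nonneg hz0.le _)
  have h4 : 2 * √x * Real.log x ≤ z ^ (X - W) := by
    have hl : Real.log x ≤ 4 * z ^ (X / 4) := by
      have := Real.log_le_rpow_div hx0.le (show (0 : ℝ) < 1 / 4 by norm_num)
      rw [hx, ← Real.rpow_mul hz0.le] at this
      rw [hx]
      calc _ ≤ _ := this
        _ = _ := by rw [show X * (1 / 4) = X / 4 by ring]; ring
    have hs : √x = z ^ (X / 2) := by
      rw [Real.sqrt_eq_rpow, hx, ← Real.rpow_mul hz0.le]; congr 1; ring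
    have h8 : 8 ≤ z ^ (X / 4 - W) := by
      calc (8 : ℝ) = 4 ^ (3 / 2 : ℝ) := by
            rw [show (4 : ℝ) = 2 ^ (2 : ℝ) by norm_num, ← Real.rpow_mul (by norm_num)]; norm_num
        _ ≤ z ^ (3 / 2 : ℝ) := Real.rpow_le_rpow (by norm_num) hz (by norm_num)
        _ ≤ z ^ (X / 4 - W) := Real.rpow_le_rpow_of_exponent_le hz1.le (by linarith)
    calc 2 * √x * Real.log x ≤ 2 * z ^ (X / 2) * (4 * z ^ (X / 4)) := by
          rw [hs]; gcongr
      _ = 8 * (z ^ (X / 2) * z ^ (X / 4)) := by ring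
      _ ≤ z ^ (X / 4 - W) * (z ^ (X / 2) * z ^ (X / 4)) := by gcongr
      _ = z ^ (X - W) := by
          rw [← Real.rpow_add hz0, ← Real.rpow_add hz0]; congr 1; ring
  linarith

end Linnik

namespace Linnik

open Finset

lemma exists_realChar {q : ℕ} {χ : DirichletCharacter ℂ q} (hχ : χ ≠ 1) (h2 : χ ^ 2 = 1) :
    ∃ s : DirichletCharacter ℝ q, s ≠ 1 ∧ s.IsQuadratic ∧ ∀ a, χ a = (s a : ℂ) := by
  have hval : ∀ a, χ a = ((χ a).re : ℂ) := by
    intro a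
    rcases MulChar.isQuadratic_iff_sq_eq_one.mpr h2 a with h | h | h <;> simp [h]
  let s : DirichletCharacter ℝ q :=
    { toFun := fun a => (χ a).re
      map_one' := by simp
      map_mul' := fun a b => by
        rw [map_mul]
        apply Complex.ofReal_injective
        rw [Complex.ofReal_mul, ← hval a, ← hval b, ← map_mul, ← hval]
      map_nonunit' := fun a ha => by simp [χ.map_nonunit ha] }
  have hs : ∀ a, χ a = (s a : ℂ) := hval
  refine ⟨s, fun h => hχ ?_, fun a => ?_, hs⟩
  · ext a
    rw [hs, h, MulChar.one_apply_coe, MulChar.one_apply_coe]; simp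
  · have := hs a
    rcases MulChar.isQuadratic_iff_sq_eq_one.mpr h2 a with h | h | h <;> rw [h] at this
    · left; exact_mod_cast this.symm
    · right; left; exact_mod_cast this.symm
    · right; right; exact_mod_cast this.symm

lemma abs_char_le_one {q : ℕ} {s : DirichletCharacter ℝ q} (hs : s.IsQuadratic) (a : ZMod q) :
    |s a| ≤ 1 := by
  rcases hs a with h | h | h <;> simp [h]

lemma abs_sum_char_le {q : ℕ} [NeZero q] {s : DirichletCharacter ℝ q} (hs1 : s ≠ 1)
    (hs : s.IsQuadratic) (M n : ℕ) : |∑ i ∈ range n, s ((M + i : ℕ) : ZMod q)| ≤ q := by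
  induction n using Nat.strong_induction_on generalizing M with
  | _ n ih =>
    rcases lt_or_ge n q with h | h
    · calc |∑ i ∈ range n, s ((M + i : ℕ) : ZMod q)| ≤ ∑ i ∈ range n, 1 :=
            (abs_sum_le_sum_abs _ _).trans (sum_le_sum fun i _ => abs_char_le_one hs _)
        _ ≤ q := by simp; exact_mod_cast h.le
    · obtain ⟨m, rfl⟩ := Nat.exists_eq_add_of_le h
      rw [sum_range_add]
      have h0 : ∑ i ∈ range q, s ((M + i : ℕ) : ZMod q) = 0 := by
        have h1 := MulChar.sum_eq_zero_of_ne_one hs1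
        rw [← Equiv.sum_comp (Equiv.addLeft (M : ZMod q))] at h1
        rw [← h1]
        refine sum_bij (fun i _ => (i : ZMod q)) (fun _ _ => mem_univ _) ?_ ?_ ?_
        · intro i hi j hj hij
          rw [ZMod.natCast_eq_natCast_iff'] at hij
          rwa [Nat.mod_eq_of_lt (mem_range.1 hi), Nat.mod_eq_of_lt (mem_range.1 hj)] at hij
        · intro b _
          exact ⟨b.val, mem_range.2 b.val_lt, ZMod.natCast_zmod_val b⟩
        · intro i _
          simp
      rw [h0, zero_add]
      simpa only [add_assoc] using ih m (by have := NeZero.pos q; omega) (M + q)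

lemma abs_sum_mul_antitone_le {c f : ℕ → ℝ} {B : ℝ}
    (hc : ∀ n, |∑ i ∈ range n, c i| ≤ B) (hf : Antitone f) (hf0 : ∀ n, 0 ≤ f n) (n : ℕ) :
    |∑ i ∈ range n, c i * f i| ≤ B * f 0 := by
  have hB : 0 ≤ B := (abs_nonneg _).trans (hc 0)
  have key : ∑ i ∈ range n, c i * f i = f n * ∑ i ∈ range n, c i +
      ∑ i ∈ range n, (f i - f (i + 1)) * ∑ j ∈ range (i + 1), c j := by
    induction n with
    | zero => simp
    | succ n ih =>
      rw [sum_range_succ, ih, sum_range_succ (fun i => (f i - f (i + 1)) * _),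
        sum_range_succ c]
      ring
  rw [key]
  calc |f n * ∑ i ∈ range n, c i + ∑ i ∈ range n, (f i - f (i + 1)) * ∑ j ∈ range (i + 1), c j|
      ≤ f n * B + ∑ i ∈ range n, (f i - f (i + 1)) * B := by
        refine (abs_add_le _ _).trans (add_le_add ?_ ((abs_sum_le_sum_abs _ _).trans
          (sum_le_sum fun i _ => ?_)))
        · rw [abs_mul, abs_of_nonneg (hf0 n)]
          exact mul_le_mul_of_nonneg_left (hc n) (hf0 n)
        · have : 0 ≤ f i - f (i + 1) := sub_nonneg.2 (hf (Nat.le_succ i))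
          rw [abs_mul, abs_of_nonneg this]
          exact mul_le_mul_of_nonneg_left (hc _) this
    _ = B * f 0 := by
        rw [← sum_mul, sum_range_sub']; ring

lemma abs_sum_Ioc_char_mul_le {q : ℕ} [NeZero q] {s : DirichletCharacter ℝ q} (hs1 : s ≠ 1)
    (hs : s.IsQuadratic) {f : ℕ → ℝ} {M : ℕ} (hf : AntitoneOn f (Set.Ioi M))
    (hf0 : ∀ n, M < n → 0 ≤ f n) (N : ℕ) :
    |∑ n ∈ Ioc M N, s n * f n| ≤ q * f (M + 1) := by
  have h := abs_sum_mul_antitone_le (c := fun i => s ((M + 1 + i : ℕ) : ZMod q))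
    (f := fun i => f (M + 1 + i)) (abs_sum_char_le hs1 hs (M + 1))
    (fun i j hij => hf (by simp; omega) (by simp; omega) (by omega))
    (fun i => hf0 _ (by omega)) (N - M)
  convert h using 2
  rw [← Finset.Ico_succ_succ_eq_Ioc, sum_Ico_eq_sum_range]
  refine sum_congr (by simp) fun i _ => ?_
  simp

lemma LFunction_one_approx {q : ℕ} [NeZero q] {χ : DirichletCharacter ℂ q} (hχ : χ ≠ 1)
    {s : DirichletCharacter ℝ q} (hs1 : s ≠ 1) (hs : s.IsQuadratic) (hχs : ∀ a, χ a = (s a : ℂ)) :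
    ∃ L : ℝ, DirichletCharacter.LFunction χ 1 = L ∧
      ∀ N : ℕ, |∑ n ∈ Ioc 0 N, s n / n - L| ≤ q / (N + 1) := by
  have step : ∀ N : ℕ, ∀ σ : ℝ, 1 < σ →
      ‖DirichletCharacter.LFunction χ σ - ∑ n ∈ Ioc 0 N, (s n : ℂ) / (n : ℂ) ^ (σ : ℂ)‖ ≤
        q / (N + 1) := by
    intro N σ hσ
    have hσ' : 1 < (σ : ℂ).re := by simpa using hσ
    rw [DirichletCharacter.LFunction_eq_LSeries χ hσ']
    have hsum : LSeriesSummable (fun n : ℕ => χ n) (σ : ℂ) :=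
      (DirichletCharacter.LSeriesSummable_iff (NeZero.ne q) χ).2 hσ'
    have ht := hsum.hasSum.tendsto_sum_nat
    refine le_of_tendsto ((ht.sub_const _).norm) ?_
    filter_upwards [Filter.eventually_ge_atTop (N + 1)] with m hm
    have e1 : ∑ n ∈ range m, LSeries.term (fun n : ℕ => χ n) (σ : ℂ) n =
        ∑ n ∈ Ioc 0 (m - 1), (s n : ℂ) / (n : ℂ) ^ (σ : ℂ) := by
      have : range m = insert 0 (Ioc 0 (m - 1)) := by
        ext n; simp; omega
      rw [this, sum_insert (by simp), LSeries.term_zero, zero_add]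
      refine sum_congr rfl fun n hn => ?_
      rw [LSeries.term_of_ne_zero (by simp at hn; omega), hχs]
    have e2 : ∑ n ∈ Ioc 0 (m - 1), (s n : ℂ) / (n : ℂ) ^ (σ : ℂ) =
        ∑ n ∈ Ioc 0 N, (s n : ℂ) / (n : ℂ) ^ (σ : ℂ) +
        ((∑ n ∈ Ioc N (m - 1), s n * (n : ℝ) ^ (-σ) : ℝ) : ℂ) := by
      rw [← sum_Ioc_consecutive _ (Nat.zero_le N) (show N ≤ m - 1 by omega)]
      congr 1
      push_cast
      refine sum_congr rfl fun n _ => ?_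
      rw [Complex.ofReal_cpow (Nat.cast_nonneg n), Complex.ofReal_natCast, Complex.ofReal_neg,
        Complex.cpow_neg, div_eq_mul_inv]
    rw [e1, e2, add_sub_cancel_left, Complex.norm_real, Real.norm_eq_abs]
    refine (abs_sum_Ioc_char_mul_le hs1 hs (f := fun n : ℕ => (n : ℝ) ^ (-σ)) ?_
      (fun n _ => by positivity) _).trans ?_
    · intro a ha b hb hab
      have ha : N < a := ha
      refine Real.rpow_le_rpow_of_nonpos (by exact_mod_cast (by omega : 0 < a))
        (by exact_mod_cast hab) (by linarith)
    · rw [div_eq_mul_inv]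
      refine mul_le_mul_of_nonneg_left ?_ (by positivity)
      rw [← Real.rpow_neg_one]
      push_cast
      exact Real.rpow_le_rpow_of_exponent_le (by linarith [Nat.cast_nonneg (α := ℝ) N])
        (by linarith)
  have lim : ∀ N : ℕ, ‖DirichletCharacter.LFunction χ 1 - ∑ n ∈ Ioc 0 N, (s n : ℂ) / n‖ ≤
      q / (N + 1) := by
    intro N
    have hc : Continuous fun σ : ℝ => DirichletCharacter.LFunction χ σ -
        ∑ n ∈ Ioc 0 N, (s n : ℂ) / (n : ℂ) ^ (σ : ℂ) := by
      refine ((DirichletCharacter.differentiable_LFunction hχ).continuous.comp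
        Complex.continuous_ofReal).sub (continuous_finsetSum _ fun n hn => ?_)
      have hn0 : (n : ℂ) ≠ 0 := by
        have : 0 < n := (mem_Ioc.1 hn).1
        exact_mod_cast this.ne'
      refine continuous_const.div (Complex.continuous_ofReal.const_cpow (Or.inl hn0)) fun σ => ?_
      rw [Complex.cpow_def_of_ne_zero hn0]; exact Complex.exp_ne_zero _
    have ht : Filter.Tendsto (fun σ : ℝ => ‖DirichletCharacter.LFunction χ σ -
        ∑ n ∈ Ioc 0 N, (s n : ℂ) / (n : ℂ) ^ (σ : ℂ)‖) (nhdsWithin 1 (Set.Ioi 1)) _ :=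
      (hc.norm.tendsto 1).mono_left nhdsWithin_le_nhds
    have := le_of_tendsto ht (by
      filter_upwards [self_mem_nhdsWithin] with σ hσ using step N σ hσ)
    simpa using this
  have him : (DirichletCharacter.LFunction χ 1).im = 0 := by
    by_contra h
    have h0 : 0 < |(DirichletCharacter.LFunction χ 1).im| := abs_pos.2 h
    obtain ⟨N, hN⟩ := exists_nat_gt (q / |(DirichletCharacter.LFunction χ 1).im|)
    have h1 := (Complex.abs_im_le_norm _).trans (lim N)
    have e : (∑ n ∈ Ioc 0 N, (s n : ℂ) / n).im = 0 := by
      rw [← Complex.ofReal_im (∑ n ∈ Ioc 0 N, s n / n)]; push_cast; rfl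
    rw [Complex.sub_im, e, sub_zero, le_div_iff₀ (by positivity)] at h1
    rw [div_lt_iff₀ h0] at hN
    nlinarith
  refine ⟨(DirichletCharacter.LFunction χ 1).re, Complex.ext rfl (by simpa using him), fun N => ?_⟩
  have h1 := (Complex.abs_re_le_norm _).trans (lim N)
  have e : (∑ n ∈ Ioc 0 N, (s n : ℂ) / n).re = ∑ n ∈ Ioc 0 N, s n / n := by
    rw [← Complex.ofReal_re (∑ n ∈ Ioc 0 N, s n / n)]; push_cast; rfl
  rwa [Complex.sub_re, e, abs_sub_comm] at h1

noncomputable def divSum {q : ℕ} (s : DirichletCharacter ℝ q) (n : ℕ) : ℝ := ∑ d ∈ n.divisors, s d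

section divSum

variable {q : ℕ} {s : DirichletCharacter ℝ q}

lemma divSum_mul_coprime {m n : ℕ} (h : m.Coprime n) :
    divSum s (m * n) = divSum s m * divSum s n := by
  let f : ArithmeticFunction ℝ := ⟨fun n => if n = 0 then 0 else s n, by simp⟩
  have hf : f.IsMultiplicative := by
    rw [ArithmeticFunction.IsMultiplicative.iff_ne_zero]
    refine ⟨by simp [f], fun {m n} hm hn _ => ?_⟩
    simp [f, hm, hn]
  have hr : ∀ k, divSum s k = ((ArithmeticFunction.zeta : ArithmeticFunction ℝ) * f) k := by
    intro k
    rw [ArithmeticFunction.coe_zeta_mul_apply, divSum]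
    refine sum_congr rfl fun d hd => ?_
    have : d ≠ 0 := (Nat.pos_of_mem_divisors hd).ne'
    simp [f, this]
  rw [hr, hr, hr]
  exact (ArithmeticFunction.isMultiplicative_zeta.natCast.mul hf).map_mul_of_coprime h

lemma divSum_prime_pow {p : ℕ} (hp : p.Prime) (k : ℕ) :
    divSum s (p ^ k) = ∑ i ∈ range (k + 1), s p ^ i := by
  rw [divSum, Nat.sum_divisors_prime_pow hp]; simp

lemma divSum_nonneg (hs : s.IsQuadratic) (n : ℕ) : 0 ≤ divSum s n := by
  induction n using Nat.recOnPrimeCoprime with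
  | zero => simp [divSum]
  | prime_pow p n hp =>
    rw [divSum_prime_pow hp]
    rcases hs p with h | h | h
    · exact sum_nonneg fun i _ => by rw [h]; positivity
    · exact sum_nonneg fun i _ => by rw [h]; positivity
    · rw [h, neg_one_geom_sum]; split_ifs <;> norm_num
  | coprime a b _ _ hab ha hb => rw [divSum_mul_coprime hab]; exact mul_nonneg ha hb

lemma one_le_divSum_sq (hs : s.IsQuadratic) {m : ℕ} (hm : m ≠ 0) : 1 ≤ divSum s (m ^ 2) := by
  induction m using Nat.recOnPrimeCoprime with
  | zero => exact absurd rfl hm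
  | prime_pow p n hp =>
    rw [← pow_mul, divSum_prime_pow hp]
    rcases hs p with h | h | h
    · rw [h, sum_range_succ']
      simp
    · rw [h]; simp
    · rw [h, neg_one_geom_sum, if_neg]
      simp [Nat.even_add_one]
  | coprime a b h1 h2 hab ha hb =>
    rw [mul_pow, divSum_mul_coprime (hab.pow 2 2)]
    exact one_le_mul_of_one_le_of_one_le (ha (by omega)) (hb (by omega))

lemma divSum_prime {p : ℕ} (hp : p.Prime) : divSum s p = 1 + s p := by
  have := divSum_prime_pow (s := s) hp 1
  simpa [sum_range_succ] using this

lemma divSum_prime_mul {p : ℕ} (hp : p.Prime) (m : ℕ) :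
    divSum s (p * m) = (1 + s p) * divSum s m -
      if p ∣ m then s p * divSum s (m / p) else 0 := by
  rcases Nat.eq_zero_or_pos m with rfl | hm
  · simp [divSum]
  have himg : ∀ k : ℕ, ∑ d ∈ k.divisors.image (p * ·), s (d : ℕ) = s p * divSum s k := by
    intro k
    rw [sum_image (fun a _ b _ h => Nat.eq_of_mul_eq_mul_left hp.pos h), divSum, mul_sum]
    exact sum_congr rfl fun d _ => by push_cast; rw [map_mul]
  have hun : (p * m).divisors = m.divisors ∪ m.divisors.image (p * ·) := by
    rw [Nat.divisors_mul, hp.divisors]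
    ext d
    simp only [mem_mul, mem_union, mem_image, mem_insert, mem_singleton]
    constructor
    · rintro ⟨y, rfl | rfl, e, he, rfl⟩
      · left; simpa using he
      · right; exact ⟨e, he, rfl⟩
    · rintro (h | ⟨e, he, rfl⟩)
      · exact ⟨1, Or.inl rfl, d, h, one_mul d⟩
      · exact ⟨p, Or.inr rfl, e, he, rfl⟩
  have hin : ∑ d ∈ m.divisors ∩ m.divisors.image (p * ·), s (d : ℕ) =
      if p ∣ m then s p * divSum s (m / p) else 0 := by
    split_ifs with h
    · rw [← himg]
      congr 1
      ext d
      simp only [mem_inter, mem_image, Nat.mem_divisors]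
      constructor
      · rintro ⟨⟨h1, _⟩, e, _, rfl⟩
        exact ⟨e, ⟨(Nat.dvd_div_iff_mul_dvd h).2 h1, (Nat.div_pos (Nat.le_of_dvd hm h) hp.pos).ne'⟩, rfl⟩
      · rintro ⟨e, ⟨h1, _⟩, rfl⟩
        have h2 := (Nat.dvd_div_iff_mul_dvd h).1 h1
        exact ⟨⟨h2, hm.ne'⟩, e, ⟨(Dvd.intro_left _ rfl).trans h2, hm.ne'⟩, rfl⟩
    · refine sum_eq_zero fun d hd => ?_
      simp only [mem_inter, mem_image, Nat.mem_divisors] at hd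
      obtain ⟨⟨h1, _⟩, e, _, rfl⟩ := hd
      exact absurd ((Dvd.intro _ rfl).trans h1) h
  have := sum_union_inter (s₁ := m.divisors) (s₂ := m.divisors.image (p * ·)) (f := fun d : ℕ => s d)
  rw [← hun, hin, himg] at this
  change divSum s (p * m) + _ = divSum s m + _ at this
  linarith

end divSum

lemma antitoneOn_inv_sub_inv_exp_sub_one :
    AntitoneOn (fun v : ℝ => 1 / v - 1 / (Real.exp v - 1)) (Set.Ioi 0) := by
  have hd : ∀ v : ℝ, 0 < v → HasDerivAt (fun v : ℝ => 1 / v - 1 / (Real.exp v - 1))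
      (-1 / v ^ 2 + Real.exp v / (Real.exp v - 1) ^ 2) v := by
    intro v hv
    have h1 : 0 < Real.exp v - 1 := by linarith [Real.add_one_lt_exp hv.ne']
    have := ((hasDerivAt_inv hv.ne').sub (((Real.hasDerivAt_exp v).sub_const 1).inv h1.ne'))
    simp only [one_div]
    refine this.congr_deriv ?_
    ring
  refine antitoneOn_of_deriv_nonpos (convex_Ioi 0)
    (fun v hv => (hd v hv).continuousAt.continuousWithinAt)
    (fun v hv => (hd v (by simpa using hv)).differentiableAt.differentiableWithinAt) fun v hv => ?_
  rw [interior_Ioi] at hv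
  have hv : 0 < v := hv
  rw [(hd v hv).deriv]
  have h1 : 0 < Real.exp v - 1 := by linarith [Real.add_one_lt_exp hv.ne']
  have h2 : v / 2 ≤ Real.sinh (v / 2) := Real.self_le_sinh_iff.2 (by linarith)
  have e1 : Real.exp v = Real.exp (v / 2) ^ 2 := by rw [← Real.exp_nat_mul]; ring_nf
  have e2 : Real.exp v - 1 = 2 * Real.exp (v / 2) * Real.sinh (v / 2) := by
    rw [Real.sinh_eq, Real.exp_neg, e1]; field_simp
  have h3 : v ^ 2 * Real.exp v ≤ (Real.exp v - 1) ^ 2 := by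
    rw [e2, e1, mul_pow, mul_pow]
    have : v ^ 2 ≤ (2 * Real.sinh (v / 2)) ^ 2 := pow_le_pow_left₀ hv.le (by linarith) 2
    nlinarith [sq_nonneg (Real.exp (v / 2))]
  have h4 : Real.exp v / (Real.exp v - 1) ^ 2 ≤ 1 / v ^ 2 := by
    rw [div_le_div_iff₀ (by positivity) (by positivity)]; linarith
  have : -1 / v ^ 2 = -(1 / v ^ 2) := by ring
  linarith

lemma inv_sub_inv_exp_sub_one_mem {v : ℝ} (hv : 0 < v) :
    0 ≤ 1 / v - 1 / (Real.exp v - 1) ∧ 1 / v - 1 / (Real.exp v - 1) ≤ 1 := by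
  have h0 := Real.add_one_lt_exp hv.ne'
  have h1 : 0 < Real.exp v - 1 := by linarith
  constructor
  · rw [sub_nonneg]
    exact one_div_le_one_div_of_le hv (by linarith)
  · have h2 : 1 - v ≤ Real.exp (-v) := by linarith [Real.add_one_le_exp (-v)]
    have h3 : (1 - v) * Real.exp v ≤ 1 := by
      have := mul_le_mul_of_nonneg_right h2 (Real.exp_pos v).le
      rwa [← Real.exp_add, neg_add_cancel, Real.exp_zero] at this
    rw [div_sub_div _ _ hv.ne' h1.ne', div_le_one (by positivity)]
    linarith

/-- Sums of `f` weighted by the divisor sums, as double sums over factorisations. -/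
lemma sum_divSum_mul_eq {q : ℕ} (s : DirichletCharacter ℝ q) (f : ℕ → ℝ) (N : ℕ) :
    ∑ n ∈ Ioc 0 N, divSum s n * f n = ∑ m ∈ Ioc 0 N, s m * ∑ k ∈ Ioc 0 (N / m), f (m * k) := by
  simp only [divSum, sum_mul, mul_sum]
  rw [sum_sigma', sum_sigma']
  refine sum_bij' (fun x _ => ⟨x.2, x.1 / x.2⟩) (fun y _ => ⟨y.1 * y.2, y.1⟩) ?_ ?_ ?_ ?_ ?_
  · rintro ⟨n, d⟩ h
    simp only [mem_sigma, mem_Ioc, Nat.mem_divisors] at h ⊢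
    obtain ⟨⟨h1, h2⟩, h3, h4⟩ := h
    have := Nat.pos_of_dvd_of_pos h3 h1
    have := Nat.le_of_dvd h1 h3
    exact ⟨⟨by omega, by omega⟩, Nat.div_pos ‹_› ‹_›, Nat.div_le_div_right h2⟩
  · rintro ⟨d, k⟩ h
    simp only [mem_sigma, mem_Ioc, Nat.mem_divisors] at h ⊢
    obtain ⟨⟨h1, h2⟩, h3, h4⟩ := h
    have := Nat.mul_pos h1 h3
    refine ⟨⟨this, ?_⟩, Dvd.intro _ rfl, this.ne'⟩
    rw [mul_comm]; exact (Nat.le_div_iff_mul_le h1).1 h4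
  · rintro ⟨n, d⟩ h
    simp only [mem_sigma, mem_Ioc, Nat.mem_divisors] at h ⊢
    rw [Nat.mul_div_cancel' h.2.1]
  · rintro ⟨d, k⟩ h
    simp only [mem_sigma, mem_Ioc] at h ⊢
    rw [Nat.mul_div_cancel_left _ h.1.1]
  · rintro ⟨n, d⟩ h
    simp only [mem_sigma, mem_Ioc, Nat.mem_divisors] at h ⊢
    rw [Nat.mul_div_cancel' h.2.1]

lemma geom_sum_Ioc_approx {t : ℝ} (ht0 : 0 < t) (ht1 : t < 1) {m : ℕ} (hm : 0 < m) (N : ℕ) :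
    |∑ k ∈ Ioc 0 (N / m), t ^ (m * k) - 1 / ((t ^ m)⁻¹ - 1)| ≤ t ^ N / (1 - t) := by
  set u := t ^ m
  have hu0 : 0 < u := pow_pos ht0 m
  have hu1 : u ≤ t := pow_le_of_le_one ht0.le ht1.le hm.ne'
  have h1 : ∑ k ∈ Ioc 0 (N / m), t ^ (m * k) = u / (1 - u) - u ^ (N / m + 1) / (1 - u) := by
    have : 1 - u ≠ 0 := by linarith
    induction N / m with
    | zero => simp
    | succ n ih =>
      rw [sum_Ioc_succ_top (Nat.zero_le n), ih, pow_mul]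
      change _ + u ^ (n + 1) = _
      field_simp
      ring
  have h2 : 1 / (u⁻¹ - 1) = u / (1 - u) := by
    have : 1 - u ≠ 0 := by linarith
    have : u⁻¹ - 1 = (1 - u) / u := by field_simp
    rw [this, one_div_div]
  have h4 : u ^ (N / m + 1) ≤ t ^ N := by
    rw [← pow_mul]
    apply pow_le_pow_of_le_one ht0.le ht1.le
    have := Nat.lt_mul_div_succ N hm
    omega
  rw [h1, h2, sub_sub_cancel_left, abs_neg, abs_of_nonneg (div_nonneg (by positivity) (by linarith))]
  exact div_le_div₀ (by positivity) h4 (by linarith) (by linarith)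

theorem LFunction_one_ge {q : ℕ} [NeZero q] {s : DirichletCharacter ℝ q} (hs1 : s ≠ 1)
    (hs : s.IsQuadratic) {L : ℝ} (hL : ∀ N : ℕ, |∑ n ∈ Ioc 0 N, s n / n - L| ≤ q / (N + 1)) :
    1 / (40 * q) ≤ L := by
  have hq : (1 : ℝ) ≤ q := by exact_mod_cast NeZero.one_le
  set Y : ℝ := (4 * q) ^ 2 with hY
  have hY0 : 0 < Y := by positivity
  set t := Real.exp (-(1 / Y)) with ht
  have ht0 : 0 < t := Real.exp_pos _
  have ht1 : t < 1 := by rw [ht, Real.exp_lt_one_iff]; simp; positivity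
  have htm : ∀ m : ℕ, (t ^ m)⁻¹ = Real.exp (m / Y) := by
    intro m
    rw [ht, ← Real.exp_nat_mul, ← Real.exp_neg]
    congr 1; ring
  have fin : ∀ N : ℕ, (4 * q) ^ 2 ≤ N → 4 * q * Real.exp (-1) ≤
      Y * (L + q / (N + 1)) + q + N * (t ^ N / (1 - t)) := by
    intro N hN
    have low : 4 * q * Real.exp (-1) ≤ ∑ n ∈ Ioc 0 N, divSum s n * t ^ n := by
      calc 4 * q * Real.exp (-1) = ∑ j ∈ Ioc 0 (4 * q), Real.exp (-1) := by simp
        _ ≤ ∑ j ∈ Ioc 0 (4 * q), divSum s (j ^ 2) * t ^ (j ^ 2) := by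
            refine sum_le_sum fun j hj => ?_
            rw [mem_Ioc] at hj
            have h1 := one_le_divSum_sq hs (m := j) (by omega)
            have h2 : Real.exp (-1) ≤ t ^ (j ^ 2) := by
              rw [ht, ← Real.exp_nat_mul, Real.exp_le_exp]
              have : ((j ^ 2 : ℕ) : ℝ) ≤ Y := by
                rw [hY]; exact_mod_cast Nat.pow_le_pow_left hj.2 2
              have := (div_le_one hY0).2 this
              rw [mul_neg, mul_one_div]; linarith
            exact h2.trans (le_mul_of_one_le_left (by positivity) h1)
        _ = ∑ n ∈ (Ioc 0 (4 * q)).image (· ^ 2), divSum s n * t ^ n := by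
            rw [sum_image fun a _ b _ h => Nat.pow_left_injective two_ne_zero h]
        _ ≤ _ := by
            refine sum_le_sum_of_subset_of_nonneg ?_ fun n _ _ =>
              mul_nonneg (divSum_nonneg hs n) (by positivity)
            intro n hn
            simp only [mem_image, mem_Ioc] at hn ⊢
            obtain ⟨j, hj, rfl⟩ := hn
            exact ⟨pow_pos hj.1 2, (Nat.pow_le_pow_left hj.2 2).trans hN⟩
    have eq : ∑ n ∈ Ioc 0 N, divSum s n * t ^ n = Y * ∑ n ∈ Ioc 0 N, s n / n -
        ∑ m ∈ Ioc 0 N, s m * (1 / (m / Y) - 1 / (Real.exp (m / Y) - 1)) +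
        ∑ m ∈ Ioc 0 N, s m * (∑ k ∈ Ioc 0 (N / m), t ^ (m * k) - 1 / ((t ^ m)⁻¹ - 1)) := by
      rw [sum_divSum_mul_eq, mul_sum, ← sum_sub_distrib, ← sum_add_distrib]
      refine sum_congr rfl fun m hm => ?_
      rw [htm, one_div_div]
      ring
    have b1 : |∑ m ∈ Ioc 0 N, s m * (1 / (m / Y) - 1 / (Real.exp (m / Y) - 1))| ≤ q := by
      have := abs_sum_Ioc_char_mul_le hs1 hs (M := 0)
        (f := fun m : ℕ => 1 / (m / Y) - 1 / (Real.exp (m / Y) - 1)) ?_ ?_ N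
      · refine this.trans (mul_le_of_le_one_right (by positivity) ?_)
        exact (inv_sub_inv_exp_sub_one_mem (by positivity)).2
      · intro a ha b hb hab
        have ha : 0 < a := ha
        have hb : 0 < b := hb
        exact antitoneOn_inv_sub_inv_exp_sub_one (a := (a : ℝ) / Y) (b := b / Y)
          (Set.mem_Ioi.2 (by positivity)) (Set.mem_Ioi.2 (by positivity)) (by gcongr)
      · intro n hn
        exact (inv_sub_inv_exp_sub_one_mem (by positivity)).1
    have b2 : |∑ m ∈ Ioc 0 N, s m * (∑ k ∈ Ioc 0 (N / m), t ^ (m * k) - 1 / ((t ^ m)⁻¹ - 1))| ≤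
        N * (t ^ N / (1 - t)) := by
      calc _ ≤ ∑ m ∈ Ioc 0 N, t ^ N / (1 - t) := by
            refine (abs_sum_le_sum_abs _ _).trans (sum_le_sum fun m hm => ?_)
            rw [abs_mul]
            exact (mul_le_of_le_one_left (abs_nonneg _) (abs_char_le_one hs _)).trans
              (geom_sum_Ioc_approx ht0 ht1 (mem_Ioc.1 hm).1 N)
        _ = _ := by simp
    have b3 : Y * ∑ n ∈ Ioc 0 N, s n / n ≤ Y * (L + q / (N + 1)) :=
      mul_le_mul_of_nonneg_left (by linarith [(abs_le.1 (hL N)).2]) hY0.le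
    rw [eq] at low
    linarith [(abs_le.1 b1).1, (abs_le.1 b2).2]
  have lim : Filter.Tendsto (fun N : ℕ => Y * (L + q / (N + 1)) + q + N * (t ^ N / (1 - t)))
      Filter.atTop (nhds (Y * (L + 0) + q + 0 / (1 - t))) := by
    refine Filter.Tendsto.add (((tendsto_const_nhds.add ?_).const_mul _).add_const _) ?_
    · have := (tendsto_one_div_add_atTop_nhds_zero_nat (𝕜 := ℝ)).const_mul (q : ℝ)
      simpa [div_eq_mul_inv] using this
    · have := (tendsto_self_mul_const_pow_of_lt_one ht0.le ht1).div_const (1 - t)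
      simpa [mul_div_assoc] using this
  have key := ge_of_tendsto lim (by
    filter_upwards [Filter.eventually_ge_atTop ((4 * q) ^ 2)] with N hN using fin N hN)
  rw [add_zero, zero_div, add_zero] at key
  have he : 0.36 ≤ Real.exp (-1) := by
    rw [Real.exp_neg, ← one_div, le_div_iff₀ (Real.exp_pos 1)]
    linarith [Real.exp_one_lt_d9]
  have h5 : 0.44 * q ≤ 16 * q * (q * L) := by
    have : Y * L = 16 * q * (q * L) := by rw [hY]; ring
    rw [← this]; nlinarith
  have h6 : 0.44 ≤ 16 * (q * L) := by
    have : (q : ℝ) * 0.44 ≤ q * (16 * (q * L)) := by linarith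
    exact le_of_mul_le_mul_left this (by linarith)
  rw [div_le_iff₀ (by positivity)]
  linarith

section progression

variable {q : ℕ} [NeZero q] {s : DirichletCharacter ℝ q}

lemma abs_card_mul_eq_sub_le {d : ℕ} (hd : IsUnit (d : ZMod q)) (a : ZMod q) {x : ℝ} (hx : 0 ≤ x) :
    |(#((Ioc 0 ⌊x⌋₊).filter fun k : ℕ => (d : ZMod q) * k = a) : ℝ) - x / q| ≤ 2 := by
  obtain ⟨u, hu⟩ := hd
  have h := abs_card_modEq_sub_le ((↑u⁻¹ * a : ZMod q).val) (NeZero.pos q) hx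
  suffices e : (Ioc 0 ⌊x⌋₊).filter (fun k : ℕ => (d : ZMod q) * k = a) =
      (Icc 1 ⌊x⌋₊).filter (fun n => n ≡ (↑u⁻¹ * a : ZMod q).val [MOD q]) by rwa [e]
  refine filter_congr fun k _ => ?_
  rw [← ZMod.natCast_eq_natCast_iff, ZMod.natCast_zmod_val, ← hu]
  constructor
  · rintro rfl; simp
  · intro h; rw [h]; simp

lemma abs_sum_char_mul_card_sub_le (hs : s.IsQuadratic) (a : ZMod q) {t : ℕ → ℝ} (ht : ∀ d, 0 ≤ t d)
    (y : ℕ) :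
    |∑ d ∈ Ioc 0 y, s d * (#((Ioc 0 ⌊t d⌋₊).filter fun k : ℕ => (d : ZMod q) * k = a) : ℝ) -
      ∑ d ∈ Ioc 0 y, s d * (t d / q)| ≤ 2 * y := by
  rw [← sum_sub_distrib]
  calc _ ≤ ∑ d ∈ Ioc 0 y, (2 : ℝ) := by
        refine (abs_sum_le_sum_abs _ _).trans (sum_le_sum fun d _ => ?_)
        rw [← mul_sub, abs_mul]
        by_cases hd : IsUnit (d : ZMod q)
        · exact (mul_le_of_le_one_left (abs_nonneg _) (abs_char_le_one hs _)).trans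
            (abs_card_mul_eq_sub_le hd a (ht d))
        · rw [s.map_nonunit hd]; simp
    _ = 2 * y := by simp [mul_comm]

lemma char_eq_of_mul_eq (hs : s.IsQuadratic) {a : ZMod q} (ha : IsUnit a) {d k : ZMod q}
    (h : d * k = a) : s d = s a * s k := by
  have hk : IsUnit k := isUnit_of_mul_isUnit_right (h ▸ ha)
  have h1 : s k * s k = 1 := by
    rcases hs k with h | h | h
    · exact absurd h (hk.map s).ne_zero
    · rw [h]; norm_num
    · rw [h]; norm_num
  rw [← h, map_mul, mul_assoc, h1, mul_one]

lemma abs_sum_divSum_sub_le (hs1 : s ≠ 1) (hs : s.IsQuadratic) {L : ℝ}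
    (hL : ∀ N : ℕ, |∑ n ∈ Ioc 0 N, s n / n - L| ≤ q / (N + 1)) {a : ZMod q} (ha : IsUnit a)
    {x : ℝ} (hx : 0 ≤ x) :
    |∑ n ∈ (Ioc 0 ⌊x⌋₊).filter (fun n : ℕ => (n : ZMod q) = a), divSum s n -
      (1 + s a) * (x / q) * L| ≤ 9 * √x := by
  have hq : (0 : ℝ) < q := by exact_mod_cast NeZero.pos q
  set N := ⌊x⌋₊ with hN
  set y := Nat.sqrt N with hy
  have hyN : y * y ≤ N := Nat.sqrt_le N
  have hyN' : N < (y + 1) * (y + 1) := Nat.lt_succ_sqrt N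
  have hyx : (y : ℝ) ≤ √x := by
    apply Real.le_sqrt_of_sq_le
    have : ((y * y : ℕ) : ℝ) ≤ N := by exact_mod_cast hyN
    push_cast at this
    rw [sq]; exact this.trans (Nat.floor_le hx)
  have hxy : √x ≤ y + 1 := by
    rw [Real.sqrt_le_left (by positivity), sq]
    have : ((N + 1 : ℕ) : ℝ) ≤ ((y + 1) * (y + 1) : ℕ) := by exact_mod_cast hyN'
    push_cast at this
    exact (Nat.lt_floor_add_one x).le.trans this
  set T := (Ioc 0 N ×ˢ Ioc 0 N).filter
    (fun v : ℕ × ℕ => v.1 * v.2 ≤ N ∧ (v.1 : ZMod q) * v.2 = a) with hT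
  set c : ℕ → ℝ := fun d => #((Ioc 0 ⌊x / d⌋₊).filter fun k : ℕ => (d : ZMod q) * k = a) with hc
  set e : ℕ → ℝ := fun d => #((Ioc 0 ⌊(y : ℝ)⌋₊).filter fun k : ℕ => (d : ZMod q) * k = a) with he
  have h0 : ∑ n ∈ (Ioc 0 N).filter (fun n : ℕ => (n : ZMod q) = a), divSum s n =
      ∑ v ∈ T, s (v.1 : ZMod q) := by
    have h := sum_divSum_mul_eq s (fun n : ℕ => if (n : ZMod q) = a then 1 else 0) N
    simp only [mul_ite, mul_one, mul_zero] at h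
    rw [sum_filter, h, hT, sum_filter, sum_product]
    refine sum_congr rfl fun d hd => ?_
    have hd0 : 0 < d := (mem_Ioc.1 hd).1
    rw [mul_sum, ← sum_filter_add_sum_filter_not (Ioc 0 N) (fun k => d * k ≤ N),
      sum_filter, sum_filter]
    rw [← sum_add_distrib]
    have hsub : Ioc 0 (N / d) ⊆ Ioc 0 N := Ioc_subset_Ioc_right (Nat.div_le_self N d)
    refine sum_subset_zero_on_sdiff hsub ?_ ?_
    · intro k hk
      simp only [mem_sdiff, mem_Ioc, not_and, not_le] at hk
      have : ¬ d * k ≤ N := by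
        intro h
        have h1 := hk.2 hk.1.1
        have : k ≤ N / d := (Nat.le_div_iff_mul_le hd0).2 (by rw [mul_comm]; exact h)
        omega
      simp [this]
    · intro k hk
      have : d * k ≤ N := by
        rw [mul_comm]; exact (Nat.le_div_iff_mul_le hd0).1 (mem_Ioc.1 hk).2
      simp [this]
  have hsplit := sum_union_inter (s₁ := T.filter fun v => v.1 ≤ y) (s₂ := T.filter fun v => v.2 ≤ y)
    (f := fun v => s (v.1 : ZMod q))
  have hun : T.filter (fun v => v.1 ≤ y) ∪ T.filter (fun v => v.2 ≤ y) = T := by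
    rw [← filter_or, filter_eq_self]
    intro v hv
    have := (mem_filter.1 hv).2.1
    by_contra h
    push Not at h
    have := Nat.mul_le_mul (Nat.succ_le_of_lt h.1) (Nat.succ_le_of_lt h.2)
    simp only [Nat.succ_eq_add_one] at this
    omega
  have h1 : ∑ v ∈ T.filter (fun v => v.1 ≤ y), s (v.1 : ZMod q) = ∑ d ∈ Ioc 0 y, s d * c d := by
    have : T.filter (fun v => v.1 ≤ y) = (Ioc 0 y).biUnion fun d =>
        ((Ioc 0 ⌊x / d⌋₊).filter fun k : ℕ => (d : ZMod q) * k = a).image fun k => (d, k) := by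
      ext ⟨d, k⟩
      simp only [hT, mem_filter, mem_product, mem_Ioc, mem_biUnion, mem_image, Prod.mk.injEq]
      constructor
      · rintro ⟨⟨⟨⟨a1, a2⟩, a3, a4⟩, a5, a6⟩, a7⟩
        refine ⟨d, ⟨a1, a7⟩, k, ⟨⟨a3, ?_⟩, a6⟩, rfl, rfl⟩
        rw [Nat.floor_div_natCast, Nat.le_div_iff_mul_le a1, mul_comm]; exact a5
      · rintro ⟨d', ⟨a1, a2⟩, k', ⟨⟨a3, a4⟩, a5⟩, rfl, rfl⟩
        rw [Nat.floor_div_natCast, Nat.le_div_iff_mul_le a1, mul_comm] at a4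
        have b1 := Nat.le_mul_of_pos_right d' a3
        have b2 := Nat.le_mul_of_pos_left k' a1
        exact ⟨⟨⟨⟨a1, by omega⟩, a3, by omega⟩, a4, a5⟩, a2⟩
    rw [this, sum_biUnion]
    · refine sum_congr rfl fun d _ => ?_
      rw [sum_image (fun a _ b _ h => (Prod.mk.inj h).2)]
      simp [hc, mul_comm]
    · intro d _ d' _ hdd
      rw [Function.onFun, disjoint_left]
      intro v hv hv'
      simp only [mem_image] at hv hv'
      obtain ⟨_, _, rfl⟩ := hv
      obtain ⟨_, _, h⟩ := hv'
      exact hdd (Prod.mk.inj h).1.symm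
  have h2 : ∑ v ∈ T.filter (fun v => v.2 ≤ y), s (v.1 : ZMod q) = s a * ∑ d ∈ Ioc 0 y, s d * c d := by
    rw [← h1, mul_sum]
    refine sum_bij (fun v _ => v.swap) ?_ ?_ ?_ ?_
    · rintro ⟨d, k⟩ h
      simp only [hT, mem_filter, mem_product, Prod.swap] at h ⊢
      obtain ⟨⟨⟨a1, a2⟩, a3, a4⟩, a5⟩ := h
      exact ⟨⟨⟨a2, a1⟩, by rw [mul_comm]; exact a3, by rw [mul_comm]; exact a4⟩, a5⟩
    · intro v _ w _ h; exact Prod.swap_injective h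
    · rintro ⟨d, k⟩ h
      refine ⟨(k, d), ?_, rfl⟩
      simp only [hT, mem_filter, mem_product] at h ⊢
      obtain ⟨⟨⟨a1, a2⟩, a3, a4⟩, a5⟩ := h
      exact ⟨⟨⟨a2, a1⟩, by rw [mul_comm]; exact a3, by rw [mul_comm]; exact a4⟩, a5⟩
    · rintro ⟨d, k⟩ h
      exact char_eq_of_mul_eq hs ha (mem_filter.1 (mem_filter.1 h).1).2.2
  have h3 : ∑ v ∈ T.filter (fun v => v.1 ≤ y) ∩ T.filter (fun v => v.2 ≤ y), s (v.1 : ZMod q) =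
      ∑ d ∈ Ioc 0 y, s d * e d := by
    have : T.filter (fun v => v.1 ≤ y) ∩ T.filter (fun v => v.2 ≤ y) =
        (Ioc 0 y ×ˢ Ioc 0 y).filter (fun v : ℕ × ℕ => (v.1 : ZMod q) * v.2 = a) := by
      ext ⟨d, k⟩
      simp only [hT, mem_filter, mem_product, mem_Ioc, mem_inter]
      constructor
      · tauto
      · rintro ⟨⟨⟨a1, a2⟩, a3, a4⟩, a5⟩
        have b0 := Nat.mul_le_mul a2 a4
        have b1 := Nat.le_mul_of_pos_right d a3
        have b2 := Nat.le_mul_of_pos_left k a1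
        have : d * k ≤ N := b0.trans hyN
        refine ⟨⟨⟨⟨⟨a1, ?_⟩, a3, ?_⟩, this, a5⟩, a2⟩, ⟨⟨⟨a1, ?_⟩, a3, ?_⟩, this, a5⟩, a4⟩ <;> omega
    rw [this, sum_filter, sum_product]
    refine sum_congr rfl fun d _ => ?_
    rw [← sum_filter]
    simp [he, mul_comm]
  rw [hun, h1, h2, h3, ← h0] at hsplit
  have b1 := abs_sum_char_mul_card_sub_le hs a (t := fun d => x / d) (fun d => by positivity) y
  have b2 := abs_sum_char_mul_card_sub_le hs a (t := fun _ => (y : ℝ)) (fun d => by positivity) y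
  have e1 : ∑ d ∈ Ioc 0 y, s d * (x / d / q) = x / q * ∑ d ∈ Ioc 0 y, s d / d := by
    rw [mul_sum]; exact sum_congr rfl fun d _ => by ring
  have e2 : |∑ d ∈ Ioc 0 y, s d * ((y : ℝ) / q)| ≤ y := by
    have h := abs_sum_Ioc_char_mul_le hs1 hs (M := 0) (f := fun _ => (y : ℝ) / q)
      (fun _ _ _ _ _ => le_rfl) (fun _ _ => by positivity) y
    rwa [mul_div_cancel₀ _ hq.ne'] at h
  have b3 : |x / q * ∑ d ∈ Ioc 0 y, s d / d - x / q * L| ≤ √x := by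
    rw [← mul_sub, abs_mul, abs_of_nonneg (by positivity : 0 ≤ x / q)]
    calc x / q * |∑ d ∈ Ioc 0 y, s d / d - L| ≤ x / q * (q / (y + 1)) :=
          mul_le_mul_of_nonneg_left (hL y) (by positivity)
      _ = x / (y + 1) := by field_simp
      _ ≤ √x := by
          rw [div_le_iff₀ (by positivity)]
          calc x = √x * √x := (Real.mul_self_sqrt hx).symm
            _ ≤ _ := mul_le_mul_of_nonneg_left hxy (Real.sqrt_nonneg x)
  change |∑ d ∈ Ioc 0 y, s d * c d - _| ≤ _ at b1
  change |∑ d ∈ Ioc 0 y, s d * e d - _| ≤ _ at b2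
  rw [e1] at b1
  have hsa := abs_le.1 (abs_char_le_one hs a)
  have b4 : |∑ d ∈ Ioc 0 y, s d * c d - x / q * L| ≤ 3 * √x := by
    have := abs_sub_le (∑ d ∈ Ioc 0 y, s d * c d) (x / q * ∑ d ∈ Ioc 0 y, s d / d) (x / q * L)
    linarith
  have b5 : |∑ d ∈ Ioc 0 y, s d * e d| ≤ 3 * √x := by
    have := abs_sub_abs_le_abs_sub (∑ d ∈ Ioc 0 y, s d * e d) (∑ d ∈ Ioc 0 y, s d * ((y : ℝ) / q))
    linarith
  have e3 : ∑ n ∈ (Ioc 0 N).filter (fun n : ℕ => (n : ZMod q) = a), divSum s n -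
      (1 + s a) * (x / q) * L = (1 + s a) * (∑ d ∈ Ioc 0 y, s d * c d - x / q * L) -
        ∑ d ∈ Ioc 0 y, s d * e d := by linear_combination hsplit
  rw [e3]
  refine (abs_sub _ _).trans ?_
  rw [abs_mul, abs_of_nonneg (by linarith : 0 ≤ 1 + s a)]
  have : (1 + s a) * |∑ d ∈ Ioc 0 y, s d * c d - x / q * L| ≤ 2 * (3 * √x) :=
    mul_le_mul (by linarith) b4 (abs_nonneg _) (by norm_num)
  linarith

end progression

section sieve

variable {q : ℕ} {s : DirichletCharacter ℝ q}

noncomputable def progSum (s : DirichletCharacter ℝ q) (D : Finset ℕ) (a : ZMod q) (x : ℝ) : ℝ :=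
  ∑ n ∈ (Ioc 0 ⌊x⌋₊).filter (fun n : ℕ => (n : ZMod q) = a ∧ ∀ p ∈ D, p ∣ n), divSum s n

lemma sum_filter_dvd_reindex {p : ℕ} (hp : p.Prime) {u : (ZMod q)ˣ} (hu : (u : ZMod q) = p)
    {Q : ℕ → Prop} [DecidablePred Q] (hQ : ∀ m, Q (p * m) ↔ Q m) (a : ZMod q) (x : ℝ) (F : ℕ → ℝ) :
    ∑ n ∈ (Ioc 0 ⌊x⌋₊).filter (fun n : ℕ => ((n : ZMod q) = a ∧ Q n) ∧ p ∣ n), F n =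
    ∑ m ∈ (Ioc 0 ⌊x / p⌋₊).filter (fun m : ℕ => (m : ZMod q) = a * ↑u⁻¹ ∧ Q m), F (p * m) := by
  have hmod : ∀ m : ℕ, ((p * m : ℕ) : ZMod q) = a ↔ (m : ZMod q) = a * ↑u⁻¹ := by
    intro m
    push_cast
    rw [← hu, Units.eq_mul_inv_iff_mul_eq, mul_comm]
  symm
  refine sum_bij (fun m _ => p * m) ?_ ?_ ?_ ?_
  · intro m hm
    simp only [mem_filter, mem_Ioc] at hm ⊢
    obtain ⟨⟨h1, h2⟩, h3, h4⟩ := hm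
    rw [Nat.floor_div_natCast, Nat.le_div_iff_mul_le hp.pos, mul_comm] at h2
    exact ⟨⟨Nat.mul_pos hp.pos h1, h2⟩, ⟨(hmod m).2 h3, (hQ m).2 h4⟩, Dvd.intro _ rfl⟩
  · intro m _ n _ h
    exact Nat.eq_of_mul_eq_mul_left hp.pos h
  · intro n hn
    simp only [mem_filter, mem_Ioc] at hn
    obtain ⟨⟨h1, h2⟩, ⟨h3, h4⟩, m, rfl⟩ := hn
    refine ⟨m, ?_, rfl⟩
    simp only [mem_filter, mem_Ioc]
    rw [Nat.floor_div_natCast, Nat.le_div_iff_mul_le hp.pos, mul_comm]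
    exact ⟨⟨Nat.pos_of_mul_pos_left h1, h2⟩, (hmod m).1 h3, (hQ m).1 h4⟩
  · intro m _; rfl

lemma sum_divSum_filter_dvd {p : ℕ} (hp : p.Prime) {u : (ZMod q)ˣ} (hu : (u : ZMod q) = p)
    {Q : ℕ → Prop} [DecidablePred Q] (hQ : ∀ m, Q (p * m) ↔ Q m) (a : ZMod q) (x : ℝ) :
    ∑ n ∈ (Ioc 0 ⌊x⌋₊).filter (fun n : ℕ => ((n : ZMod q) = a ∧ Q n) ∧ p ∣ n), divSum s n =
    (1 + s p) * ∑ n ∈ (Ioc 0 ⌊x / p⌋₊).filter (fun n : ℕ => (n : ZMod q) = a * ↑u⁻¹ ∧ Q n),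
        divSum s n -
      s p * ∑ n ∈ (Ioc 0 ⌊x / p / p⌋₊).filter
        (fun n : ℕ => (n : ZMod q) = a * ↑u⁻¹ * ↑u⁻¹ ∧ Q n), divSum s n := by
  rw [sum_filter_dvd_reindex hp hu hQ]
  simp only [divSum_prime_mul hp]
  rw [sum_sub_distrib, ← mul_sum, ← sum_filter, filter_filter,
    sum_filter_dvd_reindex hp hu hQ _ _ (fun n => s p * divSum s (n / p)), ← mul_sum]
  simp only [Nat.mul_div_cancel_left _ hp.pos]

lemma progSum_insert {p : ℕ} (hp : p.Prime) {u : (ZMod q)ˣ} (hu : (u : ZMod q) = p)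
    {D : Finset ℕ} (hD : ∀ l ∈ D, l.Prime ∧ l ≠ p) (a : ZMod q) (x : ℝ) :
    progSum s (insert p D) a x = (1 + s p) * progSum s D (a * ↑u⁻¹) (x / p) -
      s p * progSum s D (a * ↑u⁻¹ * ↑u⁻¹) (x / p / p) := by
  have h1 : progSum s (insert p D) a x = ∑ n ∈ (Ioc 0 ⌊x⌋₊).filter
      (fun n : ℕ => ((n : ZMod q) = a ∧ ∀ l ∈ D, l ∣ n) ∧ p ∣ n), divSum s n := by
    rw [progSum]
    congr 1
    refine filter_congr fun n _ => ?_
    rw [forall_mem_insert]; tauto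
  rw [h1]
  refine sum_divSum_filter_dvd hp hu (fun m => forall₂_congr fun l hl => ?_) a x
  have hlp : Nat.Coprime l p := (Nat.coprime_primes (hD l hl).1 hp).2 (hD l hl).2
  exact hlp.dvd_mul_left

/-- The density of `divSum s` on the multiples of a prime. -/
noncomputable def divDensity (s : DirichletCharacter ℝ q) (p : ℕ) : ℝ := (1 + s p - s p / p) / p

lemma one_sub_divDensity {p : ℕ} (hp : p.Prime) :
    1 - divDensity s p = (1 - 1 / (p : ℝ)) * (1 - s p / p) := by
  have : (p : ℝ) ≠ 0 := by exact_mod_cast hp.ne_zero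
  rw [divDensity]; field_simp; ring

lemma abs_progSum_sub_le [NeZero q] (hs1 : s ≠ 1) (hs : s.IsQuadratic) {L : ℝ}
    (hL : ∀ N : ℕ, |∑ n ∈ Ioc 0 N, s n / n - L| ≤ q / (N + 1)) {D : Finset ℕ}
    (hD : ∀ p ∈ D, p.Prime ∧ ¬ p ∣ q) (a : (ZMod q)ˣ) {x : ℝ} (hx : 0 ≤ x) :
    |progSum s D a x - (1 + s a) * (x / q) * L * ∏ p ∈ D, divDensity s p| ≤ 3 ^ #D * (9 * √x) := by
  induction D using Finset.induction_on generalizing a x with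
  | empty =>
    have := abs_sum_divSum_sub_le hs1 hs hL a.isUnit hx
    simpa [progSum] using this
  | insert p D hpD ih =>
    have hp := (hD p (mem_insert_self p D)).1
    have hp0 : (0 : ℝ) < p := by exact_mod_cast hp.pos
    have hp1 : (1 : ℝ) ≤ p := by exact_mod_cast hp.one_lt.le
    obtain ⟨u, hu⟩ : IsUnit (p : ZMod q) := by
      rw [ZMod.isUnit_iff_coprime]
      exact (Nat.Prime.coprime_iff_not_dvd hp).2 (hD p (mem_insert_self p D)).2
    have hDp : ∀ l ∈ D, l.Prime ∧ l ≠ p := fun l hl =>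
      ⟨(hD l (mem_insert_of_mem hl)).1, fun h => hpD (h ▸ hl)⟩
    have ih' := ih fun l hl => hD l (mem_insert_of_mem hl)
    have i1 := ih' (a * u⁻¹) (x := x / p) (by positivity)
    have i2 := ih' (a * u⁻¹ * u⁻¹) (x := x / p / p) (by positivity)
    simp only [Units.val_mul, map_mul] at i1 i2
    rw [progSum_insert hp hu hDp, prod_insert hpD, card_insert_of_notMem hpD]
    have hsu : s (p : ZMod q) = 1 ∨ s (p : ZMod q) = -1 := by
      rw [← hu]
      rcases hs u with h | h | h
      · exact absurd h (u.isUnit.map s).ne_zero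
      · exact Or.inl h
      · exact Or.inr h
    have hsui : s (↑u⁻¹ : ZMod q) = s p := by
      have : s (↑u⁻¹ : ZMod q) * s p = 1 := by rw [← hu, ← map_mul]; simp
      rcases hsu with h | h <;> rw [h] at this ⊢ <;> linarith
    rw [hsui] at i1 i2
    have s1 : √(x / p) ≤ √x := Real.sqrt_le_sqrt (div_le_self hx hp1)
    have s2 : √(x / p / p) ≤ √x :=
      Real.sqrt_le_sqrt ((div_le_self (by positivity) hp1).trans (div_le_self hx hp1))
    set G := ∏ p ∈ D, divDensity s p
    have key : ∀ A B : ℝ, (1 + s p) * A - s p * B -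
        (1 + s a) * (x / q) * L * (divDensity s p * G) =
        (1 + s p) * (A - (1 + s a * s p) * (x / p / q) * L * G) -
        s p * (B - (1 + s a * s p * s p) * (x / p / p / q) * L * G) := by
      intro A B
      have hq : (q : ℝ) ≠ 0 := by exact_mod_cast NeZero.ne q
      rw [divDensity]
      rcases hsu with h | h <;> rw [h] <;> field_simp <;> ring
    rw [key]
    have hab : |s (p : ZMod q)| = 1 ∧ |1 + s (p : ZMod q)| ≤ 2 := by
      rcases hsu with h | h <;> rw [h] <;> norm_num
    refine (abs_sub _ _).trans ?_
    rw [abs_mul, abs_mul, hab.1, one_mul, pow_succ]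
    have h3 : (0 : ℝ) < 3 ^ #D := by positivity
    have j1 := i1.trans (mul_le_mul_of_nonneg_left (mul_le_mul_of_nonneg_left s1 (by norm_num)) h3.le)
    have j2 := i2.trans (mul_le_mul_of_nonneg_left (mul_le_mul_of_nonneg_left s2 (by norm_num)) h3.le)
    have := mul_le_mul hab.2 j1 (abs_nonneg _) (by norm_num)
    linarith

noncomputable def roughSum (s : DirichletCharacter ℝ q) (z : ℝ) (a : ZMod q) (x : ℝ) : ℝ :=
  ∑ n ∈ (Ioc 0 ⌊x⌋₊).filter (fun n : ℕ => (n : ZMod q) = a ∧ Rough z n), divSum s n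

/-- The inverse of the partial Euler product of a real character. -/
noncomputable def eulerInv (s : DirichletCharacter ℝ q) (z : ℝ) : ℝ :=
  ∏ p ∈ primesUpTo z, (1 - s p / p)

lemma isSieveDensity_divDensity (hs : s.IsQuadratic) {z : ℝ} (hz0 : 0 ≤ z) :
    IsSieveDensity ((primesUpTo z).filter fun p => ¬ p ∣ q) (divDensity s) z := by
  have hp : ∀ p ∈ (primesUpTo z).filter (fun p => ¬ p ∣ q), p.Prime :=
    fun p hp => prime_of_mem_primesUpTo (mem_filter.1 hp).1
  have h2 : ∀ p ∈ (primesUpTo z).filter (fun p => ¬ p ∣ q), (2 : ℝ) ≤ p :=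
    fun p h => by exact_mod_cast (hp p h).two_le
  have hdiv : ∀ p ∈ (primesUpTo z).filter (fun p => ¬ p ∣ q),
      1 / (p : ℝ) ≤ 1 / 2 ∧ 0 < 1 / (p : ℝ) ∧ |s p / p| ≤ 1 / p := by
    intro p h
    have := h2 p h
    refine ⟨one_div_le_one_div_of_le (by norm_num) this, by positivity, ?_⟩
    rw [abs_div, abs_of_nonneg (by positivity : (0 : ℝ) ≤ p)]
    gcongr
    exact abs_char_le_one hs _
  refine ⟨hp, fun p h => ((mem_primesUpTo hz0).1 (mem_filter.1 h).1).2, fun p h => ?_, fun p h => ?_,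
    fun p h => ?_, fun p h => ?_⟩
  · obtain ⟨h3, h4, h5⟩ := hdiv p h
    have := h2 p h
    rw [divDensity]
    refine div_nonneg ?_ (by linarith)
    rcases hs p with h | h | h <;> rw [h]
    · simp
    · linarith
    · linarith [neg_div (p : ℝ) 1]
  · obtain ⟨h3, h4, h5⟩ := hdiv p h
    have h6 := one_sub_divDensity (s := s) (hp p h)
    have := mul_nonneg (by linarith : 0 ≤ 1 - 1 / (p : ℝ)) (by linarith [(abs_le.1 h5).2] : 0 ≤ 1 - s p / p)
    linarith
  · obtain ⟨h3, h4, h5⟩ := hdiv p h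
    have := h2 p h
    rw [divDensity]
    gcongr
    rcases hs p with h | h | h <;> rw [h]
    · simp
    · linarith
    · linarith [neg_div (p : ℝ) 1]
  · obtain ⟨h3, h4, h5⟩ := hdiv p h
    rw [one_sub_divDensity (hp p h), sq]
    exact mul_le_mul_of_nonneg_left (by linarith [(abs_le.1 h5).2]) (by linarith)

/-- Fundamental lemma for divisor sums over rough numbers in arithmetic progressions. -/
theorem exists_abs_roughSum_sub_le : ∃ K : ℝ, 0 < K ∧ ∀ (b : ℕ) (z : ℝ) (q : ℕ) [NeZero q],
    (q : ℝ) ≤ z → ∀ s : DirichletCharacter ℝ q, s ≠ 1 → s.IsQuadratic → ∀ L : ℝ,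
    (∀ N : ℕ, |∑ n ∈ Ioc 0 N, s n / n - L| ≤ q / (N + 1)) → ∀ (a : (ZMod q)ˣ) (x : ℝ), 0 ≤ x →
      |roughSum s z a x - (1 + s a) * (rho z * (L * eulerInv s z) * x / q.totient)|
        ≤ K * Real.exp (-(b : ℝ)) * ((1 + s a) * (rho z * (L * eulerInv s z) * x / q.totient)) +
          9 * √x * (z ^ (4 * b + 6)) ^ 3 := by
  obtain ⟨K, hK, hsieve⟩ := exists_sievePair
  refine ⟨K, hK, fun b z q _ hqz s hs1 hs L hL a x hx => ?_⟩
  have hq : 0 < q := NeZero.pos q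
  have hq1 : (1 : ℝ) ≤ q := by exact_mod_cast hq
  have hz1 : 1 ≤ z := hq1.trans hqz
  have hz0 : 0 ≤ z := by linarith
  have hL0 : 0 ≤ L := le_trans (by positivity) (LFunction_one_ge hs1 hs hL)
  set P := (primesUpTo z).filter (fun p => ¬ p ∣ q) with hP
  have hPprime : ∀ p ∈ P, p.Prime := fun p hp => prime_of_mem_primesUpTo (mem_filter.1 hp).1
  obtain ⟨lp, lm, hsv⟩ := hsieve b z hz1 P _ (isSieveDensity_divDensity hs hz0)
  have hsa : 0 ≤ 1 + s a := by linarith [(abs_le.1 (abs_char_le_one hs a)).1]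
  have key := hsv.abs_sum_sub_le ((Ioc 0 ⌊x⌋₊).filter (fun n : ℕ => (n : ZMod q) = a))
    (divSum s) (fun n _ => divSum_nonneg hs n) (Y := (1 + s a) * (x / q) * L) (by positivity)
    (fun D => 3 ^ #D * (9 * √x)) (fun D => by positivity) (by
      intro D hD _
      have h := abs_progSum_sub_le hs1 hs hL
        (fun p hp => ⟨hPprime p (hD hp), (mem_filter.1 (hD hp)).2⟩) a hx
      rw [filter_filter]
      exact h)
  have e1 : ∑ n ∈ (Ioc 0 ⌊x⌋₊).filter (fun n : ℕ => (n : ZMod q) = a) with ∀ p ∈ P, ¬ p ∣ n,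
      divSum s n = roughSum s z a x := by
    rw [filter_filter, roughSum]
    congr 1
    refine filter_congr fun n _ => and_congr_right fun hn => ?_
    constructor
    · intro h p hp hpn
      by_cases hpq : p ∣ q
      · have hpp := prime_of_mem_primesUpTo hp
        have ha := a.isUnit
        rw [← hn, ZMod.isUnit_iff_coprime] at ha
        exact Nat.Prime.not_dvd_one hpp (ha ▸ Nat.dvd_gcd hpn hpq)
      · exact h p (mem_filter.2 ⟨hp, hpq⟩) hpn
    · intro h p hp
      exact h p (mem_filter.1 hp).1
  have hφ : (0 : ℝ) < q.totient := by exact_mod_cast Nat.totient_pos.2 hq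
  have e2 : (1 + s a) * (x / q) * L * ∏ p ∈ P, (1 - divDensity s p) =
      (1 + s a) * (rho z * (L * eulerInv s z) * x / q.totient) := by
    have h1 : ∏ p ∈ P, (1 - divDensity s p) =
        (∏ p ∈ P, (1 - 1 / (p : ℝ))) * ∏ p ∈ P, (1 - s p / p) := by
      rw [← prod_mul_distrib]
      exact prod_congr rfl fun p hp => one_sub_divDensity (hPprime p hp)
    have h2 : ∏ p ∈ P, (1 - s p / p) = eulerInv s z := by
      rw [hP, eulerInv, prod_filter]
      refine prod_congr rfl fun p hp => ?_
      split_ifs with h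
      · have : ¬ IsUnit (p : ZMod q) := by
          rw [ZMod.isUnit_iff_coprime, Nat.Prime.coprime_iff_not_dvd (prime_of_mem_primesUpTo hp)]
          exact not_not.2 h
        rw [s.map_nonunit this]; simp
      · rfl
    rw [h1, h2, ← rho_eq_totient hq hqz, ← hP]
    field_simp
  set y := z ^ (4 * b + 6) with hy
  have hy0 : 0 ≤ y := by positivity
  have e3 : ∑ D ∈ P.powerset.filter (fun D : Finset ℕ => ∏ p ∈ D, (p : ℝ) ≤ y),
      (3 ^ #D * (9 * √x)) ≤ 9 * √x * y ^ 3 := by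
    have hc := card_subsets_le hPprime (y := y) hy0
    calc _ ≤ ∑ D ∈ P.powerset.filter (fun D : Finset ℕ => ∏ p ∈ D, (p : ℝ) ≤ y),
          (y ^ 2 * (9 * √x)) := by
          refine sum_le_sum fun D hD => mul_le_mul_of_nonneg_right ?_ (by positivity)
          simp only [mem_filter, mem_powerset] at hD
          have h2 : (2 : ℝ) ^ #D ≤ ∏ p ∈ D, (p : ℝ) := by
            rw [← prod_const]
            exact prod_le_prod (fun _ _ => by norm_num) fun p hp => by
              exact_mod_cast (hPprime p (hD.1 hp)).two_le
          calc (3 : ℝ) ^ #D ≤ 4 ^ #D := by gcongr; norm_num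
            _ = (2 ^ #D) ^ 2 := by rw [← pow_mul, mul_comm, pow_mul]; norm_num
            _ ≤ y ^ 2 := by gcongr; exact h2.trans hD.2
      _ ≤ y * (y ^ 2 * (9 * √x)) := by
          rw [sum_const, nsmul_eq_mul]; gcongr
      _ = _ := by ring
  rw [e1, e2] at key
  linarith

end sieve

/-- The density of divisor sums over rough numbers in a residue class. -/
noncomputable def roughDensity {q : ℕ} (s : DirichletCharacter ℝ q) (L z : ℝ) : ℝ :=
  rho z * (L * eulerInv s z) / q.totient

section bounds

variable {q : ℕ} {s : DirichletCharacter ℝ q}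

lemma one_sub_inv_le_one_sub_char_div (hs : s.IsQuadratic) (p : ℕ) :
    1 - 1 / (p : ℝ) ≤ 1 - s p / p := by
  have := (abs_le.1 (abs_char_le_one hs p)).2
  have : s p / p ≤ 1 / p := by gcongr
  linarith

lemma one_sub_inv_pos {z : ℝ} {p : ℕ} (hp : p ∈ primesUpTo z) : 0 < 1 - 1 / (p : ℝ) := by
  have : (1 : ℝ) < p := by exact_mod_cast (prime_of_mem_primesUpTo hp).one_lt
  rw [sub_pos, div_lt_one (by linarith)]; exact this

lemma rho_le_eulerInv (hs : s.IsQuadratic) (z : ℝ) : rho z ≤ eulerInv s z :=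
  prod_le_prod (fun _ hp => (one_sub_inv_pos hp).le) fun p _ => one_sub_inv_le_one_sub_char_div hs p

lemma eulerInv_mul_rho_le (hs : s.IsQuadratic) {w z : ℝ} (hwz : w ≤ z) :
    eulerInv s w * rho z ≤ eulerInv s z * rho w := by
  have hsub : primesUpTo w ⊆ primesUpTo z := by
    intro p hp
    simp only [primesUpTo, mem_filter, mem_range] at hp ⊢
    exact ⟨lt_of_lt_of_le hp.1 (by gcongr), hp.2⟩
  have h1 := prod_sdiff (f := fun p : ℕ => 1 - 1 / (p : ℝ)) hsub
  have h2 := prod_sdiff (f := fun p : ℕ => 1 - s p / p) hsub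
  change _ * rho w = rho z at h1
  change _ * eulerInv s w = eulerInv s z at h2
  rw [← h1, ← h2]
  have h3 : ∏ p ∈ primesUpTo z \ primesUpTo w, (1 - 1 / (p : ℝ)) ≤
      ∏ p ∈ primesUpTo z \ primesUpTo w, (1 - s p / p) :=
    prod_le_prod (fun p hp => (one_sub_inv_pos (mem_sdiff.1 hp).1).le)
      fun p _ => one_sub_inv_le_one_sub_char_div hs p
  have h4 : 0 ≤ eulerInv s w * rho w :=
    mul_nonneg ((rho_pos w).le.trans (rho_le_eulerInv hs w)) (rho_pos w).le
  have := mul_le_mul_of_nonneg_right h3 h4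
  linarith

end bounds

lemma exists_le_rpow (C : ℝ) {δ : ℝ} (hδ : 0 < δ) : ∃ Z₀ : ℝ, 4 ≤ Z₀ ∧ ∀ z, Z₀ ≤ z → C ≤ z ^ δ := by
  obtain ⟨Z, hZ⟩ := Filter.eventually_atTop.1 ((tendsto_rpow_atTop hδ).eventually_ge_atTop C)
  exact ⟨max 4 Z, le_max_left _ _, fun z hz => hZ z ((le_max_right _ _).trans hz)⟩

lemma natCast_le_rpow {q : ℕ} {z : ℝ} (h : (q : ℝ) ^ 200 ≤ z) : (q : ℝ) ≤ z ^ (1 / 200 : ℝ) := by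
  have : (q : ℝ) = ((q : ℝ) ^ (200 : ℕ)) ^ (1 / 200 : ℝ) := by
    rw [← Real.rpow_natCast, ← Real.rpow_mul (by positivity)]; norm_num
  rw [this]
  exact Real.rpow_le_rpow (by positivity) h (by norm_num)

theorem exists_rpow_le_roughDensity : ∃ Z₀ : ℝ, 4 ≤ Z₀ ∧ ∀ (z : ℝ) (q : ℕ) [NeZero q], Z₀ ≤ z →
    (q : ℝ) ^ 200 ≤ z → ∀ s : DirichletCharacter ℝ q, s ≠ 1 → s.IsQuadratic → ∀ L : ℝ,
    (∀ N : ℕ, |∑ n ∈ Ioc 0 N, s n / n - L| ≤ q / (N + 1)) →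
      z ^ (-(1 / 50) : ℝ) ≤ roughDensity s L z := by
  obtain ⟨c, hc, _, hrho⟩ := exists_rho_ge
  obtain ⟨Z₀, hZ4, hZ⟩ := exists_le_rpow (40 * 800 ^ 2 / c ^ 2) (δ := 3 / 400) (by norm_num)
  refine ⟨Z₀, hZ4, fun z q _ hz hqz s hs1 hs L hL => ?_⟩
  have hz4 : 4 ≤ z := hZ4.trans hz
  have hz0 : 0 < z := by linarith
  have hq : (1 : ℝ) ≤ q := by exact_mod_cast NeZero.one_le
  have hℓ : 0 < Real.log z := Real.log_pos (by linarith)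
  have hφ : (0 : ℝ) < q.totient := by exact_mod_cast Nat.totient_pos.2 (NeZero.pos q)
  have hφq : (q.totient : ℝ) ≤ q := by exact_mod_cast Nat.totient_le q
  have h1 := hrho z (by linarith)
  have h2 := h1.trans (rho_le_eulerInv hs z)
  have h3 := LFunction_one_ge hs1 hs hL
  have hlog : Real.log z ≤ 800 * z ^ (1 / 800 : ℝ) := by
    have := Real.log_le_rpow_div hz0.le (show (0 : ℝ) < 1 / 800 by norm_num)
    linarith
  have hq2 : (q : ℝ) ^ 2 ≤ z ^ (1 / 100 : ℝ) := by
    have := pow_le_pow_left₀ (by positivity) (natCast_le_rpow hqz) 2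
    rw [← Real.rpow_natCast (z ^ (1 / 200 : ℝ)), ← Real.rpow_mul hz0.le] at this
    norm_num at this ⊢
    exact this
  have hl2 : Real.log z ^ 2 ≤ 800 ^ 2 * z ^ (1 / 400 : ℝ) := by
    have := pow_le_pow_left₀ hℓ.le hlog 2
    rw [mul_pow, ← Real.rpow_natCast (z ^ (1 / 800 : ℝ)), ← Real.rpow_mul hz0.le] at this
    norm_num at this ⊢
    exact this
  calc z ^ (-(1 / 50) : ℝ) = 1 / (z ^ (1 / 100 : ℝ) * z ^ (1 / 400 : ℝ) * z ^ (3 / 400 : ℝ)) := by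
        rw [← Real.rpow_add hz0, ← Real.rpow_add hz0, Real.rpow_neg hz0.le, one_div]
        norm_num
    _ ≤ 1 / ((q : ℝ) ^ 2 * (Real.log z ^ 2 / 800 ^ 2) * (40 * 800 ^ 2 / c ^ 2)) := by
        apply one_div_le_one_div_of_le (by positivity)
        have := hZ z hz
        have : Real.log z ^ 2 / 800 ^ 2 ≤ z ^ (1 / 400 : ℝ) := by
          rw [div_le_iff₀ (by norm_num)]; linarith
        gcongr
    _ = c / Real.log z * (1 / (40 * q) * (c / Real.log z)) / q := by field_simp
    _ ≤ roughDensity s L z := by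
        have hρ := rho_pos z
        have hE : 0 < eulerInv s z := hρ.trans_le (rho_le_eulerInv hs z)
        have : 0 < L := lt_of_lt_of_le (by positivity) h3
        rw [roughDensity]
        gcongr

lemma roughSum_anti {q : ℕ} {s : DirichletCharacter ℝ q} (hs : s.IsQuadratic) {w z : ℝ}
    (h : w ≤ z) (a : ZMod q) (x : ℝ) : roughSum s z a x ≤ roughSum s w a x := by
  refine sum_le_sum_of_subset_of_nonneg ?_ fun n _ _ => divSum_nonneg hs n
  intro n hn
  rw [mem_filter] at hn ⊢
  refine ⟨hn.1, hn.2.1, fun p hp => hn.2.2 p ?_⟩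
  simp only [primesUpTo, mem_filter, mem_range] at hp ⊢
  exact ⟨lt_of_lt_of_le hp.1 (by gcongr), hp.2⟩

lemma roughSum_nonneg {q : ℕ} {s : DirichletCharacter ℝ q} (hs : s.IsQuadratic) (z : ℝ)
    (a : ZMod q) (x : ℝ) : 0 ≤ roughSum s z a x := sum_nonneg fun n _ => divSum_nonneg hs n

theorem exists_roughSum_le : ∃ K : ℝ, 1 ≤ K ∧ ∃ Z₀ : ℝ, 4 ≤ Z₀ ∧
    ∀ (z : ℝ) (q : ℕ) [NeZero q], Z₀ ≤ z →
    (q : ℝ) ^ 200 ≤ z → ∀ s : DirichletCharacter ℝ q, s ≠ 1 → s.IsQuadratic → ∀ L : ℝ,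
    (∀ N : ℕ, |∑ n ∈ Ioc 0 N, s n / n - L| ≤ q / (N + 1)) → ∀ (a : (ZMod q)ˣ) (t : ℝ), z ≤ t →
      roughSum s z a t ≤ K * roughDensity s L z * t := by
  obtain ⟨c, hc, hc1, hrho⟩ := exists_rho_ge
  obtain ⟨K, hK, hS⟩ := exists_abs_roughSum_sub_le
  obtain ⟨Z₁, hZ4, hW⟩ := exists_rpow_le_roughDensity
  obtain ⟨Z₂, _, hZ2⟩ := exists_le_rpow 9 (δ := 3 / 10) (by norm_num)
  refine ⟨2 * (1 + K) * (100 / c) ^ 2 + 1, by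
    have : 0 ≤ 2 * (1 + K) * (100 / c) ^ 2 := by positivity
    linarith, max Z₁ Z₂, hZ4.trans (le_max_left _ _), fun z q _ hz hqz s hs1 hs L hL a t ht => ?_⟩
  have hz1 : Z₁ ≤ z := (le_max_left _ _).trans hz
  have hz2 : Z₂ ≤ z := (le_max_right _ _).trans hz
  have hz4 : 4 ≤ z := hZ4.trans hz1
  have hz0 : 0 < z := by linarith
  have ht0 : 0 < t := by linarith
  have hφ : (0 : ℝ) < q.totient := by exact_mod_cast Nat.totient_pos.2 (NeZero.pos q)
  set w := z ^ (1 / 100 : ℝ) with hw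
  have hw1 : 1 < w := Real.one_lt_rpow (by linarith) (by norm_num)
  have hwz : w ≤ z := by
    calc w ≤ z ^ (1 : ℝ) := Real.rpow_le_rpow_of_exponent_le (by linarith) (by norm_num)
      _ = z := Real.rpow_one z
  have hqw : (q : ℝ) ≤ w := (natCast_le_rpow hqz).trans
    (Real.rpow_le_rpow_of_exponent_le (by linarith) (by norm_num))
  have hL0 : 0 < L := lt_of_lt_of_le (by have := NeZero.pos q; positivity) (LFunction_one_ge hs1 hs hL)
  have hWz := hW z q hz1 hqz s hs1 hs L hL
  have hW0 : 0 < roughDensity s L z := lt_of_lt_of_le (by positivity) hWz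
  have hsieve := (abs_le.1 (hS 0 w q hqw s hs1 hs L hL a t ht0.le)).2
  have hρz := rho_pos z
  have hρw := rho_pos w
  have hEz := hρz.trans_le (rho_le_eulerInv hs z)
  have hEw := hρw.trans_le (rho_le_eulerInv hs w)
  have hℓ : 0 < Real.log z := Real.log_pos (by linarith)
  have hr : rho w ≤ 100 / c * rho z := by
    have h1 := rho_le_inv_log hw1
    rw [hw, Real.log_rpow hz0] at h1
    have h2 := hrho z (by linarith)
    calc rho w ≤ 1 / (1 / 100 * Real.log z) := h1
      _ = 100 / c * (c / Real.log z) := by field_simp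
      _ ≤ _ := by gcongr
  have hE : eulerInv s w ≤ 100 / c * eulerInv s z := by
    have h1 := eulerInv_mul_rho_le hs hwz
    have h2 : eulerInv s w * rho z ≤ 100 / c * eulerInv s z * rho z := by
      calc _ ≤ eulerInv s z * rho w := h1
        _ ≤ eulerInv s z * (100 / c * rho z) := by gcongr
        _ = _ := by ring
    exact le_of_mul_le_mul_right h2 hρz
  have hmain : rho w * (L * eulerInv s w) * t / q.totient ≤ (100 / c) ^ 2 * roughDensity s L z * t := by
    calc _ ≤ (100 / c * rho z) * (L * (100 / c * eulerInv s z)) * t / q.totient := by gcongr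
      _ = _ := by rw [roughDensity]; ring
  have herr : 9 * √t * (w ^ (4 * 0 + 6)) ^ 3 ≤ roughDensity s L z * t := by
    have h1 : (w ^ (4 * 0 + 6)) ^ 3 = z ^ (18 / 100 : ℝ) := by
      rw [← pow_mul, hw, ← Real.rpow_natCast, ← Real.rpow_mul hz0.le]; norm_num
    have h2 : z ^ (1 / 2 : ℝ) ≤ √t := by
      rw [← Real.sqrt_eq_rpow]; exact Real.sqrt_le_sqrt ht
    calc 9 * √t * (w ^ (4 * 0 + 6)) ^ 3 ≤ z ^ (3 / 10 : ℝ) * √t * z ^ (18 / 100 : ℝ) := by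
          rw [h1]; gcongr; exact hZ2 z hz2
      _ = √t * (z ^ (-(1 / 50) : ℝ) * z ^ (1 / 2 : ℝ)) := by
          rw [← Real.rpow_add hz0, mul_comm (z ^ (3 / 10 : ℝ)), mul_assoc, ← Real.rpow_add hz0]
          norm_num
      _ ≤ √t * (roughDensity s L z * √t) := by gcongr
      _ = roughDensity s L z * t := by
          linear_combination roughDensity s L z * Real.mul_self_sqrt ht0.le
  have hsa := (abs_le.1 (abs_char_le_one hs a)).2
  have hsa' := (abs_le.1 (abs_char_le_one hs a)).1
  set M := rho w * (L * eulerInv s w) * t / q.totient with hM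
  have hM0 : 0 ≤ M := by positivity
  have hMM : (1 + s a) * M ≤ 2 * M := mul_le_mul_of_nonneg_right (by linarith) hM0
  have hKM : K * Real.exp (-((0 : ℕ) : ℝ)) * ((1 + s a) * M) ≤ K * (2 * M) := by
    simp only [Nat.cast_zero, neg_zero, Real.exp_zero, mul_one]
    exact mul_le_mul_of_nonneg_left hMM hK.le
  have hfin : 2 * (1 + K) * M ≤ 2 * (1 + K) * ((100 / c) ^ 2 * roughDensity s L z * t) := by gcongr
  have := roughSum_anti hs hwz (a : ZMod q) t
  linarith

theorem exists_roughSum_ge : ∃ X₁ : ℝ, 2 ≤ X₁ ∧ ∃ Z₀ : ℝ, 4 ≤ Z₀ ∧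
    ∀ (z : ℝ) (q : ℕ) [NeZero q], Z₀ ≤ z →
    (q : ℝ) ^ 200 ≤ z → ∀ s : DirichletCharacter ℝ q, s ≠ 1 → s.IsQuadratic → ∀ L : ℝ,
    (∀ N : ℕ, |∑ n ∈ Ioc 0 N, s n / n - L| ≤ q / (N + 1)) → ∀ a : (ZMod q)ˣ, s a = 1 →
    ∀ X : ℝ, X₁ ≤ X → 3 / 2 * (roughDensity s L z * z ^ X) ≤ roughSum s z a (z ^ X) := by
  obtain ⟨K, hK, hS⟩ := exists_abs_roughSum_sub_le
  obtain ⟨Z₁, hZ4, hW⟩ := exists_rpow_le_roughDensity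
  obtain ⟨b, hb⟩ : ∃ b : ℕ, K * Real.exp (-(b : ℝ)) ≤ 1 / 8 := by
    obtain ⟨b, hb⟩ := exists_nat_gt (8 * K)
    refine ⟨b, ?_⟩
    rw [Real.exp_neg, ← div_eq_mul_inv, div_le_iff₀ (Real.exp_pos _)]
    linarith [Real.add_one_le_exp (b : ℝ)]
  set k : ℕ := (4 * b + 6) * 3 with hk
  refine ⟨2 * k + 4, by have : (0 : ℝ) ≤ k := by positivity
                        linarith, max Z₁ 36, hZ4.trans (le_max_left _ _),
    fun z q _ hz hqz s hs1 hs L hL a ha X hX => ?_⟩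
  have hz1 : Z₁ ≤ z := (le_max_left _ _).trans hz
  have hz2 : 36 ≤ z := (le_max_right _ _).trans hz
  have hz0 : 0 < z := by linarith
  have hq : (1 : ℝ) ≤ q := by exact_mod_cast NeZero.one_le
  have hqz' : (q : ℝ) ≤ z := (le_self_pow₀ hq (by norm_num)).trans hqz
  have hWz := hW z q hz1 hqz s hs1 hs L hL
  have hW0 : 0 < roughDensity s L z := lt_of_lt_of_le (by positivity) hWz
  set x := z ^ X with hx
  have hx0 : 0 < x := by positivity
  have hsieve := (abs_le.1 (hS b z q hqz' s hs1 hs L hL a x hx0.le)).1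
  have e : (1 + s a) * (rho z * (L * eulerInv s z) * x / q.totient) = 2 * (roughDensity s L z * x) := by
    rw [ha, roughDensity]; ring
  rw [e] at hsieve
  have herr : 9 * √x * (z ^ (4 * b + 6)) ^ 3 ≤ 1 / 4 * (roughDensity s L z * x) := by
    have h1 : √x = z ^ (X / 2) := by
      rw [Real.sqrt_eq_rpow, hx, ← Real.rpow_mul hz0.le]; ring_nf
    have h2 : 36 * z ^ k ≤ z ^ (-(1 / 50) : ℝ) * √x := by
      calc 36 * z ^ k ≤ z ^ (1 : ℝ) * z ^ (k : ℝ) := by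
            rw [Real.rpow_one, Real.rpow_natCast]; gcongr
        _ = z ^ (1 + k : ℝ) := (Real.rpow_add hz0 _ _).symm
        _ ≤ z ^ (-(1 / 50) + X / 2) := Real.rpow_le_rpow_of_exponent_le (by linarith) (by linarith)
        _ = _ := by rw [Real.rpow_add hz0, h1]
    have h3 : 36 * z ^ k * √x ≤ roughDensity s L z * x := by
      calc 36 * z ^ k * √x ≤ z ^ (-(1 / 50) : ℝ) * √x * √x := by gcongr
        _ = z ^ (-(1 / 50) : ℝ) * x := by rw [mul_assoc, Real.mul_self_sqrt hx0.le]
        _ ≤ _ := by gcongr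
    rw [← pow_mul, ← hk]
    linarith
  have h8 : K * Real.exp (-(b : ℝ)) * (2 * (roughDensity s L z * x)) ≤
      1 / 8 * (2 * (roughDensity s L z * x)) := mul_le_mul_of_nonneg_right hb (by positivity)
  linarith

lemma rough_prime_mul_iff {z : ℝ} (hz : 0 ≤ z) {p : ℕ} (hp : p.Prime) (h : z < p) (m : ℕ) :
    Rough z (p * m) ↔ Rough z m := by
  refine ⟨fun H r hr hrm => H r hr (hrm.mul_left p), fun H r hr hrm => ?_⟩
  rcases ((prime_of_mem_primesUpTo hr).dvd_mul).1 hrm with h' | h'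
  · exact not_dvd_of_prime_of_lt hz hp h r hr h'
  · exact H r hr h'

/-- The primes in `(z, √x]`. -/
noncomputable def sievingPrimes (z x : ℝ) : Finset ℕ :=
  (Ioc 0 ⌊√x⌋₊).filter fun p : ℕ => p.Prime ∧ z < p

lemma mem_sievingPrimes {z x : ℝ} {p : ℕ} :
    p ∈ sievingPrimes z x ↔ p.Prime ∧ z < p ∧ (p : ℝ) ≤ √x := by
  simp only [sievingPrimes, mem_filter, mem_Ioc, Nat.le_floor_iff (Real.sqrt_nonneg x)]
  exact ⟨fun h => ⟨h.2.1, h.2.2, h.1.2⟩, fun h => ⟨⟨h.1.pos, h.2.2⟩, h.1, h.2.1⟩⟩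

section decomposition

variable {q : ℕ} {s : DirichletCharacter ℝ q}

/-- The part of `roughSum` supported on multiples of `p`. -/
noncomputable def roughMultSum (s : DirichletCharacter ℝ q) (z : ℝ) (a : ZMod q) (x : ℝ) (p : ℕ) : ℝ :=
  ∑ n ∈ (Ioc 0 ⌊x⌋₊).filter (fun n : ℕ => ((n : ZMod q) = a ∧ Rough z n) ∧ p ∣ n), divSum s n

lemma roughSum_le_add_sum (hs : s.IsQuadratic) {z : ℝ} (hz : 0 ≤ z) (a : ZMod q) (x : ℝ) :
    roughSum s z a x ≤ 1 + 2 * primeCount a x + ∑ p ∈ sievingPrimes z x, roughMultSum s z a x p := by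
  set T := (Ioc 0 ⌊x⌋₊).filter (fun n : ℕ => (n : ZMod q) = a ∧ Rough z n) with hT
  have hone : divSum s 1 = 1 := by simp [divSum]
  have hpt : ∀ n ∈ T, divSum s n ≤ (if n = 1 then 1 else 0) + (if n.Prime then 2 else 0) +
      ∑ p ∈ sievingPrimes z x, if p ∣ n then divSum s n else 0 := by
    intro n hn
    obtain ⟨hnx, -, hr⟩ := mem_filter.1 hn
    have hn0 := (mem_Ioc.1 hnx).1
    have hd := divSum_nonneg hs n
    have hsum : 0 ≤ ∑ p ∈ sievingPrimes z x, if p ∣ n then divSum s n else 0 :=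
      sum_nonneg fun p _ => by split_ifs <;> simp [hd]
    by_cases h1 : n = 1
    · subst h1
      rw [hone] at hsum ⊢
      simp only [if_true, Nat.not_prime_one, if_false]
      linarith
    by_cases hp : n.Prime
    · rw [if_neg h1, if_pos hp]
      have := (abs_le.1 (abs_char_le_one hs n)).2
      rw [divSum_prime hp] at hsum ⊢
      linarith
    · rw [if_neg h1, if_neg hp]
      have hm := Nat.minFac_prime h1
      have hmem : n.minFac ∈ sievingPrimes z x := by
        rw [mem_sievingPrimes]
        refine ⟨hm, ?_, ?_⟩
        · by_contra hc
          push Not at hc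
          exact hr _ ((mem_primesUpTo hz).2 ⟨hm, hc⟩) (Nat.minFac_dvd n)
        · apply Real.le_sqrt_of_sq_le
          have h2 : n.minFac ^ 2 ≤ n := Nat.minFac_sq_le_self hn0 hp
          have hx0 : 0 ≤ x := by
            by_contra hc
            push Not at hc
            rw [Nat.floor_of_nonpos hc.le] at hnx
            simp at hnx
          have h4 : (n : ℝ) ≤ x := (Nat.le_floor_iff hx0).1 (mem_Ioc.1 hnx).2
          have h5 : ((n.minFac ^ 2 : ℕ) : ℝ) ≤ n := by exact_mod_cast h2
          push_cast at h5
          linarith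
      have := single_le_sum (f := fun p => if p ∣ n then divSum s n else 0)
        (fun p _ => by split_ifs <;> simp [hd]) hmem
      simp only [Nat.minFac_dvd, if_true] at this
      linarith
  have h1 : ∑ n ∈ T, (if n = 1 then (1 : ℝ) else 0) ≤ 1 := by
    rw [sum_ite_eq']; split_ifs <;> norm_num
  have h2 : ∑ n ∈ T, (if n.Prime then (2 : ℝ) else 0) ≤ 2 * primeCount a x := by
    rw [← sum_filter, sum_const, nsmul_eq_mul, mul_comm]
    have : #(T.filter fun n : ℕ => n.Prime) ≤ primeCount a x := by
      apply card_le_card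
      intro n hn
      simp only [hT, mem_filter] at hn ⊢
      exact ⟨hn.1.1, hn.2, hn.1.2.1⟩
    gcongr
  have h3 : ∑ n ∈ T, ∑ p ∈ sievingPrimes z x, (if p ∣ n then divSum s n else 0) =
      ∑ p ∈ sievingPrimes z x, roughMultSum s z a x p := by
    rw [sum_comm]
    refine sum_congr rfl fun p _ => ?_
    rw [← sum_filter, hT, filter_filter, roughMultSum]
  calc roughSum s z a x = ∑ n ∈ T, divSum s n := rfl
    _ ≤ _ := sum_le_sum hpt
    _ ≤ _ := by rw [sum_add_distrib, sum_add_distrib, h3]; linarith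

lemma roughSum_le_one (hs : s.IsQuadratic) {z : ℝ} (hz : 0 ≤ z) (a : ZMod q) {x : ℝ} (hx : x ≤ z) :
    roughSum s z a x ≤ 1 := by
  have hsub : (Ioc 0 ⌊x⌋₊).filter (fun n : ℕ => (n : ZMod q) = a ∧ Rough z n) ⊆ {1} := by
    intro n hn
    obtain ⟨hnx, -, hr⟩ := mem_filter.1 hn
    have hnx := mem_Ioc.1 hnx
    rw [mem_singleton]
    by_contra h1
    have := hr.lt_of_one_lt hz (by omega)
    have h2 : (n : ℝ) ≤ ⌊z⌋₊ := by exact_mod_cast hnx.2.trans (Nat.floor_le_floor hx)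
    linarith [Nat.floor_le hz]
  calc roughSum s z a x ≤ ∑ n ∈ {1}, divSum s n :=
        sum_le_sum_of_subset_of_nonneg hsub fun n _ _ => divSum_nonneg hs n
    _ = 1 := by simp [divSum]

lemma isUnit_natCast_of_prime_of_lt [NeZero q] {p : ℕ} (hp : p.Prime) (h : q < p) :
    IsUnit (p : ZMod q) := by
  rw [ZMod.isUnit_iff_coprime, Nat.Prime.coprime_iff_not_dvd hp]
  exact fun hd => absurd (Nat.le_of_dvd (NeZero.pos q) hd) (by omega)

lemma roughMultSum_le [NeZero q] (hs : s.IsQuadratic) {z A x : ℝ} (hqz : (q : ℝ) ≤ z)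
    (hA : ∀ (a : (ZMod q)ˣ) (t : ℝ), z ≤ t → roughSum s z a t ≤ A * t) (hA0 : 0 ≤ A)
    (hx : z ^ 2 ≤ x) (a : (ZMod q)ˣ) {p : ℕ} (hp : p ∈ sievingPrimes z x) :
    roughMultSum s z a x p ≤
      2 * A * x * ((if s p = 1 then 1 else 0) / p) + (A * x * ((p : ℝ) ^ 2)⁻¹ + 1) := by
  obtain ⟨hpp, hzp, hpx⟩ := mem_sievingPrimes.1 hp
  have hz0 : 0 ≤ z := (Nat.cast_nonneg q).trans hqz
  have hx0 : 0 ≤ x := (sq_nonneg z).trans hx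
  have hp0 : (0 : ℝ) < p := by exact_mod_cast hpp.pos
  have hqp : q < p := by exact_mod_cast hqz.trans_lt hzp
  obtain ⟨u, hu⟩ := isUnit_natCast_of_prime_of_lt hpp hqp
  have hsq := sum_divSum_filter_dvd (s := s) hpp hu (Q := Rough z)
    (fun m => rough_prime_mul_iff hz0 hpp hzp m) (a : ZMod q) x
  change roughMultSum s z a x p = (1 + s p) * roughSum s z (a * ↑u⁻¹) (x / p) -
    s p * roughSum s z (a * ↑u⁻¹ * ↑u⁻¹) (x / p / p) at hsq
  have hsp : s p = 1 ∨ s p = -1 := by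
    rcases hs p with h | h | h
    · rw [← hu] at h
      exact absurd h ((u.isUnit.map s).ne_zero)
    · exact Or.inl h
    · exact Or.inr h
  have e1 : (a : ZMod q) * ↑u⁻¹ = ((a * u⁻¹ : (ZMod q)ˣ) : ZMod q) := by push_cast; rfl
  have e2 : (a : ZMod q) * ↑u⁻¹ * ↑u⁻¹ = ((a * u⁻¹ * u⁻¹ : (ZMod q)ˣ) : ZMod q) := by push_cast; rfl
  rw [e2, e1] at hsq
  have hpos : 0 ≤ A * x * ((p : ℝ) ^ 2)⁻¹ := by positivity
  rcases hsp with h | h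
  · rw [hsq, h, if_pos rfl]
    have hzx : z ≤ x / p := by
      rw [le_div_iff₀ hp0]
      have h1 : z ≤ √x := Real.le_sqrt_of_sq_le hx
      calc z * p ≤ √x * √x := by gcongr
        _ = x := Real.mul_self_sqrt hx0
    have h1 := hA (a * u⁻¹) (x / p) hzx
    have h2 := roughSum_nonneg hs z ((a * u⁻¹ * u⁻¹ : (ZMod q)ˣ) : ZMod q) (x / p / p)
    have h3 : 2 * A * x * (1 / p) = 2 * (A * (x / p)) := by ring
    linarith
  · rw [hsq, h, if_neg (by norm_num)]
    have h3 : A * x * ((p : ℝ) ^ 2)⁻¹ = A * (x / p / p) := by field_simp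
    rcases le_total z (x / p / p) with h4 | h4
    · have := hA (a * u⁻¹ * u⁻¹) _ h4
      rw [h3]
      simp only [zero_div, mul_zero]
      linarith
    · have := roughSum_le_one hs hz0 ((a * u⁻¹ * u⁻¹ : (ZMod q)ˣ) : ZMod q) h4
      simp only [zero_div, mul_zero]
      linarith

/-- Partial summation of `∑ c n / n` when the partial sums of `c` grow at most linearly. -/
lemma sum_div_le_of_sum_le {c : ℕ → ℝ} {C : ℝ} (hC : 0 ≤ C)
    (h : ∀ N : ℕ, ∑ n ∈ Ioc 0 N, c n ≤ C * N) (N : ℕ) :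
    ∑ n ∈ Ioc 0 N, c n / n ≤ C * (1 + Real.log N) := by
  have hind : ∀ N : ℕ, ∑ n ∈ Ioc 0 N, c n / n ≤
      (∑ n ∈ Ioc 0 N, c n - C * N) / (N + 1) + C * ∑ n ∈ range N, ((n : ℝ) + 1)⁻¹ := by
    intro N
    induction N with
    | zero => simp
    | succ N ih =>
      have hN := h N
      rw [sum_Ioc_succ_top (Nat.zero_le N), sum_Ioc_succ_top (Nat.zero_le N), sum_range_succ]
      push_cast
      set S := ∑ n ∈ Ioc 0 N, c n
      have h1 : (S - C * N) / ((N : ℝ) + 1) + c (N + 1) / ((N : ℝ) + 1) =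
          (S + c (N + 1) - C * (N + 1)) / ((N : ℝ) + 1) + C * ((N : ℝ) + 1)⁻¹ := by
        field_simp; ring
      have h2 := h (N + 1)
      rw [sum_Ioc_succ_top (Nat.zero_le N)] at h2
      push_cast at h2
      have h3 : (S + c (N + 1) - C * (N + 1)) / ((N : ℝ) + 1) ≤
          (S + c (N + 1) - C * (N + 1)) / ((N : ℝ) + 1 + 1) := by
        rw [div_le_div_iff₀ (by positivity) (by positivity)]
        nlinarith
      rw [mul_add C (∑ n ∈ range N, ((n : ℝ) + 1)⁻¹)]
      linarith
  refine (hind N).trans ?_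
  have h1 : (∑ n ∈ Ioc 0 N, c n - C * N) / ((N : ℝ) + 1) ≤ 0 :=
    div_nonpos_of_nonpos_of_nonneg (by linarith [h N]) (by positivity)
  have h2 : ∑ n ∈ range N, ((n : ℝ) + 1)⁻¹ ≤ 1 + Real.log N := by
    have := harmonic_le_one_add_log N
    simp only [harmonic] at this
    push_cast at this
    exact this
  have := mul_le_mul_of_nonneg_left h2 hC
  linarith

lemma sum_split_primes_le [NeZero q] (hs : s.IsQuadratic) {z A : ℝ} (hqz : (q : ℝ) ≤ z) (hA0 : 0 ≤ A)
    (hA : ∀ (a : (ZMod q)ˣ) (t : ℝ), z ≤ t → roughSum s z a t ≤ A * t) (N : ℕ) :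
    ∑ p ∈ Ioc 0 N, (if p.Prime ∧ z < p ∧ s p = 1 then (1 : ℝ) else 0) ≤
      A * q.totient / 2 * N := by
  have hz0 : 0 ≤ z := (Nat.cast_nonneg q).trans hqz
  rcases lt_or_ge (N : ℝ) z with hN | hN
  · rw [sum_eq_zero]
    · positivity
    · intro p hp
      rw [if_neg]
      rintro ⟨-, h, -⟩
      have : (p : ℝ) ≤ N := by exact_mod_cast (mem_Ioc.1 hp).2
      linarith
  have hpt : ∀ k ∈ Ioc 0 N, 2 * (if k.Prime ∧ z < k ∧ s k = 1 then (1 : ℝ) else 0) ≤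
      ∑ a : (ZMod q)ˣ, if (k : ZMod q) = a ∧ Rough z k then divSum s k else 0 := by
    intro k _
    have hnn : ∀ a ∈ (univ : Finset (ZMod q)ˣ),
        0 ≤ if (k : ZMod q) = a ∧ Rough z k then divSum s k else 0 := by
      intro a _
      split_ifs
      · exact divSum_nonneg hs k
      · exact le_rfl
    split_ifs with h
    · obtain ⟨hk, hzk, hsk⟩ := h
      have hqk : q < k := by exact_mod_cast hqz.trans_lt hzk
      obtain ⟨u, hu⟩ := isUnit_natCast_of_prime_of_lt hk hqk
      refine le_trans ?_ (single_le_sum hnn (mem_univ u))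
      rw [if_pos ⟨hu.symm, not_dvd_of_prime_of_lt hz0 hk hzk⟩, divSum_prime hk, hsk]
      norm_num
    · rw [mul_zero]; exact sum_nonneg hnn
  have h1 := sum_le_sum hpt
  rw [← mul_sum, sum_comm] at h1
  have h2 : ∑ a : (ZMod q)ˣ, ∑ k ∈ Ioc 0 N, (if (k : ZMod q) = a ∧ Rough z k then divSum s k else 0)
      ≤ ∑ _a : (ZMod q)ˣ, A * N := by
    refine sum_le_sum fun a _ => ?_
    rw [← sum_filter]
    have := hA a N hN
    rwa [roughSum, Nat.floor_natCast] at this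
  rw [sum_const, card_univ, ZMod.card_units_eq_totient, nsmul_eq_mul] at h2
  linarith

lemma sum_sievingPrimes_split_le [NeZero q] (hs : s.IsQuadratic) {z A : ℝ} (hqz : (q : ℝ) ≤ z)
    (hA0 : 0 ≤ A) (hA : ∀ (a : (ZMod q)ˣ) (t : ℝ), z ≤ t → roughSum s z a t ≤ A * t) {x : ℝ}
    (hx : 1 ≤ x) :
    ∑ p ∈ sievingPrimes z x, (if s p = 1 then (1 : ℝ) else 0) / p ≤
      A * q.totient / 2 * (1 + Real.log x / 2) := by
  have h1 := sum_div_le_of_sum_le (c := fun p : ℕ => if p.Prime ∧ z < p ∧ s p = 1 then (1 : ℝ) else 0)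
    (by positivity) (sum_split_primes_le hs hqz hA0 hA) ⌊√x⌋₊
  have h2 : ∑ p ∈ sievingPrimes z x, (if s p = 1 then (1 : ℝ) else 0) / p =
      ∑ p ∈ Ioc 0 ⌊√x⌋₊, (if p.Prime ∧ z < p ∧ s p = 1 then (1 : ℝ) else 0) / p := by
    rw [sievingPrimes, sum_filter]
    refine sum_congr rfl fun p _ => ?_
    by_cases ha : p.Prime <;> by_cases hb : z < p <;> simp [ha, hb]
  rw [h2]
  refine h1.trans ?_
  have hsx : 1 ≤ √x := by rw [Real.one_le_sqrt]; exact hx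
  have h3 : Real.log ⌊√x⌋₊ ≤ Real.log x / 2 := by
    rw [← Real.log_sqrt (by linarith)]
    apply Real.log_le_log
    · exact_mod_cast Nat.floor_pos.2 hsx
    · exact Nat.floor_le (by linarith)
  gcongr

lemma sum_sievingPrimes_inv_sq_le {z x : ℝ} (hz : 1 ≤ z) (hx : z ^ 2 ≤ x) :
    ∑ p ∈ sievingPrimes z x, ((p : ℝ) ^ 2)⁻¹ ≤ 2 / z := by
  have hzx : z ≤ √x := Real.le_sqrt_of_sq_le hx
  have hf : 1 ≤ ⌊z⌋₊ := Nat.floor_pos.2 hz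
  have hf' : (1 : ℝ) ≤ ⌊z⌋₊ := by exact_mod_cast hf
  have hsub : sievingPrimes z x ⊆ Ioc ⌊z⌋₊ ⌊√x⌋₊ := by
    intro p hp
    obtain ⟨-, h1, h2⟩ := mem_sievingPrimes.1 hp
    exact mem_Ioc.2 ⟨(Nat.floor_lt (by linarith)).2 h1, Nat.le_floor h2⟩
  calc _ ≤ ∑ p ∈ Ioc ⌊z⌋₊ ⌊√x⌋₊, ((p : ℝ) ^ 2)⁻¹ :=
        sum_le_sum_of_subset_of_nonneg hsub fun _ _ _ => by positivity
    _ ≤ (⌊z⌋₊ : ℝ)⁻¹ - (⌊√x⌋₊ : ℝ)⁻¹ :=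
        sum_Ioc_inv_sq_le_sub (by omega) (Nat.floor_le_floor hzx)
    _ ≤ (⌊z⌋₊ : ℝ)⁻¹ := by
        have : 0 ≤ (⌊√x⌋₊ : ℝ)⁻¹ := by positivity
        linarith
    _ ≤ 2 / z := by
        rw [inv_le_comm₀ (by linarith) (by positivity), inv_div]
        linarith [Nat.lt_floor_add_one z]

end decomposition

/-- Primes in a residue class on which the real character is `1`, when its `L`-value is small. -/
theorem exists_primeCount_ge_of_small_LFunction : ∃ c : ℝ, 0 < c ∧ ∃ X₁ : ℝ, 2 ≤ X₁ ∧
    ∃ Z₀ : ℝ, 4 ≤ Z₀ ∧ ∀ (z : ℝ) (q : ℕ) [NeZero q], Z₀ ≤ z →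
    (q : ℝ) ^ 200 ≤ z → ∀ s : DirichletCharacter ℝ q, s ≠ 1 → s.IsQuadratic → ∀ L : ℝ,
    (∀ N : ℕ, |∑ n ∈ Ioc 0 N, s n / n - L| ≤ q / (N + 1)) → ∀ a : (ZMod q)ˣ, s a = 1 →
    ∀ X : ℝ, X₁ ≤ X → L * eulerInv s z * X ≤ c → z ^ (X - 1) ≤ primeCount (a : ZMod q) (z ^ X) := by
  obtain ⟨Z₁, hZ4, hW⟩ := exists_rpow_le_roughDensity
  obtain ⟨K, hK, Z₂, -, hup⟩ := exists_roughSum_le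
  obtain ⟨X₁, hX2, Z₃, -, hlo⟩ := exists_roughSum_ge
  obtain ⟨Z₄, -, hZ16⟩ := exists_le_rpow 16 (δ := 49 / 50) (by norm_num)
  refine ⟨1 / (4 * K ^ 2), by positivity, X₁, hX2, max (max Z₁ Z₂) (max (max Z₃ Z₄) (16 * K)),
    hZ4.trans ((le_max_left _ _).trans (le_max_left _ _)),
    fun z q _ hz hqz s hs1 hs L hL a ha X hX hsmall => ?_⟩
  simp only [max_le_iff] at hz
  obtain ⟨⟨hz1, hz2⟩, ⟨hz3, hz4⟩, hzK⟩ := hz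
  have h4z : 4 ≤ z := hZ4.trans hz1
  have hz0 : 0 < z := by linarith
  have hℓ := log_ge_of_four_le h4z
  have hq : (1 : ℝ) ≤ q := by exact_mod_cast NeZero.one_le
  have hqz1 : (q : ℝ) ≤ z := (le_self_pow₀ hq (by norm_num)).trans hqz
  have hφ : (0 : ℝ) < q.totient := by exact_mod_cast Nat.totient_pos.2 (NeZero.pos q)
  have hWz := hW z q hz1 hqz s hs1 hs L hL
  set W := roughDensity s L z with hWdef
  have hW0 : 0 < W := lt_of_lt_of_le (by positivity) hWz
  set x := z ^ X with hxdef
  have hx0 : 0 < x := by positivity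
  have hzx : z ^ 2 ≤ x := by
    rw [hxdef, ← Real.rpow_natCast]
    exact Real.rpow_le_rpow_of_exponent_le (by linarith) (by push_cast; linarith)
  have hx1 : 1 ≤ x := by nlinarith
  have hA := hup z q hz2 hqz s hs1 hs L hL
  have hlow := hlo z q hz3 hqz s hs1 hs L hL a ha X hX
  have hA0 : 0 ≤ K * W := by positivity
  have hdec := roughSum_le_add_sum hs hz0.le (a : ZMod q) x
  have hcomp : ∑ p ∈ sievingPrimes z x, roughMultSum s z a x p ≤
      2 * (K * W) * x * (K * W * q.totient / 2 * (1 + Real.log x / 2)) +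
        (K * W * x * (2 / z) + √x) := by
    refine (sum_le_sum fun p hp => roughMultSum_le hs hqz1 hA hA0 hzx a hp).trans ?_
    rw [sum_add_distrib, sum_add_distrib, ← mul_sum, ← mul_sum]
    have h1 := sum_sievingPrimes_split_le hs hqz1 hA0 hA hx1
    have h2 := sum_sievingPrimes_inv_sq_le (by linarith) hzx
    have h3 : ∑ _p ∈ sievingPrimes z x, (1 : ℝ) ≤ √x := by
      rw [sum_const, nsmul_eq_mul, mul_one]
      refine le_trans ?_ (Nat.floor_le (Real.sqrt_nonneg x))
      have : #(sievingPrimes z x) ≤ #(Ioc 0 ⌊√x⌋₊) := card_filter_le _ _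
      rw [Nat.card_Ioc] at this
      exact_mod_cast this
    gcongr
  have hWφ : W * q.totient = rho z * (L * eulerInv s z) := by
    rw [hWdef, roughDensity]; field_simp
  have hf0 : 0 ≤ L * eulerInv s z := by
    have : 0 < rho z * (L * eulerInv s z) := by rw [← hWφ]; positivity
    exact (pos_of_mul_pos_right this (rho_pos z).le).le
  have hlogx : Real.log x = X * Real.log z := Real.log_rpow hz0 X
  have hmain : W * q.totient * (1 + Real.log x / 2) ≤ 1 / (4 * K ^ 2) := by
    refine le_trans ?_ hsmall
    have h1 : 1 + Real.log x / 2 ≤ X * Real.log z := by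
      rw [hlogx]
      nlinarith
    calc W * q.totient * (1 + Real.log x / 2)
        ≤ (1 / Real.log z * (L * eulerInv s z)) * (X * Real.log z) := by
          rw [hWφ]
          have := rho_le_inv_log (z := z) (by linarith)
          have hlx := Real.log_nonneg hx1
          gcongr
      _ = L * eulerInv s z * X := by field_simp
  have hfirst : 2 * (K * W) * x * (K * W * q.totient / 2 * (1 + Real.log x / 2)) ≤ 1 / 4 * (W * x) := by
    calc _ = K ^ 2 * (W * x) * (W * q.totient * (1 + Real.log x / 2)) := by ring
      _ ≤ K ^ 2 * (W * x) * (1 / (4 * K ^ 2)) := by gcongr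
      _ = _ := by field_simp
  have hsecond : K * W * x * (2 / z) ≤ 1 / 8 * (W * x) := by
    have : K * (2 / z) ≤ 1 / 8 := by
      rw [mul_div_assoc', div_le_iff₀ hz0]; linarith
    calc _ = (K * (2 / z)) * (W * x) := by ring
      _ ≤ _ := by gcongr
  have hsx : √x = z ^ (X / 2) := by
    rw [Real.sqrt_eq_rpow, hxdef, ← Real.rpow_mul hz0.le]; ring_nf
  have hWx : z ^ (X - 1 / 50) ≤ W * x := by
    calc z ^ (X - 1 / 50) = z ^ (-(1 / 50) : ℝ) * x := by
          rw [hxdef, ← Real.rpow_add hz0]; ring_nf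
      _ ≤ _ := by gcongr
  have h16 := hZ16 z hz4
  have hthird : 16 * √x ≤ W * x := by
    refine le_trans ?_ hWx
    calc 16 * √x ≤ z ^ (49 / 50 : ℝ) * z ^ (X / 2) := by rw [hsx]; gcongr
      _ = z ^ (49 / 50 + X / 2) := by rw [← Real.rpow_add hz0]
      _ ≤ _ := Real.rpow_le_rpow_of_exponent_le (by linarith) (by linarith)
  have hsx1 : 1 ≤ √x := by rw [Real.one_le_sqrt]; exact hx1
  have hfin : 16 * z ^ (X - 1) ≤ W * x := by
    refine le_trans ?_ hWx
    calc 16 * z ^ (X - 1) ≤ z ^ (49 / 50 : ℝ) * z ^ (X - 1) := by gcongr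
      _ = z ^ (X - 1 / 50) := by rw [← Real.rpow_add hz0]; ring_nf
  have hpos : 0 < z ^ (X - 1) := by positivity
  linarith

/-- The value at `1` of the `L`-function with the small Euler factors removed. -/
lemma LFunction_roughChar_eq_mul_eulerInv {q : ℕ} [NeZero q] {z : ℝ} (hqz : (q : ℝ) ≤ z)
    {χ : DirichletCharacter ℂ q} (hχ : χ ≠ 1) {s : DirichletCharacter ℝ q}
    (hχs : ∀ a, χ a = (s a : ℂ)) {L : ℝ} (hL : DirichletCharacter.LFunction χ 1 = L) :
    DirichletCharacter.LFunction (roughChar z χ) 1 = ((L * eulerInv s z : ℝ) : ℂ) := by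
  have hz0 : 0 ≤ z := (Nat.cast_nonneg q).trans hqz
  have hpf : (modulus q z).primeFactors = primesUpTo z := by
    ext p
    rw [mem_primesUpTo hz0, Nat.mem_primeFactors]
    constructor
    · rintro ⟨hp, hd, -⟩
      refine ⟨hp, ?_⟩
      rcases (hp.dvd_mul).1 hd with h | h
      · have : (p : ℝ) ≤ q := by exact_mod_cast Nat.le_of_dvd (NeZero.pos q) h
        linarith
      · obtain ⟨r, hr, hpr⟩ := (hp.prime.dvd_finsetProd_iff _).1 h
        have hr' := (mem_primesUpTo hz0).1 hr
        rw [(Nat.prime_dvd_prime_iff_eq hp hr'.1).1 hpr]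
        exact hr'.2
    · rintro ⟨hp, hpz⟩
      refine ⟨hp, (dvd_prod_of_mem (fun p => p) ((mem_primesUpTo hz0).2 ⟨hp, hpz⟩)).mul_left q,
        NeZero.ne _⟩
  have h := DirichletCharacter.LFunction_changeLevel (N := modulus q z) (Dvd.intro _ rfl) χ (s := 1)
    (Or.inl hχ)
  refine h.trans ?_
  rw [hL, hpf, eulerInv]
  push_cast
  congr 1
  refine prod_congr rfl fun p _ => ?_
  rw [hχs, Complex.cpow_neg, Complex.cpow_one, div_eq_mul_inv]

lemma exists_rpow_le_primeCount_mul : ∃ A : ℕ, 1 ≤ A ∧ ∃ W : ℝ, 0 < W ∧ ∃ X₀ : ℝ, 2 ≤ X₀ ∧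
    ∀ (q : ℕ) [NeZero q], 8 ≤ q → ∀ (a : (ZMod q)ˣ) (X : ℝ), X₀ ≤ X →
      ((q : ℝ) ^ A) ^ (X - W) ≤
        primeCount (a : ZMod q) (((q : ℝ) ^ A) ^ X) * (X * Real.log ((q : ℝ) ^ A)) := by
  obtain ⟨K, hK, hpolar⟩ := exists_hasPolarForm
  obtain ⟨c, hc, X₁, hX₁, Z₀, hZ4, hexc⟩ := exists_primeCount_ge_of_small_LFunction
  set κ := 1 - Real.exp (-(c / K) / 4) with hκ
  have hcK : 0 < c / K := by positivity
  have hκ0 : 0 < κ := by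
    rw [hκ, sub_pos, Real.exp_lt_one_iff]; linarith
  have hκ1 : κ ≤ 1 := by rw [hκ]; linarith [Real.exp_pos (-(c / K) / 4)]
  obtain ⟨W, hW, X₂, hX₂, hreg⟩ := exists_primeCount_ge_of_hasPolarForm (by linarith : 0 ≤ K) hκ0
  obtain ⟨m, hm⟩ := pow_unbounded_of_one_lt Z₀ (show (1 : ℝ) < 8 by norm_num)
  refine ⟨m + 200, by omega, max W 1, lt_max_of_lt_left hW, max X₁ X₂,
    hX₁.trans (le_max_left _ _), fun q _ hq a X hX => ?_⟩
  have hq8 : (8 : ℝ) ≤ q := by exact_mod_cast hq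
  have hq1 : (1 : ℝ) ≤ q := by linarith
  set z := (q : ℝ) ^ (m + 200) with hz
  have hZz : Z₀ ≤ z := by
    calc Z₀ ≤ 8 ^ m := hm.le
      _ ≤ (q : ℝ) ^ m := by gcongr
      _ ≤ z := pow_le_pow_right₀ hq1 (by omega)
  have hz4 : 4 ≤ z := hZ4.trans hZz
  have hz200 : (q : ℝ) ^ 200 ≤ z := pow_le_pow_right₀ hq1 (by omega)
  have hz20 : (q : ℝ) ^ 20 ≤ z := pow_le_pow_right₀ hq1 (by omega)
  have hqz : (q : ℝ) ≤ z := le_self_pow₀ hq1 (by omega)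
  have hℓ := log_ge_of_four_le hz4
  have hX1 : X₁ ≤ X := (le_max_left _ _).trans hX
  have hX2 : X₂ ≤ X := (le_max_right _ _).trans hX
  have hz1 : 1 ≤ z := by linarith
  have hregular : ∀ lam τ : ℝ, 0 ≤ lam → |τ| ≤ 1 → HasPolarForm q z K lam τ a →
      (∀ v, X / 4 ≤ v → κ ≤ 1 - τ * Real.exp (-lam * v)) →
      z ^ (X - max W 1) ≤ primeCount (a : ZMod q) (z ^ X) * (X * Real.log z) :=
    fun lam τ hlam hτ hpf hv =>
      (Real.rpow_le_rpow_of_exponent_le hz1 (by linarith [le_max_left W 1])).trans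
        (hreg q z hz4 hqz a lam τ X hlam hτ hpf hX2 hv)
  rcases hpolar q z hz4 hz20 with h | ⟨χ, hχ1, hχ2, lam, hlam, hLval, h⟩
  · exact hregular 0 0 le_rfl (by norm_num) (h a) fun v _ => by simpa using hκ1
  rcases char_eq_one_or_neg_one hχ2 a with ha | ha
  · rcases le_total (c / K) (lam * X) with hlX | hlX
    · refine hregular lam 1 hlam (by norm_num) (h a 1 (by rw [ha]; norm_num)) fun v hv => ?_
      have h1 : lam * (X / 4) ≤ lam * v := by gcongr
      have h2 : Real.exp (-lam * v) ≤ Real.exp (-(c / K) / 4) := Real.exp_le_exp.2 (by linarith)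
      rw [hκ]; linarith
    · obtain ⟨s, hs1, hs, hχs⟩ := exists_realChar hχ1 hχ2
      obtain ⟨L, hL, hLN⟩ := LFunction_one_approx hχ1 hs1 hs hχs
      have hsa : s a = 1 := by
        have := hχs a
        rw [ha] at this
        exact_mod_cast this.symm
      rw [LFunction_roughChar_eq_mul_eulerInv hqz hχ1 hχs hL, Complex.norm_real] at hLval
      have hf : L * eulerInv s z * X ≤ c := by
        have hX0 : 0 ≤ X := by linarith
        calc L * eulerInv s z * X ≤ K * lam * X :=
              mul_le_mul_of_nonneg_right ((Real.le_norm_self _).trans hLval) hX0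
          _ = K * (lam * X) := by ring
          _ ≤ K * (c / K) := by gcongr
          _ = c := by field_simp
      have h1 := hexc z q hZz hz200 s hs1 hs L hLN a hsa X hX1 hf
      have h2 : z ^ (X - max W 1) ≤ z ^ (X - 1) :=
        Real.rpow_le_rpow_of_exponent_le hz1 (by linarith [le_max_right W 1])
      have h3 : 1 ≤ X * Real.log z := by nlinarith
      exact (h2.trans h1).trans (le_mul_of_one_le_right (Nat.cast_nonneg _) h3)
  · refine hregular lam (-1) hlam (by norm_num) (h a (-1) (by rw [ha]; norm_num)) fun v _ => ?_
    have := Real.exp_pos (-lam * v)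
    linarith

/-- Linnik's theorem with a quantitative count of primes in the residue class. -/
theorem exists_le_primeCount_mul_log : ∃ B : ℝ, 0 < B ∧ ∀ (q : ℕ) [NeZero q], 8 ≤ q →
    ∀ (a : (ZMod q)ˣ) (x : ℝ), (q : ℝ) ^ B ≤ x →
      x ≤ (q : ℝ) ^ B * (primeCount (a : ZMod q) x * Real.log x) := by
  obtain ⟨A, hA, W, hW, X₀, hX₀, h⟩ := exists_rpow_le_primeCount_mul
  have hA' : (1 : ℝ) ≤ A := by exact_mod_cast hA
  refine ⟨A * (W + X₀), by positivity, fun q _ hq a x hx => ?_⟩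
  have hq8 : (8 : ℝ) ≤ q := by exact_mod_cast hq
  have hq0 : (0 : ℝ) < q := by linarith
  set z := (q : ℝ) ^ A with hz
  have hqz : ∀ y : ℝ, (q : ℝ) ^ (A * y) = z ^ y := fun y => by
    rw [hz, Real.rpow_mul hq0.le, Real.rpow_natCast]
  have hz1 : 1 < z := one_lt_pow₀ (by linarith) (by omega)
  have hz0 : 0 < z := by linarith
  have hℓ : 0 < Real.log z := Real.log_pos hz1
  rw [hqz] at hx ⊢
  have hx0 : 0 < x := lt_of_lt_of_le (by positivity) hx
  set X := Real.log x / Real.log z with hX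
  have hzX : z ^ X = x := by
    rw [Real.rpow_def_of_pos hz0, hX, mul_div_cancel₀ _ hℓ.ne', Real.exp_log hx0]
  have hXX : W + X₀ ≤ X := by
    rw [hX, le_div_iff₀ hℓ]
    exact (Real.rpow_le_iff_le_log hz0 hx0).1 hx
  have h1 := h q hq a X (by linarith)
  have hlog : X * Real.log z = Real.log x := by rw [hX, div_mul_cancel₀ _ hℓ.ne']
  rw [hzX, hlog, Real.rpow_sub hz0, hzX, div_le_iff₀ (by positivity)] at h1
  have hlx : 0 ≤ Real.log x := by
    rw [← hlog]; have : 0 ≤ X := by linarith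
    positivity
  calc x ≤ primeCount (a : ZMod q) x * Real.log x * z ^ W := h1
    _ ≤ primeCount (a : ZMod q) x * Real.log x * z ^ (W + X₀) := by
        gcongr
        · exact hz1.le
        · linarith
    _ = _ := by ring

/-- There are at least `n` primes up to `q ^ L * n * log (2 * n)` in each reduced class mod `q`. -/
theorem exists_le_primeCount : ∃ L : ℝ, 0 < L ∧ ∀ (q : ℕ) [NeZero q], 8 ≤ q →
    ∀ (a : (ZMod q)ˣ) (n : ℕ), 1 ≤ n →
      n ≤ primeCount (a : ZMod q) ((q : ℝ) ^ L * n * Real.log (2 * n)) := by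
  obtain ⟨B, hB, h⟩ := exists_le_primeCount_mul_log
  refine ⟨max (2 * B) 4, lt_max_of_lt_right (by norm_num), fun q _ hq a n hn => ?_⟩
  set M := max (2 * B) 4 with hM
  have hM1 : 2 * B ≤ M := le_max_left _ _
  have hM2 : 4 ≤ M := le_max_right _ _
  have hq8 : (8 : ℝ) ≤ q := by exact_mod_cast hq
  have hq0 : (0 : ℝ) < q := by linarith
  have hn1 : (1 : ℝ) ≤ n := by exact_mod_cast hn
  have hl2 : (1 : ℝ) / 2 ≤ Real.log (2 * n) := by
    have h1 : Real.log 2 ≤ Real.log (2 * n) := Real.log_le_log (by norm_num) (by linarith)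
    linarith [Real.log_two_gt_d9]
  set ℓ := Real.log (2 * n) with hℓ
  set y := (q : ℝ) ^ (M / 2) with hy
  have hy64 : 64 ≤ y := by
    calc (64 : ℝ) = 8 ^ (2 : ℝ) := by norm_num
      _ ≤ (q : ℝ) ^ (2 : ℝ) := by gcongr
      _ ≤ y := Real.rpow_le_rpow_of_exponent_le (by linarith) (by linarith)
  have hy0 : 0 < y := by linarith
  have hyy : (q : ℝ) ^ M = y * y := by
    rw [hy, ← Real.rpow_add hq0]; ring_nf
  have hBy : (q : ℝ) ^ B ≤ y := Real.rpow_le_rpow_of_exponent_le (by linarith) (by linarith)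
  have hB0 : 0 < (q : ℝ) ^ B := by positivity
  set x := (q : ℝ) ^ M * n * ℓ with hx
  have hxB : (q : ℝ) ^ B ≤ x := by
    have h1 : (1 : ℝ) ≤ y * n * ℓ := by
      have : (1 : ℝ) ≤ y * ℓ := by nlinarith
      calc (1 : ℝ) ≤ y * ℓ * 1 := by linarith
        _ ≤ y * ℓ * n := by gcongr
        _ = _ := by ring
    calc (q : ℝ) ^ B ≤ y * 1 := by linarith
      _ ≤ y * (y * n * ℓ) := by gcongr
      _ = x := by rw [hx, hyy]; ring
  have hmain := h q hq a x hxB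
  have hlogx : Real.log x ≤ 4 * Real.log y * ℓ + 2 * ℓ := by
    have hn0 : (0 : ℝ) < n := by linarith
    have hℓ0 : 0 < ℓ := by linarith
    rw [hx, hyy, Real.log_mul (by positivity) hℓ0.ne', Real.log_mul (by positivity) hn0.ne',
      Real.log_mul hy0.ne' hy0.ne']
    have h1 : Real.log n ≤ ℓ := Real.log_le_log hn0 (by linarith)
    have h2 : Real.log ℓ ≤ ℓ := (Real.log_le_sub_one_of_pos hℓ0).trans (by linarith)
    have h3 : 0 ≤ Real.log y := Real.log_nonneg (by linarith)
    nlinarith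
  have hlogy : 4 * Real.log y + 2 ≤ y := by
    have h1 := Real.log_le_sub_one_of_pos (show 0 < y / 8 by positivity)
    rw [Real.log_div hy0.ne' (by norm_num), show (8 : ℝ) = 2 ^ 3 by norm_num, Real.log_pow] at h1
    have := Real.log_two_lt_d9
    norm_num at h1
    linarith
  have hP : (0 : ℝ) ≤ primeCount (a : ZMod q) x := Nat.cast_nonneg _
  have hfin : y * y * n * ℓ ≤ y * y * primeCount (a : ZMod q) x * ℓ := by
    calc y * y * n * ℓ = x := by rw [hx, hyy]
      _ ≤ (q : ℝ) ^ B * (primeCount (a : ZMod q) x * Real.log x) := hmain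
      _ ≤ (q : ℝ) ^ B * (primeCount (a : ZMod q) x * (y * ℓ)) := by
          gcongr
          calc Real.log x ≤ (4 * Real.log y + 2) * ℓ := by linarith
            _ ≤ y * ℓ := by gcongr
      _ ≤ y * (primeCount (a : ZMod q) x * (y * ℓ)) := by gcongr
      _ = _ := by ring
  have h1 := le_of_mul_le_mul_right hfin (by linarith)
  have h2 := le_of_mul_le_mul_left h1 (by positivity)
  exact_mod_cast h2

lemma exists_legendreSym_neg_eq {p : ℕ} [Fact p.Prime] (hp : Odd p) {e : ℤ} (he : e = 1 ∨ e = -1) :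
    ∃ t : ℕ, t.Coprime p ∧ legendreSym p (-(t : ℤ)) = e := by
  have key : ∀ b : ZMod p, b ≠ 0 → ∃ t : ℕ, t.Coprime p ∧ ((-(t : ℤ) : ℤ) : ZMod p) = b := by
    intro b hb
    refine ⟨(-b).val, ?_, by simp⟩
    rw [← ZMod.isUnit_iff_coprime, ZMod.natCast_zmod_val]
    exact isUnit_iff_ne_zero.2 (neg_ne_zero.2 hb)
  rcases he with rfl | rfl
  · obtain ⟨t, ht, h⟩ := key 1 one_ne_zero
    refine ⟨t, ht, (legendreSym.eq_one_iff p (by rw [h]; exact one_ne_zero)).2 ?_⟩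
    rw [h]; exact IsSquare.one
  · obtain ⟨b, hb⟩ := FiniteField.exists_nonsquare (F := ZMod p) (by
      rw [ZMod.ringChar_zmod_n]
      rintro rfl
      exact absurd hp (by decide))
    obtain ⟨t, ht, h⟩ := key b (by rintro rfl; exact hb IsSquare.zero)
    refine ⟨t, ht, (legendreSym.eq_neg_one_iff p).2 ?_⟩
    rwa [h]

/-- A reduced residue class all of whose primes satisfy the prescribed local conditions. -/
lemma exists_unit_legendreSym (S : Finset ℕ) (hS : ∀ p ∈ S, p.Prime ∧ Odd p) (ε : ℕ → ℤ)
    (hε : ∀ p ∈ S, ε p = 1 ∨ ε p = -1) :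
    ∃ a : (ZMod (8 * ∏ p ∈ S, p))ˣ, ∀ r : ℕ, (r : ZMod (8 * ∏ p ∈ S, p)) = a →
      r % 8 = 3 ∧ ∀ p, (hp : p ∈ S) → @legendreSym p (Fact.mk (hS p hp).1) (-(r : ℤ)) = ε p := by
  have hex : ∀ p, ∃ t : ℕ, (hp : p ∈ S) → t.Coprime p ∧
      @legendreSym p (Fact.mk (hS p hp).1) (-(t : ℤ)) = ε p := by
    intro p
    by_cases hp : p ∈ S
    · have := Fact.mk (hS p hp).1
      obtain ⟨t, ht⟩ := exists_legendreSym_neg_eq (hS p hp).2 (hε p hp)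
      exact ⟨t, fun _ => ht⟩
    · exact ⟨0, fun h => absurd h hp⟩
  choose t ht using hex
  have h8 : 8 ∉ S := fun h => absurd (hS 8 h).1 (by norm_num)
  have hcop8 : ∀ p ∈ S, Nat.Coprime 8 p := fun p hp => by
    rw [show 8 = 2 ^ 3 by norm_num]
    exact (Nat.coprime_two_left.2 (hS p hp).2).pow_left 3
  obtain ⟨k, hk⟩ := Nat.chineseRemainderOfFinset (fun i => if i = 8 then 3 else t i) (fun i => i)
    (insert 8 S) (by
      intro i hi
      rcases mem_insert.1 hi with rfl | hi
      · norm_num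
      · exact (hS i hi).1.ne_zero) (by
      intro i hi j hj hij
      simp only [coe_insert, Set.mem_insert_iff, mem_coe] at hi hj
      change Nat.Coprime i j
      rcases hi with rfl | hi <;> rcases hj with rfl | hj
      · exact absurd rfl hij
      · exact hcop8 j hj
      · exact (hcop8 i hi).symm
      · exact (Nat.coprime_primes (hS i hi).1 (hS j hj).1).2 hij)
  have hk8 : k ≡ 3 [MOD 8] := by simpa using hk 8 (mem_insert_self _ _)
  have hkp : ∀ p ∈ S, k ≡ t p [MOD p] := fun p hp => by
    have hne : p ≠ 8 := fun h => h8 (h ▸ hp)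
    simpa [hne] using hk p (mem_insert_of_mem hp)
  have hcop : k.Coprime (8 * ∏ p ∈ S, p) := by
    apply Nat.Coprime.mul_right
    · rw [Nat.Coprime, hk8.gcd_eq]; norm_num
    · refine Nat.Coprime.prod_right fun p hp => ?_
      rw [Nat.Coprime, (hkp p hp).gcd_eq]
      exact (ht p hp).1
  refine ⟨ZMod.unitOfCoprime k hcop, fun r hr => ?_⟩
  rw [ZMod.coe_unitOfCoprime, ZMod.natCast_eq_natCast_iff] at hr
  refine ⟨(hr.of_dvd (Dvd.intro _ rfl)).trans hk8, fun p hp => ?_⟩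
  have := Fact.mk (hS p hp).1
  have h1 : r ≡ t p [MOD p] :=
    (hr.of_dvd ((dvd_prod_of_mem (fun p => p) hp).mul_left 8)).trans (hkp p hp)
  rw [← (ht p hp).2]
  have h2 : (r : ZMod p) = (t p : ZMod p) := (ZMod.natCast_eq_natCast_iff _ _ _).2 h1
  simp only [legendreSym]
  push_cast
  rw [h2]

end Linnik

/-- **Quantitative version of the construction of admissible primes.**
Let `S` be a finite set of odd primes, `ε : S → {−1, 1}`, and
`C = 8 * ∏_{p ∈ S} p`. There is an absolute constant `L > 0` (independent of `S`
and `ε`) such that the set `Q` of primes `q` with `q ≡ 3 (mod 8)` and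
`(−q / p) = ε p` for all `p ∈ S` is infinite, and for every `n ≥ 1` its `n`-th
element is at most `C ^ L * n * log (2 * n)`. -/
theorem nth_admissible_prime_bound :
    ∃ L : ℝ, 0 < L ∧
      ∀ (S : Finset ℕ) (hS : ∀ p ∈ S, p.Prime ∧ Odd p)
        (ε : ℕ → ℤ), (∀ p ∈ S, ε p = 1 ∨ ε p = -1) →
        {q : ℕ | q.Prime ∧ q % 8 = 3 ∧
            ∀ p, (hp : p ∈ S) →
              @legendreSym p (Fact.mk (hS p hp).1) (-(q : ℤ)) = ε p}.Infinite ∧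
        ∀ n : ℕ, 1 ≤ n →
          ((Nat.nth (fun q => q.Prime ∧ q % 8 = 3 ∧
              ∀ p, (hp : p ∈ S) →
                @legendreSym p (Fact.mk (hS p hp).1) (-(q : ℤ)) = ε p) (n - 1) : ℝ) ≤
            ((8 * ∏ p ∈ S, p : ℕ) : ℝ) ^ L * (n : ℝ) * Real.log (2 * (n : ℝ))) := by
  classical
  obtain ⟨L, hL, h⟩ := Linnik.exists_le_primeCount
  refine ⟨L, hL, fun S hS ε hε => ?_⟩
  set P : ℕ → Prop := fun q => q.Prime ∧ q % 8 = 3 ∧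
    ∀ p, (hp : p ∈ S) → @legendreSym p (Fact.mk (hS p hp).1) (-(q : ℤ)) = ε p with hP
  set C := 8 * ∏ p ∈ S, p with hC
  have hprod : 0 < ∏ p ∈ S, p := Finset.prod_pos fun p hp => (hS p hp).1.pos
  have hC8 : 8 ≤ C := by omega
  have : NeZero C := ⟨by omega⟩
  obtain ⟨a, ha⟩ := Linnik.exists_unit_legendreSym S hS ε hε
  have hsub : ∀ x : ℝ, ((Finset.Ioc 0 ⌊x⌋₊).filter fun p : ℕ => p.Prime ∧ (p : ZMod C) = a) ⊆
      (Finset.range (⌊x⌋₊ + 1)).filter P := by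
    intro x r hr
    rw [Finset.mem_filter, Finset.mem_Ioc] at hr
    rw [Finset.mem_filter, Finset.mem_range]
    exact ⟨by omega, hr.2.1, ha r hr.2.2⟩
  have hcount : ∀ n : ℕ, 1 ≤ n →
      n ≤ Nat.count P (⌊(C : ℝ) ^ L * n * Real.log (2 * n)⌋₊ + 1) := by
    intro n hn
    rw [Nat.count_eq_card_filter_range]
    exact (h C hC8 a n hn).trans (Finset.card_le_card (hsub _))
  constructor
  · intro hfin
    have h1 := hcount (hfin.toFinset.card + 1) (by omega)
    rw [Nat.count_eq_card_filter_range] at h1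
    have h2 : ∀ N, ((Finset.range N).filter P).card ≤ hfin.toFinset.card := fun N =>
      Finset.card_le_card fun r hr => by
        rw [Set.Finite.mem_toFinset]
        exact (Finset.mem_filter.1 hr).2
    exact absurd (h1.trans (h2 _)) (by omega)
  · intro n hn
    have h1 : n - 1 < Nat.count P (⌊(C : ℝ) ^ L * n * Real.log (2 * n)⌋₊ + 1) :=
      lt_of_lt_of_le (by omega) (hcount n hn)
    have h2 := Nat.lt_succ_iff.1 (Nat.nth_lt_of_lt_count h1)
    have hn1 : (1 : ℝ) ≤ n := by exact_mod_cast hn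
    have h0 : 0 ≤ (C : ℝ) ^ L * n * Real.log (2 * n) := by
      have := Real.log_nonneg (show (1 : ℝ) ≤ 2 * n by linarith)
      positivity
    exact (Nat.le_floor_iff h0).1 h2
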